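/- Let n ≥ 3, 2n/(n+2) < p ≤ 2 and 2 ≤ q ≤ 2n/(n−2). There exist a constant C = C(n,p,q) and a sufficiently small R₀ > 0 such that for every x₀ ∈ ℝⁿ, every u ∈ C^∞_0(B_{R₀}(x₀) ∖ {x₀}) (complex-valued) and every τ > 1, one has τ^{β₀} ‖(log r)^{−1} e^{−τφ(r)} u‖_{L^q(r^{−n}dx)} + τ^{β₁} ‖(log r)^{−1} e^{−τφ(r)} r ∇u‖_{L^2(r^{−n}dx)} ≤ C ‖(log r) e^{−τφ(r)} r² Δu‖_{L^p(r^{−n}dx)}, where β₀ = 3/2 − (3n−2)(2−p)/(8p) − n(q−2)/(2q) and β₁ = 1/2 − (3n−2)(2−p)/(8p). -/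

import Mathlib

open MeasureTheory Metric ENNReal

noncomputable section

/-- The `i`-th partial derivative of `u`. -/
def pderivC {n : ℕ} (u : EuclideanSpace ℝ (Fin n) → ℂ) (i : Fin n)
    (x : EuclideanSpace ℝ (Fin n)) : ℂ :=
  fderiv ℝ u x (EuclideanSpace.single i 1)

/-- The Laplacian of `u`. -/
def lapl {n : ℕ} (u : EuclideanSpace ℝ (Fin n) → ℂ) (x : EuclideanSpace ℝ (Fin n)) : ℂ :=
  ∑ i, fderiv ℝ (fderiv ℝ u) x (EuclideanSpace.single i 1) (EuclideanSpace.single i 1)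

/-- The (Euclidean) norm of the gradient of `u`. -/
def gradN {n : ℕ} (u : EuclideanSpace ℝ (Fin n) → ℂ) (x : EuclideanSpace ℝ (Fin n)) : ℝ :=
  Real.sqrt (∑ i, ‖pderivC u i x‖ ^ 2)

/-- The term `W · ∇u`. -/
def Wgrad {n : ℕ} (W : EuclideanSpace ℝ (Fin n) → EuclideanSpace ℂ (Fin n))
    (u : EuclideanSpace ℝ (Fin n) → ℂ) (x : EuclideanSpace ℝ (Fin n)) : ℂ :=
  ∑ i, W x i * pderivC u i x

/-- `u` is a solution of `Δu + W·∇u + Vu = 0` on `B`: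
`u ∈ L^∞_loc(B) ∩ W^{1,2}_loc(B) ∩ W^{2,p}_loc(B)` for some `p ∈ (2n/(n+2), 2]`, and the
equation holds a.e. on `B`. -/
def IsSolution {n : ℕ} (B : Set (EuclideanSpace ℝ (Fin n)))
    (W : EuclideanSpace ℝ (Fin n) → EuclideanSpace ℂ (Fin n))
    (V : EuclideanSpace ℝ (Fin n) → ℂ)
    (u : EuclideanSpace ℝ (Fin n) → ℂ) : Prop :=
  ∃ p : ℝ, 2 * (n : ℝ) / (n + 2) < p ∧ p ≤ 2 ∧
    (∀ Kc : Set (EuclideanSpace ℝ (Fin n)), Kc ⊆ B → IsCompact Kc →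
      eLpNorm u ⊤ (volume.restrict Kc) < ⊤ ∧
      eLpNorm u 2 (volume.restrict Kc) < ⊤ ∧
      eLpNorm (fun x => gradN u x) 2 (volume.restrict Kc) < ⊤ ∧
      eLpNorm (fun x => ‖fderiv ℝ (fderiv ℝ u) x‖) (ENNReal.ofReal p) (volume.restrict Kc) < ⊤) ∧
    (∀ᵐ x ∂(volume.restrict B),
      DifferentiableAt ℝ u x ∧ DifferentiableAt ℝ (fderiv ℝ u) x ∧
      lapl u x + Wgrad W u x + V x * u x = 0)

/-- The weight function `φ(r) = log r + log ((log r)^2)`. -/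
def phiC (r : ℝ) : ℝ := Real.log r + Real.log ((Real.log r) ^ 2)

/-- `1/s` for an extended-real exponent `s`, interpreted as `0` when `s = ∞`. -/
def inva (s : ℝ≥0∞) : ℝ := s⁻¹.toReal

/-- The weighted norm `‖g‖_{L^p(E, r^{-n} dx)}` (here `g` stands for the pointwise absolute
value of the function being measured). -/
def wLp {n : ℕ} (x₀ : EuclideanSpace ℝ (Fin n)) (p : ℝ)
    (g : EuclideanSpace ℝ (Fin n) → ℝ) (E : Set (EuclideanSpace ℝ (Fin n))) : ℝ≥0∞ :=
  (∫⁻ x in E, ENNReal.ofReal (|g x| ^ p * ‖x - x₀‖ ^ (-(n : ℝ)))) ^ (1 / p)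

section FourierBasic

open FourierTransform ComplexConjugate

variable {V : Type*} [NormedAddCommGroup V] [InnerProductSpace ℝ V] [FiniteDimensional ℝ V]
  [MeasurableSpace V] [BorelSpace V]

theorem integral_fourier_mul_eq_of_integrable {f g : V → ℂ} (hf : Integrable f)
    (hg : Integrable g) : ∫ ξ, 𝓕 f ξ * g ξ = ∫ x, f x * 𝓕 g x := by
  have h := VectorFourier.integral_fourierIntegral_smul_eq_flip (μ := volume) (ν := volume)
    (L := innerₗ V) Real.continuous_fourierChar (by simpa using continuous_inner) hf hg
  simp only [smul_eq_mul, flip_innerₗ] at h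
  exact h

theorem norm_fourier_le_integral_norm (f : V → ℂ) (ξ : V) : ‖𝓕 f ξ‖ ≤ ∫ x, ‖f x‖ :=
  VectorFourier.norm_fourierIntegral_le_integral_norm _ _ _ _ _

theorem continuous_fourier_of_integrable {f : V → ℂ} (hf : Integrable f) : Continuous (𝓕 f) :=
  VectorFourier.fourierIntegral_continuous Real.continuous_fourierChar (by simpa using continuous_inner) hf

theorem conj_fourier_eq (f : V → ℂ) (ξ : V) :
    conj (𝓕 f ξ) = 𝓕 (fun x => conj (f (-x))) ξ := by
  rw [Real.fourier_eq', Real.fourier_eq', ← integral_conj,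
    ← integral_neg_eq_self]
  congr 1 with x
  simp [← Complex.exp_conj, Complex.conj_ofNat]

/-- If the Fourier transform of a multiplier `k` is bounded by `B`, the quadratic form with symbol
`k` is bounded by `B` on `L¹`. -/
theorem norm_integral_mul_normSq_fourier_le {k f : V → ℂ} {B : ℝ} (hk : Integrable k)
    (hf : Integrable f) (hB : ∀ X, ‖𝓕 k X‖ ≤ B) :
    ‖∫ ξ, k ξ * ((‖𝓕 f ξ‖ ^ 2 : ℝ) : ℂ)‖ ≤ B * (∫ x, ‖f x‖) ^ 2 := by
  set g : V → ℂ := fun x => conj (f (-x)) with hg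
  have hgi : Integrable g := by
    have : Integrable (fun x => f (-x)) := hf.comp_neg
    exact (Complex.conjCLE.toContinuousLinearMap).integrable_comp this
  have hgn : ∫ x, ‖g x‖ = ∫ x, ‖f x‖ := by
    simp only [hg, RCLike.norm_conj]
    exact integral_neg_eq_self (fun x => ‖f x‖) volume
  have hkg : Integrable (fun ξ => k ξ * 𝓕 g ξ) :=
    hk.mul_bdd (c := ∫ x, ‖g x‖) (continuous_fourier_of_integrable hgi).aestronglyMeasurable
      (Filter.Eventually.of_forall fun ξ => norm_fourier_le_integral_norm g ξ)
  have hB0 : 0 ≤ B := (norm_nonneg _).trans (hB 0)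
  have h1 : ∫ ξ, k ξ * ((‖𝓕 f ξ‖ ^ 2 : ℝ) : ℂ) = ∫ x, f x * 𝓕 (fun ξ => k ξ * 𝓕 g ξ) x := by
    rw [← integral_fourier_mul_eq_of_integrable hf hkg]
    congr 1 with ξ
    have : ((‖𝓕 f ξ‖ ^ 2 : ℝ) : ℂ) = 𝓕 f ξ * conj (𝓕 f ξ) := by
      rw [Complex.mul_conj, Complex.normSq_eq_norm_sq]
    rw [this, conj_fourier_eq]
    ring
  have h2 : ∀ x, ‖𝓕 (fun ξ => k ξ * 𝓕 g ξ) x‖ ≤ B * ∫ x, ‖f x‖ := by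
    intro x
    set kx : V → ℂ := fun ξ => Complex.exp (↑(-2 * Real.pi * inner ℝ ξ x) * Complex.I) * k ξ
      with hkx
    have hn : ∀ ξ, ‖Complex.exp (↑(-2 * Real.pi * inner ℝ ξ x) * Complex.I)‖ = 1 := fun ξ =>
      Complex.norm_exp_ofReal_mul_I _
    have hkxi : Integrable kx :=
      hk.bdd_mul (c := 1) (by fun_prop) (Filter.Eventually.of_forall fun ξ => (hn ξ).le)
    have h3 : 𝓕 (fun ξ => k ξ * 𝓕 g ξ) x = ∫ ξ, g ξ * 𝓕 kx ξ := by
      rw [← integral_fourier_mul_eq_of_integrable hgi hkxi, Real.fourier_eq']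
      congr 1 with ξ
      simp only [hkx, smul_eq_mul]
      ring
    have h4 : ∀ y, 𝓕 kx y = 𝓕 k (x + y) := by
      intro y
      rw [Real.fourier_eq', Real.fourier_eq']
      congr 1 with ξ
      simp only [hkx, smul_eq_mul]
      rw [← mul_assoc, ← Complex.exp_add]
      congr 2
      rw [inner_add_right]
      push_cast
      ring
    rw [h3]
    calc ‖∫ ξ, g ξ * 𝓕 kx ξ‖ ≤ ∫ ξ, ‖g ξ‖ * B := by
          refine norm_integral_le_of_norm_le (hgi.norm.mul_const B) ?_
          refine Filter.Eventually.of_forall fun ξ => ?_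
          rw [norm_mul, h4]
          exact mul_le_mul_of_nonneg_left (hB _) (norm_nonneg _)
      _ = B * ∫ x, ‖f x‖ := by rw [integral_mul_const, hgn, mul_comm]
  rw [h1]
  calc _ ≤ ∫ x, ‖f x‖ * (B * ∫ x, ‖f x‖) := by
        refine norm_integral_le_of_norm_le (hf.norm.mul_const _) ?_
        refine Filter.Eventually.of_forall fun x => ?_
        rw [norm_mul]
        exact mul_le_mul_of_nonneg_left (h2 _) (norm_nonneg _)
    _ = B * (∫ x, ‖f x‖) ^ 2 := by rw [integral_mul_const]; ring

theorem fourier_ae_eq_Lp_fourier {f : V → ℂ} (hf1 : Integrable f) (hf2 : MemLp f 2 volume) :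
    𝓕 f =ᵐ[volume] (𝓕 (hf2.toLp f) : Lp (α := V) ℂ 2 volume) := by
  refine ae_eq_of_integral_contDiff_smul_eq
    (continuous_fourier_of_integrable hf1).locallyIntegrable
    ((Lp.memLp _).locallyIntegrable (by norm_num)) ?_
  intro g hg hgs
  have hgC : ContDiff ℝ (⊤ : ℕ∞) (fun x => (g x : ℂ)) := Complex.ofRealCLM.contDiff.comp hg
  have hgsC : HasCompactSupport (fun x => (g x : ℂ)) := hgs.comp_left (g := fun r : ℝ => (r : ℂ)) (by simp)
  set G : SchwartzMap V ℂ := hgsC.toSchwartzMap hgC with hG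
  have hGg : ∀ x, G x = (g x : ℂ) := fun x => rfl
  have h1 := Lp.inner_fourier_eq ((FourierTransform.fourierInv G).toLp 2 : Lp (α := V) ℂ 2 volume) (hf2.toLp f)
  rw [SchwartzMap.toLp_fourier_eq, FourierTransform.fourier_fourierInv_eq] at h1
  rw [L2.inner_def, L2.inner_def] at h1
  have h2 : ∫ x, g x • (𝓕 (hf2.toLp f) : Lp (α := V) ℂ 2 volume) x
      = ∫ x, inner ℂ (G.toLp 2 volume x) ((𝓕 (hf2.toLp f) : Lp (α := V) ℂ 2 volume) x) := by
    refine integral_congr_ae ?_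
    filter_upwards [SchwartzMap.coeFn_toLp G 2 volume] with x hx
    rw [hx, hGg]
    simp [mul_comm]
  rw [h2, h1]
  have h3 : ∫ x, inner ℂ ((FourierTransform.fourierInv G).toLp 2 volume x) ((hf2.toLp f : Lp (α := V) ℂ 2 volume) x)
      = ∫ x, 𝓕 (G : V → ℂ) x * f x := by
    refine integral_congr_ae ?_
    filter_upwards [SchwartzMap.coeFn_toLp (FourierTransform.fourierInv G) 2 volume, hf2.coeFn_toLp] with x hx hx2
    rw [hx, hx2, SchwartzMap.fourierInv_coe]
    have : conj (𝓕⁻ (G : V → ℂ) x) = 𝓕 (G : V → ℂ) x := by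
      rw [Real.fourierInv_eq', Real.fourier_eq', ← integral_conj]
      congr 1 with y
      simp [← Complex.exp_conj, hGg, Complex.conj_ofNat]
    simp [this, mul_comm]
  rw [h3, integral_fourier_mul_eq_of_integrable G.integrable hf1]
  congr 1

/-- Plancherel's identity for functions in `L¹ ∩ L²`. -/
theorem eLpNorm_fourier_two {f : V → ℂ} (hf1 : Integrable f) (hf2 : MemLp f 2 volume) :
    eLpNorm (𝓕 f) 2 = eLpNorm f 2 := by
  rw [eLpNorm_congr_ae (fourier_ae_eq_Lp_fourier hf1 hf2)]
  have h := Lp.norm_fourier_eq (hf2.toLp f)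
  rw [Lp.norm_def, Lp.norm_def] at h
  rw [(ENNReal.toReal_eq_toReal_iff' (Lp.eLpNorm_ne_top _) (Lp.eLpNorm_ne_top _)).1 h]
  exact eLpNorm_congr_ae hf2.coeFn_toLp

end FourierBasic

section FourierInterpolation

open FourierTransform

variable {V : Type*} [NormedAddCommGroup V] [InnerProductSpace ℝ V] [FiniteDimensional ℝ V]
  [MeasurableSpace V] [BorelSpace V]

theorem fourier_add_of_integrable {f g : V → ℂ} (hf : Integrable f) (hg : Integrable g) (ξ : V) :
    𝓕 (fun x => f x + g x) ξ = 𝓕 f ξ + 𝓕 g ξ := by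
  rw [Real.fourier_eq, Real.fourier_eq, Real.fourier_eq, ← integral_add]
  · simp only [smul_add]
  · exact (Real.fourierIntegral_convergent_iff ξ).2 hf
  · exact (Real.fourierIntegral_convergent_iff ξ).2 hg

theorem fourier_finset_sum_of_integrable {ι : Type*} (s : Finset ι) {f : ι → V → ℂ}
    (hf : ∀ i ∈ s, Integrable (f i)) (ξ : V) :
    𝓕 (fun x => ∑ i ∈ s, f i x) ξ = ∑ i ∈ s, 𝓕 (f i) ξ := by
  simp only [Real.fourier_eq]
  rw [← integral_finsetSum]
  · simp only [Finset.smul_sum]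
  · intro i hi
    exact (Real.fourierIntegral_convergent_iff ξ).2 (hf i hi)

theorem integrable_mul_normSq_fourier {M : V → ℝ} {A : ℝ} (hM : Measurable M)
    (hMA : ∀ ξ, ‖M ξ‖ ≤ A) {f : V → ℂ} (hf1 : Integrable f) (hf2 : MemLp f 2) :
    Integrable (fun ξ => M ξ * ‖𝓕 f ξ‖ ^ 2) := by
  have h : MemLp (𝓕 f) 2 volume :=
    ⟨(continuous_fourier_of_integrable hf1).aestronglyMeasurable, by
      rw [eLpNorm_fourier_two hf1 hf2]; exact hf2.2⟩
  exact h.integrable_norm_pow (by norm_num) |>.bdd_mul hM.aestronglyMeasurable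
    (Filter.Eventually.of_forall hMA)

theorem integral_normSq_fourier {f : V → ℂ} (hf1 : Integrable f) (hf2 : MemLp f 2) :
    ∫ ξ, ‖𝓕 f ξ‖ ^ 2 = ∫ x, ‖f x‖ ^ 2 := by
  have h := eLpNorm_fourier_two hf1 hf2
  have h' : MemLp (𝓕 f) 2 volume :=
    ⟨(continuous_fourier_of_integrable hf1).aestronglyMeasurable, by
      rw [eLpNorm_fourier_two hf1 hf2]; exact hf2.2⟩
  rw [h'.eLpNorm_eq_integral_rpow_norm (by norm_num) (by norm_num),
    hf2.eLpNorm_eq_integral_rpow_norm (by norm_num) (by norm_num)] at h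
  have h0 : ∀ g : V → ℂ, 0 ≤ ∫ x, ‖g x‖ ^ (2 : ℝ≥0∞).toReal := fun g =>
    integral_nonneg fun x => Real.rpow_nonneg (norm_nonneg _) _
  rw [ENNReal.ofReal_eq_ofReal_iff (Real.rpow_nonneg (h0 _) _) (Real.rpow_nonneg (h0 _) _),
    Real.rpow_left_inj (h0 _) (h0 _) (by norm_num)] at h
  simpa using h

theorem norm_sum_sq_le_weighted (K : ℕ) (a : ℕ → ℂ) {t : ℝ} (ht0 : 0 < t) (ht1 : t < 1) :
    ‖∑ j ∈ Finset.range K, a j‖ ^ 2 ≤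
      (1 - t)⁻¹ * ∑ j ∈ Finset.range K, (t ^ j)⁻¹ * ‖a j‖ ^ 2 := by
  have h1 : (∑ j ∈ Finset.range K, ‖a j‖) ^ 2 ≤
      (∑ j ∈ Finset.range K, t ^ j) * ∑ j ∈ Finset.range K, (t ^ j)⁻¹ * ‖a j‖ ^ 2 := by
    refine Finset.sum_sq_le_sum_mul_sum_of_sq_le_mul _ (fun i _ => by positivity)
      (fun i _ => by positivity) fun i _ => le_of_eq ?_
    field_simp
  have h2 : ∑ j ∈ Finset.range K, t ^ j ≤ (1 - t)⁻¹ := by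
    rw [← tsum_geometric_of_lt_one ht0.le ht1]
    exact (summable_geometric_of_lt_one ht0.le ht1).sum_le_tsum _ fun i _ => by positivity
  calc _ ≤ (∑ j ∈ Finset.range K, ‖a j‖) ^ 2 := by gcongr; exact norm_sum_le _ _
    _ ≤ _ := h1.trans (mul_le_mul_of_nonneg_right h2 (Finset.sum_nonneg fun i _ => by positivity))

theorem layer_decomposition {μ₀ : ℝ} (hμ : 0 < μ₀) {K : ℕ} {z : ℂ} (hz : ‖z‖ ≤ 2 ^ K * μ₀) :
    z = (if ‖z‖ ≤ μ₀ then z else 0) +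
      ∑ j ∈ Finset.range K, if 2 ^ j * μ₀ < ‖z‖ ∧ ‖z‖ ≤ 2 ^ (j + 1) * μ₀ then z else 0 := by
  induction K with
  | zero => simp at hz; simp [hz]
  | succ K ih =>
    rw [Finset.sum_range_succ, ← add_assoc]
    by_cases h : ‖z‖ ≤ 2 ^ K * μ₀
    · rw [if_neg (c := 2 ^ K * μ₀ < ‖z‖ ∧ _) (by intro h2; linarith [h2.1]), add_zero]
      exact ih h
    · push Not at h
      rw [if_pos (c := 2 ^ K * μ₀ < ‖z‖ ∧ _) ⟨h, hz⟩, if_neg, Finset.sum_eq_zero]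
      · simp
      · intro j hj
        rw [if_neg]
        intro h2
        have : (2 : ℝ) ^ (j + 1) ≤ 2 ^ K :=
          pow_le_pow_right₀ (by norm_num) (by simpa using Finset.mem_range.1 hj)
        nlinarith [h2.2]
      · have : (1 : ℝ) ≤ 2 ^ K := one_le_pow₀ (by norm_num)
        nlinarith

/-- Restricted real interpolation between an `L² → L²` bound and an `L¹ → L^∞` type bound. -/
theorem exists_interpolation_const {p κ : ℝ} (hp : 1 ≤ p) (hp2 : p ≤ 2) (hκ : 0 ≤ κ)
    (hpκ : 2 < p * (1 + 1 / (1 + κ))) :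
    ∃ C : ℝ, 0 < C ∧ ∀ (M : V → ℝ) (A B : ℝ), Measurable M → (∀ ξ, 0 ≤ M ξ) → (∀ ξ, M ξ ≤ A) →
      0 < A → 0 < B →
      (∀ f : V → ℂ, Integrable f → MemLp f 2 → ∀ ρ : ℝ, 0 < ρ → ρ ≤ 1 →
        ∫ ξ, M ξ * ‖𝓕 f ξ‖ ^ 2 ≤
          A * (ρ * (∫ x, ‖f x‖ ^ 2) + ρ ^ (-κ) * B * (∫ x, ‖f x‖) ^ 2)) →
      ∀ f : V → ℂ, Measurable f → Integrable f → MemLp f 2 →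
        Integrable (fun x => ‖f x‖ ^ p) → (∃ K, ∀ x, ‖f x‖ ≤ K) →
        ∫ ξ, M ξ * ‖𝓕 f ξ‖ ^ 2 ≤ C * A * B ^ (2 / p - 1) * (∫ x, ‖f x‖ ^ p) ^ (2 / p) := by
  set g : ℝ := p / (1 + κ) with hg
  have hg0 : 0 < g := by positivity
  set c : ℝ := (p + g - 2) / 2 with hc
  have hc0 : 0 < c := by
    have : p * (1 + 1 / (1 + κ)) = p + g := by rw [hg]; ring
    rw [hc]; linarith
  set t : ℝ := 2 ^ (-c) with ht
  have ht0 : 0 < t := by positivity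
  have ht1 : t < 1 := Real.rpow_lt_one_of_one_lt_of_neg (by norm_num) (by linarith)
  set S : ℝ := (1 - t)⁻¹ with hS
  have hS0 : 0 < S := inv_pos.2 (by linarith)
  refine ⟨2 + 16 * S ^ 2, by positivity, ?_⟩
  intro M A B hM hM0 hMA hA hB hyp f hfm hf1 hf2 hfp hfb
  obtain ⟨Kb, hKb⟩ := hfb
  have hMn : ∀ ξ, ‖M ξ‖ ≤ A := fun ξ => by
    rw [Real.norm_of_nonneg (hM0 ξ)]; exact hMA ξ
  set I : ℝ := ∫ x, ‖f x‖ ^ p with hI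
  have hI0 : 0 ≤ I := integral_nonneg fun x => by positivity
  rcases hI0.eq_or_lt with hI00 | hIpos
  · have h0 : (fun x => ‖f x‖ ^ p) =ᵐ[volume] 0 :=
      (integral_eq_zero_iff_of_nonneg (fun x => by positivity) hfp).1 hI00.symm
    have h1 : f =ᵐ[volume] 0 := by
      filter_upwards [h0] with x hx
      have : ‖f x‖ ^ p = 0 := hx
      rw [Real.rpow_eq_zero (norm_nonneg _) (by linarith)] at this
      simpa using this
    have h2 : ∀ ξ, 𝓕 f ξ = 0 := fun ξ => by
      rw [Real.fourier_congr_ae h1, Real.fourier_eq]; simp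
    simp only [h2]
    simp only [norm_zero, ne_eq, OfNat.ofNat_ne_zero, not_false_eq_true, zero_pow, mul_zero,
      integral_zero]
    positivity
  set μ₀ : ℝ := (B * I) ^ (1 / p) with hμ
  have hμ0 : 0 < μ₀ := by positivity
  have hμp : μ₀ ^ p = B * I := by
    rw [hμ, ← Real.rpow_mul (by positivity), one_div_mul_cancel (by linarith), Real.rpow_one]
  set Q : ℝ := B ^ (2 / p - 1) * I ^ (2 / p) with hQ
  have hQ0 : 0 < Q := by positivity
  have hμQ : μ₀ ^ 2 = B * Q := by
    rw [hμ, ← Real.rpow_natCast, ← Real.rpow_mul (by positivity), Real.mul_rpow hB.le hI0, hQ,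
      ← mul_assoc]
    congr 1
    · nth_rewrite 2 [← Real.rpow_one B]
      rw [← Real.rpow_add hB]
      congr 1; push_cast; ring
    · congr 1; push_cast; ring
  obtain ⟨K, hK⟩ := pow_unbounded_of_one_lt (Kb / μ₀) (one_lt_two : (1 : ℝ) < 2)
  have hbd : ∀ x, ‖f x‖ ≤ 2 ^ K * μ₀ := fun x =>
    (hKb x).trans (by rw [div_lt_iff₀ hμ0] at hK; exact hK.le)
  set E0 : Set V := {x | ‖f x‖ ≤ μ₀} with hE0
  set E : ℕ → Set V := fun j => {x | 2 ^ j * μ₀ < ‖f x‖ ∧ ‖f x‖ ≤ 2 ^ (j + 1) * μ₀} with hE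
  have hE0m : MeasurableSet E0 := measurableSet_le hfm.norm measurable_const
  have hEm : ∀ j, MeasurableSet (E j) := fun j =>
    (measurableSet_lt measurable_const hfm.norm).inter (measurableSet_le hfm.norm measurable_const)
  set f0 : V → ℂ := E0.indicator f with hf0
  set F : ℕ → V → ℂ := fun j => (E j).indicator f with hF
  have hf01 : Integrable f0 := hf1.indicator hE0m
  have hf02 : MemLp f0 2 := hf2.indicator hE0m
  have hF1 : ∀ j, Integrable (F j) := fun j => hf1.indicator (hEm j)
  have hF2 : ∀ j, MemLp (F j) 2 := fun j => hf2.indicator (hEm j)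
  have hdec : f = fun x => f0 x + ∑ j ∈ Finset.range K, F j x := by
    funext x
    have := layer_decomposition hμ0 (hbd x)
    simp only [hf0, hF, Set.indicator_apply, hE0, hE, Set.mem_ofPred_eq]
    exact this
  have hfour : ∀ ξ, 𝓕 f ξ = 𝓕 f0 ξ + ∑ j ∈ Finset.range K, 𝓕 (F j) ξ := by
    intro ξ
    rw [← fourier_finset_sum_of_integrable _ (fun j _ => hF1 j),
      ← fourier_add_of_integrable hf01 (integrable_finsetSum _ fun j _ => hF1 j), ← hdec]
  have hpt : ∀ ξ, M ξ * ‖𝓕 f ξ‖ ^ 2 ≤ 2 * (M ξ * ‖𝓕 f0 ξ‖ ^ 2) +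
      ∑ j ∈ Finset.range K, (2 * S * (t ^ j)⁻¹) * (M ξ * ‖𝓕 (F j) ξ‖ ^ 2) := by
    intro ξ
    have h1 := norm_sum_sq_le_weighted K (fun j => 𝓕 (F j) ξ) ht0 ht1
    have h2 : ‖𝓕 f ξ‖ ^ 2 ≤ 2 * ‖𝓕 f0 ξ‖ ^ 2 + 2 * ‖∑ j ∈ Finset.range K, 𝓕 (F j) ξ‖ ^ 2 := by
      rw [hfour]
      have := norm_add_le (𝓕 f0 ξ) (∑ j ∈ Finset.range K, 𝓕 (F j) ξ)
      calc _ ≤ (‖𝓕 f0 ξ‖ + ‖∑ j ∈ Finset.range K, 𝓕 (F j) ξ‖) ^ 2 := by gcongr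
        _ ≤ _ := by nlinarith [sq_nonneg (‖𝓕 f0 ξ‖ - ‖∑ j ∈ Finset.range K, 𝓕 (F j) ξ‖)]
    calc M ξ * ‖𝓕 f ξ‖ ^ 2 ≤ M ξ * (2 * ‖𝓕 f0 ξ‖ ^ 2 +
          2 * (S * ∑ j ∈ Finset.range K, (t ^ j)⁻¹ * ‖𝓕 (F j) ξ‖ ^ 2)) := by
          refine mul_le_mul_of_nonneg_left (h2.trans ?_) (hM0 ξ)
          gcongr
      _ = _ := by
          rw [mul_add, Finset.mul_sum, Finset.mul_sum, Finset.mul_sum]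
          congr 1
          · ring
          · exact Finset.sum_congr rfl fun j _ => by ring
  have hint : ∀ j, Integrable (fun ξ => M ξ * ‖𝓕 (F j) ξ‖ ^ 2) := fun j =>
    integrable_mul_normSq_fourier hM hMn (hF1 j) (hF2 j)
  have hint0 : Integrable (fun ξ => M ξ * ‖𝓕 f0 ξ‖ ^ 2) :=
    integrable_mul_normSq_fourier hM hMn hf01 hf02
  have hN0 : ∫ ξ, M ξ * ‖𝓕 f0 ξ‖ ^ 2 ≤ A * Q := by
    have h1 : ∫ ξ, M ξ * ‖𝓕 f0 ξ‖ ^ 2 ≤ ∫ ξ, A * ‖𝓕 f0 ξ‖ ^ 2 := by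
      refine integral_mono hint0 ?_ fun ξ => mul_le_mul_of_nonneg_right (hMA ξ) (by positivity)
      exact integrable_mul_normSq_fourier (M := fun _ => A) measurable_const (A := A)
        (fun _ => by rw [Real.norm_of_nonneg hA.le]) hf01 hf02
    rw [integral_const_mul, integral_normSq_fourier hf01 hf02] at h1
    refine h1.trans (mul_le_mul_of_nonneg_left ?_ hA.le)
    have h2 : ∫ x, ‖f0 x‖ ^ 2 ≤ ∫ x, μ₀ ^ (2 - p) * ‖f x‖ ^ p := by
      refine integral_mono (hf02.integrable_norm_pow (by norm_num)) (hfp.const_mul _) fun x => ?_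
      by_cases hx : x ∈ E0
      · have hx' : ‖f x‖ ≤ μ₀ := hx
        simp only [hf0, Set.indicator_of_mem hx]
        rcases (norm_nonneg (f x)).eq_or_lt with h0 | h0
        · rw [← h0]; simp only [ne_eq, OfNat.ofNat_ne_zero, not_false_eq_true, zero_pow]; positivity
        · calc ‖f x‖ ^ 2 = ‖f x‖ ^ (2 - p) * ‖f x‖ ^ p := by
                rw [← Real.rpow_add h0, ← Real.rpow_natCast]; congr 1; push_cast; ring
            _ ≤ _ := by
                gcongr
      · simp only [hf0, Set.indicator_of_notMem hx, norm_zero, ne_eq, OfNat.ofNat_ne_zero,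
          not_false_eq_true, zero_pow]
        positivity
    rw [integral_const_mul] at h2
    refine h2.trans (le_of_eq ?_)
    have h3 : μ₀ ^ (2 - p) * μ₀ ^ p = μ₀ ^ 2 := by
      rw [← Real.rpow_add hμ0, ← Real.rpow_natCast]; congr 1; push_cast; ring
    rw [hμp, hμQ] at h3
    have : B * (μ₀ ^ (2 - p) * I) = B * Q := by rw [← h3]; ring
    exact mul_left_cancel₀ hB.ne' this
  have hvol : ∀ j, volume.real (E j) ≤ ((2 : ℝ) ^ (j : ℝ)) ^ (-p) / B := by
    intro j
    have h1 : volume.real (E j) * (2 ^ j * μ₀) ^ p ≤ I := by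
      have := mul_meas_ge_le_integral_of_nonneg (μ := volume) (f := fun x => ‖f x‖ ^ p)
        (Filter.Eventually.of_forall fun x => by positivity) hfp ((2 ^ j * μ₀) ^ p)
      rw [mul_comm]
      refine le_trans (mul_le_mul_of_nonneg_left ?_ (by positivity)) this
      refine measureReal_mono (fun x hx => ?_) ?_
      · exact Real.rpow_le_rpow (by positivity) hx.1.le (by linarith)
      · exact (hfp.measure_ge_lt_top (by positivity)).ne
    rw [Real.mul_rpow (by positivity) hμ0.le, hμp] at h1
    rw [Real.rpow_neg (by positivity), Real.rpow_natCast, le_div_iff₀ hB, ← one_div,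
      le_div_iff₀ (by positivity)]
    refine le_of_mul_le_mul_right ?_ hIpos
    linarith
  have hNj : ∀ j, ∫ ξ, M ξ * ‖𝓕 (F j) ξ‖ ^ 2 ≤ 8 * A * Q * (t ^ j) ^ 2 := by
    intro j
    set X : ℝ := (2 : ℝ) ^ (j : ℝ) with hX
    have hX1 : 1 ≤ X := Real.one_le_rpow (by norm_num) (by positivity)
    have hX0 : 0 < X := by positivity
    have hXj : (2 : ℝ) ^ j = X := (Real.rpow_natCast _ _).symm
    have htj : t ^ j = X ^ (-c) := by
      rw [ht, hX, ← Real.rpow_natCast, ← Real.rpow_mul (by norm_num), ← Real.rpow_mul (by norm_num),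
        mul_comm]
    have hb : ∀ x ∈ E j, ‖f x‖ ≤ 2 * X * μ₀ := by
      intro x hx
      have := hx.2
      rw [pow_succ, hXj] at this
      linarith
    have hEfin : volume (E j) ≠ ⊤ := by
      refine ((measure_mono fun x hx => ?_).trans_lt
        (hfp.measure_ge_lt_top (show (0 : ℝ) < (2 ^ j * μ₀) ^ p by positivity))).ne
      exact Real.rpow_le_rpow (by positivity) hx.1.le (by linarith)
    have hL : ∀ m : ℕ, m ≠ 0 → ∫ x, ‖F j x‖ ^ m ≤ (2 * X * μ₀) ^ m * volume.real (E j) := by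
      intro m hm
      have h1 : (fun x => ‖F j x‖ ^ m) = (E j).indicator (fun x => ‖f x‖ ^ m) := by
        funext x
        by_cases hx : x ∈ E j
        · simp [hF, hx]
        · simp [hF, hx, hm]
      rw [h1, integral_indicator (hEm j), mul_comm, ← smul_eq_mul, ← setIntegral_const]
      refine integral_mono_of_nonneg (Filter.Eventually.of_forall fun x => by positivity)
        (integrableOn_const hEfin) ?_
      filter_upwards [ae_restrict_mem (hEm j)] with x hx
      gcongr
      exact hb x hx
    have h1 := hL 1 one_ne_zero
    have h2 := hL 2 two_ne_zero
    simp only [pow_one] at h1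
    have hv0 : 0 ≤ volume.real (E j) := measureReal_nonneg
    have hv := hvol j
    rw [← hX] at hv
    have hρ0 : 0 < X ^ (-g) := by positivity
    have h3 := hyp (F j) (hF1 j) (hF2 j) (X ^ (-g)) hρ0
      (Real.rpow_le_one_of_one_le_of_nonpos hX1 (by linarith))
    refine h3.trans ?_
    have e1 : X ^ (-g) * X ^ (-p) * X ^ 2 = (t ^ j) ^ 2 := by
      rw [htj, ← Real.rpow_natCast, ← Real.rpow_natCast, ← Real.rpow_mul hX0.le,
        ← Real.rpow_add hX0, ← Real.rpow_add hX0, hc]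
      congr 1; push_cast; ring
    have e2 : (X ^ (-g)) ^ (-κ) * (X ^ (-p)) ^ 2 * X ^ 2 = (t ^ j) ^ 2 := by
      have hgk : g * κ = p - g := by rw [hg]; field_simp; ring
      rw [htj, ← Real.rpow_natCast, ← Real.rpow_natCast, ← Real.rpow_natCast,
        ← Real.rpow_mul hX0.le, ← Real.rpow_mul hX0.le, ← Real.rpow_mul hX0.le,
        ← Real.rpow_add hX0, ← Real.rpow_add hX0, hc]
      congr 1; push_cast; linarith
    have h4 : ∫ x, ‖F j x‖ ^ 2 ≤ (2 * X * μ₀) ^ 2 * (X ^ (-p) / B) := h2.trans (by gcongr)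
    have h5 : ∫ x, ‖F j x‖ ≤ (2 * X * μ₀) * (X ^ (-p) / B) := h1.trans (by gcongr)
    have h50 : 0 ≤ ∫ x, ‖F j x‖ := integral_nonneg fun x => norm_nonneg _
    calc _ ≤ A * (X ^ (-g) * ((2 * X * μ₀) ^ 2 * (X ^ (-p) / B)) +
          (X ^ (-g)) ^ (-κ) * B * ((2 * X * μ₀) * (X ^ (-p) / B)) ^ 2) := by gcongr
      _ = 4 * A * (μ₀ ^ 2 / B) * (X ^ (-g) * X ^ (-p) * X ^ 2 +
          (X ^ (-g)) ^ (-κ) * (X ^ (-p)) ^ 2 * X ^ 2) := by field_simp; ring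
      _ = _ := by rw [e1, e2, hμQ]; field_simp; ring
  have hsum : ∑ j ∈ Finset.range K, t ^ j ≤ S := by
    rw [hS, ← tsum_geometric_of_lt_one ht0.le ht1]
    exact (summable_geometric_of_lt_one ht0.le ht1).sum_le_tsum _ fun i _ => by positivity
  calc ∫ ξ, M ξ * ‖𝓕 f ξ‖ ^ 2 ≤ ∫ ξ, (2 * (M ξ * ‖𝓕 f0 ξ‖ ^ 2) +
      ∑ j ∈ Finset.range K, (2 * S * (t ^ j)⁻¹) * (M ξ * ‖𝓕 (F j) ξ‖ ^ 2)) := by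
        refine integral_mono (integrable_mul_normSq_fourier hM hMn hf1 hf2) ?_ hpt
        exact (hint0.const_mul _).add (integrable_finsetSum _ fun j _ => (hint j).const_mul _)
    _ = 2 * (∫ ξ, M ξ * ‖𝓕 f0 ξ‖ ^ 2) +
        ∑ j ∈ Finset.range K, (2 * S * (t ^ j)⁻¹) * ∫ ξ, M ξ * ‖𝓕 (F j) ξ‖ ^ 2 := by
        rw [integral_add (hint0.const_mul _)
          (integrable_finsetSum _ fun j _ => (hint j).const_mul _),
          integral_finsetSum _ fun j _ => (hint j).const_mul _]
        simp only [integral_const_mul]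
    _ ≤ 2 * (A * Q) + ∑ j ∈ Finset.range K, (2 * S * (t ^ j)⁻¹) * (8 * A * Q * (t ^ j) ^ 2) := by
        refine add_le_add (mul_le_mul_of_nonneg_left hN0 (by norm_num))
          (Finset.sum_le_sum fun j _ => mul_le_mul_of_nonneg_left (hNj j) (by positivity))
    _ = 2 * (A * Q) + 16 * S * A * Q * ∑ j ∈ Finset.range K, t ^ j := by
        rw [Finset.mul_sum]
        congr 1
        refine Finset.sum_congr rfl fun j _ => ?_
        field_simp
        ring
    _ ≤ 2 * (A * Q) + 16 * S * A * Q * S := by gcongr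
    _ = _ := by rw [hQ]; ring

end FourierInterpolation

section KernelCalculus

open Filter Topology

theorem norm_one_sub_exp_neg_le {w : ℂ} (hw : 0 ≤ w.re) : ‖1 - Complex.exp (-w)‖ ≤ ‖w‖ := by
  have hderiv : ∀ z : ℂ, HasDerivAt (fun z => Complex.exp (-z)) (-Complex.exp (-z)) z := fun z => by
    simpa using (hasDerivAt_neg z).cexp
  have h := (convex_halfSpace_re_ge 0).norm_image_sub_le_of_norm_deriv_le (𝕜 := ℂ)
    (f := fun z : ℂ => Complex.exp (-z)) (C := 1) (x := w) (y := 0)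
    (fun z _ => (hderiv z).differentiableAt) (fun z hz => by
      rw [(hderiv z).deriv, norm_neg, Complex.norm_exp, Complex.neg_re]
      exact Real.exp_le_one_iff.2 (by simpa using hz)) hw (by simp)
  simpa using h

theorem integrableOn_pow_mul_exp_neg_mul (m : ℕ) {w : ℂ} (hw : 0 < w.re) :
    IntegrableOn (fun u : ℝ => (u : ℂ) ^ m * Complex.exp (-(u * w))) (Set.Ioi 0) := by
  have h := integrableOn_rpow_mul_exp_neg_mul_rpow (p := 1) (s := m) (b := w.re)
    (by have : (0 : ℝ) ≤ m := by positivity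
        linarith) one_pos hw
  refine h.mono' (by fun_prop) ?_
  filter_upwards [ae_restrict_mem measurableSet_Ioi] with u hu
  have hu' : (0 : ℝ) < u := hu
  simp [Complex.norm_exp, abs_of_pos hu', mul_comm]

theorem tendsto_pow_mul_exp_neg_mul (m : ℕ) {w : ℂ} (hw : 0 < w.re) :
    Tendsto (fun u : ℝ => (u : ℂ) ^ m * Complex.exp (-(u * w))) atTop (𝓝 0) := by
  rw [tendsto_zero_iff_norm_tendsto_zero]
  have h := tendsto_rpow_mul_exp_neg_mul_atTop_nhds_zero (m : ℝ) w.re hw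
  refine h.congr' ?_
  filter_upwards [eventually_gt_atTop 0] with u hu
  simp [Complex.norm_exp, abs_of_pos hu, mul_comm]

theorem integral_pow_mul_exp_neg_mul (m : ℕ) {w : ℂ} (hw : 0 < w.re) :
    ∫ u in Set.Ioi (0 : ℝ), (u : ℂ) ^ m * Complex.exp (-(u * w)) = m.factorial / w ^ (m + 1) := by
  have hw0 : w ≠ 0 := fun h => by simp [h] at hw
  have hd : ∀ u : ℝ, HasDerivAt (fun u : ℝ => Complex.exp (-(u * w))) (-w * Complex.exp (-(u * w))) u := by
    intro u
    have h1 : HasDerivAt (fun u : ℝ => -((u : ℂ) * w)) (-(1 * w)) u :=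
      ((Complex.ofRealCLM.hasDerivAt (x := u)).mul_const w).neg
    simpa [mul_comm] using h1.cexp
  induction m with
  | zero =>
    have h := integral_Ioi_of_hasDerivAt_of_tendsto' (a := 0)
      (f := fun u : ℝ => -w⁻¹ * Complex.exp (-(u * w)))
      (f' := fun u : ℝ => (u : ℂ) ^ 0 * Complex.exp (-(u * w))) (m := -w⁻¹ * 0)
      (fun u _ => by
        have := (hd u).const_mul (-w⁻¹)
        refine this.congr_deriv ?_
        rw [← mul_assoc, neg_mul_neg, inv_mul_cancel₀ hw0, pow_zero]) (integrableOn_pow_mul_exp_neg_mul 0 hw)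
      (by simpa using (tendsto_pow_mul_exp_neg_mul 0 hw).const_mul (-w⁻¹))
    rw [h]; simp
  | succ m ih =>
    have hi1 := (integrableOn_pow_mul_exp_neg_mul m hw).const_mul ((m : ℂ) + 1)
    have hi2 := (integrableOn_pow_mul_exp_neg_mul (m + 1) hw).const_mul w
    have h := integral_Ioi_of_hasDerivAt_of_tendsto' (a := 0)
      (f := fun u : ℝ => (u : ℂ) ^ (m + 1) * Complex.exp (-(u * w)))
      (f' := fun u : ℝ => ((m : ℂ) + 1) * ((u : ℂ) ^ m * Complex.exp (-(u * w))) -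
        w * ((u : ℂ) ^ (m + 1) * Complex.exp (-(u * w)))) (m := 0)
      (fun u _ => by
        have h1 : HasDerivAt (fun u : ℝ => (u : ℂ) ^ (m + 1)) (((m : ℂ) + 1) * (u : ℂ) ^ m) u := by
          simpa using (Complex.ofRealCLM.hasDerivAt (x := u)).fun_pow (m + 1)
        have := h1.mul (hd u)
        refine this.congr_deriv ?_
        ring) (hi1.sub hi2) (tendsto_pow_mul_exp_neg_mul (m + 1) hw)
    rw [integral_sub hi1 hi2, integral_const_mul, integral_const_mul, ih] at h
    have h2 : w * ∫ u in Set.Ioi (0 : ℝ), (u : ℂ) ^ (m + 1) * Complex.exp (-(u * w)) =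
        ((m : ℂ) + 1) * (m.factorial / w ^ (m + 1)) := by
      simp at h
      linear_combination -h
    rw [Nat.factorial_succ]
    push_cast
    refine mul_left_cancel₀ hw0 (h2.trans ?_)
    field_simp
    ring

/-- If `y' ≥ 1` then `1 / (1 + y²)` has integral at most `π`. -/
theorem integral_inv_one_add_sq_le_pi {y y' : ℝ → ℝ} {R : ℝ}
    (hy : ∀ s ∈ Set.Ici R, HasDerivAt y (y' s) s) (hy' : ∀ s ∈ Set.Ici R, 1 ≤ y' s)
    (hlim : Tendsto y atTop atTop) (hyc : Measurable y) :
    IntegrableOn (fun s => 1 / (1 + y s ^ 2)) (Set.Ioi R) ∧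
      ∫ s in Set.Ioi R, 1 / (1 + y s ^ 2) ≤ Real.pi := by
  have hd : ∀ s ∈ Set.Ici R, HasDerivAt (fun s => Real.arctan (y s)) (1 / (1 + y s ^ 2) * y' s) s :=
    fun s hs => (hy s hs).arctan
  have hnn : ∀ s ∈ Set.Ioi R, 0 ≤ 1 / (1 + y s ^ 2) * y' s := fun s hs => by
    have := hy' s (Set.Ioi_subset_Ici_self hs)
    positivity
  have hl : Tendsto (fun s => Real.arctan (y s)) atTop (𝓝 (Real.pi / 2)) :=
    (tendsto_nhds_of_tendsto_nhdsWithin Real.tendsto_arctan_atTop).comp hlim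
  have hI := integrableOn_Ioi_deriv_of_nonneg' hd hnn hl
  have hv := integral_Ioi_of_hasDerivAt_of_nonneg' hd hnn hl
  have hle : ∀ s ∈ Set.Ioi R, 1 / (1 + y s ^ 2) ≤ 1 / (1 + y s ^ 2) * y' s := fun s hs =>
    le_mul_of_one_le_right (by positivity) (hy' s (Set.Ioi_subset_Ici_self hs))
  have hI2 : IntegrableOn (fun s => 1 / (1 + y s ^ 2)) (Set.Ioi R) := by
    refine hI.mono' ((measurable_const.div (measurable_const.add (hyc.pow_const 2))).aestronglyMeasurable) ?_
    filter_upwards [ae_restrict_mem measurableSet_Ioi] with s hs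
    rw [Real.norm_of_nonneg (by positivity)]
    exact hle s hs
  refine ⟨hI2, (setIntegral_mono_on hI2 hI measurableSet_Ioi hle).trans ?_⟩
  rw [hv]
  have := Real.neg_pi_div_two_lt_arctan (y R)
  linarith

theorem exp_neg_le_rpow_neg {x σ : ℝ} (hx : 0 < x) (hσ : 0 ≤ σ) (hσ1 : σ ≤ 1) :
    Real.exp (-x) ≤ x ^ (-σ) := by
  rcases le_or_gt x 1 with h | h
  · calc Real.exp (-x) ≤ 1 := Real.exp_le_one_iff.2 (by linarith)
      _ ≤ _ := Real.one_le_rpow_of_pos_of_le_one_of_nonpos hx h (by linarith)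
  · calc Real.exp (-x) = (Real.exp x)⁻¹ := Real.exp_neg x
      _ ≤ x⁻¹ := inv_anti₀ hx (by linarith [Real.add_one_le_exp x])
      _ = x ^ (-1 : ℝ) := (Real.rpow_neg_one x).symm
      _ ≤ _ := Real.rpow_le_rpow_of_exponent_le h.le (by linarith)

theorem integral_exp_neg_abs_div_le {ε σ s : ℝ} (hε : 0 < ε) (hσ : 0 < σ) (hσ1 : σ ≤ 1)
    (hs : 0 < s) :
    Integrable (fun x : ℝ => Real.exp (-((ε + |x|) * s)) / (ε + |x|)) ∧
      ∫ x : ℝ, Real.exp (-((ε + |x|) * s)) / (ε + |x|) ≤ 2 / σ * (ε * s) ^ (-σ) := by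
  have hd : ∀ x ∈ Set.Ici (0 : ℝ), HasDerivAt (fun x : ℝ => -(ε + x) ^ (-σ) / σ)
      ((ε + x) ^ (-1 - σ)) x := by
    intro x hx
    have hx0 : (0 : ℝ) ≤ x := hx
    have h1 : HasDerivAt (fun x : ℝ => ε + x) 1 x := (hasDerivAt_id x).const_add ε
    have h2 := ((h1.rpow_const (p := -σ) (Or.inl (by positivity))).neg).div_const σ
    refine h2.congr_deriv ?_
    rw [show -σ - 1 = -1 - σ by ring]
    field_simp
  have hnn : ∀ x ∈ Set.Ioi (0 : ℝ), 0 ≤ (ε + x) ^ (-1 - σ) := fun x hx => by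
    have hx0 : (0 : ℝ) < x := hx
    positivity
  have hlim : Tendsto (fun x : ℝ => -(ε + x) ^ (-σ) / σ) atTop (𝓝 0) := by
    have := ((tendsto_rpow_neg_atTop hσ).comp
      (tendsto_atTop_add_const_left atTop ε tendsto_id)).neg.div_const σ
    simpa using this
  have hg0 := integrableOn_Ioi_deriv_of_nonneg' hd hnn hlim
  have hg : Integrable (fun x : ℝ => (ε + |x|) ^ (-1 - σ)) := by
    have h1 : IntegrableOn (fun x : ℝ => (ε + |x|) ^ (-1 - σ)) (Set.Ioi 0) :=
      hg0.congr_fun (fun x hx => by rw [abs_of_pos hx]) measurableSet_Ioi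
    have h2 : IntegrableOn (fun x : ℝ => (ε + |x|) ^ (-1 - σ)) (Set.Iic 0) := by
      rw [← Measure.map_neg_eq_self (volume : Measure ℝ)]
      let e : MeasurableEmbedding fun x : ℝ => -x := (Homeomorph.neg ℝ).measurableEmbedding
      rw [e.integrableOn_map_iff]
      simpa [Function.comp_def, integrableOn_Ici_iff_integrableOn_Ioi] using h1
    rw [← integrableOn_univ, ← Set.Iic_union_Ioi (a := (0 : ℝ))]
    exact h2.union h1
  have hgv : ∫ x : ℝ, (ε + |x|) ^ (-1 - σ) = 2 / σ * ε ^ (-σ) := by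
    rw [integral_comp_abs (f := fun x : ℝ => (ε + x) ^ (-1 - σ)),
      integral_Ioi_of_hasDerivAt_of_nonneg' hd hnn hlim, add_zero]
    ring
  have hle : ∀ x : ℝ, Real.exp (-((ε + |x|) * s)) / (ε + |x|) ≤
      s ^ (-σ) * (ε + |x|) ^ (-1 - σ) := by
    intro x
    have hA : 0 < ε + |x| := by positivity
    have := exp_neg_le_rpow_neg (mul_pos hA hs) hσ.le hσ1
    rw [Real.mul_rpow hA.le hs.le] at this
    rw [div_le_iff₀ hA]
    refine this.trans (le_of_eq ?_)
    rw [mul_assoc, ← Real.rpow_add_one hA.ne', mul_comm]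
    ring_nf
  have hI : Integrable (fun x : ℝ => Real.exp (-((ε + |x|) * s)) / (ε + |x|)) := by
    refine (hg.const_mul (s ^ (-σ))).mono' (Measurable.aestronglyMeasurable (by fun_prop)) (Eventually.of_forall fun x => ?_)
    rw [Real.norm_of_nonneg (by positivity)]
    exact hle x
  refine ⟨hI, (integral_mono hI (hg.const_mul _) hle).trans (le_of_eq ?_)⟩
  rw [integral_const_mul, hgv, Real.mul_rpow hε.le hs.le]
  ring

end KernelCalculus

section ConeKernel

open Filter Topology FourierTransform RealInnerProductSpace

variable {m : ℕ}

/-- The damped oscillatory profile on the half space `u > 0`. -/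
def coneProfile (m : ℕ) (α s : ℝ) (q : ℝ × EuclideanSpace ℝ (Fin m)) : ℂ :=
  if 0 < q.1 then
    ((q.1 ^ ((m : ℝ) / 2) : ℝ) : ℂ) *
      (Complex.exp (-(q.1 + s * (2 - q.1) * Complex.I)) *
        Complex.exp (-(((α : ℂ) - s * Complex.I) / q.1) * ‖q.2‖ ^ 2))
  else 0

theorem measurable_coneProfile (α : ℝ) :
    Measurable (fun q : ℝ × (ℝ × EuclideanSpace ℝ (Fin m)) => coneProfile m α q.1 q.2) := by
  unfold coneProfile
  refine Measurable.ite (measurableSet_lt measurable_const (by fun_prop)) ?_ measurable_const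
  fun_prop

theorem norm_coneProfile (α s : ℝ) (q : ℝ × EuclideanSpace ℝ (Fin m)) :
    ‖coneProfile m α s q‖ = if 0 < q.1 then
      q.1 ^ ((m : ℝ) / 2) * (Real.exp (-q.1) * Real.exp (-(α / q.1) * ‖q.2‖ ^ 2)) else 0 := by
  unfold coneProfile
  split_ifs with h
  · rw [norm_mul, norm_mul, Complex.norm_exp, Complex.norm_exp, Complex.norm_real,
      Real.norm_of_nonneg (Real.rpow_nonneg h.le _)]
    congr 3
    · simp
    · have : (-(((α : ℂ) - s * Complex.I) / q.1) * ‖q.2‖ ^ 2) =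
          ((-(α / q.1) * ‖q.2‖ ^ 2 : ℝ) : ℂ) + ((s / q.1 * ‖q.2‖ ^ 2 : ℝ) : ℂ) * Complex.I := by
        push_cast; ring
      rw [this]; simp [-Complex.ofReal_pow]
  · simp

theorem gaussian_slice {z : ℂ} (hz : 0 < z.re) {u : ℝ} (hu : 0 < u)
    (Y : EuclideanSpace ℝ (Fin m)) :
    ∫ ζ : EuclideanSpace ℝ (Fin m), Complex.exp (-(2 * Real.pi * ⟪ζ, Y⟫ * Complex.I)) *
        Complex.exp (-(z / u) * ‖ζ‖ ^ 2) =
      ((u ^ ((m : ℝ) / 2) : ℝ) : ℂ) * (Real.pi / z) ^ ((m : ℂ) / 2) *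
        Complex.exp (-(u * (Real.pi ^ 2 * ‖Y‖ ^ 2 / z))) := by
  have hz0 : z ≠ 0 := by rintro rfl; simp at hz
  have hu0 : (u : ℂ) ≠ 0 := by exact_mod_cast hu.ne'
  have hb : 0 < (z / u).re := by rw [Complex.div_ofReal_re]; positivity
  have h := fourier_gaussian_innerProductSpace (V := EuclideanSpace ℝ (Fin m)) hb Y
  rw [Real.fourier_eq'] at h
  simp only [smul_eq_mul] at h
  have hpz : (Real.pi : ℂ) / z ≠ 0 := div_ne_zero (by exact_mod_cast Real.pi_ne_zero) hz0
  have e1 : (Real.pi : ℂ) / (z / u) = u * (Real.pi / z) := by field_simp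
  rw [e1, Complex.cpow_def_of_ne_zero (mul_ne_zero hu0 hpz), Complex.log_ofReal_mul hu hpz,
    add_mul, Complex.exp_add, ← Complex.cpow_def_of_ne_zero hpz, Complex.ofReal_log hu.le,
    ← Complex.cpow_def_of_ne_zero hu0] at h
  rw [Complex.ofReal_cpow hu.le]
  simp only [finrank_euclideanSpace, Fintype.card_fin] at h
  push_cast at h ⊢
  refine (integral_congr_ae (ae_of_all _ fun ζ => ?_)).trans (h.trans ?_)
  · ring_nf
  · congr 2; field_simp

theorem integrable_coneProfile {α : ℝ} (hα : 0 < α) (s : ℝ) :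
    Integrable (coneProfile m α s) := by
  have hmeas : Measurable (coneProfile m α s) :=
    (measurable_coneProfile α).comp (by fun_prop : Measurable fun q => (s, q))
  have hnorm : ∀ u, 0 < u → ∫ ζ : EuclideanSpace ℝ (Fin m), ‖coneProfile m α s (u, ζ)‖ =
      Real.exp (-u) * u ^ m * (Real.pi / α) ^ ((m : ℝ) / 2) := by
    intro u hu
    simp only [norm_coneProfile, hu, if_true]
    rw [integral_const_mul, integral_const_mul,
      GaussianFourier.integral_rexp_neg_mul_sq_norm (div_pos hα hu)]
    simp only [finrank_euclideanSpace, Fintype.card_fin]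
    have e1 : Real.pi / (α / u) = u * (Real.pi / α) := by field_simp
    rw [e1, Real.mul_rpow hu.le (by positivity)]
    have e2 : u ^ m = u ^ ((m : ℝ) / 2) * u ^ ((m : ℝ) / 2) := by
      rw [← Real.rpow_add hu, add_halves, Real.rpow_natCast]
    rw [e2]; ring
  rw [Measure.volume_eq_prod, integrable_prod_iff hmeas.aestronglyMeasurable]
  constructor
  · refine Eventually.of_forall fun u => ?_
    by_cases hu : 0 < u
    · have hi : Integrable fun ζ : EuclideanSpace ℝ (Fin m) =>
          Real.exp (-(α / u) * ‖ζ‖ ^ 2) := by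
        refine Integrable.of_integral_ne_zero ?_
        rw [GaussianFourier.integral_rexp_neg_mul_sq_norm (div_pos hα hu)]
        positivity
      refine (integrable_norm_iff (hmeas.comp
        (by fun_prop : Measurable fun ζ => (u, ζ))).aestronglyMeasurable).1 ?_
      simp only [norm_coneProfile, hu, if_true, Function.comp_def]
      exact (hi.const_mul _).const_mul _
    · simp [coneProfile, hu]
  · have h0 := (integrableOn_pow_mul_exp_neg_mul m (w := 1) (by simp)).norm
    have h1 : IntegrableOn (fun u : ℝ => ∫ ζ : EuclideanSpace ℝ (Fin m),
        ‖coneProfile m α s (u, ζ)‖) (Set.Ioi 0) := by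
      refine (h0.mul_const ((Real.pi / α) ^ ((m : ℝ) / 2))).congr ?_
      filter_upwards [ae_restrict_mem measurableSet_Ioi] with u hu
      have hu' : (0 : ℝ) < u := hu
      rw [hnorm u hu']
      simp only [norm_mul, norm_pow, Complex.norm_real, Real.norm_of_nonneg hu'.le,
        Complex.norm_exp, mul_one, Complex.neg_re, Complex.ofReal_re]
      ring
    refine (integrableOn_univ.1 ?_)
    rw [← Set.Iic_union_Ioi (a := (0 : ℝ))]
    refine IntegrableOn.union ?_ h1
    refine integrableOn_zero.congr_fun (fun u hu => ?_) measurableSet_Iic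
    have hu' : ¬ (0 : ℝ) < u := not_lt.2 hu
    simp [coneProfile, hu']

end ConeKernel

section ConeKernelFourier

open Filter Topology FourierTransform RealInnerProductSpace

variable {m : ℕ}

theorem integral_coneProfile_mul_exp {α s : ℝ} (hα : 0 < α) (X : ℝ)
    (Y : EuclideanSpace ℝ (Fin m)) :
    ∫ q : ℝ × EuclideanSpace ℝ (Fin m),
        Complex.exp (-(2 * Real.pi * (q.1 * X + ⟪q.2, Y⟫) * Complex.I)) * coneProfile m α s q =
      Complex.exp (-(2 * s * Complex.I)) * (Real.pi / (α - s * Complex.I)) ^ ((m : ℂ) / 2) *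
        (m.factorial / (1 - s * Complex.I + 2 * Real.pi * X * Complex.I +
          Real.pi ^ 2 * ‖Y‖ ^ 2 / (α - s * Complex.I)) ^ (m + 1)) := by
  set z : ℂ := α - s * Complex.I with hz
  have hzre : z.re = α := by simp [hz]
  have hz0 : 0 < z.re := by rw [hzre]; exact hα
  set w : ℂ := 1 - s * Complex.I + 2 * Real.pi * X * Complex.I + Real.pi ^ 2 * ‖Y‖ ^ 2 / z with hw
  have hwre : 0 < w.re := by
    have : (Real.pi ^ 2 * ‖Y‖ ^ 2 / z : ℂ) = ((Real.pi ^ 2 * ‖Y‖ ^ 2 : ℝ) : ℂ) / z := by push_cast; rfl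
    rw [hw, this]
    simp only [Complex.add_re, Complex.sub_re, Complex.one_re, Complex.mul_re, Complex.ofReal_re,
      Complex.I_re, Complex.ofReal_im, Complex.I_im, Complex.div_re]
    simp only [hzre]
    have : 0 ≤ Real.pi ^ 2 * ‖Y‖ ^ 2 * α / Complex.normSq z :=
      div_nonneg (by positivity) (Complex.normSq_nonneg z)
    simp [-Complex.ofReal_pow]
    linarith
  have hint : Integrable fun q : ℝ × EuclideanSpace ℝ (Fin m) =>
      Complex.exp (-(2 * Real.pi * (q.1 * X + ⟪q.2, Y⟫) * Complex.I)) * coneProfile m α s q := by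
    refine (integrable_coneProfile hα s).bdd_mul (c := 1)
      (Measurable.aestronglyMeasurable (by fun_prop)) (Eventually.of_forall fun q => ?_)
    rw [Complex.norm_exp]
    simp
  rw [Measure.volume_eq_prod] at hint ⊢
  rw [integral_prod _ hint]
  have key : ∀ u : ℝ, ∫ ζ : EuclideanSpace ℝ (Fin m),
      Complex.exp (-(2 * Real.pi * (u * X + ⟪ζ, Y⟫) * Complex.I)) * coneProfile m α s (u, ζ) =
      (Set.Ioi (0 : ℝ)).indicator (fun u : ℝ => Complex.exp (-(2 * s * Complex.I)) *
        (Real.pi / z) ^ ((m : ℂ) / 2) * ((u : ℂ) ^ m * Complex.exp (-(u * w)))) u := by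
    intro u
    by_cases hu : 0 < u
    · rw [Set.indicator_of_mem (Set.mem_Ioi.2 hu)]
      have e : ∀ ζ : EuclideanSpace ℝ (Fin m),
          Complex.exp (-(2 * Real.pi * (u * X + ⟪ζ, Y⟫) * Complex.I)) * coneProfile m α s (u, ζ) =
          (((u ^ ((m : ℝ) / 2) : ℝ) : ℂ) * (Complex.exp (-(u + s * (2 - u) * Complex.I)) *
            Complex.exp (-(2 * Real.pi * (u * X) * Complex.I)))) *
          (Complex.exp (-(2 * Real.pi * ⟪ζ, Y⟫ * Complex.I)) *
            Complex.exp (-(z / u) * ‖ζ‖ ^ 2)) := by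
        intro ζ
        simp only [coneProfile, hu, if_true]
        rw [mul_add, add_mul, neg_add, Complex.exp_add]
        ring
      rw [integral_congr_ae (ae_of_all _ e), integral_const_mul, gaussian_slice hz0 hu]
      have e2 : (u : ℂ) ^ m = ((u ^ ((m : ℝ) / 2) : ℝ) : ℂ) * ((u ^ ((m : ℝ) / 2) : ℝ) : ℂ) := by
        rw [← Complex.ofReal_mul, ← Real.rpow_add hu, add_halves, Real.rpow_natCast]
        push_cast; rfl
      have e3 : Complex.exp (-(u * w)) * Complex.exp (-(2 * s * Complex.I)) =
          Complex.exp (-(u + s * (2 - u) * Complex.I)) *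
            Complex.exp (-(2 * Real.pi * (u * X) * Complex.I)) *
            Complex.exp (-(u * (Real.pi ^ 2 * ‖Y‖ ^ 2 / z))) := by
        rw [← Complex.exp_add, ← Complex.exp_add, ← Complex.exp_add, hw]
        congr 1
        ring
      rw [e2]
      linear_combination (-((u ^ ((m : ℝ) / 2) : ℝ) : ℂ) * ((u ^ ((m : ℝ) / 2) : ℝ) : ℂ) *
        (Real.pi / z) ^ ((m : ℂ) / 2)) * e3
    · rw [Set.indicator_of_notMem (by simpa using hu)]
      simp [coneProfile, hu]
  rw [integral_congr_ae (ae_of_all _ key), integral_indicator measurableSet_Ioi,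
    integral_const_mul, integral_pow_mul_exp_neg_mul m hwre]

theorem norm_integral_coneProfile_mul_exp_le (hm : 1 ≤ m) {α s : ℝ} (hα : 0 < α) (hs : 0 < s)
    (X : ℝ) (Y : EuclideanSpace ℝ (Fin m)) :
    ‖∫ q : ℝ × EuclideanSpace ℝ (Fin m),
        Complex.exp (-(2 * Real.pi * (q.1 * X + ⟪q.2, Y⟫) * Complex.I)) * coneProfile m α s q‖ ≤
      (Real.pi / s) ^ ((m : ℝ) / 2) * (m.factorial *
        (1 / (1 + (s - 2 * Real.pi * X - Real.pi ^ 2 * ‖Y‖ ^ 2 * (s / (α ^ 2 + s ^ 2))) ^ 2))) := by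
  rw [integral_coneProfile_mul_exp hα]
  set z : ℂ := α - s * Complex.I with hz
  set w : ℂ := 1 - s * Complex.I + 2 * Real.pi * X * Complex.I + Real.pi ^ 2 * ‖Y‖ ^ 2 / z with hw
  have hzre : z.re = α := by simp [hz]
  have hzim : z.im = -s := by simp [hz]
  have hnz : Complex.normSq z = α ^ 2 + s ^ 2 := by
    rw [Complex.normSq_apply, hzre, hzim]; ring
  have hden : 0 < α ^ 2 + s ^ 2 := by positivity
  have hdiv : (Real.pi ^ 2 * ‖Y‖ ^ 2 / z : ℂ) = ((Real.pi ^ 2 * ‖Y‖ ^ 2 : ℝ) : ℂ) / z := by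
    push_cast; rfl
  obtain ⟨Q, hQ⟩ : ∃ Q, Q = Real.pi ^ 2 * ‖Y‖ ^ 2 := ⟨_, rfl⟩
  have hwre : w.re = 1 + Q * α / (α ^ 2 + s ^ 2) := by
    rw [hw, hdiv, ← hQ, Complex.add_re, Complex.div_re, hnz, hzre, hzim]
    simp
  have hwim : w.im = -(s - 2 * Real.pi * X - Q * (s / (α ^ 2 + s ^ 2))) := by
    rw [hw, hdiv, ← hQ, Complex.add_im, Complex.div_im, hnz, hzre, hzim]
    simp
    ring
  rw [hQ] at hwre hwim
  set y := s - 2 * Real.pi * X - Real.pi ^ 2 * ‖Y‖ ^ 2 * (s / (α ^ 2 + s ^ 2)) with hy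
  have hre1 : 1 ≤ w.re := by
    rw [hwre]
    have : 0 ≤ Real.pi ^ 2 * ‖Y‖ ^ 2 * α / (α ^ 2 + s ^ 2) := by positivity
    linarith
  have hw1 : 1 ≤ ‖w‖ := hre1.trans (Complex.re_le_norm w)
  have hw2 : 1 + y ^ 2 ≤ ‖w‖ ^ (m + 1) := by
    calc 1 + y ^ 2 ≤ w.re ^ 2 + w.im ^ 2 := by rw [hwim]; nlinarith
      _ = ‖w‖ ^ 2 := by rw [← Complex.normSq_eq_norm_sq, Complex.normSq_apply]; ring
      _ ≤ _ := pow_le_pow_right₀ hw1 (by omega)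
  have hsz : s ≤ ‖z‖ := by
    have := Complex.abs_im_le_norm z
    rw [hzim, abs_neg, abs_of_pos hs] at this
    exact this
  have e1 : ‖Complex.exp (-(2 * s * Complex.I))‖ = 1 := by
    rw [Complex.norm_exp]; simp
  have e2 : ‖((Real.pi : ℂ) / z) ^ ((m : ℂ) / 2)‖ = (Real.pi / ‖z‖) ^ ((m : ℝ) / 2) := by
    have hz0 : z ≠ 0 := by
      rintro h; rw [h] at hzre; simp at hzre; exact hα.ne hzre
    have : ((m : ℂ) / 2) = (((m : ℝ) / 2 : ℝ) : ℂ) := by push_cast; rfl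
    rw [this, Complex.norm_cpow_real, norm_div, Complex.norm_real, Real.norm_of_nonneg Real.pi_pos.le]
  rw [norm_mul, norm_mul, e1, e2, one_mul, norm_div, norm_pow, Complex.norm_natCast,
    div_eq_mul_one_div (m.factorial : ℝ)]
  have hzpos : 0 < ‖z‖ := hs.trans_le hsz
  gcongr

theorem integral_phase_le_pi {α R X Q : ℝ} (hα : 0 < α) (hαR : α ≤ R) (hQ : 0 ≤ Q) :
    IntegrableOn (fun s : ℝ => 1 / (1 + (s - X - Q * (s / (α ^ 2 + s ^ 2))) ^ 2)) (Set.Ioi R) ∧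
      ∫ s in Set.Ioi R, 1 / (1 + (s - X - Q * (s / (α ^ 2 + s ^ 2))) ^ 2) ≤ Real.pi := by
  refine integral_inv_one_add_sq_le_pi (y := fun s => s - X - Q * (s / (α ^ 2 + s ^ 2)))
    (y' := fun s => 1 - Q * ((α ^ 2 - s ^ 2) / (α ^ 2 + s ^ 2) ^ 2)) ?_ ?_ ?_ (by fun_prop)
  · intro s hs
    have hden : α ^ 2 + s ^ 2 ≠ 0 := by positivity
    have h := (((hasDerivAt_id s).sub_const X).sub
      (((hasDerivAt_id s).div (((hasDerivAt_id s).fun_pow 2).const_add (α ^ 2)) hden).const_mul Q))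
    refine h.congr_deriv ?_
    simp
    left
    ring
  · intro s hs
    have hs' : R ≤ s := hs
    have : (α ^ 2 - s ^ 2) / (α ^ 2 + s ^ 2) ^ 2 ≤ 0 :=
      div_nonpos_of_nonpos_of_nonneg (by nlinarith) (by positivity)
    nlinarith
  · refine tendsto_atTop_mono' _ (f₁ := fun s : ℝ => s + (-X - Q * (1 / α ))) ?_
      (tendsto_atTop_add_const_right _ _ tendsto_id)
    filter_upwards [eventually_gt_atTop 0] with s hs
    have : s / (α ^ 2 + s ^ 2) ≤ 1 / α := by
      rw [div_le_div_iff₀ (by positivity) hα]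
      nlinarith [sq_nonneg (s - α), mul_pos hs hα]
    nlinarith

end ConeKernelFourier

section ConeKernelBound

open Filter Topology FourierTransform RealInnerProductSpace

variable {m : ℕ}

/-- The oscillatory kernel at time `s`, in the coordinates `(η₁, η₂, ζ)`. -/
def coneKernel (m : ℕ) (ε α s : ℝ) (p : ℝ × (ℝ × EuclideanSpace ℝ (Fin m))) : ℂ :=
  ((Real.exp (-((ε + |p.1|) * s)) / (ε + |p.1|) : ℝ) : ℂ) *
    coneProfile m α s ((1, 0) + p.2)

theorem isAddLeftInvariant_volume_prod :
    (volume : Measure (ℝ × EuclideanSpace ℝ (Fin m))).IsAddLeftInvariant :=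
  inferInstanceAs ((volume : Measure ℝ).prod
    (volume : Measure (EuclideanSpace ℝ (Fin m)))).IsAddLeftInvariant

theorem norm_integral_shifted_coneProfile_mul_exp_le (hm : 1 ≤ m) {α s : ℝ} (hα : 0 < α)
    (hs : 0 < s) (X : ℝ) (Y : EuclideanSpace ℝ (Fin m)) :
    ‖∫ q : ℝ × EuclideanSpace ℝ (Fin m),
        Complex.exp (-(2 * Real.pi * (q.1 * X + ⟪q.2, Y⟫) * Complex.I)) *
          coneProfile m α s ((1, 0) + q)‖ ≤
      (Real.pi / s) ^ ((m : ℝ) / 2) * (m.factorial *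
        (1 / (1 + (s - 2 * Real.pi * X - Real.pi ^ 2 * ‖Y‖ ^ 2 * (s / (α ^ 2 + s ^ 2))) ^ 2))) := by
  refine le_trans (le_of_eq ?_) (norm_integral_coneProfile_mul_exp_le hm hα hs X Y)
  have := isAddLeftInvariant_volume_prod (m := m)
  have h := integral_add_left_eq_self (μ := (volume : Measure (ℝ × EuclideanSpace ℝ (Fin m))))
    (fun q : ℝ × EuclideanSpace ℝ (Fin m) =>
      Complex.exp (-(2 * Real.pi * (q.1 * X + ⟪q.2, Y⟫) * Complex.I)) * coneProfile m α s q) (1, 0)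
  rw [← h]
  have e : ∀ q : ℝ × EuclideanSpace ℝ (Fin m),
      Complex.exp (-(2 * Real.pi * ((((1, 0) + q).1 : ℝ) * X + ⟪((1, 0) + q).2, Y⟫) * Complex.I)) *
        coneProfile m α s ((1, 0) + q) =
      Complex.exp (-(2 * Real.pi * X * Complex.I)) *
      (Complex.exp (-(2 * Real.pi * (q.1 * X + ⟪q.2, Y⟫) * Complex.I)) *
        coneProfile m α s ((1, 0) + q)) := by
    intro q
    rw [← mul_assoc, ← Complex.exp_add]
    congr 2
    simp
    ring
  simp only [e]
  rw [integral_const_mul, norm_mul]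
  have : ‖Complex.exp (-(2 * Real.pi * X * Complex.I))‖ = 1 := by rw [Complex.norm_exp]; simp
  rw [this, one_mul]

theorem norm_coneKernel (ε α s : ℝ) (hε : 0 < ε) (p : ℝ × (ℝ × EuclideanSpace ℝ (Fin m))) :
    ‖coneKernel m ε α s p‖ = Real.exp (-((ε + |p.1|) * s)) / (ε + |p.1|) *
      ‖coneProfile m α 0 ((1, 0) + p.2)‖ := by
  unfold coneKernel
  rw [norm_mul, Complex.norm_real, Real.norm_of_nonneg (by positivity), norm_coneProfile,
    norm_coneProfile]

theorem measurable_coneKernel (ε α : ℝ) :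
    Measurable fun q : ℝ × (ℝ × (ℝ × EuclideanSpace ℝ (Fin m))) => coneKernel m ε α q.1 q.2 := by
  unfold coneKernel
  refine Measurable.mul (by fun_prop) ?_
  exact (measurable_coneProfile α).comp
    (by fun_prop : Measurable fun q : ℝ × (ℝ × (ℝ × EuclideanSpace ℝ (Fin m))) =>
      (q.1, ((1, 0) + q.2.2 : ℝ × EuclideanSpace ℝ (Fin m))))

theorem integrable_coneKernel {ε α R : ℝ} (hε : 0 < ε) (hα : 0 < α) (hR : 0 < R) :
    Integrable (fun q : ℝ × (ℝ × (ℝ × EuclideanSpace ℝ (Fin m))) => coneKernel m ε α q.1 q.2)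
      ((volume.restrict (Set.Ioi R)).prod volume) := by
  have := isAddLeftInvariant_volume_prod (m := m)
  have h1 : Integrable (fun s : ℝ => Real.exp (ε * R) * Real.exp (-ε * s))
      (volume.restrict (Set.Ioi R)) := (exp_neg_integrableOn_Ioi R hε).const_mul _
  have h2 := (integral_exp_neg_abs_div_le hε one_pos le_rfl hR).1
  have h3 : Integrable (fun q : ℝ × EuclideanSpace ℝ (Fin m) => coneProfile m α 0 ((1, 0) + q)) :=
    (integrable_coneProfile hα 0).comp_add_left (1, 0)
  have h4 := h1.mul_prod (h2.mul_prod h3.norm)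
  refine h4.mono' (measurable_coneKernel ε α).aestronglyMeasurable ?_
  have hmem : ∀ᵐ q : ℝ × (ℝ × (ℝ × EuclideanSpace ℝ (Fin m)))
      ∂((volume.restrict (Set.Ioi R)).prod volume), q.1 ∈ Set.Ioi R :=
    Measure.quasiMeasurePreserving_fst.ae (ae_restrict_mem measurableSet_Ioi)
  filter_upwards [hmem] with q hq
  have hq' : R < q.1 := hq
  rw [norm_coneKernel _ _ _ hε, ← mul_assoc]
  have ha : 0 ≤ |q.2.1| := abs_nonneg _
  rw [← mul_div_assoc]
  gcongr
  rw [← Real.exp_add, ← Real.exp_add]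
  gcongr
  nlinarith

theorem norm_integral_coneKernel_mul_exp_le (hm : 1 ≤ m) {ε α R σ : ℝ} (hε : 0 < ε) (hα : 0 < α)
    (hαR : α ≤ R) (hσ : 0 < σ) (hσ1 : σ ≤ 1) (X₁ X₂ : ℝ) (Y : EuclideanSpace ℝ (Fin m)) :
    ‖∫ p : ℝ × (ℝ × EuclideanSpace ℝ (Fin m)),
      Complex.exp (-(2 * Real.pi * (p.1 * X₁ + (p.2.1 * X₂ + ⟪p.2.2, Y⟫)) * Complex.I)) *
        ∫ s in Set.Ioi R, coneKernel m ε α s p‖ ≤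
      2 / σ * (ε * R) ^ (-σ) * ((Real.pi / R) ^ ((m : ℝ) / 2) * m.factorial) * Real.pi := by
  have hR : 0 < R := hα.trans_le hαR
  set e : ℝ × (ℝ × EuclideanSpace ℝ (Fin m)) → ℂ := fun p =>
    Complex.exp (-(2 * Real.pi * (p.1 * X₁ + (p.2.1 * X₂ + ⟪p.2.2, Y⟫)) * Complex.I)) with he
  have hint : Integrable (fun q : ℝ × (ℝ × (ℝ × EuclideanSpace ℝ (Fin m))) =>
      e q.2 * coneKernel m ε α q.1 q.2) ((volume.restrict (Set.Ioi R)).prod volume) := by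
    refine (integrable_coneKernel hε hα hR).bdd_mul (c := 1)
      (Measurable.aestronglyMeasurable (by fun_prop)) (Eventually.of_forall fun q => ?_)
    simp only [he]
    rw [Complex.norm_exp]
    simp
  simp only [← integral_const_mul]
  rw [← integral_integral_swap hint]
  obtain ⟨hphi, hphi'⟩ := integral_phase_le_pi (X := 2 * Real.pi * X₂)
    (Q := Real.pi ^ 2 * ‖Y‖ ^ 2) hα hαR (by positivity)
  have hC : 0 ≤ 2 / σ * (ε * R) ^ (-σ) * ((Real.pi / R) ^ ((m : ℝ) / 2) * m.factorial) := by
    positivity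
  refine (norm_integral_le_of_norm_le (hphi.const_mul
    (2 / σ * (ε * R) ^ (-σ) * ((Real.pi / R) ^ ((m : ℝ) / 2) * m.factorial))) ?_).trans ?_
  · filter_upwards [ae_restrict_mem measurableSet_Ioi] with s hs
    have hs' : R < s := hs
    have hs0 : 0 < s := hR.trans hs'
    have hfac : ∀ p : ℝ × (ℝ × EuclideanSpace ℝ (Fin m)), e p * coneKernel m ε α s p =
        (Complex.exp (-(2 * Real.pi * (p.1 * X₁) * Complex.I)) *
          ((Real.exp (-((ε + |p.1|) * s)) / (ε + |p.1|) : ℝ) : ℂ)) *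
        (Complex.exp (-(2 * Real.pi * (p.2.1 * X₂ + ⟪p.2.2, Y⟫) * Complex.I)) *
          coneProfile m α s ((1, 0) + p.2)) := by
      intro p
      simp only [he, coneKernel]
      rw [mul_add, add_mul, neg_add, Complex.exp_add]
      ring
    change ‖∫ p, e p * coneKernel m ε α s p‖ ≤ _
    rw [integral_congr_ae (ae_of_all _ hfac), Measure.volume_eq_prod, integral_prod_mul (fun x : ℝ =>
      Complex.exp (-(2 * Real.pi * (x * X₁) * Complex.I)) *
          ((Real.exp (-((ε + |x|) * s)) / (ε + |x|) : ℝ) : ℂ)) (fun q : ℝ × EuclideanSpace ℝ (Fin m) =>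
        Complex.exp (-(2 * Real.pi * (q.1 * X₂ + ⟪q.2, Y⟫) * Complex.I)) *
          coneProfile m α s ((1, 0) + q)), norm_mul]
    obtain ⟨g1, g2⟩ := integral_exp_neg_abs_div_le hε hσ hσ1 hs0
    have b1 : ‖∫ x : ℝ, Complex.exp (-(2 * Real.pi * (x * X₁) * Complex.I)) *
          ((Real.exp (-((ε + |x|) * s)) / (ε + |x|) : ℝ) : ℂ)‖ ≤ 2 / σ * (ε * R) ^ (-σ) := by
      refine (norm_integral_le_of_norm_le g1 (Eventually.of_forall fun x => ?_)).trans (g2.trans ?_)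
      · rw [norm_mul, Complex.norm_real, Complex.norm_exp, Real.norm_of_nonneg (by positivity)]
        simp
      · gcongr 2 / σ * ?_
        exact Real.rpow_le_rpow_of_nonpos (by positivity) (by gcongr) (by linarith)
    have b2 := norm_integral_shifted_coneProfile_mul_exp_le hm hα hs0 X₂ Y
    rw [Measure.volume_eq_prod] at b2
    calc _ ≤ (2 / σ * (ε * R) ^ (-σ)) * _ := mul_le_mul b1 b2 (norm_nonneg _) (by positivity)
      _ ≤ (2 / σ * (ε * R) ^ (-σ)) * ((Real.pi / R) ^ ((m : ℝ) / 2) * (m.factorial * _)) := by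
        gcongr
      _ = _ := by ring
  · rw [integral_const_mul]
    gcongr

end ConeKernelBound

section ConeMultiplier

open Filter Topology FourierTransform RealInnerProductSpace

variable {m : ℕ}

/-- Euclidean space of dimension `m + 2`, with coordinates `(η₁, η₂, ζ)`. -/
abbrev ConeSpace (m : ℕ) : Type :=
  WithLp 2 (ℝ × WithLp 2 (ℝ × EuclideanSpace ℝ (Fin m)))

/-- The coordinates of a point of `ConeSpace`. -/
def coneCoords (w : ConeSpace m) : ℝ × (ℝ × EuclideanSpace ℝ (Fin m)) :=
  (w.fst, (w.snd.fst, w.snd.snd))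

theorem measurePreserving_coneCoords : MeasurePreserving (coneCoords (m := m)) := by
  have h1 : MeasurePreserving
      (WithLp.ofLp : ConeSpace m → ℝ × WithLp 2 (ℝ × EuclideanSpace ℝ (Fin m))) :=
    WithLp.volume_preserving_ofLp _ _
  have h2 : MeasurePreserving
      (WithLp.ofLp : WithLp 2 (ℝ × EuclideanSpace ℝ (Fin m)) → ℝ × EuclideanSpace ℝ (Fin m)) :=
    WithLp.volume_preserving_ofLp _ _
  exact ((MeasurePreserving.id (volume : Measure ℝ)).prod h2).comp h1

theorem integral_coneCoords {k : ℝ × (ℝ × EuclideanSpace ℝ (Fin m)) → ℂ} (hk : AEStronglyMeasurable k) :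
    ∫ w : ConeSpace m, k (coneCoords w) = ∫ p, k p := by
  have h := measurePreserving_coneCoords (m := m)
  rw [← h.map_eq] at hk ⊢
  rw [integral_map h.measurable.aemeasurable hk]

/-- The amplitude of the cone multiplier. -/
def coneAmp (m : ℕ) (u : ℝ) : ℝ := if 0 < u then u ^ ((m : ℝ) / 2) * Real.exp (-u) else 0

/-- The phase of the cone multiplier. -/
def conePhase (q : ℝ × EuclideanSpace ℝ (Fin m)) : ℝ := ‖q.2‖ ^ 2 / (1 + q.1) - (1 - q.1)

/-- The cone multiplier. -/
def coneMult (m : ℕ) (ε : ℝ) (p : ℝ × (ℝ × EuclideanSpace ℝ (Fin m))) : ℝ :=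
  coneAmp m (1 + p.2.1) / ((ε + |p.1|) ^ 2 + conePhase p.2 ^ 2)

theorem coneAmp_nonneg (u : ℝ) : 0 ≤ coneAmp m u := by
  unfold coneAmp
  split_ifs <;> positivity

theorem coneAmp_le (u : ℝ) : coneAmp m u ≤ 1 + m.factorial := by
  unfold coneAmp
  split_ifs with hu
  · have h1 : u ^ ((m : ℝ) / 2) ≤ 1 + u ^ m := by
      rcases le_or_gt u 1 with h | h
      · have := Real.rpow_le_one hu.le h (by positivity : (0 : ℝ) ≤ (m : ℝ) / 2)
        have : 0 ≤ u ^ m := by positivity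
        linarith
      · have := Real.rpow_le_rpow_of_exponent_le h.le
          (by linarith [(Nat.cast_nonneg m : (0 : ℝ) ≤ m)] : (m : ℝ) / 2 ≤ m)
        rw [Real.rpow_natCast] at this
        linarith
    have h2 := Real.pow_div_factorial_le_exp u hu.le m
    rw [div_le_iff₀ (by positivity)] at h2
    have h3 : (1 : ℝ) ≤ Real.exp u := Real.one_le_exp hu.le
    rw [Real.exp_neg, ← div_eq_mul_inv, div_le_iff₀ (Real.exp_pos u)]
    nlinarith
  · positivity

theorem measurable_coneAmp : Measurable (coneAmp m) := by
  unfold coneAmp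
  exact Measurable.ite measurableSet_Ioi (by fun_prop) measurable_const

theorem measurable_coneMult (ε : ℝ) : Measurable (coneMult m ε) := by
  unfold coneMult conePhase
  exact (measurable_coneAmp.comp (by fun_prop : Measurable fun p :
    ℝ × (ℝ × EuclideanSpace ℝ (Fin m)) => 1 + p.2.1)).div (by fun_prop)

theorem coneMult_nonneg (ε : ℝ) (p : ℝ × (ℝ × EuclideanSpace ℝ (Fin m))) :
    0 ≤ coneMult m ε p := div_nonneg (coneAmp_nonneg _) (by positivity)

theorem coneMult_le {ε : ℝ} (hε : 0 < ε) (p : ℝ × (ℝ × EuclideanSpace ℝ (Fin m))) :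
    coneMult m ε p ≤ (1 + m.factorial) * ε⁻¹ ^ 2 := by
  unfold coneMult
  rw [inv_pow, ← div_eq_mul_inv]
  have h := coneAmp_le (m := m) (1 + p.2.1)
  have h2 : ε ^ 2 ≤ (ε + |p.1|) ^ 2 + conePhase p.2 ^ 2 := by
    nlinarith [abs_nonneg p.1, sq_nonneg (conePhase p.2)]
  exact div_le_div₀ (by positivity) h (by positivity) h2

theorem coneKernel_eq {ε : ℝ} (hε : 0 < ε) (α s : ℝ)
    (p : ℝ × (ℝ × EuclideanSpace ℝ (Fin m))) :
    coneKernel m ε α s p =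
      ((coneAmp m (1 + p.2.1) / (ε + |p.1|) * Real.exp (-(α * (‖p.2.2‖ ^ 2 / (1 + p.2.1)))) : ℝ) : ℂ) *
        Complex.exp ((-((ε + |p.1| : ℝ) : ℂ) + conePhase p.2 * Complex.I) * s) := by
  unfold coneKernel coneAmp coneProfile conePhase
  by_cases hu : 0 < 1 + p.2.1
  · have hu0 : (1 : ℂ) + p.2.1 ≠ 0 := by exact_mod_cast hu.ne'
    have hA : (ε : ℂ) + (|p.1| : ℝ) ≠ 0 := by
      have : ε + |p.1| ≠ 0 := by positivity
      exact_mod_cast this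
    simp only [Prod.fst_add, Prod.snd_add, hu, if_true, zero_add]
    push_cast
    rw [show ∀ a b c d e g h k : ℂ, (a / b * (c * (d * e)) = c * g / b * h * k ↔
      c / b * (a * d * e) = c / b * (g * h * k)) from fun a b c d e g h k => by
        constructor <;> intro h <;> linear_combination h]
    congr 1
    rw [← Complex.exp_add, ← Complex.exp_add, ← Complex.exp_add, ← Complex.exp_add]
    congr 1
    field_simp
    ring
  · simp [hu]

theorem integral_coneKernel {ε : ℝ} (hε : 0 < ε) (α R : ℝ)
    (p : ℝ × (ℝ × EuclideanSpace ℝ (Fin m))) :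
    ∫ s in Set.Ioi R, coneKernel m ε α s p =
      ((coneAmp m (1 + p.2.1) / (ε + |p.1|) * Real.exp (-(α * (‖p.2.2‖ ^ 2 / (1 + p.2.1)))) : ℝ) : ℂ) *
        (Complex.exp (-((((ε + |p.1| : ℝ) : ℂ) - conePhase p.2 * Complex.I) * R)) /
          (((ε + |p.1| : ℝ) : ℂ) - conePhase p.2 * Complex.I)) := by
  simp only [coneKernel_eq hε]
  rw [integral_const_mul, integral_exp_mul_complex_Ioi]
  · congr 1
    rw [show (-((ε + |p.1| : ℝ) : ℂ) + conePhase p.2 * Complex.I) =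
      -(((ε + |p.1| : ℝ) : ℂ) - conePhase p.2 * Complex.I) by ring, neg_div_neg_eq, neg_mul]
  · have : 0 < ε + |p.1| := by positivity
    simp
    linarith

theorem fourier_coneKernel_le (hm : 1 ≤ m) {ε α R σ : ℝ} (hε : 0 < ε) (hα : 0 < α)
    (hαR : α ≤ R) (hσ : 0 < σ) (hσ1 : σ ≤ 1) :
    Integrable (fun w : ConeSpace m => ∫ s in Set.Ioi R, coneKernel m ε α s (coneCoords w)) ∧
    ∀ X : ConeSpace m,
      ‖𝓕 (fun w : ConeSpace m => ∫ s in Set.Ioi R, coneKernel m ε α s (coneCoords w)) X‖ ≤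
        2 / σ * (ε * R) ^ (-σ) * ((Real.pi / R) ^ ((m : ℝ) / 2) * m.factorial) * Real.pi := by
  have hint : Integrable fun p : ℝ × (ℝ × EuclideanSpace ℝ (Fin m)) =>
      ∫ s in Set.Ioi R, coneKernel m ε α s p :=
    (integrable_coneKernel (m := m) hε hα (hα.trans_le hαR)).integral_prod_right
  refine ⟨measurePreserving_coneCoords.integrable_comp_of_integrable hint, fun X => ?_⟩
  have h := norm_integral_coneKernel_mul_exp_le hm hε hα hαR hσ hσ1 X.fst X.snd.fst X.snd.snd
  refine le_trans (le_of_eq ?_) h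
  rw [← integral_coneCoords]
  · rw [Real.fourier_eq']
    congr 2
    ext w
    rw [smul_eq_mul]
    congr 2
    simp [WithLp.prod_inner_apply, coneCoords]
    ring
  · exact (Measurable.aestronglyMeasurable (by fun_prop)).mul hint.aestronglyMeasurable

end ConeMultiplier

section ConeQuadraticForm

open Filter Topology FourierTransform RealInnerProductSpace

variable {m : ℕ}

theorem measurable_norm_sq_fourier {V : Type*} [NormedAddCommGroup V] [InnerProductSpace ℝ V]
    [FiniteDimensional ℝ V] [MeasurableSpace V] [BorelSpace V] {f : V → ℂ} (hf : Integrable f) :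
    Measurable fun ξ => ‖𝓕 f ξ‖ ^ 2 :=
  ((continuous_fourier_of_integrable hf).norm.pow 2).measurable

/-- The tail `s > R` of the oscillatory integral, without damping. -/
def coneTail (m : ℕ) (ε R : ℝ) (p : ℝ × (ℝ × EuclideanSpace ℝ (Fin m))) : ℂ :=
  ((coneAmp m (1 + p.2.1) / (ε + |p.1|) : ℝ) : ℂ) *
    (Complex.exp (-((((ε + |p.1| : ℝ) : ℂ) - conePhase p.2 * Complex.I) * R)) /
      (((ε + |p.1| : ℝ) : ℂ) - conePhase p.2 * Complex.I))

theorem measurable_coneTail (ε R : ℝ) : Measurable (coneTail m ε R) := by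
  unfold coneTail conePhase
  have h := (measurable_coneAmp (m := m)).comp (by fun_prop : Measurable fun p :
    ℝ × (ℝ × EuclideanSpace ℝ (Fin m)) => 1 + p.2.1)
  simp only [Function.comp_def] at h
  fun_prop

theorem norm_coneTail_le {ε R : ℝ} (hε : 0 < ε) (hR : 0 ≤ R)
    (p : ℝ × (ℝ × EuclideanSpace ℝ (Fin m))) :
    ‖coneTail m ε R p‖ ≤ (1 + m.factorial) / ε * (1 / ε) := by
  unfold coneTail
  have hA : 0 < ε + |p.1| := by positivity
  have hle : ε ≤ ‖(((ε + |p.1| : ℝ) : ℂ) - conePhase p.2 * Complex.I)‖ := by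
    refine le_trans ?_ (Complex.re_le_norm _)
    simp
  rw [norm_mul, norm_div, Complex.norm_real, Complex.norm_exp,
    Real.norm_of_nonneg (div_nonneg (coneAmp_nonneg _) hA.le)]
  have h1 : Real.exp (-((((ε + |p.1| : ℝ) : ℂ) - conePhase p.2 * Complex.I) * R)).re ≤ 1 := by
    rw [Real.exp_le_one_iff]
    simp
    positivity
  have := coneAmp_le (m := m) (1 + p.2.1)
  have h0 := coneAmp_nonneg (m := m) (1 + p.2.1)
  gcongr
  simp

theorem norm_integral_coneTail_le (hm : 1 ≤ m) {ε R σ : ℝ} (hε : 0 < ε)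
    (hR : 0 < R) (hσ : 0 < σ) (hσ1 : σ ≤ 1) {f : ConeSpace m → ℂ} (hf1 : Integrable f)
    (hf2 : MemLp f 2) :
    ‖∫ ξ : ConeSpace m, coneTail m ε R (coneCoords ξ) * ((‖𝓕 f ξ‖ ^ 2 : ℝ) : ℂ)‖ ≤
      2 / σ * (ε * R) ^ (-σ) * ((Real.pi / R) ^ ((m : ℝ) / 2) * m.factorial) * Real.pi *
        (∫ x, ‖f x‖) ^ 2 := by
  have hlim : Tendsto (fun α : ℝ => ∫ ξ : ConeSpace m,
      (∫ s in Set.Ioi R, coneKernel m ε α s (coneCoords ξ)) * ((‖𝓕 f ξ‖ ^ 2 : ℝ) : ℂ))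
      (𝓝[>] 0) (𝓝 (∫ ξ : ConeSpace m, coneTail m ε R (coneCoords ξ) * ((‖𝓕 f ξ‖ ^ 2 : ℝ) : ℂ))) := by
    have hform : ∀ (α : ℝ) (p : ℝ × (ℝ × EuclideanSpace ℝ (Fin m))),
        ∫ s in Set.Ioi R, coneKernel m ε α s p =
          ((Real.exp (-(α * (‖p.2.2‖ ^ 2 / (1 + p.2.1)))) : ℝ) : ℂ) * coneTail m ε R p := by
      intro α p
      rw [integral_coneKernel hε, coneTail]
      push_cast
      ring
    simp only [hform]
    have hmeas := measurable_norm_sq_fourier hf1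
    have hmt := (measurable_coneTail (m := m) ε R).comp measurePreserving_coneCoords.measurable
    have hmc := (measurePreserving_coneCoords (m := m)).measurable
    simp only [Function.comp_def] at hmt
    refine tendsto_integral_filter_of_dominated_convergence
      (fun ξ => ((1 + m.factorial) / ε * (1 / ε)) * ‖𝓕 f ξ‖ ^ 2) ?_ ?_ ?_ ?_
    · refine Eventually.of_forall fun α => Measurable.aestronglyMeasurable ?_
      fun_prop
    · filter_upwards [self_mem_nhdsWithin] with α hα
      have hα' : (0 : ℝ) < α := hα
      refine Eventually.of_forall fun ξ => ?_
      rw [norm_mul, Complex.norm_real, Real.norm_of_nonneg (by positivity : 0 ≤ ‖𝓕 f ξ‖ ^ 2)]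
      gcongr
      set p := coneCoords ξ
      by_cases hu : 0 < 1 + p.2.1
      · rw [norm_mul, Complex.norm_real, Real.norm_of_nonneg (Real.exp_pos _).le]
        have : Real.exp (-(α * (‖p.2.2‖ ^ 2 / (1 + p.2.1)))) ≤ 1 := by
          rw [Real.exp_le_one_iff]
          have : 0 ≤ α * (‖p.2.2‖ ^ 2 / (1 + p.2.1)) := by positivity
          linarith
        exact (mul_le_of_le_one_left (norm_nonneg _) this).trans (norm_coneTail_le hε hR.le p)
      · have : coneTail m ε R p = 0 := by simp [coneTail, coneAmp, hu]
        rw [this, mul_zero, norm_zero]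
        positivity
    · exact integrable_mul_normSq_fourier (M := fun _ => (1 + m.factorial) / ε * (1 / ε))
        measurable_const (fun _ => le_rfl) hf1 hf2
    · refine Eventually.of_forall fun ξ => ?_
      have h0 : Tendsto (fun α : ℝ => ((Real.exp (-(α * (‖(coneCoords ξ).2.2‖ ^ 2 /
          (1 + (coneCoords ξ).2.1)))) : ℝ) : ℂ) * coneTail m ε R (coneCoords ξ) *
          ((‖𝓕 f ξ‖ ^ 2 : ℝ) : ℂ)) (𝓝 0) (𝓝 (((Real.exp (-(0 * (‖(coneCoords ξ).2.2‖ ^ 2 /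
          (1 + (coneCoords ξ).2.1)))) : ℝ) : ℂ) * coneTail m ε R (coneCoords ξ) *
          ((‖𝓕 f ξ‖ ^ 2 : ℝ) : ℂ))) := by
        refine Continuous.tendsto (f := fun α : ℝ => ((Real.exp (-(α * (‖(coneCoords ξ).2.2‖ ^ 2 /
          (1 + (coneCoords ξ).2.1)))) : ℝ) : ℂ) * coneTail m ε R (coneCoords ξ) *
          ((‖𝓕 f ξ‖ ^ 2 : ℝ) : ℂ)) ?_ 0
        fun_prop
      simp only [zero_mul, neg_zero, Real.exp_zero, Complex.ofReal_one, one_mul] at h0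
      exact h0.mono_left nhdsWithin_le_nhds
  refine le_of_tendsto hlim.norm ?_
  filter_upwards [Ioc_mem_nhdsGT hR] with α hα
  obtain ⟨h1, h2⟩ := fourier_coneKernel_le hm hε hα.1 hα.2 hσ hσ1
  exact norm_integral_mul_normSq_fourier_le h1 hf1 h2

theorem coneMult_le_tail {ε R : ℝ} (hε : 0 < ε) (hR : 0 ≤ R)
    (p : ℝ × (ℝ × EuclideanSpace ℝ (Fin m))) :
    coneMult m ε p ≤ (1 + m.factorial) * (R / ε) + (coneTail m ε R p).re := by
  set A : ℝ := ε + |p.1| with hAdef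
  have hA : 0 < A := by positivity
  set w : ℂ := (A : ℂ) - conePhase p.2 * Complex.I with hw
  have hwre : w.re = A := by simp [hw]
  have hw0 : w ≠ 0 := fun h => by rw [h] at hwre; simp at hwre; exact hA.ne hwre
  have e1 : coneMult m ε p = (((coneAmp m (1 + p.2.1) / A : ℝ) : ℂ) * (1 / w)).re := by
    rw [Complex.re_ofReal_mul, one_div, Complex.inv_re, hwre, coneMult, ← hAdef]
    have : Complex.normSq w = A ^ 2 + conePhase p.2 ^ 2 := by
      rw [Complex.normSq_apply]; simp [hw]; ring
    rw [this]
    have : A ^ 2 + conePhase p.2 ^ 2 ≠ 0 := by positivity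
    field_simp
  have e2 : ((coneAmp m (1 + p.2.1) / A : ℝ) : ℂ) * (1 / w) =
      ((coneAmp m (1 + p.2.1) / A : ℝ) : ℂ) * ((1 - Complex.exp (-(w * R))) / w) +
        coneTail m ε R p := by
    rw [coneTail, ← hAdef, ← hw]
    ring
  rw [e1, e2, Complex.add_re]
  gcongr
  refine (Complex.re_le_norm _).trans ?_
  rw [norm_mul, norm_div, Complex.norm_real,
    Real.norm_of_nonneg (div_nonneg (coneAmp_nonneg _) hA.le)]
  have h1 : ‖1 - Complex.exp (-(w * R))‖ ≤ ‖w‖ * R := by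
    refine (norm_one_sub_exp_neg_le ?_).trans (le_of_eq ?_)
    · rw [Complex.re_mul_ofReal, hwre]; positivity
    · rw [norm_mul, Complex.norm_real, Real.norm_of_nonneg hR]
  have h2 : ‖1 - Complex.exp (-(w * R))‖ / ‖w‖ ≤ R := by
    rw [div_le_iff₀ (norm_pos_iff.2 hw0)]; linarith
  have h3 : coneAmp m (1 + p.2.1) / A ≤ (1 + m.factorial) / ε :=
    div_le_div₀ (by positivity) (coneAmp_le _) hε (by simp [hAdef])
  calc _ ≤ (1 + m.factorial) / ε * R := mul_le_mul h3 h2 (by positivity) (by positivity)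
    _ = _ := by ring

theorem integral_coneMult_le (hm : 1 ≤ m) {ε R σ : ℝ} (hε : 0 < ε)
    (hR : 0 < R) (hσ : 0 < σ) (hσ1 : σ ≤ 1) {f : ConeSpace m → ℂ} (hf1 : Integrable f)
    (hf2 : MemLp f 2) :
    ∫ ξ : ConeSpace m, coneMult m ε (coneCoords ξ) * ‖𝓕 f ξ‖ ^ 2 ≤
      (1 + m.factorial) * (R / ε) * (∫ x, ‖f x‖ ^ 2) +
      2 / σ * (ε * R) ^ (-σ) * ((Real.pi / R) ^ ((m : ℝ) / 2) * m.factorial) * Real.pi *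
        (∫ x, ‖f x‖) ^ 2 := by
  have hmc := (measurePreserving_coneCoords (m := m)).measurable
  have hmt := (measurable_coneTail (m := m) ε R).comp hmc
  have hmm := (measurable_coneMult (m := m) ε).comp hmc
  simp only [Function.comp_def] at hmt hmm
  have i1 := integrable_mul_normSq_fourier (M := fun ξ : ConeSpace m =>
    coneMult m ε (coneCoords ξ)) hmm (fun ξ => by
      rw [Real.norm_of_nonneg (coneMult_nonneg _ _)]; exact coneMult_le hε _) hf1 hf2
  have i2 := integrable_mul_normSq_fourier (M := fun ξ : ConeSpace m =>
    (coneTail m ε R (coneCoords ξ)).re) (Complex.measurable_re.comp hmt) (fun ξ =>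
      (Complex.abs_re_le_norm _).trans (norm_coneTail_le hε hR.le _)) hf1 hf2
  have i3 := integrable_mul_normSq_fourier (M := fun _ : ConeSpace m =>
    (1 + m.factorial) * (R / ε)) measurable_const (fun ξ => le_rfl) hf1 hf2
  have hre : ∫ ξ : ConeSpace m, (coneTail m ε R (coneCoords ξ)).re * ‖𝓕 f ξ‖ ^ 2 =
      (∫ ξ : ConeSpace m, coneTail m ε R (coneCoords ξ) * ((‖𝓕 f ξ‖ ^ 2 : ℝ) : ℂ)).re := by
    rw [← RCLike.re_eq_complex_re, ← integral_re]
    · simp [-Complex.ofReal_pow]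
    · have i4 := (integrable_mul_normSq_fourier (M := fun _ : ConeSpace m => (1 : ℝ))
        measurable_const (fun ξ => le_rfl) hf1 hf2).ofReal (𝕜 := ℂ)
      simp only [one_mul] at i4
      exact i4.bdd_mul hmt.aestronglyMeasurable
        (Eventually.of_forall fun ξ => norm_coneTail_le hε hR.le _)
  calc _ ≤ ∫ ξ : ConeSpace m, ((1 + m.factorial) * (R / ε) * ‖𝓕 f ξ‖ ^ 2 +
        (coneTail m ε R (coneCoords ξ)).re * ‖𝓕 f ξ‖ ^ 2) := by
        refine integral_mono i1 (i3.add i2) fun ξ => ?_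
        simp only
        rw [← add_mul]
        exact mul_le_mul_of_nonneg_right (coneMult_le_tail hε hR.le _) (by positivity)
    _ ≤ _ := by
        rw [integral_add i3 i2, integral_const_mul, integral_normSq_fourier hf1 hf2, hre]
        refine add_le_add le_rfl ?_
        exact (Complex.re_le_norm _).trans (norm_integral_coneTail_le hm hε hR hσ hσ1 hf1 hf2)

end ConeQuadraticForm

section FourierForms

open Filter Topology FourierTransform RealInnerProductSpace

variable {m : ℕ} {V V' : Type*} [NormedAddCommGroup V] [InnerProductSpace ℝ V]
    [FiniteDimensional ℝ V] [MeasurableSpace V] [BorelSpace V]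
    [NormedAddCommGroup V'] [InnerProductSpace ℝ V']
    [FiniteDimensional ℝ V'] [MeasurableSpace V'] [BorelSpace V']

/-- A one-parameter family of bounds for the quadratic form of a Fourier multiplier, interpolating
between `L²` and `L¹`. -/
def FourierFormBound (M : V → ℝ) (A B κ : ℝ) : Prop :=
  ∀ f : V → ℂ, Integrable f → MemLp f 2 → ∀ ρ : ℝ, 0 < ρ → ρ ≤ 1 →
    ∫ ξ, M ξ * ‖𝓕 f ξ‖ ^ 2 ≤ A * (ρ * (∫ x, ‖f x‖ ^ 2) + ρ ^ (-κ) * B * (∫ x, ‖f x‖) ^ 2)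

theorem FourierFormBound.comp {M : V' → ℝ} {A B κ : ℝ} (h : FourierFormBound M A B κ)
    (T : V ≃ₗᵢ[ℝ] V') : FourierFormBound (fun ξ => M (T ξ)) A B κ := by
  intro f hf1 hf2 ρ hρ hρ1
  have hT := T.symm.measurePreserving
  have hemb : MeasurableEmbedding T.symm := T.symm.toHomeomorph.measurableEmbedding
  have h1 : Integrable (f ∘ T.symm) := (hT.integrable_comp_emb hemb).2 hf1
  have h2 : MemLp (f ∘ T.symm) 2 := hf2.comp_measurePreserving hT
  have h3 := h (f ∘ T.symm) h1 h2 ρ hρ hρ1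
  have e1 : ∫ η, M η * ‖𝓕 (f ∘ T.symm) η‖ ^ 2 = ∫ ξ, M (T ξ) * ‖𝓕 f ξ‖ ^ 2 := by
    rw [← hT.integral_comp hemb]
    simp [Real.fourier_comp_linearIsometry]
  have e2 : ∫ x, ‖(f ∘ T.symm) x‖ ^ 2 = ∫ x, ‖f x‖ ^ 2 := hT.integral_comp hemb (fun x => ‖f x‖ ^ 2)
  have e3 : ∫ x, ‖(f ∘ T.symm) x‖ = ∫ x, ‖f x‖ := hT.integral_comp hemb (fun x => ‖f x‖)
  rwa [e1, e2, e3] at h3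

theorem FourierFormBound.add {M N : V → ℝ} {A A' B κ K K' : ℝ} (h : FourierFormBound M A B κ)
    (h' : FourierFormBound N A' B κ) (hM : Measurable M) (hN : Measurable N)
    (hMK : ∀ ξ, ‖M ξ‖ ≤ K) (hNK : ∀ ξ, ‖N ξ‖ ≤ K') :
    FourierFormBound (fun ξ => M ξ + N ξ) (A + A') B κ := by
  intro f hf1 hf2 ρ hρ hρ1
  simp only [add_mul]
  rw [integral_add (integrable_mul_normSq_fourier hM hMK hf1 hf2)
    (integrable_mul_normSq_fourier hN hNK hf1 hf2)]
  exact add_le_add (h f hf1 hf2 ρ hρ hρ1) (h' f hf1 hf2 ρ hρ hρ1)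

theorem FourierFormBound.mono {M N : V → ℝ} {A B κ c K : ℝ} (h : FourierFormBound N A B κ)
    (hM : Measurable M) (hM0 : ∀ ξ, 0 ≤ M ξ) (hN : Measurable N) (hc : 0 ≤ c)
    (hMN : ∀ ξ, M ξ ≤ c * N ξ) (hNK : ∀ ξ, ‖N ξ‖ ≤ K) :
    FourierFormBound M (c * A) B κ := by
  intro f hf1 hf2 ρ hρ hρ1
  have i2 := integrable_mul_normSq_fourier hN hNK hf1 hf2
  have i1 := integrable_mul_normSq_fourier (A := c * K) hM (fun ξ => by
    rw [Real.norm_of_nonneg (hM0 ξ)]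
    exact (hMN ξ).trans (mul_le_mul_of_nonneg_left ((Real.le_norm_self _).trans (hNK ξ)) hc)) hf1 hf2
  calc ∫ ξ, M ξ * ‖𝓕 f ξ‖ ^ 2 ≤ ∫ ξ, c * (N ξ * ‖𝓕 f ξ‖ ^ 2) := by
        refine integral_mono i1 (i2.const_mul c) fun ξ => ?_
        simp only
        rw [← mul_assoc]
        exact mul_le_mul_of_nonneg_right (hMN ξ) (by positivity)
    _ ≤ _ := by
        rw [integral_const_mul, mul_assoc]
        exact mul_le_mul_of_nonneg_left (h f hf1 hf2 ρ hρ hρ1) hc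

theorem FourierFormBound.mono_const {M : V → ℝ} {A A' B κ : ℝ} (h : FourierFormBound M A B κ)
    (hA : A ≤ A') (hB : 0 ≤ B) : FourierFormBound M A' B κ := fun f hf1 hf2 ρ hρ hρ1 =>
  (h f hf1 hf2 ρ hρ hρ1).trans (mul_le_mul_of_nonneg_right hA (by positivity))

theorem exists_coneMult_formBound (hm : 1 ≤ m) {σ : ℝ} (hσ : 0 < σ) (hσ1 : σ ≤ 1) :
    ∃ C : ℝ, 0 < C ∧ ∀ ε : ℝ, 0 < ε →
      FourierFormBound (fun ξ : ConeSpace m => coneMult m ε (coneCoords ξ)) (C * ε⁻¹ ^ 2)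
        (ε ^ ((m : ℝ) / 2 + 2)) ((m : ℝ) / 2 + σ) := by
  set C₂ : ℝ := 2 / σ * (Real.pi ^ ((m : ℝ) / 2) * m.factorial) * Real.pi with hC₂
  have hC₂0 : 0 < C₂ := by positivity
  refine ⟨(1 + m.factorial) + C₂, by positivity, fun ε hε f hf1 hf2 ρ hρ hρ1 => ?_⟩
  have h := integral_coneMult_le hm (R := ρ / ε) hε (by positivity) hσ hσ1 hf1 hf2
  have e1 : ε * (ρ / ε) = ρ := by field_simp
  have e2 : Real.pi / (ρ / ε) = Real.pi * (ρ⁻¹ * ε) := by field_simp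
  rw [e1, e2, Real.mul_rpow Real.pi_pos.le (by positivity), Real.mul_rpow (by positivity) hε.le,
    Real.inv_rpow hρ.le, ← Real.rpow_neg hρ.le] at h
  have e3 : ρ ^ (-((m : ℝ) / 2 + σ)) = ρ ^ (-σ) * ρ ^ (-((m : ℝ) / 2)) := by
    rw [← Real.rpow_add hρ]; ring_nf
  have e4 : ε ^ ((m : ℝ) / 2 + 2) = ε ^ ((m : ℝ) / 2) * ε ^ 2 := by
    rw [Real.rpow_add hε]; norm_num
  rw [e3, e4]
  set a := ∫ x, ‖f x‖ ^ 2 with ha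
  set b := (∫ x, ‖f x‖) ^ 2 with hb
  have ha0 : 0 ≤ a := integral_nonneg fun x => by positivity
  have hb0 : 0 ≤ b := sq_nonneg _
  set X := ρ ^ (-σ) * ρ ^ (-((m : ℝ) / 2)) * ε ^ ((m : ℝ) / 2) * b with hX
  have hX0 : 0 ≤ X := by positivity
  calc _ ≤ _ := h
    _ = (1 + m.factorial) * (ε⁻¹ ^ 2 * ρ * a) + C₂ * X := by
        rw [hX, hC₂]
        field_simp
    _ ≤ ((1 + m.factorial) + C₂) * (ε⁻¹ ^ 2 * ρ * a) + ((1 + m.factorial) + C₂) * X := by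
        have hq : (0 : ℝ) ≤ 1 + m.factorial := by positivity
        exact add_le_add (mul_le_mul_of_nonneg_right (by linarith) (by positivity))
          (mul_le_mul_of_nonneg_right (by linarith) hX0)
    _ = _ := by
        rw [hX]
        field_simp

theorem exp_neg_le_const_mul_rpow_neg {s : ℝ} (hs : 0 ≤ s) {y : ℝ} (hy : 0 < y) :
    Real.exp (-y) ≤ (1 + (⌈s⌉₊).factorial) * y ^ (-s) := by
  have h1 : y ^ s ≤ 1 + y ^ ⌈s⌉₊ := by
    rcases le_or_gt y 1 with h | h
    · have := Real.rpow_le_one hy.le h hs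
      have : 0 ≤ y ^ ⌈s⌉₊ := by positivity
      linarith
    · have := Real.rpow_le_rpow_of_exponent_le h.le (Nat.le_ceil s)
      rw [Real.rpow_natCast] at this
      linarith
  have h2 := Real.pow_div_factorial_le_exp y hy.le ⌈s⌉₊
  rw [div_le_iff₀ (by positivity)] at h2
  have h3 : (1 : ℝ) ≤ Real.exp y := Real.one_le_exp hy.le
  rw [Real.exp_neg, Real.rpow_neg hy.le, ← div_eq_mul_inv, inv_eq_one_div,
    div_le_div_iff₀ (Real.exp_pos y) (by positivity)]
  nlinarith

theorem exists_bessel_formBound (hV : Module.finrank ℝ V = m + 2) {σ : ℝ} (hσ : 0 < σ) :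
    ∃ C : ℝ, 0 < C ∧ ∀ ε : ℝ, 0 < ε → ε ≤ 1 →
      FourierFormBound (fun ξ : V => 1 / (1 + ‖ξ‖ ^ 2)) (C * ε⁻¹ ^ 2)
        (ε ^ ((m : ℝ) / 2 + 2)) ((m : ℝ) / 2 + σ) := by
  set s : ℝ := (m : ℝ) / 2 + σ with hs
  have hs0 : 0 ≤ s := by positivity
  have hI : Integrable fun ξ : V => (1 + ‖ξ‖ ^ 2) ^ (-(2 * (s + 1)) / 2) :=
    integrable_rpow_neg_one_add_norm_sq (by rw [hV, hs]; push_cast; linarith)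
  set C₀ : ℝ := 1 + (⌈s⌉₊).factorial with hC₀
  set J : ℝ := ∫ ξ : V, (1 + ‖ξ‖ ^ 2) ^ (-(2 * (s + 1)) / 2) with hJ
  have hJ0 : 0 ≤ J := integral_nonneg fun ξ => by positivity
  have hC₀0 : 0 < C₀ := by positivity
  refine ⟨1 + C₀ * J, by positivity, fun ε hε hε1 f hf1 hf2 ρ hρ hρ1 => ?_⟩
  set R : ℝ := ρ * ε⁻¹ ^ 2 with hR
  have hR0 : 0 < R := by positivity
  set k : V → ℝ := fun ξ => Real.exp (-(R * (1 + ‖ξ‖ ^ 2))) / (1 + ‖ξ‖ ^ 2) with hk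
  have hk0 : ∀ ξ, 0 ≤ k ξ := fun ξ => by positivity
  have hkle : ∀ ξ, k ξ ≤ C₀ * R ^ (-s) * (1 + ‖ξ‖ ^ 2) ^ (-(2 * (s + 1)) / 2) := by
    intro ξ
    have hx : 0 < 1 + ‖ξ‖ ^ 2 := by positivity
    have h1 := exp_neg_le_const_mul_rpow_neg hs0 (mul_pos hR0 hx)
    rw [Real.mul_rpow hR0.le hx.le] at h1
    have e : (1 + ‖ξ‖ ^ 2) ^ (-(2 * (s + 1)) / 2) = (1 + ‖ξ‖ ^ 2) ^ (-s) / (1 + ‖ξ‖ ^ 2) := by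
      rw [← Real.rpow_sub_one hx.ne']; ring_nf
    rw [e]
    calc k ξ ≤ (C₀ * (R ^ (-s) * (1 + ‖ξ‖ ^ 2) ^ (-s))) / (1 + ‖ξ‖ ^ 2) := by
          simp only [hk]; gcongr
      _ = _ := by ring
  have hkm : Measurable k := by fun_prop
  have hki : Integrable k := (hI.const_mul _).mono' hkm.aestronglyMeasurable
    (Eventually.of_forall fun ξ => by rw [Real.norm_of_nonneg (hk0 ξ)]; exact hkle ξ)
  have hkJ : ∫ ξ, k ξ ≤ C₀ * R ^ (-s) * J := by
    rw [hJ, ← integral_const_mul]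
    exact integral_mono hki (hI.const_mul _) hkle
  have hM1 : ∀ ξ : V, 1 / (1 + ‖ξ‖ ^ 2) ≤ R + k ξ := by
    intro ξ
    have hx : 0 < 1 + ‖ξ‖ ^ 2 := by positivity
    simp only [hk]
    rw [← sub_le_iff_le_add, ← sub_div, div_le_iff₀ hx]
    linarith [Real.add_one_le_exp (-(R * (1 + ‖ξ‖ ^ 2)))]
  have hle1 : ∀ ξ : V, 1 / (1 + ‖ξ‖ ^ 2) ≤ 1 := fun ξ => by
    rw [div_le_one (by positivity)]; nlinarith [norm_nonneg ξ]
  have hk1 : ∀ ξ : V, ‖k ξ‖ ≤ 1 := fun ξ => by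
    rw [Real.norm_of_nonneg (hk0 ξ)]
    refine le_trans ?_ (hle1 ξ)
    simp only [hk]
    gcongr
    rw [Real.exp_le_one_iff]
    have : 0 ≤ R * (1 + ‖ξ‖ ^ 2) := by positivity
    linarith
  have i1 := integrable_mul_normSq_fourier (M := fun ξ : V => 1 / (1 + ‖ξ‖ ^ 2)) (A := 1)
    (by fun_prop) (fun ξ => by rw [Real.norm_of_nonneg (by positivity)]; exact hle1 ξ) hf1 hf2
  have i2 := integrable_mul_normSq_fourier (M := fun ξ : V => R) measurable_const
    (fun ξ => le_rfl) hf1 hf2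
  have i3 := integrable_mul_normSq_fourier hkm hk1 hf1 hf2
  have hk3 : ∫ ξ, k ξ * ‖𝓕 f ξ‖ ^ 2 ≤ (C₀ * R ^ (-s) * J) * (∫ x, ‖f x‖) ^ 2 := by
    have h := norm_integral_mul_normSq_fourier_le (k := fun ξ => (k ξ : ℂ)) (B := C₀ * R ^ (-s) * J)
      hki.ofReal hf1 (fun X => (norm_fourier_le_integral_norm _ X).trans (by
        simpa [abs_of_nonneg (hk0 _)] using hkJ))
    refine le_trans ?_ h
    have e : ∫ ξ, (k ξ : ℂ) * ((‖𝓕 f ξ‖ ^ 2 : ℝ) : ℂ) =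
        ((∫ ξ, k ξ * ‖𝓕 f ξ‖ ^ 2 : ℝ) : ℂ) := by
      rw [← integral_complex_ofReal]; push_cast; rfl
    rw [e, Complex.norm_real]
    exact Real.le_norm_self _
  set a := ∫ x, ‖f x‖ ^ 2 with ha
  set b := (∫ x, ‖f x‖) ^ 2 with hb
  have ha0 : 0 ≤ a := integral_nonneg fun x => by positivity
  have hb0 : 0 ≤ b := sq_nonneg _
  have hRs : R ^ (-s) ≤ ε⁻¹ ^ 2 * (ρ ^ (-s) * ε ^ ((m : ℝ) / 2 + 2)) := by
    rw [hR, Real.mul_rpow hρ.le (by positivity)]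
    have e1 : (ε⁻¹ ^ 2) ^ (-s) = ε ^ (2 * s) := by
      rw [← Real.rpow_natCast, ← Real.rpow_mul (by positivity), Real.inv_rpow hε.le,
        ← Real.rpow_neg hε.le]
      congr 1; push_cast; ring
    have e2 : ε ^ ((m : ℝ) / 2 + 2) = ε ^ ((m : ℝ) / 2) * ε ^ 2 := by
      rw [Real.rpow_add hε]; norm_num
    have e3 : ε ^ (2 * s) ≤ ε ^ ((m : ℝ) / 2) :=
      Real.rpow_le_rpow_of_exponent_ge hε hε1 (by
        rw [hs]; linarith [(Nat.cast_nonneg m : (0 : ℝ) ≤ m)])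
    rw [e1, e2]
    calc ρ ^ (-s) * ε ^ (2 * s) ≤ ρ ^ (-s) * ε ^ ((m : ℝ) / 2) := by gcongr
      _ = _ := by field_simp
  calc _ ≤ ∫ ξ, (R * ‖𝓕 f ξ‖ ^ 2 + k ξ * ‖𝓕 f ξ‖ ^ 2) := by
        refine integral_mono i1 (i2.add i3) fun ξ => ?_
        simp only
        rw [← add_mul]
        exact mul_le_mul_of_nonneg_right (hM1 ξ) (by positivity)
    _ ≤ R * a + (C₀ * R ^ (-s) * J) * b := by
        rw [integral_add i2 i3, integral_const_mul, integral_normSq_fourier hf1 hf2]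
        exact add_le_add le_rfl hk3
    _ ≤ R * a + (C₀ * (ε⁻¹ ^ 2 * (ρ ^ (-s) * ε ^ ((m : ℝ) / 2 + 2))) * J) * b := by gcongr
    _ = 1 * (ε⁻¹ ^ 2 * (ρ * a)) + C₀ * J * (ε⁻¹ ^ 2 * (ρ ^ (-s) * ε ^ ((m : ℝ) / 2 + 2) * b)) := by
        rw [hR]; ring
    _ ≤ (1 + C₀ * J) * (ε⁻¹ ^ 2 * (ρ * a)) +
        (1 + C₀ * J) * (ε⁻¹ ^ 2 * (ρ ^ (-s) * ε ^ ((m : ℝ) / 2 + 2) * b)) := by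
        have : 0 ≤ C₀ * J := by positivity
        gcongr <;> linarith
    _ = _ := by ring

end FourierForms

section SphereMultiplier

open Filter Topology FourierTransform RealInnerProductSpace

variable {m : ℕ}

theorem sphereMult_le_coneMult {ε : ℝ} (hε : 0 < ε) {a b : ℝ} {z : EuclideanSpace ℝ (Fin m)}
    (hb : 0 ≤ b) (hD : (1 - (a ^ 2 + (b ^ 2 + ‖z‖ ^ 2))) ^ 2 + 4 * a ^ 2 < 1 / 16) :
    (1 + (a ^ 2 + (b ^ 2 + ‖z‖ ^ 2))) /
        (ε ^ 2 + (1 - (a ^ 2 + (b ^ 2 + ‖z‖ ^ 2))) ^ 2 + 4 * a ^ 2) ≤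
      9 * Real.exp 3 * coneMult m ε (a, (b, z)) := by
  set N := a ^ 2 + (b ^ 2 + ‖z‖ ^ 2) with hN
  have hN1 : N ≤ 5 / 4 := by nlinarith [sq_nonneg a]
  have hN2 : (N - 1) ^ 2 ≤ 1 / 16 := by nlinarith [sq_nonneg a]
  have ha : a ^ 2 ≤ 1 / 64 := by nlinarith [sq_nonneg (1 - N)]
  have hb2 : b ≤ 2 := by nlinarith [sq_nonneg a, sq_nonneg ‖z‖]
  have hu : 0 < 1 + b := by linarith
  have hamp : Real.exp (-3) ≤ coneAmp m (1 + b) := by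
    unfold coneAmp
    rw [if_pos hu]
    have h1 : 1 ≤ (1 + b) ^ ((m : ℝ) / 2) := Real.one_le_rpow (by linarith) (by positivity)
    have h2 : Real.exp (-3) ≤ Real.exp (-(1 + b)) := Real.exp_le_exp.2 (by linarith)
    nlinarith [Real.exp_pos (-3)]
  have hF : conePhase (b, z) = (N - 1 - a ^ 2) / (1 + b) := by
    simp only [conePhase, hN]
    field_simp
    ring
  have hF2 : conePhase (b, z) ^ 2 ≤ (N - 1 - a ^ 2) ^ 2 := by
    rw [hF, div_pow]
    exact div_le_self (sq_nonneg _) (by nlinarith)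
  have hden : (ε + |a|) ^ 2 + conePhase (b, z) ^ 2 ≤ 4 * (ε ^ 2 + (1 - N) ^ 2 + 4 * a ^ 2) := by
    have h3 : (ε + |a|) ^ 2 ≤ 2 * ε ^ 2 + 2 * a ^ 2 := by
      nlinarith [sq_nonneg (ε - |a|), sq_abs a]
    nlinarith [sq_nonneg (N - 1 + a ^ 2), sq_nonneg a]
  have hpos : 0 < ε ^ 2 + (1 - N) ^ 2 + 4 * a ^ 2 := by positivity
  have hpos2 : 0 < (ε + |a|) ^ 2 + conePhase (b, z) ^ 2 := by positivity
  have hM : Real.exp (-3) / (4 * (ε ^ 2 + (1 - N) ^ 2 + 4 * a ^ 2)) ≤ coneMult m ε (a, (b, z)) :=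
    div_le_div₀ (coneAmp_nonneg _) hamp hpos2 hden
  calc (1 + N) / (ε ^ 2 + (1 - N) ^ 2 + 4 * a ^ 2)
      ≤ (9 / 4) / (ε ^ 2 + (1 - N) ^ 2 + 4 * a ^ 2) := by gcongr; linarith
    _ = 9 * Real.exp 3 * (Real.exp (-3) / (4 * (ε ^ 2 + (1 - N) ^ 2 + 4 * a ^ 2))) := by
        rw [Real.exp_neg]
        field_simp
    _ ≤ _ := by gcongr

theorem norm_sq_coneSpace (ξ : ConeSpace m) :
    ‖ξ‖ ^ 2 = ξ.fst ^ 2 + (ξ.snd.fst ^ 2 + ‖ξ.snd.snd‖ ^ 2) := by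
  rw [WithLp.prod_norm_sq_eq_of_L2, WithLp.prod_norm_sq_eq_of_L2]
  simp

theorem coneSphereMult_le {ε : ℝ} (hε : 0 < ε) (ξ : ConeSpace m) :
    (1 + ‖ξ‖ ^ 2) / (ε ^ 2 + (1 - ‖ξ‖ ^ 2) ^ 2 + 4 * ξ.fst ^ 2) ≤
      9 * Real.exp 3 * (coneMult m ε (coneCoords ξ) + coneMult m ε (coneCoords (-ξ)) +
        1 / (1 + ‖ξ‖ ^ 2)) := by
  have p1 := coneMult_nonneg ε (coneCoords ξ)
  have p2 := coneMult_nonneg ε (coneCoords (-ξ))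
  have he : (9 : ℝ) ≤ Real.exp 3 := by
    have := Real.exp_one_gt_d9
    have h : Real.exp 3 = Real.exp 1 ^ 3 := by rw [← Real.exp_nat_mul]; norm_num
    rw [h]
    nlinarith [pow_le_pow_left₀ (by norm_num) this.le 3]
  have p3 : 0 ≤ 1 / (1 + ‖ξ‖ ^ 2) := by positivity
  rcases le_or_gt (1 / 16) ((1 - ‖ξ‖ ^ 2) ^ 2 + 4 * ξ.fst ^ 2) with hD | hD
  · have h1 : (1 + ‖ξ‖ ^ 2) / (ε ^ 2 + (1 - ‖ξ‖ ^ 2) ^ 2 + 4 * ξ.fst ^ 2) ≤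
        81 * (1 / (1 + ‖ξ‖ ^ 2)) := by
      rw [← div_eq_mul_one_div, div_le_div_iff₀ (by positivity) (by positivity)]
      set N := ‖ξ‖ ^ 2
      set s := |1 - N| with hs
      have hs2 : s ^ 2 = (1 - N) ^ 2 := sq_abs _
      have hNs : 1 + N ≤ 2 + s := by linarith [neg_abs_le (1 - N)]
      have hN0 : 0 ≤ N := by positivity
      nlinarith [sq_nonneg ε, sq_nonneg (4 * s - 1), sq_nonneg ξ.fst]
    nlinarith [mul_nonneg (sub_nonneg.2 he) p3, mul_nonneg (Real.exp_pos 3).le (add_nonneg p1 p2)]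
  · rcases le_or_gt 0 ξ.snd.fst with hb | hb
    · have h := sphereMult_le_coneMult (m := m) (a := ξ.fst) (b := ξ.snd.fst) (z := ξ.snd.snd) hε hb
        (by rw [← norm_sq_coneSpace]; exact hD)
      rw [← norm_sq_coneSpace] at h
      refine h.trans (mul_le_mul_of_nonneg_left ?_ (by positivity))
      have : coneMult m ε (ξ.fst, (ξ.snd.fst, ξ.snd.snd)) = coneMult m ε (coneCoords ξ) := rfl
      linarith
    · have h := sphereMult_le_coneMult (m := m) (a := (-ξ).fst) (b := (-ξ).snd.fst)
        (z := (-ξ).snd.snd) hε (by simpa using hb.le)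
        (by rw [← norm_sq_coneSpace]; simpa using hD)
      rw [← norm_sq_coneSpace, norm_neg, WithLp.neg_fst, neg_sq] at h
      refine h.trans (mul_le_mul_of_nonneg_left ?_ (by positivity))
      have : coneMult m ε (-ξ.fst, ((-ξ).snd.fst, (-ξ).snd.snd)) =
        coneMult m ε (coneCoords (-ξ)) := rfl
      linarith

theorem exists_coneSphereMult_formBound (hm : 1 ≤ m) {σ : ℝ} (hσ : 0 < σ) (hσ1 : σ ≤ 1) :
    ∃ C : ℝ, 0 < C ∧ ∀ ε : ℝ, 0 < ε → ε ≤ 1 →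
      FourierFormBound (fun ξ : ConeSpace m =>
        (1 + ‖ξ‖ ^ 2) / (ε ^ 2 + (1 - ‖ξ‖ ^ 2) ^ 2 + 4 * ξ.fst ^ 2)) (C * ε⁻¹ ^ 2)
        (ε ^ ((m : ℝ) / 2 + 2)) ((m : ℝ) / 2 + σ) := by
  obtain ⟨C₁, hC₁, h₁⟩ := exists_coneMult_formBound hm hσ hσ1
  obtain ⟨C₂, hC₂, h₂⟩ := exists_bessel_formBound (V := ConeSpace m) (m := m) (by
    rw [(WithLp.linearEquiv 2 ℝ _).finrank_eq, Module.finrank_prod,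
      (WithLp.linearEquiv 2 ℝ _).finrank_eq, Module.finrank_prod]
    simp; ring) hσ
  refine ⟨9 * Real.exp 3 * (C₁ + C₁ + C₂), by positivity, fun ε hε hε1 => ?_⟩
  have hmeas : Measurable fun ξ : ConeSpace m => coneMult m ε (coneCoords ξ) :=
    (measurable_coneMult ε).comp measurePreserving_coneCoords.measurable
  have hb : ∀ ξ : ConeSpace m, ‖coneMult m ε (coneCoords ξ)‖ ≤ (1 + m.factorial) * ε⁻¹ ^ 2 :=
    fun ξ => by
      rw [Real.norm_of_nonneg (coneMult_nonneg _ _)]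
      exact coneMult_le hε _
  have hle1 : ∀ ξ : ConeSpace m, ‖1 / (1 + ‖ξ‖ ^ 2)‖ ≤ 1 := fun ξ => by
    rw [Real.norm_of_nonneg (by positivity), div_le_one (by positivity)]
    nlinarith [norm_nonneg ξ]
  have k1 := h₁ ε hε
  have k2 := k1.comp (LinearIsometryEquiv.neg ℝ)
  have hmeas2 : Measurable fun ξ : ConeSpace m =>
      coneMult m ε (coneCoords (LinearIsometryEquiv.neg ℝ ξ)) :=
    hmeas.comp (LinearIsometryEquiv.neg ℝ (E := ConeSpace m)).continuous.measurable
  have k3 := k1.add k2 hmeas hmeas2 hb (fun ξ => hb _)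
  have hb3 := fun ξ : ConeSpace m => (norm_add_le _ _).trans (add_le_add (hb ξ) (hb (-ξ)))
  have hm3 : Measurable fun ξ : ConeSpace m => 1 / (1 + ‖ξ‖ ^ 2) := by fun_prop
  have k4 := k3.add (h₂ ε hε hε1) (hmeas.add hmeas2) hm3 hb3 hle1
  have k5 := k4.mono (M := fun ξ : ConeSpace m =>
        (1 + ‖ξ‖ ^ 2) / (ε ^ 2 + (1 - ‖ξ‖ ^ 2) ^ 2 + 4 * ξ.fst ^ 2)) (c := 9 * Real.exp 3)
    (by
      have : Measurable fun ξ : ConeSpace m => ξ.fst :=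
        (measurable_fst (α := ℝ) (β := ℝ × EuclideanSpace ℝ (Fin m))).comp
          (measurePreserving_coneCoords (m := m)).measurable
      fun_prop) (fun ξ => by positivity) ((hmeas.add hmeas2).add hm3) (by positivity)
    (fun ξ => coneSphereMult_le hε ξ)
    (fun ξ => (norm_add_le _ _).trans (add_le_add (hb3 ξ) (hle1 ξ)))
  convert k5 using 1
  ring

theorem exists_linearIsometryEquiv_coneSpace {V : Type*} [NormedAddCommGroup V]
    [InnerProductSpace ℝ V] [FiniteDimensional ℝ V] (hV : Module.finrank ℝ V = m + 2)
    {a : V} (ha : ‖a‖ = 1) : ∃ T : V ≃ₗᵢ[ℝ] ConeSpace m, ∀ ξ, (T ξ).fst = ⟪a, ξ⟫ := by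
  have hf : Module.finrank ℝ (ConeSpace m) = m + 2 := by
    rw [(WithLp.linearEquiv 2 ℝ _).finrank_eq, Module.finrank_prod,
      (WithLp.linearEquiv 2 ℝ _).finrank_eq, Module.finrank_prod]
    simp; ring
  let T₀ : V ≃ₗᵢ[ℝ] ConeSpace m := (stdOrthonormalBasis ℝ V).equiv
    (stdOrthonormalBasis ℝ (ConeSpace m)) (finCongr (hV.trans hf.symm))
  set e : ConeSpace m := WithLp.toLp 2 (1, 0) with he
  have hn : ‖T₀ a‖ = ‖e‖ := by
    rw [T₀.norm_map, ha]
    have : ‖e‖ ^ 2 = 1 := by rw [norm_sq_coneSpace]; simp [he]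
    nlinarith [norm_nonneg e]
  let U : ConeSpace m ≃ₗᵢ[ℝ] ConeSpace m := (ℝ ∙ (T₀ a - e))ᗮ.reflection
  have hU : U (T₀ a) = e := Submodule.reflection_sub hn
  refine ⟨T₀.trans U, fun ξ => ?_⟩
  rw [← (T₀.trans U).inner_map_map a ξ]
  simp only [LinearIsometryEquiv.trans_apply, hU]
  rw [WithLp.prod_inner_apply]
  simp [he]

/-- The `L^p → L²` bound for the symbol of the conjugated Laplacian. -/
theorem exists_sphereMult_const {V : Type*} [NormedAddCommGroup V]
    [InnerProductSpace ℝ V] [FiniteDimensional ℝ V] [MeasurableSpace V] [BorelSpace V]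
    {n : ℕ} (hn : 3 ≤ n) (hV : Module.finrank ℝ V = n) {p : ℝ}
    (hp : 2 * (n : ℝ) / (n + 2) < p) (hp2 : p ≤ 2) :
    ∃ C : ℝ, 0 < C ∧ ∀ a : V, ‖a‖ = 1 → ∀ ε : ℝ, 0 < ε → ε ≤ 1 →
      ∀ f : V → ℂ, Measurable f → Integrable f → MemLp f 2 → Integrable (fun x => ‖f x‖ ^ p) →
        (∃ K, ∀ x, ‖f x‖ ≤ K) →
        ∫ ξ, (1 + ‖ξ‖ ^ 2) / (ε ^ 2 + (1 - ‖ξ‖ ^ 2) ^ 2 + 4 * ⟪a, ξ⟫ ^ 2) * ‖𝓕 f ξ‖ ^ 2 ≤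
          C * ε ^ (-2 + (n + 2) * (1 / p - 1 / 2)) * (∫ x, ‖f x‖ ^ p) ^ (2 / p) := by
  obtain ⟨m, rfl⟩ : ∃ m, n = m + 2 := ⟨n - 2, by omega⟩
  have hm : 1 ≤ m := by omega
  have hmR : (1 : ℝ) ≤ m := by exact_mod_cast hm
  push_cast at hp ⊢
  have hp1 : 1 < p := by
    refine lt_of_le_of_lt ?_ hp
    rw [le_div_iff₀ (by positivity)]; linarith
  have hp0 : 0 < p := by linarith
  rw [div_lt_iff₀ (by positivity)] at hp
  set σ : ℝ := min 1 ((p * (2 + m / 2) - 2 * (1 + m / 2)) / 2) with hσ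
  have hσ0 : 0 < σ := lt_min one_pos (by linarith)
  have hσ1 : σ ≤ 1 := min_le_left _ _
  have hσ2 : σ ≤ (p * (2 + m / 2) - 2 * (1 + m / 2)) / 2 := min_le_right _ _
  have hκ : 2 < p * (1 + 1 / (1 + ((m : ℝ) / 2 + σ))) := by
    have hk : 0 < 1 + ((m : ℝ) / 2 + σ) := by positivity
    rw [one_add_div hk.ne', mul_div_assoc', lt_div_iff₀ hk]
    nlinarith
  obtain ⟨C₁, hC₁, h₁⟩ := exists_coneSphereMult_formBound hm hσ0 hσ1
  obtain ⟨C₂, hC₂, h₂⟩ := exists_interpolation_const (V := V) hp1.le hp2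
    (by positivity : 0 ≤ (m : ℝ) / 2 + σ) hκ
  refine ⟨C₂ * (C₁ + 6), by positivity, fun a ha ε hε hε1 f hfm hf1 hf2 hfp hfK => ?_⟩
  obtain ⟨T, hT⟩ := exists_linearIsometryEquiv_coneSpace hV ha
  have k := (h₁ ε hε hε1).comp T
  simp only [T.norm_map, hT] at k
  have k' := k.mono_const (A' := (C₁ + 6) * ε⁻¹ ^ 2) (by gcongr; linarith) (by positivity)
  have hbd : ∀ ξ : V, (1 + ‖ξ‖ ^ 2) / (ε ^ 2 + (1 - ‖ξ‖ ^ 2) ^ 2 + 4 * ⟪a, ξ⟫ ^ 2) ≤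
      (C₁ + 6) * ε⁻¹ ^ 2 := by
    intro ξ
    have h6 : (1 + ‖ξ‖ ^ 2) / (ε ^ 2 + (1 - ‖ξ‖ ^ 2) ^ 2 + 4 * ⟪a, ξ⟫ ^ 2) ≤ 6 * ε⁻¹ ^ 2 := by
      rw [div_le_iff₀ (by positivity)]
      have e : 6 * ε⁻¹ ^ 2 * (ε ^ 2 + (1 - ‖ξ‖ ^ 2) ^ 2 + 4 * ⟪a, ξ⟫ ^ 2) =
          6 + ε⁻¹ ^ 2 * (6 * ((1 - ‖ξ‖ ^ 2) ^ 2 + 4 * ⟪a, ξ⟫ ^ 2)) := by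
        field_simp; ring
      have h1 : 1 ≤ ε⁻¹ ^ 2 := one_le_pow₀ ((one_le_inv₀ hε).2 hε1)
      rw [e]
      have h2 : 6 * ((1 - ‖ξ‖ ^ 2) ^ 2 + 4 * ⟪a, ξ⟫ ^ 2) ≤
        ε⁻¹ ^ 2 * (6 * ((1 - ‖ξ‖ ^ 2) ^ 2 + 4 * ⟪a, ξ⟫ ^ 2)) :=
          le_mul_of_one_le_left (by positivity) h1
      nlinarith [sq_nonneg (‖ξ‖ ^ 2 - 2), sq_nonneg ⟪a, ξ⟫]
    refine h6.trans ?_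
    gcongr; linarith
  have k2 := h₂ _ ((C₁ + 6) * ε⁻¹ ^ 2) (ε ^ ((m : ℝ) / 2 + 2))
    (by fun_prop) (fun ξ => by positivity) hbd (by positivity) (by positivity) k' f hfm hf1 hf2
    hfp hfK
  refine k2.trans (le_of_eq ?_)
  have e1 : ε⁻¹ ^ 2 = ε ^ (-2 : ℝ) := by
    rw [Real.rpow_neg hε.le]; norm_num
  rw [e1, ← Real.rpow_mul hε.le]
  have e2 : -2 + ((m : ℝ) + 2 + 2) * (1 / p - 1 / 2) =
    -2 + ((m : ℝ) / 2 + 2) * (2 / p - 1) := by ring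
  rw [e2, Real.rpow_add hε]
  ring

end SphereMultiplier

section PartialDerivatives

open Filter Topology RealInnerProductSpace

variable {n : ℕ}

/-- The `i`-th partial derivative of a real-valued function. -/
def pd (i : Fin n) (u : EuclideanSpace ℝ (Fin n) → ℝ) (x : EuclideanSpace ℝ (Fin n)) : ℝ :=
  fderiv ℝ u x (EuclideanSpace.single i 1)

/-- The Laplacian of a real-valued function. -/
def lap (u : EuclideanSpace ℝ (Fin n) → ℝ) (x : EuclideanSpace ℝ (Fin n)) : ℝ :=
  ∑ i, pd i (pd i u) x

/-- The squared norm of the gradient of a real-valued function. -/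
def gradSq (u : EuclideanSpace ℝ (Fin n) → ℝ) (x : EuclideanSpace ℝ (Fin n)) : ℝ :=
  ∑ i, pd i u x ^ 2

variable {u v : EuclideanSpace ℝ (Fin n) → ℝ} {x : EuclideanSpace ℝ (Fin n)} {i : Fin n}

theorem gradSq_nonneg (u : EuclideanSpace ℝ (Fin n) → ℝ) (x : EuclideanSpace ℝ (Fin n)) :
    0 ≤ gradSq u x := Finset.sum_nonneg fun _ _ => sq_nonneg _

theorem pd_congr (h : u =ᶠ[𝓝 x] v) : pd i u x = pd i v x := by
  unfold pd; rw [h.fderiv_eq]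

theorem pd_add (hu : DifferentiableAt ℝ u x) (hv : DifferentiableAt ℝ v x) :
    pd i (fun y => u y + v y) x = pd i u x + pd i v x := by
  simp [pd, fderiv_fun_add hu hv]

theorem pd_sub (hu : DifferentiableAt ℝ u x) (hv : DifferentiableAt ℝ v x) :
    pd i (fun y => u y - v y) x = pd i u x - pd i v x := by
  simp [pd, fderiv_fun_sub hu hv]

theorem pd_const (c : ℝ) : pd i (fun _ => c) x = 0 := by
  simp [pd]

theorem pd_mul (hu : DifferentiableAt ℝ u x) (hv : DifferentiableAt ℝ v x) :
    pd i (fun y => u y * v y) x = u x * pd i v x + v x * pd i u x := by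
  simp [pd, fderiv_fun_mul hu hv]

theorem pd_const_mul (c : ℝ) (hu : DifferentiableAt ℝ u x) :
    pd i (fun y => c * u y) x = c * pd i u x := by
  rw [pd_mul (differentiableAt_const c) hu, pd_const, mul_zero, add_zero]

theorem pd_sum {ι : Type*} {s : Finset ι} {U : ι → EuclideanSpace ℝ (Fin n) → ℝ}
    (hU : ∀ j ∈ s, DifferentiableAt ℝ (U j) x) :
    pd i (fun y => ∑ j ∈ s, U j y) x = ∑ j ∈ s, pd i (U j) x := by
  simp [pd, fderiv_fun_sum hU]

theorem pd_comp {g : ℝ → ℝ} {g' : ℝ} (hg : HasDerivAt g g' (u x)) (hu : DifferentiableAt ℝ u x) :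
    pd i (fun y => g (u y)) x = g' * pd i u x := by
  have h := hg.comp_hasFDerivAt x hu.hasFDerivAt
  unfold pd
  rw [show (fun y => g (u y)) = g ∘ u from rfl, h.fderiv]
  simp

theorem pd_coord (i j : Fin n) : pd i (fun y => y j) x = if i = j then 1 else 0 := by
  have : HasFDerivAt (fun y : EuclideanSpace ℝ (Fin n) => y j)
    (EuclideanSpace.proj (𝕜 := ℝ) j : EuclideanSpace ℝ (Fin n) →L[ℝ] ℝ) x :=
      (EuclideanSpace.proj j : EuclideanSpace ℝ (Fin n) →L[ℝ] ℝ).hasFDerivAt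
  unfold pd
  rw [this.fderiv]
  simp [eq_comm]

theorem pd_inner (a : EuclideanSpace ℝ (Fin n)) : pd i (fun y => ⟪a, y⟫) x = a i := by
  have : HasFDerivAt (fun y : EuclideanSpace ℝ (Fin n) => ⟪a, y⟫) (innerSL ℝ a) x :=
    (innerSL ℝ a).hasFDerivAt
  unfold pd
  rw [this.fderiv]
  simp [EuclideanSpace.inner_single_right]

theorem ContDiff.pd (hu : ContDiff ℝ (⊤ : ℕ∞) u) : ContDiff ℝ (⊤ : ℕ∞) (pd i u) := by
  unfold _root_.pd
  exact (hu.fderiv_right (m := (⊤ : ℕ∞)) (by simp)).clm_apply contDiff_const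

theorem ContDiff.lap (hu : ContDiff ℝ (⊤ : ℕ∞) u) : ContDiff ℝ (⊤ : ℕ∞) (lap u) := by
  unfold _root_.lap
  exact ContDiff.sum fun i _ => hu.pd.pd

theorem ContDiff.gradSq (hu : ContDiff ℝ (⊤ : ℕ∞) u) : ContDiff ℝ (⊤ : ℕ∞) (gradSq u) := by
  unfold _root_.gradSq
  exact ContDiff.sum fun i _ => hu.pd.pow 2

theorem ContDiff.diffAt (hu : ContDiff ℝ (⊤ : ℕ∞) u) : DifferentiableAt ℝ u x :=
  (hu.differentiable (by simp)) x

theorem tsupport_pd_subset : tsupport (pd i u) ⊆ tsupport u := by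
  unfold pd
  exact tsupport_fderiv_apply_subset ℝ _

theorem lap_mul (hu : ContDiff ℝ (⊤ : ℕ∞) u) (hv : ContDiff ℝ (⊤ : ℕ∞) v) :
    lap (fun y => u y * v y) x =
      u x * lap v x + 2 * ∑ i, pd i u x * pd i v x + v x * lap u x := by
  unfold lap
  rw [Finset.mul_sum, Finset.mul_sum, Finset.mul_sum, ← Finset.sum_add_distrib,
    ← Finset.sum_add_distrib]
  refine Finset.sum_congr rfl fun i _ => ?_
  have e : pd i (fun y => u y * v y) = fun y => u y * pd i v y + v y * pd i u y := by
    ext y; exact pd_mul hu.diffAt hv.diffAt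
  rw [e, pd_add (hu.mul hv.pd).diffAt (hv.mul hu.pd).diffAt, pd_mul hu.diffAt hv.pd.diffAt,
    pd_mul hv.diffAt hu.pd.diffAt]
  ring

theorem lap_sub (hu : ContDiff ℝ (⊤ : ℕ∞) u) (hv : ContDiff ℝ (⊤ : ℕ∞) v) :
    lap (fun y => u y - v y) x = lap u x - lap v x := by
  unfold lap
  rw [← Finset.sum_sub_distrib]
  refine Finset.sum_congr rfl fun i _ => ?_
  have e : pd i (fun y => u y - v y) = fun y => pd i u y - pd i v y := by
    ext y; exact pd_sub hu.diffAt hv.diffAt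
  rw [e, pd_sub hu.pd.diffAt hv.pd.diffAt]

theorem lap_sum {ι : Type*} {s : Finset ι} {U : ι → EuclideanSpace ℝ (Fin n) → ℝ}
    (hU : ∀ j ∈ s, ContDiff ℝ (⊤ : ℕ∞) (U j)) :
    lap (fun y => ∑ j ∈ s, U j y) x = ∑ j ∈ s, lap (U j) x := by
  unfold lap
  rw [Finset.sum_comm]
  refine Finset.sum_congr rfl fun i _ => ?_
  have e : pd i (fun y => ∑ j ∈ s, U j y) = fun y => ∑ j ∈ s, pd i (U j) y := by
    ext y; exact pd_sum fun j hj => (hU j hj).diffAt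
  rw [e, pd_sum fun j hj => (hU j hj).pd.diffAt]

theorem integral_pd_eq_zero (hu : ContDiff ℝ 1 u) (hc : HasCompactSupport u) :
    ∫ x, pd i u x = 0 := by
  have hd : Continuous (pd i u) := by
    unfold pd
    exact (hu.continuous_fderiv (by simp)).clm_apply continuous_const
  have hdc : HasCompactSupport (pd i u) := hc.mono' ((subset_tsupport _).trans tsupport_pd_subset)
  have h := integral_bilinear_hasLineDerivAt_right_eq_neg_left_of_integrable
    (μ := (volume : Measure (EuclideanSpace ℝ (Fin n)))) (f := fun _ => (1 : ℝ)) (f' := fun _ => 0)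
    (g := u) (g' := pd i u) (v := EuclideanSpace.single i 1) (B := ContinuousLinearMap.mul ℝ ℝ)
    (by simp) (by simpa using hd.integrable_of_hasCompactSupport hdc)
    (by simpa using hu.continuous.integrable_of_hasCompactSupport hc)
    (fun x _ => by
      simpa using (hasFDerivAt_const (𝕜 := ℝ) (1 : ℝ) x).hasLineDerivAt (EuclideanSpace.single i 1))
    (fun x _ => ((hu.differentiable (by simp)) x).hasFDerivAt.hasLineDerivAt _)
  simpa using h

end PartialDerivatives

section Parametrix

open Filter Topology FourierTransform RealInnerProductSpace SchwartzMap LineDeriv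

variable {V : Type*} [NormedAddCommGroup V]
    [InnerProductSpace ℝ V] [FiniteDimensional ℝ V] [MeasurableSpace V] [BorelSpace V]

/-- The multiplier bounding the inverse symbol of the conjugated Laplacian, regularised at
scale `ε`. -/
def sphereMult (a : V) (ε : ℝ) (ξ : V) : ℝ :=
  (1 + ‖ξ‖ ^ 2) / (ε ^ 2 + (1 - ‖ξ‖ ^ 2) ^ 2 + 4 * ⟪a, ξ⟫ ^ 2)

theorem sphereMult_nonneg (a : V) (ε : ℝ) (ξ : V) : 0 ≤ sphereMult a ε ξ := by
  unfold sphereMult; positivity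

theorem sphereMult_le (a : V) {ε : ℝ} (hε : 0 < ε) (hε1 : ε ≤ 1) (ξ : V) :
    sphereMult a ε ξ ≤ 6 * ε⁻¹ ^ 2 := by
  unfold sphereMult
  rw [div_le_iff₀ (by positivity)]
  have e : 6 * ε⁻¹ ^ 2 * (ε ^ 2 + (1 - ‖ξ‖ ^ 2) ^ 2 + 4 * ⟪a, ξ⟫ ^ 2) =
      6 + ε⁻¹ ^ 2 * (6 * ((1 - ‖ξ‖ ^ 2) ^ 2 + 4 * ⟪a, ξ⟫ ^ 2)) := by
    field_simp; ring
  have h1 : 1 ≤ ε⁻¹ ^ 2 := one_le_pow₀ ((one_le_inv₀ hε).2 hε1)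
  rw [e]
  have h2 : 6 * ((1 - ‖ξ‖ ^ 2) ^ 2 + 4 * ⟪a, ξ⟫ ^ 2) ≤
    ε⁻¹ ^ 2 * (6 * ((1 - ‖ξ‖ ^ 2) ^ 2 + 4 * ⟪a, ξ⟫ ^ 2)) :=
      le_mul_of_one_le_left (by positivity) h1
  nlinarith [sq_nonneg (‖ξ‖ ^ 2 - 2), sq_nonneg ⟪a, ξ⟫]

theorem measurable_sphereMult (a : V) (ε : ℝ) : Measurable (sphereMult a ε) := by
  unfold sphereMult; fun_prop

theorem fourier_smul_eq (f : V → ℂ) {l : ℝ} (hl : 0 < l) (η : V) :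
    𝓕 f (l • η) = ((l ^ Module.finrank ℝ V)⁻¹ : ℝ) • 𝓕 (fun y => f (l⁻¹ • y)) η := by
  rw [Real.fourier_eq', Real.fourier_eq']
  have h := Measure.integral_comp_smul (volume : Measure V)
    (fun y => Complex.exp (((-2 * Real.pi * ⟪y, η⟫ : ℝ) : ℂ) * Complex.I) • f (l⁻¹ • y)) l
  rw [abs_of_pos (by positivity)] at h
  rw [← h]
  refine integral_congr_ae (Eventually.of_forall fun x => ?_)
  simp only [smul_smul, inv_mul_cancel₀ hl.ne', one_smul, real_inner_smul_left,
    real_inner_smul_right]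

theorem exists_scaled_sphereMult_const {n : ℕ} (hn : 3 ≤ n) (hV : Module.finrank ℝ V = n) {p : ℝ}
    (hp : 2 * (n : ℝ) / (n + 2) < p) (hp2 : p ≤ 2) :
    ∃ C : ℝ, 0 < C ∧ ∀ a : V, ‖a‖ = 1 → ∀ ε : ℝ, 0 < ε → ε ≤ 1 → ∀ l : ℝ, 0 < l →
      ∀ f : V → ℂ, Continuous f → HasCompactSupport f →
        ∫ ξ, sphereMult a ε (l⁻¹ • ξ) * ‖𝓕 f ξ‖ ^ 2 ≤
          C * ε ^ (-2 + (n + 2) * (1 / p - 1 / 2)) * l ^ (2 * n * (1 / p - 1 / 2)) *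
            (∫ x, ‖f x‖ ^ p) ^ (2 / p) := by
  obtain ⟨C, hC, h⟩ := exists_sphereMult_const hn hV hp hp2
  have hp0 : 0 < p := lt_trans (by positivity) hp
  refine ⟨C, hC, fun a ha ε hε hε1 l hl f hf hfc => ?_⟩
  set ft : V → ℂ := fun y => f (l⁻¹ • y) with hft
  have hc : Continuous ft := hf.comp (continuous_const_smul _)
  have hcs : HasCompactSupport ft :=
    hfc.comp_homeomorph (Homeomorph.smulOfNeZero l⁻¹ (inv_ne_zero hl.ne'))
  obtain ⟨K, hK⟩ := hcs.exists_bound_of_continuous hc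
  have hint : Integrable fun x => ‖ft x‖ ^ p :=
    (hc.norm.rpow_const fun _ => Or.inr hp0.le).integrable_of_hasCompactSupport
      (hcs.norm.comp_left (g := fun t : ℝ => t ^ p) (Real.zero_rpow hp0.ne'))
  have k := h a ha ε hε hε1 ft hc.measurable (hc.integrable_of_hasCompactSupport hcs)
    (hc.memLp_of_hasCompactSupport hcs) hint ⟨K, hK⟩
  have e1 : ∫ ξ, sphereMult a ε (l⁻¹ • ξ) * ‖𝓕 f ξ‖ ^ 2 =
      (l ^ n)⁻¹ * ∫ η, sphereMult a ε η * ‖𝓕 ft η‖ ^ 2 := by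
    have h1 := Measure.integral_comp_smul (volume : Measure V)
      (fun η => sphereMult a ε η * ‖𝓕 f (l • η)‖ ^ 2) l⁻¹
    simp only [smul_smul, mul_inv_cancel₀ hl.ne', one_smul] at h1
    rw [h1, hV, abs_of_pos (by positivity), smul_eq_mul, ← integral_const_mul, ← integral_const_mul]
    refine integral_congr_ae (Eventually.of_forall fun η => ?_)
    simp only
    rw [fourier_smul_eq f hl, hV, norm_smul, Real.norm_of_nonneg (by positivity)]
    rw [← hft]
    generalize ‖𝓕 ft η‖ = F
    rw [inv_pow, inv_inv]
    field_simp
  have e2 : ∫ x, ‖ft x‖ ^ p = l ^ n * ∫ x, ‖f x‖ ^ p := by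
    have h1 := Measure.integral_comp_smul (volume : Measure V) (fun y => ‖f y‖ ^ p) l⁻¹
    rw [hV, abs_of_pos (by positivity), smul_eq_mul] at h1
    simp only [hft]
    rw [h1, inv_pow, inv_inv]
  rw [e1]
  calc (l ^ n)⁻¹ * ∫ η, sphereMult a ε η * ‖𝓕 ft η‖ ^ 2
      ≤ (l ^ n)⁻¹ * (C * ε ^ (-2 + (n + 2) * (1 / p - 1 / 2)) * (∫ x, ‖ft x‖ ^ p) ^ (2 / p)) :=
        mul_le_mul_of_nonneg_left k (by positivity)
    _ = _ := by
        rw [e2, Real.mul_rpow (by positivity) (integral_nonneg fun x => by positivity)]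
        have e3 : l ^ (2 * (n : ℝ) * (1 / p - 1 / 2)) = (l ^ n)⁻¹ * (l ^ n) ^ (2 / p) := by
          rw [← Real.rpow_natCast, ← Real.rpow_neg hl.le, ← Real.rpow_mul hl.le,
            ← Real.rpow_add hl]
          congr 1; ring
        rw [e3]; ring

/-- The regularised inverse symbol of the conjugated Laplacian. -/
def invSymbol (a : V) (ε : ℝ) (ξ : V) : ℂ :=
  ((ε ^ 2 + (1 - ‖ξ‖ ^ 2) ^ 2 + 4 * ⟪a, ξ⟫ ^ 2)⁻¹ : ℝ) *
    (((1 - ‖ξ‖ ^ 2 : ℝ) : ℂ) - 2 * Complex.I * (⟪a, ξ⟫ : ℝ))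

theorem hasTemperateGrowth_invSymbol (a : V) {ε : ℝ} (hε : 0 < ε) :
    (invSymbol a ε).HasTemperateGrowth := by
  have hN : (fun ξ : V => ((1 - ‖ξ‖ ^ 2 : ℝ) : ℂ)).HasTemperateGrowth :=
    Function.HasTemperateGrowth.comp Function.Complex.hasTemperateGrowth_ofReal
      ((Function.HasTemperateGrowth.const 1).sub (Function.hasTemperateGrowth_norm_sq V))
  have hK : (fun ξ : V => ((⟪a, ξ⟫ : ℝ) : ℂ)).HasTemperateGrowth :=
    Function.HasTemperateGrowth.comp Function.Complex.hasTemperateGrowth_ofReal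
      (Function.hasTemperateGrowth_inner_right a)
  have hQ : (fun ξ : V => ((1 - ‖ξ‖ ^ 2 : ℝ) : ℂ) - 2 * Complex.I * (⟪a, ξ⟫ : ℝ)).HasTemperateGrowth :=
    hN.sub ((Function.HasTemperateGrowth.const (2 * Complex.I)).mul hK)
  have hZ := (Function.HasTemperateGrowth.const ((ε⁻¹ : ℝ) : ℂ) (E := V)).mul hQ
  have hD := (Function.hasTemperateGrowth_one_add_norm_sq_rpow (H := ℂ) (-1)).comp hZ
  have hD' := Function.HasTemperateGrowth.comp Function.Complex.hasTemperateGrowth_ofReal hD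
  have h := ((Function.HasTemperateGrowth.const (((ε⁻¹ ^ 2 : ℝ) : ℂ)) (E := V)).mul hD').mul hQ
  refine (congrArg (fun g : V → ℂ => g.HasTemperateGrowth) (funext fun ξ => ?_)).mpr h
  simp only [invSymbol, Pi.mul_apply, Function.comp_apply]
  congr 1
  rw [← Complex.ofReal_mul]
  congr 1
  rw [Real.rpow_neg_one, norm_mul, mul_pow, Complex.sq_norm (_ - _), Complex.normSq_apply]
  simp only [Complex.sub_re, Complex.sub_im, Complex.mul_re, Complex.mul_im, Complex.ofReal_re,
    Complex.ofReal_im, Complex.I_re, Complex.I_im, Complex.re_ofNat, Complex.im_ofNat,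
    Complex.norm_real, Real.norm_of_nonneg (inv_nonneg.2 hε.le)]
  rw [inv_pow, ← mul_inv]
  congr 1
  rw [mul_add, mul_inv_cancel_left₀ (by positivity : ε ^ 2 ≠ 0)]
  ring

theorem norm_invSymbol_sq (a : V) (ε : ℝ) (ξ : V) :
    ‖invSymbol a ε ξ‖ ^ 2 = ((ε ^ 2 + (1 - ‖ξ‖ ^ 2) ^ 2 + 4 * ⟪a, ξ⟫ ^ 2)⁻¹) ^ 2 *
      ((1 - ‖ξ‖ ^ 2) ^ 2 + 4 * ⟪a, ξ⟫ ^ 2) := by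
  rw [invSymbol, norm_mul, mul_pow, Complex.sq_norm (_ - _), Complex.normSq_apply, Complex.norm_real,
    Real.norm_eq_abs, sq_abs]
  simp only [Complex.sub_re, Complex.sub_im, Complex.mul_re, Complex.mul_im, Complex.ofReal_re,
    Complex.ofReal_im, Complex.I_re, Complex.I_im, Complex.re_ofNat, Complex.im_ofNat]
  ring

theorem one_add_mul_norm_invSymbol_sq_le (a : V) {ε : ℝ} (hε : 0 < ε) (ξ : V) :
    (1 + ‖ξ‖ ^ 2) * ‖invSymbol a ε ξ‖ ^ 2 ≤ sphereMult a ε ξ := by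
  rw [norm_invSymbol_sq, sphereMult]
  have hd : 0 < ε ^ 2 + (1 - ‖ξ‖ ^ 2) ^ 2 + 4 * ⟪a, ξ⟫ ^ 2 := by positivity
  rw [le_div_iff₀ hd]
  have : ((ε ^ 2 + (1 - ‖ξ‖ ^ 2) ^ 2 + 4 * ⟪a, ξ⟫ ^ 2)⁻¹) ^ 2 *
      ((1 - ‖ξ‖ ^ 2) ^ 2 + 4 * ⟪a, ξ⟫ ^ 2) * (ε ^ 2 + (1 - ‖ξ‖ ^ 2) ^ 2 + 4 * ⟪a, ξ⟫ ^ 2) ≤ 1 := by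
    have hQ : (1 - ‖ξ‖ ^ 2) ^ 2 + 4 * ⟪a, ξ⟫ ^ 2 ≤ ε ^ 2 + (1 - ‖ξ‖ ^ 2) ^ 2 + 4 * ⟪a, ξ⟫ ^ 2 := by
      nlinarith [sq_nonneg ε]
    generalize (1 - ‖ξ‖ ^ 2) ^ 2 + 4 * ⟪a, ξ⟫ ^ 2 = Q at *
    generalize ε ^ 2 + (1 - ‖ξ‖ ^ 2) ^ 2 + 4 * ⟪a, ξ⟫ ^ 2 = D at *
    have e : D⁻¹ ^ 2 * Q * D = D⁻¹ * Q := by field_simp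
    rw [e, inv_mul_le_iff₀ hd, mul_one]
    exact hQ
  calc _ = (1 + ‖ξ‖ ^ 2) * (((ε ^ 2 + (1 - ‖ξ‖ ^ 2) ^ 2 + 4 * ⟪a, ξ⟫ ^ 2)⁻¹) ^ 2 *
      ((1 - ‖ξ‖ ^ 2) ^ 2 + 4 * ⟪a, ξ⟫ ^ 2) * (ε ^ 2 + (1 - ‖ξ‖ ^ 2) ^ 2 + 4 * ⟪a, ξ⟫ ^ 2)) := by ring
    _ ≤ (1 + ‖ξ‖ ^ 2) * 1 := by gcongr
    _ = _ := mul_one _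

theorem symbol_mul_invSymbol_sub_one (a : V) {ε : ℝ} (hε : 0 < ε) (ξ : V) :
    (((1 - ‖ξ‖ ^ 2 : ℝ) : ℂ) + 2 * Complex.I * (⟪a, ξ⟫ : ℝ)) * invSymbol a ε ξ - 1 =
      ((-(ε ^ 2 / (ε ^ 2 + (1 - ‖ξ‖ ^ 2) ^ 2 + 4 * ⟪a, ξ⟫ ^ 2)) : ℝ) : ℂ) := by
  have hd : 0 < ε ^ 2 + (1 - ‖ξ‖ ^ 2) ^ 2 + 4 * ⟪a, ξ⟫ ^ 2 := by positivity
  unfold invSymbol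
  generalize 1 - ‖ξ‖ ^ 2 = N at *
  generalize ⟪a, ξ⟫ = K at *
  have hd' : ((ε : ℂ) ^ 2 + N ^ 2 + 4 * K ^ 2) * ((ε : ℂ) ^ 2 + N ^ 2 + 4 * K ^ 2)⁻¹ = 1 :=
    mul_inv_cancel₀ (by exact_mod_cast hd.ne')
  push_cast
  rw [div_eq_mul_inv]
  generalize ((ε : ℂ) ^ 2 + N ^ 2 + 4 * K ^ 2)⁻¹ = Z at *
  linear_combination hd' - 4 * K ^ 2 * Z * Complex.I_sq

theorem error_symbol_sq_le (a : V) {ε : ℝ} (hε : 0 < ε) (ξ : V) :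
    (ε ^ 2 / (ε ^ 2 + (1 - ‖ξ‖ ^ 2) ^ 2 + 4 * ⟪a, ξ⟫ ^ 2)) ^ 2 ≤ ε ^ 2 * sphereMult a ε ξ := by
  have hd : 0 < ε ^ 2 + (1 - ‖ξ‖ ^ 2) ^ 2 + 4 * ⟪a, ξ⟫ ^ 2 := by positivity
  have h1 : ε ^ 2 / (ε ^ 2 + (1 - ‖ξ‖ ^ 2) ^ 2 + 4 * ⟪a, ξ⟫ ^ 2) ≤ 1 := by
    rw [div_le_one hd]; nlinarith [sq_nonneg (1 - ‖ξ‖ ^ 2), sq_nonneg ⟪a, ξ⟫]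
  have h2 : ε ^ 2 / (ε ^ 2 + (1 - ‖ξ‖ ^ 2) ^ 2 + 4 * ⟪a, ξ⟫ ^ 2) ≤ ε ^ 2 * sphereMult a ε ξ := by
    rw [sphereMult, mul_div_assoc']
    gcongr
    nlinarith [sq_nonneg ‖ξ‖, sq_nonneg ε, mul_nonneg (sq_nonneg ε) (sq_nonneg ‖ξ‖)]
  rw [sq]
  exact (mul_le_of_le_one_left (by positivity) h1).trans h2

end Parametrix

section SchwartzParametrix

open Filter Topology FourierTransform RealInnerProductSpace SchwartzMap LineDeriv

variable {n : ℕ}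

/-- The `i`-th partial derivative of a Schwartz function. -/
def schwartzPd (i : Fin n) (w : 𝓢(EuclideanSpace ℝ (Fin n), ℂ)) : 𝓢(EuclideanSpace ℝ (Fin n), ℂ) :=
  ∂_{EuclideanSpace.single i (1 : ℝ)} w

/-- The integral of the Fourier transform of `g` against the scaled multiplier. -/
def multForm (b : EuclideanSpace ℝ (Fin n)) (ε : ℝ) (g : EuclideanSpace ℝ (Fin n) → ℂ) : ℝ :=
  ∫ ξ, sphereMult (‖b‖⁻¹ • b) ε ((‖b‖ / (2 * Real.pi))⁻¹ • ξ) * ‖𝓕 g ξ‖ ^ 2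

theorem fourier_lineDerivOp_single_apply (w : 𝓢(EuclideanSpace ℝ (Fin n), ℂ)) (i : Fin n)
    (ξ : EuclideanSpace ℝ (Fin n)) :
    𝓕 (schwartzPd i w) ξ = (2 * Real.pi * Complex.I) * ((ξ i : ℝ) * 𝓕 w ξ) := by
  rw [schwartzPd, SchwartzMap.fourier_lineDerivOp_eq, smul_apply,
    smulLeftCLM_apply_apply (Function.hasTemperateGrowth_inner_left _)]
  simp [EuclideanSpace.inner_single_right]

theorem integrable_sq_schwartz (w : 𝓢(EuclideanSpace ℝ (Fin n), ℂ)) :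
    Integrable fun x => ‖w x‖ ^ 2 :=
  (w.memLp 2 volume).integrable_norm_pow (by norm_num)

theorem integrable_sphereMult_mul_schwartz (b : EuclideanSpace ℝ (Fin n)) {ε : ℝ} (hε : 0 < ε)
    (hε1 : ε ≤ 1) (w : 𝓢(EuclideanSpace ℝ (Fin n), ℂ)) (l : ℝ) :
    Integrable fun ξ => sphereMult (‖b‖⁻¹ • b) ε (l • ξ) * ‖𝓕 w ξ‖ ^ 2 := by
  refine (integrable_sq_schwartz (𝓕 w)).bdd_mul (c := 6 * ε⁻¹ ^ 2)
    ((measurable_sphereMult _ ε).comp (measurable_const_smul l)).aestronglyMeasurable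
    (Eventually.of_forall fun ξ => ?_)
  rw [Real.norm_of_nonneg (sphereMult_nonneg _ _ _)]
  exact sphereMult_le _ hε hε1 _

theorem exists_schwartz_parametrix {b : EuclideanSpace ℝ (Fin n)} (hb : b ≠ 0) {ε : ℝ}
    (hε : 0 < ε) (hε1 : ε ≤ 1) (g : 𝓢(EuclideanSpace ℝ (Fin n), ℂ)) :
    ∃ w : 𝓢(EuclideanSpace ℝ (Fin n), ℂ),
      ∫ x, ‖w x‖ ^ 2 ≤ ‖b‖⁻¹ ^ 4 * multForm b ε g ∧
      ∑ i, ∫ x, ‖(schwartzPd i w) x‖ ^ 2 ≤ ‖b‖⁻¹ ^ 2 * multForm b ε g ∧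
      ∫ x, ‖(∑ i, schwartzPd i (schwartzPd i w) +
          ∑ i, ((2 * b i : ℝ) : ℂ) • schwartzPd i w +
          ((‖b‖ ^ 2 : ℝ) : ℂ) • w - g) x‖ ^ 2 ≤ ε ^ 2 * multForm b ε g := by
  set L := ‖b‖ with hL
  have hL0 : 0 < L := norm_pos_iff.2 hb
  set l := L / (2 * Real.pi) with hl
  have hl0 : 0 < l := by positivity
  set a := L⁻¹ • b with ha
  set m : EuclideanSpace ℝ (Fin n) → ℂ := fun ξ => ((L⁻¹ ^ 2 : ℝ) : ℂ) * invSymbol a ε (l⁻¹ • ξ)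
    with hm
  have hmt : m.HasTemperateGrowth :=
    (Function.HasTemperateGrowth.const _).mul ((hasTemperateGrowth_invSymbol a hε).comp
      (l⁻¹ • ContinuousLinearMap.id ℝ (EuclideanSpace ℝ (Fin n))).hasTemperateGrowth)
  set w := SchwartzMap.fourierMultiplierCLM ℂ m g with hw
  have hwF : ∀ ξ, 𝓕 w ξ = m ξ * 𝓕 g ξ := fun ξ => by
    rw [hw, SchwartzMap.fourierMultiplierCLM_apply, FourierTransform.fourier_fourierInv_eq,
      smulLeftCLM_apply_apply hmt, smul_eq_mul]
  have hJ := integrable_sphereMult_mul_schwartz b hε hε1 g l⁻¹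
  have hsym : ∀ ξ, (1 + ‖l⁻¹ • ξ‖ ^ 2) * ‖m ξ‖ ^ 2 ≤ L⁻¹ ^ 4 * sphereMult a ε (l⁻¹ • ξ) := by
    intro ξ
    rw [hm]
    simp only [norm_mul, mul_pow, Complex.norm_real, Real.norm_of_nonneg (sq_nonneg L⁻¹)]
    have := mul_le_mul_of_nonneg_left (one_add_mul_norm_invSymbol_sq_le a hε (l⁻¹ • ξ))
      (by positivity : 0 ≤ L⁻¹ ^ 4)
    calc _ = L⁻¹ ^ 4 * ((1 + ‖l⁻¹ • ξ‖ ^ 2) * ‖invSymbol a ε (l⁻¹ • ξ)‖ ^ 2) := by ring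
      _ ≤ _ := this
  refine ⟨w, ?_, ?_, ?_⟩
  · rw [← SchwartzMap.integral_norm_sq_fourier, multForm, ← integral_const_mul]
    refine integral_mono (integrable_sq_schwartz _) (hJ.const_mul _) fun ξ => ?_
    simp only [hwF, norm_mul, mul_pow]
    calc ‖m ξ‖ ^ 2 * ‖𝓕 g ξ‖ ^ 2 ≤ ((1 + ‖l⁻¹ • ξ‖ ^ 2) * ‖m ξ‖ ^ 2) * ‖𝓕 g ξ‖ ^ 2 := by
          gcongr
          exact le_mul_of_one_le_left (by positivity) (by simp)
      _ ≤ (L⁻¹ ^ 4 * sphereMult a ε (l⁻¹ • ξ)) * ‖𝓕 g ξ‖ ^ 2 :=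
          mul_le_mul_of_nonneg_right (hsym ξ) (sq_nonneg _)
      _ = _ := by rw [mul_assoc]; rfl
  · have e : ∀ i : Fin n, ∫ x, ‖(schwartzPd i w) x‖ ^ 2 =
        ∫ ξ, ‖𝓕 (schwartzPd i w) ξ‖ ^ 2 := fun i =>
      (SchwartzMap.integral_norm_sq_fourier _).symm
    rw [Finset.sum_congr rfl fun i _ => e i,
      ← integral_finsetSum _ fun i _ => integrable_sq_schwartz _, multForm, ← integral_const_mul]
    refine integral_mono (integrable_finsetSum _ fun i _ => integrable_sq_schwartz _)
      (hJ.const_mul _) fun ξ => ?_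
    simp only
    have e2 : ∑ i, ‖𝓕 (schwartzPd i w) ξ‖ ^ 2 =
        L ^ 2 * (‖l⁻¹ • ξ‖ ^ 2 * ‖m ξ‖ ^ 2) * ‖𝓕 g ξ‖ ^ 2 := by
      have : ∀ i, ‖𝓕 (schwartzPd i w) ξ‖ ^ 2 =
          (ξ i) ^ 2 * ((2 * Real.pi) ^ 2 * (‖m ξ‖ ^ 2 * ‖𝓕 g ξ‖ ^ 2)) := fun i => by
        rw [fourier_lineDerivOp_single_apply, hwF]
        simp only [norm_mul, Complex.norm_real, Complex.norm_I, Complex.norm_ofNat, mul_pow,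
          Real.norm_eq_abs, sq_abs]
        ring
      rw [Finset.sum_congr rfl fun i _ => this i, ← Finset.sum_mul,
        ← EuclideanSpace.real_norm_sq_eq, norm_smul, Real.norm_of_nonneg (inv_nonneg.2 hl0.le), hl]
      field_simp
    rw [e2]
    calc _ ≤ L ^ 2 * ((1 + ‖l⁻¹ • ξ‖ ^ 2) * ‖m ξ‖ ^ 2) * ‖𝓕 g ξ‖ ^ 2 := by
          gcongr
          linarith
      _ ≤ L ^ 2 * (L⁻¹ ^ 4 * sphereMult a ε (l⁻¹ • ξ)) * ‖𝓕 g ξ‖ ^ 2 := by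
          exact mul_le_mul_of_nonneg_right (mul_le_mul_of_nonneg_left (hsym ξ) (sq_nonneg _))
            (sq_nonneg _)
      _ = L⁻¹ ^ 2 * (sphereMult a ε (l⁻¹ • ξ) * ‖𝓕 g ξ‖ ^ 2) := by field_simp
  · rw [← SchwartzMap.integral_norm_sq_fourier, multForm, ← integral_const_mul]
    refine integral_mono (integrable_sq_schwartz _) (hJ.const_mul _) fun ξ => ?_
    simp only
    set D : Fin n → 𝓢(EuclideanSpace ℝ (Fin n), ℂ) := fun i =>
      schwartzPd i w with hD
    have e : 𝓕 (∑ i, schwartzPd i (D i) +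
          ∑ i, ((2 * b i : ℝ) : ℂ) • D i + ((L ^ 2 : ℝ) : ℂ) • w - g) =
        ∑ i, 𝓕 (schwartzPd i (D i)) +
          ∑ i, ((2 * b i : ℝ) : ℂ) • 𝓕 (D i) + ((L ^ 2 : ℝ) : ℂ) • 𝓕 w - 𝓕 g := by
      simp only [← SchwartzMap.fourierTransformCLM_apply (𝕜 := ℂ), map_add, map_sub, map_sum,
        map_smul]
    rw [e]
    have e2 : (∑ i, 𝓕 (schwartzPd i (D i)) +
          ∑ i, ((2 * b i : ℝ) : ℂ) • 𝓕 (D i) + ((L ^ 2 : ℝ) : ℂ) • 𝓕 w - 𝓕 g) ξ =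
        ((-(ε ^ 2 / (ε ^ 2 + (1 - ‖l⁻¹ • ξ‖ ^ 2) ^ 2 + 4 * ⟪a, l⁻¹ • ξ⟫ ^ 2)) : ℝ) : ℂ) *
          𝓕 g ξ := by
      rw [← symbol_mul_invSymbol_sub_one a hε]
      simp only [sub_apply, add_apply, sum_apply,
        smul_apply, hD, fourier_lineDerivOp_single_apply, hwF, smul_eq_mul]
      have s1 : ∑ i, 2 * (Real.pi : ℂ) * Complex.I * (((ξ i : ℝ) : ℂ) *
          (2 * Real.pi * Complex.I * (((ξ i : ℝ) : ℂ) * (m ξ * 𝓕 g ξ)))) =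
          -(2 * Real.pi) ^ 2 * ((‖ξ‖ ^ 2 : ℝ) : ℂ) * (m ξ * 𝓕 g ξ) := by
        rw [EuclideanSpace.real_norm_sq_eq]
        push_cast
        rw [Finset.mul_sum, Finset.sum_mul]
        refine Finset.sum_congr rfl fun i _ => ?_
        linear_combination (2 * (Real.pi : ℂ)) ^ 2 * ((ξ i : ℝ) : ℂ) ^ 2 * (m ξ * 𝓕 g ξ) *
          Complex.I_sq
      have s2 : ∑ i, ((2 * b i : ℝ) : ℂ) * (2 * Real.pi * Complex.I * (((ξ i : ℝ) : ℂ) *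
          (m ξ * 𝓕 g ξ))) = 2 * (2 * Real.pi) * Complex.I * ((⟪b, ξ⟫ : ℝ) : ℂ) * (m ξ * 𝓕 g ξ) := by
        rw [PiLp.inner_apply]
        push_cast
        rw [Finset.mul_sum, Finset.sum_mul]
        refine Finset.sum_congr rfl fun i _ => ?_
        simp
        ring
      rw [s1, s2, hm]
      have h1 : ‖ξ‖ ^ 2 = l ^ 2 * ‖l⁻¹ • ξ‖ ^ 2 := by
        rw [norm_smul, mul_pow, Real.norm_eq_abs, sq_abs]; field_simp
      have h2 : ⟪b, ξ⟫ = L * l * ⟪a, l⁻¹ • ξ⟫ := by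
        rw [ha, real_inner_smul_left, real_inner_smul_right]; field_simp
      rw [h1, h2]
      simp only
      generalize invSymbol a ε (l⁻¹ • ξ) = Z
      generalize ‖l⁻¹ • ξ‖ = X
      generalize ⟪a, l⁻¹ • ξ⟫ = Y
      generalize (𝓕 g) ξ = G
      have hl2 : 2 * Real.pi * l = L := by rw [hl]; field_simp
      have hl3 : (2 * Real.pi * l : ℂ) = L := by exact_mod_cast hl2
      have hL1 : (L : ℂ) * (L : ℂ)⁻¹ = 1 := mul_inv_cancel₀ (by exact_mod_cast hL0.ne')
      push_cast
      have t1 : -(2 * (Real.pi : ℂ)) ^ 2 * ((l : ℂ) ^ 2 * (X : ℂ) ^ 2) = -(L : ℂ) ^ 2 * X ^ 2 := by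
        rw [← hl3]; ring
      have t2 : 2 * (2 * (Real.pi : ℂ)) * Complex.I * (L * l * Y) = 2 * L ^ 2 * Complex.I * Y := by
        rw [← hl3]; ring
      rw [t1, t2]
      have t3 : (L : ℂ) ^ 2 * (L : ℂ)⁻¹ ^ 2 = 1 := by rw [← mul_pow, hL1, one_pow]
      linear_combination ((1 - (X : ℂ) ^ 2 + 2 * Complex.I * Y) * Z * G) * t3
    rw [e2, norm_mul, mul_pow, Complex.norm_real, Real.norm_eq_abs, sq_abs, neg_sq, ← mul_assoc]
    exact mul_le_mul_of_nonneg_right (error_symbol_sq_le a hε _) (sq_nonneg _)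

end SchwartzParametrix

section RealParametrix

open Filter Topology FourierTransform RealInnerProductSpace SchwartzMap LineDeriv

variable {n : ℕ}

theorem pd_re {w : EuclideanSpace ℝ (Fin n) → ℂ} {x : EuclideanSpace ℝ (Fin n)}
    (hw : DifferentiableAt ℝ w x) (i : Fin n) :
    pd i (fun y => (w y).re) x = (fderiv ℝ w x (EuclideanSpace.single i 1)).re := by
  have h := Complex.reCLM.hasFDerivAt.comp x hw.hasFDerivAt
  unfold pd
  rw [show (fun y => (w y).re) = Complex.reCLM ∘ w from rfl, h.fderiv]
  simp

theorem pd_re_schwartz (w : 𝓢(EuclideanSpace ℝ (Fin n), ℂ)) (i : Fin n) :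
    pd i (fun y => (w y).re) = fun x => (schwartzPd i w x).re := by
  ext x
  rw [pd_re w.differentiableAt, schwartzPd, SchwartzMap.lineDerivOp_apply_eq_fderiv]

theorem pd_exp_inner_mul (b : EuclideanSpace ℝ (Fin n)) {w : EuclideanSpace ℝ (Fin n) → ℝ}
    (hw : ContDiff ℝ (⊤ : ℕ∞) w) (i : Fin n) (x : EuclideanSpace ℝ (Fin n)) :
    pd i (fun y => Real.exp ⟪b, y⟫ * w y) x = Real.exp ⟪b, x⟫ * (b i * w x + pd i w x) := by
  have hb : ContDiff ℝ (⊤ : ℕ∞) fun y : EuclideanSpace ℝ (Fin n) => ⟪b, y⟫ := contDiff_const.inner ℝ contDiff_id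
  rw [pd_mul hb.exp.diffAt hw.diffAt, pd_comp (Real.hasDerivAt_exp _) hb.diffAt, pd_inner]
  ring

theorem lap_exp_inner_mul (b : EuclideanSpace ℝ (Fin n)) {w : EuclideanSpace ℝ (Fin n) → ℝ}
    (hw : ContDiff ℝ (⊤ : ℕ∞) w) (x : EuclideanSpace ℝ (Fin n)) :
    lap (fun y => Real.exp ⟪b, y⟫ * w y) x =
      Real.exp ⟪b, x⟫ * (lap w x + ∑ i, 2 * b i * pd i w x + ‖b‖ ^ 2 * w x) := by
  unfold lap
  rw [EuclideanSpace.real_norm_sq_eq, Finset.sum_mul, ← Finset.sum_add_distrib,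
    ← Finset.sum_add_distrib, Finset.mul_sum]
  refine Finset.sum_congr rfl fun i _ => ?_
  have e : pd i (fun y => Real.exp ⟪b, y⟫ * w y) =
      fun y => Real.exp ⟪b, y⟫ * (b i * w y + pd i w y) := by
    ext y; exact pd_exp_inner_mul b hw i y
  rw [e, pd_exp_inner_mul b ((contDiff_const.mul hw).add hw.pd),
    pd_add (contDiff_const.mul hw).diffAt hw.pd.diffAt, pd_const_mul _ hw.diffAt]
  ring

theorem exists_parametrix_const (hn : 3 ≤ n) {p : ℝ} (hp : 2 * (n : ℝ) / (n + 2) < p)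
    (hp2 : p ≤ 2) :
    ∃ C : ℝ, 0 < C ∧ ∀ b : EuclideanSpace ℝ (Fin n), b ≠ 0 → ∀ ε : ℝ, 0 < ε → ε ≤ 1 →
      ∀ f : EuclideanSpace ℝ (Fin n) → ℝ, ContDiff ℝ (⊤ : ℕ∞) f → HasCompactSupport f →
      ∃ (W : EuclideanSpace ℝ (Fin n) → ℝ) (N : ℝ), ContDiff ℝ (⊤ : ℕ∞) W ∧
        N = C * ε ^ (-2 + (n + 2) * (1 / p - 1 / 2)) * ‖b‖ ^ (2 * n * (1 / p - 1 / 2)) *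
          (∫ x, |Real.exp (-⟪b, x⟫) * f x| ^ p) ^ (2 / p) ∧
        Integrable (fun x => Real.exp (-⟪b, x⟫) ^ 2 * W x ^ 2) ∧
        ∫ x, Real.exp (-⟪b, x⟫) ^ 2 * W x ^ 2 ≤ ‖b‖⁻¹ ^ 4 * N ∧
        Integrable (fun x => Real.exp (-⟪b, x⟫) ^ 2 * gradSq W x) ∧
        ∫ x, Real.exp (-⟪b, x⟫) ^ 2 * gradSq W x ≤ ‖b‖⁻¹ ^ 2 * N ∧
        Integrable (fun x => Real.exp (-⟪b, x⟫) ^ 2 * (lap W x - f x) ^ 2) ∧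
        ∫ x, Real.exp (-⟪b, x⟫) ^ 2 * (lap W x - f x) ^ 2 ≤ ε ^ 2 * N := by
  have hfin : Module.finrank ℝ (EuclideanSpace ℝ (Fin n)) = n := by simp
  obtain ⟨C, hC, hS⟩ := exists_scaled_sphereMult_const (V := EuclideanSpace ℝ (Fin n)) hn hfin hp hp2
  have hp0 : 0 < p := lt_trans (by positivity) hp
  have hδ : 0 ≤ 1 / p - 1 / 2 := sub_nonneg.2 (one_div_le_one_div_of_le hp0 hp2)
  refine ⟨4 * C, by positivity, fun b hb ε hε hε1 f hf hfc => ?_⟩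
  have hL0 : 0 < ‖b‖ := norm_pos_iff.2 hb
  have hbs : ContDiff ℝ (⊤ : ℕ∞) fun y : EuclideanSpace ℝ (Fin n) => ⟪b, y⟫ := contDiff_const.inner ℝ contDiff_id
  set fb : EuclideanSpace ℝ (Fin n) → ℂ := fun x => ((Real.exp (-⟪b, x⟫) * f x : ℝ) : ℂ) with hfb
  have hfbs : ContDiff ℝ (⊤ : ℕ∞) fb := Complex.ofRealCLM.contDiff.comp (hbs.neg.exp.mul hf)
  have hfbc : HasCompactSupport fb := by
    have := (hfc.mul_left (f := fun x => Real.exp (-⟪b, x⟫))).comp_left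
      (g := fun t : ℝ => (t : ℂ)) (by simp)
    exact this
  obtain ⟨w, hw1, hw2, hw3⟩ := exists_schwartz_parametrix hb hε hε1 (hfbc.toSchwartzMap hfbs)
  set N₀ := multForm b ε (hfbc.toSchwartzMap hfbs) with hN₀
  have hN₀0 : 0 ≤ N₀ := integral_nonneg fun ξ => mul_nonneg (sphereMult_nonneg _ _ _) (sq_nonneg _)
  set N := 4 * C * ε ^ (-2 + (n + 2) * (1 / p - 1 / 2)) * ‖b‖ ^ (2 * n * (1 / p - 1 / 2)) *
          (∫ x, |Real.exp (-⟪b, x⟫) * f x| ^ p) ^ (2 / p) with hN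
  have hNN : 4 * N₀ ≤ N := by
    have h := hS (‖b‖⁻¹ • b) (by rw [norm_smul, norm_inv, norm_norm, inv_mul_cancel₀ hL0.ne'])
      ε hε hε1 (‖b‖ / (2 * Real.pi)) (by positivity) fb hfbs.continuous hfbc
    have hl : (‖b‖ / (2 * Real.pi)) ^ (2 * (n : ℝ) * (1 / p - 1 / 2)) ≤
        ‖b‖ ^ (2 * (n : ℝ) * (1 / p - 1 / 2)) := by
      refine Real.rpow_le_rpow (by positivity) (div_le_self hL0.le ?_) (by positivity)
      linarith [Real.pi_gt_three]
    have hI : ∫ x, ‖fb x‖ ^ p = ∫ x, |Real.exp (-⟪b, x⟫) * f x| ^ p := by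
      simp only [hfb, Complex.norm_real, Real.norm_eq_abs]
    rw [hI] at h
    have hI0 : 0 ≤ ∫ x, |Real.exp (-⟪b, x⟫) * f x| ^ p := integral_nonneg fun x => by positivity
    have h' : N₀ ≤ C * ε ^ (-2 + (n + 2) * (1 / p - 1 / 2)) *
        (‖b‖ / (2 * Real.pi)) ^ (2 * (n : ℝ) * (1 / p - 1 / 2)) *
        (∫ x, |Real.exp (-⟪b, x⟫) * f x| ^ p) ^ (2 / p) := h
    calc 4 * N₀ ≤ 4 * (C * ε ^ (-2 + (n + 2) * (1 / p - 1 / 2)) *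
        ‖b‖ ^ (2 * (n : ℝ) * (1 / p - 1 / 2)) *
        (∫ x, |Real.exp (-⟪b, x⟫) * f x| ^ p) ^ (2 / p)) := by
          refine mul_le_mul_of_nonneg_left (h'.trans ?_) (by norm_num)
          gcongr
      _ = N := by rw [hN]; ring
  set wr : EuclideanSpace ℝ (Fin n) → ℝ := fun x => (w x).re with hwr
  have hwrs : ContDiff ℝ (⊤ : ℕ∞) wr := Complex.reCLM.contDiff.comp (w.smooth _)
  have hpd : ∀ i, pd i wr = fun x => (schwartzPd i w x).re := pd_re_schwartz w
  have hlap : ∀ x, lap wr x = ∑ i, (schwartzPd i (schwartzPd i w) x).re := fun x => by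
    unfold lap
    refine Finset.sum_congr rfl fun i _ => ?_
    rw [hpd, pd_re_schwartz]
  set W : EuclideanSpace ℝ (Fin n) → ℝ := fun x => Real.exp ⟪b, x⟫ * wr x with hW
  have hWs : ContDiff ℝ (⊤ : ℕ∞) W := hbs.exp.mul hwrs
  have hre : ∀ z : ℂ, z.re ^ 2 ≤ ‖z‖ ^ 2 := fun z => by
    rw [← sq_abs]; exact pow_le_pow_left₀ (abs_nonneg _) (Complex.abs_re_le_norm z) 2
  have hee : ∀ x, Real.exp (-⟪b, x⟫) * Real.exp ⟪b, x⟫ = 1 := fun x => by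
    rw [← Real.exp_add]; simp
  have e1 : (fun x => Real.exp (-⟪b, x⟫) ^ 2 * W x ^ 2) = fun x => wr x ^ 2 := by
    ext x
    rw [← mul_pow, hW]; simp only
    rw [← mul_assoc, hee, one_mul]
  have e2 : (fun x => Real.exp (-⟪b, x⟫) ^ 2 * gradSq W x) =
      fun x => ∑ i, (b i * wr x + (schwartzPd i w x).re) ^ 2 := by
    ext x
    unfold gradSq
    rw [Finset.mul_sum]
    refine Finset.sum_congr rfl fun i _ => ?_
    rw [hW, pd_exp_inner_mul b hwrs, ← mul_pow, ← mul_assoc, hee, one_mul, hpd]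
  set err := (∑ i, schwartzPd i (schwartzPd i w) + ∑ i, ((2 * b i : ℝ) : ℂ) • schwartzPd i w +
          ((‖b‖ ^ 2 : ℝ) : ℂ) • w - hfbc.toSchwartzMap hfbs) with herr
  have e3 : (fun x => Real.exp (-⟪b, x⟫) ^ 2 * (lap W x - f x) ^ 2) =
      fun x => (err x).re ^ 2 := by
    ext x
    have : Real.exp (-⟪b, x⟫) * (lap W x - f x) = (err x).re := by
      rw [hW, lap_exp_inner_mul b hwrs, mul_sub, ← mul_assoc, hee, one_mul, hlap, herr]
      simp only [sub_apply, add_apply, sum_apply, smul_apply, smul_eq_mul, Complex.sub_re,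
        Complex.add_re, Complex.re_sum, Complex.re_ofReal_mul, hpd]
      congr 1
    rw [← mul_pow, this]
  have i1 : Integrable fun x => wr x ^ 2 := by
    refine (integrable_sq_schwartz w).mono' (by fun_prop) (Eventually.of_forall fun x => ?_)
    rw [Real.norm_of_nonneg (sq_nonneg _)]; exact hre _
  have i2' : ∀ i, Integrable fun x => (schwartzPd i w x).re ^ 2 := fun i => by
    refine (integrable_sq_schwartz (schwartzPd i w)).mono' (by fun_prop)
      (Eventually.of_forall fun x => ?_)
    rw [Real.norm_of_nonneg (sq_nonneg _)]; exact hre _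
  have hmaj : ∀ x, ∑ i, (b i * wr x + (schwartzPd i w x).re) ^ 2 ≤
      2 * ‖b‖ ^ 2 * wr x ^ 2 + 2 * ∑ i, (schwartzPd i w x).re ^ 2 := fun x => by
    rw [EuclideanSpace.real_norm_sq_eq, Finset.mul_sum, Finset.mul_sum, Finset.sum_mul,
      ← Finset.sum_add_distrib]
    refine Finset.sum_le_sum fun i _ => ?_
    nlinarith [sq_nonneg (b i * wr x - (schwartzPd i w x).re)]
  have imaj : Integrable fun x => 2 * ‖b‖ ^ 2 * wr x ^ 2 + 2 * ∑ i, (schwartzPd i w x).re ^ 2 :=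
    (i1.const_mul _).add ((integrable_finsetSum _ fun i _ => i2' i).const_mul _)
  have i2 : Integrable fun x => ∑ i, (b i * wr x + (schwartzPd i w x).re) ^ 2 := by
    refine imaj.mono' (by fun_prop) (Eventually.of_forall fun x => ?_)
    rw [Real.norm_of_nonneg (Finset.sum_nonneg fun _ _ => sq_nonneg _)]
    exact hmaj x
  have i3 : Integrable fun x => (err x).re ^ 2 := by
    refine (integrable_sq_schwartz err).mono' (by fun_prop) (Eventually.of_forall fun x => ?_)
    rw [Real.norm_of_nonneg (sq_nonneg _)]; exact hre _
  have b1 : ∫ x, wr x ^ 2 ≤ ‖b‖⁻¹ ^ 4 * N₀ :=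
    (integral_mono i1 (integrable_sq_schwartz w) fun x => hre _).trans hw1
  refine ⟨W, N, hWs, rfl, ?_⟩
  rw [e1, e2, e3]
  refine ⟨i1, b1.trans ?_, i2, ?_, i3, ?_⟩
  · gcongr; linarith
  · refine (integral_mono i2 imaj hmaj).trans ?_
    rw [integral_add (i1.const_mul _) ((integrable_finsetSum _ fun i _ => i2' i).const_mul _),
      integral_const_mul, integral_const_mul, integral_finsetSum _ fun i _ => i2' i]
    have h2 : ∑ i, ∫ x, (schwartzPd i w x).re ^ 2 ≤ ‖b‖⁻¹ ^ 2 * N₀ :=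
      (Finset.sum_le_sum fun i _ => integral_mono (i2' i) (integrable_sq_schwartz _)
        fun x => hre _).trans hw2
    calc _ ≤ 2 * ‖b‖ ^ 2 * (‖b‖⁻¹ ^ 4 * N₀) + 2 * (‖b‖⁻¹ ^ 2 * N₀) := by gcongr
      _ = ‖b‖⁻¹ ^ 2 * (4 * N₀) := by field_simp; ring
      _ ≤ _ := by gcongr
  · refine ((integral_mono i3 (integrable_sq_schwartz err) fun x => hre _).trans hw3).trans ?_
    gcongr; linarith

end RealParametrix

section RadialCalculus

open Filter Topology RealInnerProductSpace

variable {n : ℕ}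

/-- The radial (Euler) derivative `x · ∇u`. -/
def radD (u : EuclideanSpace ℝ (Fin n) → ℝ) (x : EuclideanSpace ℝ (Fin n)) : ℝ :=
  ∑ i, x i * pd i u x

/-- `s` is a smooth function which coincides with `log ‖·‖` near each point of `K`. -/
structure IsLogOn (s : EuclideanSpace ℝ (Fin n) → ℝ) (K : Set (EuclideanSpace ℝ (Fin n))) :
    Prop where
  contDiff : ContDiff ℝ (⊤ : ℕ∞) s
  ne_zero : ∀ x ∈ K, x ≠ 0
  eventually_eq : ∀ x ∈ K, ∀ᶠ y in 𝓝 x, s y = Real.log ‖y‖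

theorem exists_isLogOn {K : Set (EuclideanSpace ℝ (Fin n))} (hK : IsClosed K) (h0 : 0 ∉ K) :
    ∃ s, IsLogOn s K := by
  obtain ⟨ε, hε, hεK⟩ := Metric.isOpen_iff.1 hK.isOpen_compl 0 h0
  let χ : ContDiffBump (0 : EuclideanSpace ℝ (Fin n)) := ⟨ε / 4, ε / 2, by positivity, by linarith⟩
  have hpos : ∀ x : EuclideanSpace ℝ (Fin n), 0 < ‖x‖ ^ 2 + χ x := fun x => by
    rcases eq_or_ne x 0 with rfl | hx
    · rw [χ.one_of_mem_closedBall (mem_closedBall_self (by positivity))]; positivity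
    · have := norm_pos_iff.2 hx; have := χ.nonneg (x := x); positivity
  refine ⟨fun x => (1 / 2) * Real.log (‖x‖ ^ 2 + χ x), ?_, ?_, ?_⟩
  · exact contDiff_const.mul (((contDiff_norm_sq ℝ).add χ.contDiff).log fun x => (hpos x).ne')
  · rintro x hx rfl; exact h0 hx
  · intro x hx
    have hxε : ε ≤ ‖x‖ := by
      by_contra! h
      exact hεK (by simpa using h) hx
    filter_upwards [(continuous_norm.tendsto x).eventually (lt_mem_nhds (by linarith : ε / 2 < ‖x‖))]
      with y hy
    rw [χ.zero_of_le_dist (by simpa using hy.le), add_zero, Real.log_pow]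
    push_cast; ring

variable {s u v : EuclideanSpace ℝ (Fin n) → ℝ} {K : Set (EuclideanSpace ℝ (Fin n))}
  {x : EuclideanSpace ℝ (Fin n)} {i : Fin n}

theorem IsLogOn.mono {K' : Set (EuclideanSpace ℝ (Fin n))} (h : IsLogOn s K) (hK : K' ⊆ K) :
    IsLogOn s K' :=
  ⟨h.contDiff, fun x hx => h.ne_zero x (hK hx), fun x hx => h.eventually_eq x (hK hx)⟩

theorem IsLogOn.eq (h : IsLogOn s K) (hx : x ∈ K) : s x = Real.log ‖x‖ :=
  (h.eventually_eq x hx).self_of_nhds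

theorem IsLogOn.exp_eq (h : IsLogOn s K) (hx : x ∈ K) : Real.exp (s x) = ‖x‖ := by
  rw [h.eq hx, Real.exp_log (norm_pos_iff.2 (h.ne_zero x hx))]

theorem pd_norm_sq : pd i (fun y => ‖y‖ ^ 2) x = 2 * x i := by
  unfold pd
  rw [fderiv_norm_sq_apply]
  simp [EuclideanSpace.inner_single_right]

theorem IsLogOn.pd (h : IsLogOn s K) (hx : x ∈ K) : pd i s x = x i / ‖x‖ ^ 2 := by
  have hx0 : ‖x‖ ^ 2 ≠ 0 := pow_ne_zero _ (norm_ne_zero_iff.2 (h.ne_zero x hx))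
  have e : s =ᶠ[𝓝 x] fun y => (1 / 2) * Real.log (‖y‖ ^ 2) := by
    filter_upwards [h.eventually_eq x hx] with y hy
    rw [hy, Real.log_pow]; push_cast; ring
  have hd : DifferentiableAt ℝ (fun y : EuclideanSpace ℝ (Fin n) => ‖y‖ ^ 2) x :=
    ((contDiff_norm_sq ℝ (n := 1)).differentiable (by simp)) x
  rw [pd_congr e, pd_const_mul _ (hd.log hx0), pd_comp (Real.hasDerivAt_log hx0) hd, pd_norm_sq]
  ring

theorem pd_eq_zero_of_notMem (hx : x ∉ tsupport v) : pd i v x = 0 := by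
  rw [pd_congr (notMem_tsupport_iff_eventuallyEq.1 hx)]
  exact pd_const 0

theorem lap_eq_zero_of_notMem (hx : x ∉ tsupport v) : lap v x = 0 :=
  Finset.sum_eq_zero fun _ _ => pd_eq_zero_of_notMem fun h => hx (tsupport_pd_subset h)

theorem radD_eq_zero_of_notMem (hx : x ∉ tsupport v) : radD v x = 0 :=
  Finset.sum_eq_zero fun _ _ => by rw [pd_eq_zero_of_notMem hx, mul_zero]

theorem contDiff_coord (i : Fin n) :
    ContDiff ℝ (⊤ : ℕ∞) fun y : EuclideanSpace ℝ (Fin n) => y i :=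
  (EuclideanSpace.proj (𝕜 := ℝ) i : EuclideanSpace ℝ (Fin n) →L[ℝ] ℝ).contDiff

theorem ContDiff.radD (hu : ContDiff ℝ (⊤ : ℕ∞) u) : ContDiff ℝ (⊤ : ℕ∞) (radD u) := by
  unfold _root_.radD
  exact ContDiff.sum fun i _ => (contDiff_coord i).mul hu.pd

theorem tsupport_radD_subset : tsupport (radD v) ⊆ tsupport v :=
  closure_minimal (fun x hx => by
    by_contra h
    exact hx (radD_eq_zero_of_notMem h)) (isClosed_tsupport v)

theorem radD_add (hu : DifferentiableAt ℝ u x) (hv : DifferentiableAt ℝ v x) :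
    radD (fun y => u y + v y) x = radD u x + radD v x := by
  simp only [radD, pd_add hu hv, mul_add, Finset.sum_add_distrib]

theorem radD_sub (hu : DifferentiableAt ℝ u x) (hv : DifferentiableAt ℝ v x) :
    radD (fun y => u y - v y) x = radD u x - radD v x := by
  simp only [radD, pd_sub hu hv, mul_sub, Finset.sum_sub_distrib]

theorem radD_mul (hu : DifferentiableAt ℝ u x) (hv : DifferentiableAt ℝ v x) :
    radD (fun y => u y * v y) x = u x * radD v x + v x * radD u x := by
  simp only [radD, pd_mul hu hv, Finset.mul_sum]
  rw [← Finset.sum_add_distrib]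
  exact Finset.sum_congr rfl fun i _ => by ring

theorem radD_const_mul (c : ℝ) (hu : DifferentiableAt ℝ u x) :
    radD (fun y => c * u y) x = c * radD u x := by
  simp only [radD, pd_const_mul c hu, Finset.mul_sum]
  exact Finset.sum_congr rfl fun i _ => by ring

theorem sum_coord_sq : ∑ i, x i * x i = ‖x‖ ^ 2 := by
  rw [EuclideanSpace.real_norm_sq_eq]
  exact Finset.sum_congr rfl fun i _ => by ring

theorem IsLogOn.pd_comp (h : IsLogOn s K) (hx : x ∈ K) {g g' : ℝ → ℝ}
    (hg : ∀ t, HasDerivAt g (g' t) t) : _root_.pd i (fun y => g (s y)) x = g' (s x) * (x i / ‖x‖ ^ 2) := by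
  rw [_root_.pd_comp (hg _) h.contDiff.diffAt, h.pd hx]

theorem IsLogOn.radD_comp (h : IsLogOn s K) (hx : x ∈ K) {g g' : ℝ → ℝ}
    (hg : ∀ t, HasDerivAt g (g' t) t) : _root_.radD (fun y => g (s y)) x = g' (s x) := by
  have hx0 : ‖x‖ ^ 2 ≠ 0 := pow_ne_zero _ (norm_ne_zero_iff.2 (h.ne_zero x hx))
  unfold _root_.radD
  simp only [h.pd_comp hx hg]
  calc ∑ i, x i * (g' (s x) * (x i / ‖x‖ ^ 2)) = g' (s x) / ‖x‖ ^ 2 * ∑ i, x i * x i := by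
        rw [Finset.mul_sum]; exact Finset.sum_congr rfl fun i _ => by ring
    _ = _ := by rw [sum_coord_sq, div_mul_cancel₀ _ hx0]

theorem pd_comm (hv : ContDiff ℝ (⊤ : ℕ∞) v) (i j : Fin n) (x : EuclideanSpace ℝ (Fin n)) :
    pd i (pd j v) x = pd j (pd i v) x := by
  have hd : DifferentiableAt ℝ (fderiv ℝ v) x :=
    ((hv.fderiv_right (m := (⊤ : ℕ∞)) (by simp)).differentiable (by simp)) x
  have key : ∀ i j : Fin n, pd i (pd j v) x =
      fderiv ℝ (fderiv ℝ v) x (EuclideanSpace.single i 1) (EuclideanSpace.single j 1) := by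
    intro i j
    unfold pd
    rw [fderiv_clm_apply hd (differentiableAt_const _)]
    simp
  rw [key, key]
  exact (hv.contDiffAt.isSymmSndFDerivAt
    (by rw [minSmoothness_of_isRCLikeNormedField]; exact WithTop.coe_le_coe.2 (le_top : (2 : ℕ∞) ≤ ⊤))).eq _ _

theorem pd_radD (hv : ContDiff ℝ (⊤ : ℕ∞) v) :
    pd i (radD v) x = pd i v x + ∑ j, x j * pd i (pd j v) x := by
  unfold radD
  rw [pd_sum fun j _ => ((contDiff_coord j).mul hv.pd).diffAt]
  have : ∀ j, pd i (fun y => y j * pd j v y) x =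
      x j * pd i (pd j v) x + (if j = i then pd j v x else 0) := fun j => by
    rw [pd_mul (contDiff_coord j).diffAt hv.pd.diffAt, pd_coord]
    by_cases hij : i = j
    · subst hij; simp
    · simp [hij, Ne.symm hij]
  rw [Finset.sum_congr rfl fun j _ => this j, Finset.sum_add_distrib]
  simp [add_comm]

/-- The field `r² ∇v - x (x · ∇ v)`, tangential to the spheres centred at the origin. -/
def tanGrad (i : Fin n) (v : EuclideanSpace ℝ (Fin n) → ℝ) (x : EuclideanSpace ℝ (Fin n)) : ℝ :=
  ‖x‖ ^ 2 * pd i v x - x i * radD v x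

/-- The spherical Laplacian of `v`. -/
def sphLap (v : EuclideanSpace ℝ (Fin n) → ℝ) (x : EuclideanSpace ℝ (Fin n)) : ℝ :=
  ‖x‖ ^ 2 * lap v x - radD (radD v) x - (n - 2) * radD v x

/-- The squared norm of the spherical gradient of `v`. -/
def sphGradSq (v : EuclideanSpace ℝ (Fin n) → ℝ) (x : EuclideanSpace ℝ (Fin n)) : ℝ :=
  ‖x‖ ^ 2 * gradSq v x - radD v x ^ 2

theorem ContDiff.tanGrad (hv : ContDiff ℝ (⊤ : ℕ∞) v) : ContDiff ℝ (⊤ : ℕ∞) (tanGrad i v) :=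
  ((contDiff_norm_sq ℝ).mul hv.pd).sub ((contDiff_coord i).mul hv.radD)

theorem ContDiff.sphLap (hv : ContDiff ℝ (⊤ : ℕ∞) v) : ContDiff ℝ (⊤ : ℕ∞) (sphLap v) :=
  (((contDiff_norm_sq ℝ).mul hv.lap).sub hv.radD.radD).sub (contDiff_const.mul hv.radD)

theorem ContDiff.sphGradSq (hv : ContDiff ℝ (⊤ : ℕ∞) v) : ContDiff ℝ (⊤ : ℕ∞) (sphGradSq v) :=
  ((contDiff_norm_sq ℝ).mul hv.gradSq).sub (hv.radD.pow 2)

theorem sum_coord_mul_tanGrad : ∑ i, x i * tanGrad i v x = 0 := by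
  have : ∀ i, x i * tanGrad i v x = ‖x‖ ^ 2 * (x i * pd i v x) - (x i * x i) * radD v x :=
    fun i => by unfold tanGrad; ring
  rw [Finset.sum_congr rfl fun i _ => this i, Finset.sum_sub_distrib, ← Finset.mul_sum,
    ← Finset.sum_mul, sum_coord_sq]
  unfold radD; ring

theorem sum_tanGrad_mul_pd : ∑ i, tanGrad i v x * pd i v x = sphGradSq v x := by
  have : ∀ i, tanGrad i v x * pd i v x = ‖x‖ ^ 2 * pd i v x ^ 2 - (x i * pd i v x) * radD v x :=
    fun i => by unfold tanGrad; ring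
  rw [Finset.sum_congr rfl fun i _ => this i, Finset.sum_sub_distrib, ← Finset.mul_sum,
    ← Finset.sum_mul, sphGradSq, gradSq, sq (radD v x)]
  rfl

theorem sum_pd_tanGrad (hv : ContDiff ℝ (⊤ : ℕ∞) v) : ∑ i, pd i (tanGrad i v) x = sphLap v x := by
  have hN : ContDiff ℝ (⊤ : ℕ∞) fun y : EuclideanSpace ℝ (Fin n) => ‖y‖ ^ 2 := contDiff_norm_sq ℝ
  have : ∀ i, pd i (tanGrad i v) x = ‖x‖ ^ 2 * pd i (pd i v) x + 2 * (x i * pd i v x) -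
      x i * pd i (radD v) x - radD v x := fun i => by
    unfold tanGrad
    rw [pd_sub (hN.mul hv.pd).diffAt ((contDiff_coord i).mul hv.radD).diffAt,
      pd_mul hN.diffAt hv.pd.diffAt, pd_mul (contDiff_coord i).diffAt hv.radD.diffAt, pd_norm_sq,
      pd_coord, if_pos rfl]
    ring
  rw [Finset.sum_congr rfl fun i _ => this i, Finset.sum_sub_distrib, Finset.sum_sub_distrib,
    Finset.sum_add_distrib, ← Finset.mul_sum, ← Finset.mul_sum, sphLap]
  simp only [Finset.sum_const, Finset.card_univ, Fintype.card_fin, nsmul_eq_mul]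
  unfold lap radD
  ring

theorem sum_tanGrad_mul_pd_radD (hv : ContDiff ℝ (⊤ : ℕ∞) v) :
    ∑ i, tanGrad i v x * pd i (radD v) x = (1 / 2) * radD (sphGradSq v) x := by
  have hN : ContDiff ℝ (⊤ : ℕ∞) fun y : EuclideanSpace ℝ (Fin n) => ‖y‖ ^ 2 := contDiff_norm_sq ℝ
  have h1 : ∀ i, tanGrad i v x * pd i (radD v) x =
      ‖x‖ ^ 2 * (pd i v x ^ 2 + pd i v x * ∑ j, x j * pd j (pd i v) x) -
        (x i * pd i (radD v) x) * radD v x := fun i => by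
    have : ∑ j, x j * pd j (pd i v) x = ∑ j, x j * pd i (pd j v) x :=
      Finset.sum_congr rfl fun j _ => by rw [pd_comm hv]
    rw [this]
    unfold tanGrad
    rw [sub_mul]
    nth_rewrite 1 [pd_radD hv]
    ring
  have h2 : radD (sphGradSq v) x = 2 * ‖x‖ ^ 2 * gradSq v x +
      2 * ‖x‖ ^ 2 * (∑ i, pd i v x * ∑ j, x j * pd j (pd i v) x) -
        2 * radD v x * radD (radD v) x := by
    have e : sphGradSq v = fun y => ‖y‖ ^ 2 * gradSq v y - radD v y * radD v y := by
      ext y; unfold sphGradSq; ring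
    have eN : radD (fun y : EuclideanSpace ℝ (Fin n) => ‖y‖ ^ 2) x = 2 * ‖x‖ ^ 2 := by
      unfold radD
      simp only [pd_norm_sq]
      rw [← sum_coord_sq, Finset.mul_sum]
      exact Finset.sum_congr rfl fun i _ => by ring
    have eg : radD (gradSq v) x = 2 * ∑ i, pd i v x * ∑ j, x j * pd j (pd i v) x := by
      unfold radD
      have : ∀ j, pd j (gradSq v) x = ∑ i, 2 * (pd i v x * pd j (pd i v) x) := fun j => by
        unfold gradSq
        rw [pd_sum fun i _ => (hv.pd.pow 2).diffAt]
        refine Finset.sum_congr rfl fun i _ => ?_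
        simp only [sq]
        rw [pd_mul hv.pd.diffAt hv.pd.diffAt]; ring
      simp only [this, Finset.mul_sum]
      rw [Finset.sum_comm]
      exact Finset.sum_congr rfl fun i _ => Finset.sum_congr rfl fun j _ => by ring
    rw [e, radD_sub (hN.mul hv.gradSq).diffAt (hv.radD.mul hv.radD).diffAt,
      radD_mul hN.diffAt hv.gradSq.diffAt, radD_mul hv.radD.diffAt hv.radD.diffAt, eN, eg]
    ring
  rw [Finset.sum_congr rfl fun i _ => h1 i, Finset.sum_sub_distrib, ← Finset.mul_sum,
    ← Finset.sum_mul, Finset.sum_add_distrib, h2]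
  change _ * (gradSq v x + _) - radD (radD v) x * _ = _
  ring

theorem HasCompactSupport.of_tsupport {g : EuclideanSpace ℝ (Fin n) → ℝ} (hv : HasCompactSupport v)
    (h : tsupport g ⊆ tsupport v) : HasCompactSupport g :=
  hv.of_isClosed_subset (isClosed_tsupport g) h

theorem tsupport_subset_of_eq_zero {g : EuclideanSpace ℝ (Fin n) → ℝ}
    (h : ∀ x, x ∉ tsupport v → g x = 0) : tsupport g ⊆ tsupport v :=
  closure_minimal (fun x hx => by by_contra h'; exact hx (h x h')) (isClosed_tsupport v)

theorem hasDerivAt_exp_neg_mul (c t : ℝ) :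
    HasDerivAt (fun t => Real.exp (-c * t)) (-c * Real.exp (-c * t)) t := by
  have := ((hasDerivAt_id t).const_mul (-c)).exp
  refine this.congr_deriv ?_
  simp; ring

theorem integral_radD_eq_zero (hs : IsLogOn s (tsupport v)) (hv : ContDiff ℝ (⊤ : ℕ∞) v)
    (hc : HasCompactSupport v) : ∫ x, Real.exp (-(n : ℝ) * s x) * radD v x = 0 := by
  have hρ : ContDiff ℝ (⊤ : ℕ∞) fun y => Real.exp (-(n : ℝ) * s y) :=
    (contDiff_const.mul hs.contDiff).exp
  have hF : ∀ i, ContDiff ℝ (⊤ : ℕ∞) fun y => (y i * Real.exp (-(n : ℝ) * s y)) * v y := fun i =>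
    ((contDiff_coord i).mul hρ).mul hv
  have hFc : ∀ i, HasCompactSupport fun y : EuclideanSpace ℝ (Fin n) =>
    (y i * Real.exp (-(n : ℝ) * s y)) * v y := fun i => hc.mul_left
  have e : ∀ x, Real.exp (-(n : ℝ) * s x) * radD v x =
      ∑ i, pd i (fun y => (y i * Real.exp (-(n : ℝ) * s y)) * v y) x := by
    intro x
    by_cases hx : x ∈ tsupport v
    · have hx0 : ‖x‖ ^ 2 ≠ 0 := pow_ne_zero _ (norm_ne_zero_iff.2 (hs.ne_zero x hx))
      have : ∀ i, pd i (fun y => (y i * Real.exp (-(n : ℝ) * s y)) * v y) x =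
          Real.exp (-(n : ℝ) * s x) * (x i * pd i v x) + v x * Real.exp (-(n : ℝ) * s x) *
            (1 - n / ‖x‖ ^ 2 * (x i * x i)) := fun i => by
        rw [pd_mul ((contDiff_coord i).mul hρ).diffAt hv.diffAt,
          pd_mul (contDiff_coord i).diffAt hρ.diffAt, pd_coord, if_pos rfl,
          hs.pd_comp hx (hasDerivAt_exp_neg_mul n)]
        ring
      rw [Finset.sum_congr rfl fun i _ => this i, Finset.sum_add_distrib, ← Finset.mul_sum,
        ← Finset.mul_sum, Finset.sum_sub_distrib, ← Finset.mul_sum, sum_coord_sq]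
      simp only [Finset.sum_const, Finset.card_univ, Fintype.card_fin, nsmul_eq_mul, mul_one]
      rw [div_mul_cancel₀ _ hx0, sub_self, mul_zero, add_zero]
      rfl
    · rw [radD_eq_zero_of_notMem hx, mul_zero]
      refine (Finset.sum_eq_zero fun i _ => ?_).symm
      refine pd_eq_zero_of_notMem fun h => hx (tsupport_mul_subset_right h)
  rw [integral_congr_ae (Eventually.of_forall e), integral_finsetSum]
  · exact Finset.sum_eq_zero fun i _ => integral_pd_eq_zero ((hF i).of_le (by simp)) (hFc i)
  · exact fun i _ => (hF i).pd.continuous.integrable_of_hasCompactSupport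
      ((hFc i).of_tsupport tsupport_pd_subset)

theorem integral_sphLap_mul_add_eq_zero {g : EuclideanSpace ℝ (Fin n) → ℝ}
    (hs : IsLogOn s (tsupport v)) (hv : ContDiff ℝ (⊤ : ℕ∞) v)
    (hc : HasCompactSupport v) (hg : ContDiff ℝ (⊤ : ℕ∞) g) :
    ∫ x, Real.exp (-(n : ℝ) * s x) * (sphLap v x * g x + ∑ i, tanGrad i v x * pd i g x) = 0 := by
  have hρ : ContDiff ℝ (⊤ : ℕ∞) fun y => Real.exp (-(n : ℝ) * s y) :=
    (contDiff_const.mul hs.contDiff).exp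
  have hF : ∀ i, ContDiff ℝ (⊤ : ℕ∞) fun y => Real.exp (-(n : ℝ) * s y) * (tanGrad i v y * g y) :=
    fun i => hρ.mul (hv.tanGrad.mul hg)
  have ht0 : ∀ i, ∀ x ∉ tsupport v, tanGrad i v x = 0 := fun i x hx => by
    rw [tanGrad, pd_eq_zero_of_notMem hx, radD_eq_zero_of_notMem hx]; ring
  have hFs : ∀ i, tsupport (fun y => Real.exp (-(n : ℝ) * s y) * (tanGrad i v y * g y)) ⊆
      tsupport v := fun i => tsupport_subset_of_eq_zero fun x hx => by rw [ht0 i x hx]; ring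
  have e : ∀ x, Real.exp (-(n : ℝ) * s x) * (sphLap v x * g x + ∑ i, tanGrad i v x * pd i g x) =
      ∑ i, pd i (fun y => Real.exp (-(n : ℝ) * s y) * (tanGrad i v y * g y)) x := by
    intro x
    by_cases hx : x ∈ tsupport v
    · have : ∀ i, pd i (fun y => Real.exp (-(n : ℝ) * s y) * (tanGrad i v y * g y)) x =
          Real.exp (-(n : ℝ) * s x) * (pd i (tanGrad i v) x * g x + tanGrad i v x * pd i g x) +
            (-(n : ℝ) * Real.exp (-(n : ℝ) * s x) / ‖x‖ ^ 2 * g x) * (x i * tanGrad i v x) :=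
          fun i => by
        rw [pd_mul hρ.diffAt (hv.tanGrad.mul hg).diffAt, pd_mul hv.tanGrad.diffAt hg.diffAt,
          hs.pd_comp hx (hasDerivAt_exp_neg_mul n)]
        ring
      rw [Finset.sum_congr rfl fun i _ => this i, Finset.sum_add_distrib, ← Finset.mul_sum,
        ← Finset.mul_sum, sum_coord_mul_tanGrad, Finset.sum_add_distrib, ← Finset.sum_mul,
        sum_pd_tanGrad hv, mul_zero, add_zero]
    · rw [Finset.sum_eq_zero fun i _ => pd_eq_zero_of_notMem fun h => hx (hFs i h),
        Finset.sum_eq_zero fun i _ => by rw [ht0 i x hx, zero_mul], ← sum_pd_tanGrad hv,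
        Finset.sum_eq_zero fun i _ => ?_]
      · ring
      · exact pd_eq_zero_of_notMem fun h => hx (tsupport_subset_of_eq_zero (ht0 i) h)
  rw [integral_congr_ae (Eventually.of_forall e), integral_finsetSum]
  · exact Finset.sum_eq_zero fun i _ => integral_pd_eq_zero ((hF i).of_le (by simp))
      (hc.of_tsupport (hFs i))
  · exact fun i _ => (hF i).pd.continuous.integrable_of_hasCompactSupport
      (hc.of_tsupport (tsupport_pd_subset.trans (hFs i)))

end RadialCalculus

section CarlemanIdentity

open Filter Topology RealInnerProductSpace

variable {n : ℕ} {s u v : EuclideanSpace ℝ (Fin n) → ℝ} {x : EuclideanSpace ℝ (Fin n)} {i : Fin n}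

theorem IsLogOn.eventually {K : Set (EuclideanSpace ℝ (Fin n))} (h : IsLogOn s K) (hx : x ∈ K) :
    ∀ᶠ y in 𝓝 x, IsLogOn s {y} := by
  filter_upwards [(h.eventually_eq x hx).eventually_nhds,
    isOpen_compl_singleton.mem_nhds (h.ne_zero x hx)] with y hy hy0
  exact ⟨h.contDiff, by rintro _ rfl; exact hy0, by rintro _ rfl; exact hy⟩

theorem IsLogOn.lap_comp {K : Set (EuclideanSpace ℝ (Fin n))} (h : IsLogOn s K) (hx : x ∈ K)
    {g g' g'' : ℝ → ℝ} (hg : ∀ t, HasDerivAt g (g' t) t) (hg' : ∀ t, HasDerivAt g' (g'' t) t)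
    (hgs : ContDiff ℝ (⊤ : ℕ∞) g') :
    ‖x‖ ^ 2 * _root_.lap (fun y => g (s y)) x = g'' (s x) + (n - 2) * g' (s x) := by
  have hx0 : ‖x‖ ^ 2 ≠ 0 := pow_ne_zero _ (norm_ne_zero_iff.2 (h.ne_zero x hx))
  have hE : ContDiff ℝ (⊤ : ℕ∞) fun y => Real.exp (-2 * s y) := (contDiff_const.mul h.contDiff).exp
  have hgc : ContDiff ℝ (⊤ : ℕ∞) fun y => g' (s y) := hgs.comp h.contDiff
  have hexp : ∀ y, IsLogOn s {y} → Real.exp (-2 * s y) = (‖y‖ ^ 2)⁻¹ := fun y hy => by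
    rw [← hy.exp_eq rfl, ← Real.exp_nat_mul, ← Real.exp_neg]; push_cast; ring_nf
  have hx' : IsLogOn s {x} := h.mono (by simpa using hx)
  have key : ∀ i, _root_.pd i (_root_.pd i fun y => g (s y)) x =
      (g'' (s x) / (‖x‖ ^ 2) ^ 2 - 2 * g' (s x) / (‖x‖ ^ 2) ^ 2) * (x i * x i) +
        g' (s x) * (1 / ‖x‖ ^ 2) := fun i => by
    have e : _root_.pd i (fun y => g (s y)) =ᶠ[𝓝 x]
        fun y => g' (s y) * (y i * Real.exp (-2 * s y)) := by
      filter_upwards [h.eventually hx] with y hy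
      rw [hy.pd_comp rfl hg, hexp y hy, div_eq_mul_inv]
    rw [pd_congr e, pd_mul hgc.diffAt ((contDiff_coord i).mul hE).diffAt,
      pd_mul (contDiff_coord i).diffAt hE.diffAt, pd_coord, if_pos rfl, h.pd_comp hx hg',
      h.pd_comp hx (hasDerivAt_exp_neg_mul 2), hexp x hx']
    field_simp
    ring
  unfold _root_.lap
  rw [Finset.sum_congr rfl fun i _ => key i, Finset.sum_add_distrib, ← Finset.mul_sum,
    sum_coord_sq]
  simp only [Finset.sum_const, Finset.card_univ, Fintype.card_fin, nsmul_eq_mul]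
  generalize ‖x‖ ^ 2 = a at hx0
  field_simp
  ring

/-- The symmetric part of the conjugated Laplacian, applied to `v`. -/
def symPart (c : ℝ) (P : EuclideanSpace ℝ (Fin n) → ℝ) (v : EuclideanSpace ℝ (Fin n) → ℝ)
    (x : EuclideanSpace ℝ (Fin n)) : ℝ :=
  sphLap v x + radD (radD v) x + (P x ^ 2 - c ^ 2) * v x

/-- The antisymmetric part of the conjugated Laplacian, applied to `v`. -/
def antiPart (P Q : EuclideanSpace ℝ (Fin n) → ℝ) (v : EuclideanSpace ℝ (Fin n) → ℝ)
    (x : EuclideanSpace ℝ (Fin n)) : ℝ :=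
  2 * P x * radD v x + Q x * v x

theorem sum_tanGrad_mul_pd_antiPart (hs : IsLogOn s (tsupport v)) (hv : ContDiff ℝ (⊤ : ℕ∞) v)
    (hx : x ∈ tsupport v) {k₁ k₂ k₃ : ℝ → ℝ} (h₁ : ∀ t, HasDerivAt k₁ (k₂ t) t)
    (h₂ : ∀ t, HasDerivAt k₂ (k₃ t) t) (hk₁ : ContDiff ℝ (⊤ : ℕ∞) k₁)
    (hk₂ : ContDiff ℝ (⊤ : ℕ∞) k₂) :
    ∑ i, tanGrad i v x * pd i (antiPart (fun y => k₁ (s y)) (fun y => k₂ (s y)) v) x =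
      k₁ (s x) * radD (sphGradSq v) x + k₂ (s x) * sphGradSq v x := by
  have hP : ContDiff ℝ (⊤ : ℕ∞) fun y => k₁ (s y) := hk₁.comp hs.contDiff
  have hQ : ContDiff ℝ (⊤ : ℕ∞) fun y => k₂ (s y) := hk₂.comp hs.contDiff
  have : ∀ i, tanGrad i v x * pd i (antiPart (fun y => k₁ (s y)) (fun y => k₂ (s y)) v) x =
      2 * k₁ (s x) * (tanGrad i v x * pd i (radD v) x) + k₂ (s x) * (tanGrad i v x * pd i v x) +
        ((2 * radD v x * k₂ (s x) + v x * k₃ (s x)) / ‖x‖ ^ 2) * (x i * tanGrad i v x) := fun i => by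
    unfold antiPart
    rw [pd_add ((contDiff_const.mul hP).mul hv.radD).diffAt (hQ.mul hv).diffAt,
      pd_mul (contDiff_const.mul hP).diffAt hv.radD.diffAt, pd_mul hQ.diffAt hv.diffAt,
      pd_const_mul _ hP.diffAt, hs.pd_comp hx h₁, hs.pd_comp hx h₂]
    ring
  rw [Finset.sum_congr rfl fun i _ => this i, Finset.sum_add_distrib, Finset.sum_add_distrib,
    ← Finset.mul_sum, ← Finset.mul_sum, ← Finset.mul_sum, sum_coord_mul_tanGrad,
    sum_tanGrad_mul_pd, sum_tanGrad_mul_pd_radD hv]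
  ring

theorem integral_symPart_mul_antiPart (hs : IsLogOn s (tsupport v)) (hv : ContDiff ℝ (⊤ : ℕ∞) v)
    (hc : HasCompactSupport v) (c : ℝ) {k₁ k₂ k₃ k₄ : ℝ → ℝ} (h₁ : ∀ t, HasDerivAt k₁ (k₂ t) t)
    (h₂ : ∀ t, HasDerivAt k₂ (k₃ t) t) (h₃ : ∀ t, HasDerivAt k₃ (k₄ t) t)
    (hk₁ : ContDiff ℝ (⊤ : ℕ∞) k₁) (hk₂ : ContDiff ℝ (⊤ : ℕ∞) k₂) (hk₃ : ContDiff ℝ (⊤ : ℕ∞) k₃)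
    (hk₄ : ContDiff ℝ (⊤ : ℕ∞) k₄) :
    ∫ x, Real.exp (-(n : ℝ) * s x) * (symPart c (fun y => k₁ (s y)) v x *
        antiPart (fun y => k₁ (s y)) (fun y => k₂ (s y)) v x) =
      ∫ x, Real.exp (-(n : ℝ) * s x) *
        (-2 * k₂ (s x) * (radD v x ^ 2 + k₁ (s x) ^ 2 * v x ^ 2) + (1 / 2) * k₄ (s x) * v x ^ 2) := by
  set ρ := fun y => Real.exp (-(n : ℝ) * s y) with hρdef
  have hρ : ContDiff ℝ (⊤ : ℕ∞) ρ := (contDiff_const.mul hs.contDiff).exp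
  have hP : ContDiff ℝ (⊤ : ℕ∞) fun y => k₁ (s y) := hk₁.comp hs.contDiff
  have hQ : ContDiff ℝ (⊤ : ℕ∞) fun y => k₂ (s y) := hk₂.comp hs.contDiff
  have hR : ContDiff ℝ (⊤ : ℕ∞) fun y => k₃ (s y) := hk₃.comp hs.contDiff
  have hT : ContDiff ℝ (⊤ : ℕ∞) fun y => k₄ (s y) := hk₄.comp hs.contDiff
  set A := antiPart (fun y => k₁ (s y)) (fun y => k₂ (s y)) v with hA
  have hAs : ContDiff ℝ (⊤ : ℕ∞) A :=
    ((contDiff_const.mul hP).mul hv.radD).add (hQ.mul hv)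
  set G : EuclideanSpace ℝ (Fin n) → ℝ := fun y => k₁ (s y) * (radD v y * radD v y) +
    k₂ (s y) * (v y * radD v y) - (1 / 2) * (k₃ (s y) * (v y * v y)) +
    (k₁ (s y) * k₁ (s y) * k₁ (s y) - c ^ 2 * k₁ (s y)) * (v y * v y) -
    k₁ (s y) * sphGradSq v y with hG
  have g1 := hP.mul (hv.radD.mul hv.radD)
  have g2 := hQ.mul (hv.mul hv.radD)
  have g3 : ContDiff ℝ (⊤ : ℕ∞) fun y => (1 / 2) * (k₃ (s y) * (v y * v y)) :=
    contDiff_const.mul (hR.mul (hv.mul hv))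
  have g4 := (((hP.mul hP).mul hP).sub (contDiff_const (c := c ^ 2).mul hP)).mul (hv.mul hv)
  have g5 := hP.mul hv.sphGradSq
  have hGs : ContDiff ℝ (⊤ : ℕ∞) G := (((g1.add g2).sub g3).add g4).sub g5
  have hq0 : ∀ x ∉ tsupport v, sphGradSq v x = 0 := fun x hx => by
    rw [sphGradSq, radD_eq_zero_of_notMem hx, gradSq,
      Finset.sum_eq_zero fun i _ => by rw [pd_eq_zero_of_notMem hx]; ring]
    ring
  have hG0 : tsupport G ⊆ tsupport v := tsupport_subset_of_eq_zero fun x hx => by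
    simp only [hG]
    rw [hq0 x hx, radD_eq_zero_of_notMem hx, image_eq_zero_of_notMem_tsupport hx]; ring
  have I1 := integral_sphLap_mul_add_eq_zero hs hv hc hAs
  have I2 := integral_radD_eq_zero (hs.mono hG0) hGs (hc.of_tsupport hG0)
  have key : ∀ x, ρ x * (symPart c (fun y => k₁ (s y)) v x * A x) =
      ρ x * (-2 * k₂ (s x) * (radD v x ^ 2 + k₁ (s x) ^ 2 * v x ^ 2) +
        (1 / 2) * k₄ (s x) * v x ^ 2) +
      (ρ x * (sphLap v x * A x + ∑ i, tanGrad i v x * pd i A x) + ρ x * radD G x) := by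
    intro x
    by_cases hx : x ∈ tsupport v
    · rw [hA, sum_tanGrad_mul_pd_antiPart hs hv hx h₁ h₂ hk₁ hk₂, hG,
        radD_sub (((g1.add g2).sub g3).add g4).diffAt g5.diffAt,
        radD_add ((g1.add g2).sub g3).diffAt g4.diffAt,
        radD_sub (g1.add g2).diffAt g3.diffAt, radD_add g1.diffAt g2.diffAt,
        radD_mul hP.diffAt (hv.radD.mul hv.radD).diffAt, radD_mul hv.radD.diffAt hv.radD.diffAt,
        radD_mul hQ.diffAt (hv.mul hv.radD).diffAt, radD_mul hv.diffAt hv.radD.diffAt,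
        radD_const_mul _ (hR.mul (hv.mul hv)).diffAt, radD_mul hR.diffAt (hv.mul hv).diffAt,
        radD_mul hv.diffAt hv.diffAt,
        radD_mul (((hP.mul hP).mul hP).sub (contDiff_const.mul hP)).diffAt (hv.mul hv).diffAt,
        radD_sub ((hP.mul hP).mul hP).diffAt (contDiff_const.mul hP).diffAt,
        radD_mul (hP.mul hP).diffAt hP.diffAt, radD_mul hP.diffAt hP.diffAt,
        radD_const_mul _ hP.diffAt, radD_mul hv.diffAt hv.diffAt,
        radD_mul hP.diffAt hv.sphGradSq.diffAt, hs.radD_comp hx h₁, hs.radD_comp hx h₂,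
        hs.radD_comp hx h₃]
      unfold symPart antiPart
      ring
    · have hA0 : A x = 0 := by
        rw [hA, antiPart, radD_eq_zero_of_notMem hx, image_eq_zero_of_notMem_tsupport hx]; ring
      rw [hA0, radD_eq_zero_of_notMem fun h => hx (hG0 h), radD_eq_zero_of_notMem hx,
        image_eq_zero_of_notMem_tsupport hx, Finset.sum_eq_zero fun i _ => ?_]
      · ring
      · rw [tanGrad, pd_eq_zero_of_notMem hx, radD_eq_zero_of_notMem hx]; ring
  have hint1 : Integrable fun x => ρ x * (-2 * k₂ (s x) * (radD v x ^ 2 + k₁ (s x) ^ 2 * v x ^ 2) +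
        (1 / 2) * k₄ (s x) * v x ^ 2) := by
    refine Continuous.integrable_of_hasCompactSupport ?_
      (hc.of_tsupport (tsupport_subset_of_eq_zero fun x hx => ?_))
    · exact (hρ.mul (((contDiff_const.mul hQ).mul ((hv.radD.pow 2).add
        ((hP.pow 2).mul (hv.pow 2)))).add ((contDiff_const.mul hT).mul (hv.pow 2)))).continuous
    · rw [radD_eq_zero_of_notMem hx, image_eq_zero_of_notMem_tsupport hx]; ring
  have hint2 : Integrable fun x => ρ x * (sphLap v x * A x + ∑ i, tanGrad i v x * pd i A x) := by
    refine Continuous.integrable_of_hasCompactSupport ?_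
      (hc.of_tsupport (tsupport_subset_of_eq_zero fun x hx => ?_))
    · exact (hρ.mul ((hv.sphLap.mul hAs).add
        (ContDiff.sum fun i _ => hv.tanGrad.mul hAs.pd))).continuous
    · rw [hA, antiPart, radD_eq_zero_of_notMem hx, image_eq_zero_of_notMem_tsupport hx,
        Finset.sum_eq_zero fun i _ => ?_]
      · ring
      · rw [tanGrad, pd_eq_zero_of_notMem hx, radD_eq_zero_of_notMem hx]; ring
  have hint3 : Integrable fun x => ρ x * radD G x :=
    (hρ.mul hGs.radD).continuous.integrable_of_hasCompactSupport
      ((hc.of_tsupport (tsupport_radD_subset.trans hG0)).mul_left)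
  have hint23 : Integrable fun x =>
      ρ x * (sphLap v x * A x + ∑ i, tanGrad i v x * pd i A x) + ρ x * radD G x := hint2.add hint3
  rw [integral_congr_ae (Eventually.of_forall key), integral_add hint1 hint23,
    integral_add hint2 hint3, I1, I2]
  ring

theorem conj_lap_eq (hs : IsLogOn s (tsupport u)) (hu : ContDiff ℝ (⊤ : ℕ∞) u)
    {k k₁ k₂ : ℝ → ℝ} (h₀ : ∀ t, HasDerivAt k (k₁ t) t) (h₁ : ∀ t, HasDerivAt k₁ (k₂ t) t)
    (hk : ContDiff ℝ (⊤ : ℕ∞) k) (hk₁ : ContDiff ℝ (⊤ : ℕ∞) k₁) (hx : x ∈ tsupport u) :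
    Real.exp (-k (s x)) * (‖x‖ ^ 2 * lap u x) =
      symPart ((n - 2) / 2) (fun y => k₁ (s y) + (n - 2) / 2) (fun y => Real.exp (-k (s y)) * u y) x +
      antiPart (fun y => k₁ (s y) + (n - 2) / 2) (fun y => k₂ (s y))
        (fun y => Real.exp (-k (s y)) * u y) x := by
  set v := fun y => Real.exp (-k (s y)) * u y with hv
  have hvs : ContDiff ℝ (⊤ : ℕ∞) v := (hk.comp hs.contDiff).neg.exp.mul hu
  have hx0 : ‖x‖ ^ 2 ≠ 0 := pow_ne_zero _ (norm_ne_zero_iff.2 (hs.ne_zero x hx))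
  have hw : ContDiff ℝ (⊤ : ℕ∞) fun y => Real.exp (k (s y)) := (hk.comp hs.contDiff).exp
  have hd : ∀ t, HasDerivAt (fun t => Real.exp (k t)) (Real.exp (k t) * k₁ t) t := fun t => (h₀ t).exp
  have hd' : ∀ t, HasDerivAt (fun t => Real.exp (k t) * k₁ t)
      (Real.exp (k t) * k₁ t * k₁ t + Real.exp (k t) * k₂ t) t := fun t => (hd t).mul (h₁ t)
  have hu' : u = fun y => Real.exp (k (s y)) * v y := by
    ext y
    simp only [hv, ← mul_assoc, ← Real.exp_add, add_neg_cancel, Real.exp_zero, one_mul]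
  have hcross : ‖x‖ ^ 2 * ∑ i, pd i (fun y => Real.exp (k (s y))) x * pd i v x =
      Real.exp (k (s x)) * k₁ (s x) * radD v x := by
    have : ∀ i, pd i (fun y => Real.exp (k (s y))) x * pd i v x =
        (Real.exp (k (s x)) * k₁ (s x) / ‖x‖ ^ 2) * (x i * pd i v x) := fun i => by
      rw [hs.pd_comp hx hd]; ring
    rw [Finset.sum_congr rfl fun i _ => this i, ← Finset.mul_sum, ← mul_assoc,
      mul_div_cancel₀ _ hx0]
    rfl
  have hlapw := hs.lap_comp hx hd hd' (hk.exp.mul hk₁)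
  have hL : ‖x‖ ^ 2 * lap u x = Real.exp (k (s x)) * (‖x‖ ^ 2 * lap v x +
      2 * (k₁ (s x) * radD v x) + v x * (k₁ (s x) * k₁ (s x) + k₂ (s x) + (n - 2) * k₁ (s x))) := by
    rw [congrArg (fun f => lap f x) hu', lap_mul hw hvs]
    linear_combination 2 * hcross + v x * hlapw
  rw [hL, ← mul_assoc, ← Real.exp_add, neg_add_cancel, Real.exp_zero, one_mul]
  unfold symPart antiPart sphLap
  ring

end CarlemanIdentity

section CarlemanL2

open Filter Topology RealInnerProductSpace

variable {n : ℕ} {s u v : EuclideanSpace ℝ (Fin n) → ℝ} {x : EuclideanSpace ℝ (Fin n)} {i : Fin n}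

/-- The measure `‖x‖⁻ⁿ dx`. -/
def radMeas (n : ℕ) : Measure (EuclideanSpace ℝ (Fin n)) :=
  volume.withDensity fun x => ENNReal.ofReal (‖x‖ ^ (-(n : ℝ)))

theorem lintegral_radMeas (f : EuclideanSpace ℝ (Fin n) → ℝ≥0∞) :
    ∫⁻ x, f x ∂radMeas n = ∫⁻ x, ENNReal.ofReal (‖x‖ ^ (-(n : ℝ))) * f x := by
  rw [radMeas, lintegral_withDensity_eq_lintegral_mul_non_measurable _
    (by fun_prop) (Eventually.of_forall fun _ => ENNReal.ofReal_lt_top)]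
  rfl

theorem eLpNorm_radMeas {p : ℝ} (hp : 0 < p) (g : EuclideanSpace ℝ (Fin n) → ℝ) :
    eLpNorm g (ENNReal.ofReal p) (radMeas n) =
      (∫⁻ x, ENNReal.ofReal (|g x| ^ p * ‖x‖ ^ (-(n : ℝ)))) ^ (1 / p) := by
  rw [eLpNorm_eq_lintegral_rpow_enorm_toReal (by simpa using hp) ENNReal.ofReal_ne_top,
    ENNReal.toReal_ofReal hp.le, lintegral_radMeas]
  congr 1
  refine lintegral_congr fun x => ?_
  rw [mul_comm, ENNReal.ofReal_mul (by positivity), ← ENNReal.ofReal_rpow_of_nonneg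
    (abs_nonneg _) hp.le, Real.enorm_eq_ofReal_abs]

theorem eLpNorm_two_radMeas (g : EuclideanSpace ℝ (Fin n) → ℝ) :
    eLpNorm g 2 (radMeas n) =
      (∫⁻ x, ENNReal.ofReal (‖x‖ ^ (-(n : ℝ)) * g x ^ 2)) ^ (1 / 2 : ℝ) := by
  have := eLpNorm_radMeas (n := n) two_pos g
  rw [show ENNReal.ofReal (2 : ℝ) = 2 by simp] at this
  rw [this]
  congr 1
  refine lintegral_congr fun x => ?_
  rw [mul_comm, Real.rpow_two, sq_abs]

/-- The Carleman weight `exp (-τ φ(‖x‖))`. -/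
def carWt (τ : ℝ) (x : EuclideanSpace ℝ (Fin n)) : ℝ := Real.exp (-τ * phiC ‖x‖)

theorem carWt_pos (τ : ℝ) (x : EuclideanSpace ℝ (Fin n)) : 0 < carWt τ x := Real.exp_pos _

theorem exists_smooth_weight : ∃ k k₁ k₂ k₃ k₄ : ℝ → ℝ,
    ContDiff ℝ (⊤ : ℕ∞) k ∧ ContDiff ℝ (⊤ : ℕ∞) k₁ ∧ ContDiff ℝ (⊤ : ℕ∞) k₂ ∧
    ContDiff ℝ (⊤ : ℕ∞) k₃ ∧ ContDiff ℝ (⊤ : ℕ∞) k₄ ∧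
    (∀ t, HasDerivAt k (k₁ t) t) ∧ (∀ t, HasDerivAt k₁ (k₂ t) t) ∧
    (∀ t, HasDerivAt k₂ (k₃ t) t) ∧ (∀ t, HasDerivAt k₃ (k₄ t) t) ∧
    ∀ t < -1, k t = t + Real.log (t ^ 2) ∧ k₁ t = 1 + 2 / t ∧ k₂ t = -2 / t ^ 2 ∧
      k₃ t = 4 / t ^ 3 ∧ k₄ t = -12 / t ^ 4 := by
  let χ : ContDiffBump (0 : ℝ) := ⟨1 / 2, 1, by norm_num, by norm_num⟩
  have hpos : ∀ t : ℝ, 0 < t ^ 2 + χ t := fun t => by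
    rcases eq_or_ne t 0 with rfl | h
    · have : χ (0 : ℝ) = 1 := χ.one_of_mem_closedBall (by simp [χ])
      rw [this]; norm_num
    · have := χ.nonneg (x := t); positivity
  have hk : ContDiff ℝ (⊤ : ℕ∞) fun t : ℝ => t + Real.log (t ^ 2 + χ t) :=
    contDiff_id.add (((contDiff_id.pow 2).add χ.contDiff).log fun t => (hpos t).ne')
  have hd : ∀ {f : ℝ → ℝ}, ContDiff ℝ (⊤ : ℕ∞) f → ContDiff ℝ (⊤ : ℕ∞) (deriv f) := fun {f} hf =>
    (contDiff_infty_iff_deriv.1 hf).2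
  have hh : ∀ {f : ℝ → ℝ}, ContDiff ℝ (⊤ : ℕ∞) f → ∀ t, HasDerivAt f (deriv f t) t :=
    fun {f} hf t => ((contDiff_infty_iff_deriv.1 hf).1 t).hasDerivAt
  have step : ∀ {f g g' : ℝ → ℝ}, (∀ t < (-1 : ℝ), f t = g t) → (∀ t < -1, HasDerivAt g (g' t) t) →
      ∀ t < -1, deriv f t = g' t := fun {f g g'} hfg hg t ht => by
    have : f =ᶠ[𝓝 t] g := by filter_upwards [Iio_mem_nhds ht] with y hy using hfg y hy
    rw [this.deriv_eq, (hg t ht).deriv]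
  have e0 : ∀ t < (-1 : ℝ), t + Real.log (t ^ 2 + χ t) = t + Real.log (t ^ 2) := fun t ht => by
    rw [χ.zero_of_le_dist (by
      have : |t| = -t := abs_of_neg (by linarith)
      simp only [Real.dist_eq, sub_zero, this, χ]; linarith), add_zero]
  have e1 := step (g' := fun t => 1 + 2 / t) e0 fun t ht => by
    have ht0 : t ≠ 0 := by linarith
    refine ((hasDerivAt_id t).add ((hasDerivAt_pow 2 t).log (pow_ne_zero 2 ht0))).congr_deriv ?_
    field_simp; norm_num; try ring
  have e2 := step (g' := fun t => -2 / t ^ 2) e1 fun t ht => by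
    have ht0 : t ≠ 0 := by linarith
    refine (((hasDerivAt_const t (2 : ℝ)).div (hasDerivAt_id t) ht0).const_add 1).congr_deriv ?_
    simp
  have e3 := step (g' := fun t => 4 / t ^ 3) e2 fun t ht => by
    have ht0 : t ≠ 0 := by linarith
    refine ((hasDerivAt_const t (-2 : ℝ)).div (hasDerivAt_pow 2 t) (pow_ne_zero 2 ht0)).congr_deriv ?_
    field_simp; norm_num; try ring
  have e4 := step (g' := fun t => -12 / t ^ 4) e3 fun t ht => by
    have ht0 : t ≠ 0 := by linarith
    refine ((hasDerivAt_const t (4 : ℝ)).div (hasDerivAt_pow 3 t) (pow_ne_zero 3 ht0)).congr_deriv ?_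
    field_simp; norm_num; try ring
  exact ⟨_, _, _, _, _, hk, hd hk, hd (hd hk), hd (hd (hd hk)), hd (hd (hd (hd hk))), hh hk,
    hh (hd hk), hh (hd (hd hk)), hh (hd (hd (hd hk))),
    fun t ht => ⟨e0 t ht, e1 t ht, e2 t ht, e3 t ht, e4 t ht⟩⟩

set_option maxHeartbeats 1000000 in
/-- The `L²` Carleman inequality, in the form of lower integrals. -/
theorem carleman_lintegral (hn : 3 ≤ n) (hu : ContDiff ℝ (⊤ : ℕ∞) u) (hc : HasCompactSupport u)
    (hsupp : tsupport u ⊆ ball 0 (Real.exp (-10)) \ {0}) {τ : ℝ} (hτ : 1 < τ) :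
    ENNReal.ofReal (τ ^ 3) *
      ∫⁻ x, ENNReal.ofReal (‖x‖ ^ (-(n : ℝ)) * ((Real.log ‖x‖)⁻¹ * (carWt τ x * u x)) ^ 2) ≤
      ∫⁻ x, ENNReal.ofReal (‖x‖ ^ (-(n : ℝ)) * (carWt τ x * (‖x‖ ^ 2 * lap u x)) ^ 2) := by
  obtain ⟨s, hs⟩ := exists_isLogOn (isClosed_tsupport u) fun h => (hsupp h).2 rfl
  obtain ⟨Φ, Φ₁, Φ₂, Φ₃, Φ₄, hΦ, hΦ₁, hΦ₂, hΦ₃, hΦ₄, h₀, h₁, h₂, h₃, hval⟩ := exists_smooth_weight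
  set k := fun t => τ * Φ t
  set k₁ := fun t => τ * Φ₁ t
  set k₂ := fun t => τ * Φ₂ t
  set k₃ := fun t => τ * Φ₃ t
  set k₄ := fun t => τ * Φ₄ t
  set c : ℝ := (n - 2) / 2
  have hc0 : 0 ≤ c := by
    have : (3 : ℝ) ≤ n := by exact_mod_cast hn
    simp only [c]; linarith
  set v := fun y => Real.exp (-k (s y)) * u y with hv
  have hk : ContDiff ℝ (⊤ : ℕ∞) k := contDiff_const.mul hΦ
  have hk₁ : ContDiff ℝ (⊤ : ℕ∞) k₁ := contDiff_const.mul hΦ₁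
  have hk₂ : ContDiff ℝ (⊤ : ℕ∞) k₂ := contDiff_const.mul hΦ₂
  have hk₃ : ContDiff ℝ (⊤ : ℕ∞) k₃ := contDiff_const.mul hΦ₃
  have hk₄ : ContDiff ℝ (⊤ : ℕ∞) k₄ := contDiff_const.mul hΦ₄
  have d₀ : ∀ t, HasDerivAt k (k₁ t) t := fun t => (h₀ t).const_mul τ
  have d₁ : ∀ t, HasDerivAt k₁ (k₂ t) t := fun t => (h₁ t).const_mul τ
  have d₂ : ∀ t, HasDerivAt k₂ (k₃ t) t := fun t => (h₂ t).const_mul τ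
  have d₃ : ∀ t, HasDerivAt k₃ (k₄ t) t := fun t => (h₃ t).const_mul τ
  have hvs : ContDiff ℝ (⊤ : ℕ∞) v := (hk.comp hs.contDiff).neg.exp.mul hu
  have hvsupp : tsupport v ⊆ tsupport u := tsupport_subset_of_eq_zero fun x hx => by
    simp only [hv, image_eq_zero_of_notMem_tsupport hx, mul_zero]
  have hvc : HasCompactSupport v := hc.of_tsupport hvsupp
  have hP : ContDiff ℝ (⊤ : ℕ∞) fun y => k₁ (s y) + c := (hk₁.comp hs.contDiff).add contDiff_const
  have hQ : ContDiff ℝ (⊤ : ℕ∞) fun y => k₂ (s y) := hk₂.comp hs.contDiff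
  have hT : ContDiff ℝ (⊤ : ℕ∞) fun y => k₄ (s y) := hk₄.comp hs.contDiff
  have hρ : ContDiff ℝ (⊤ : ℕ∞) fun y => Real.exp (-(n : ℝ) * s y) :=
    (contDiff_const.mul hs.contDiff).exp
  set S := symPart c (fun y => k₁ (s y) + c) v with hS
  set A := antiPart (fun y => k₁ (s y) + c) (fun y => k₂ (s y)) v with hA
  have hSs : ContDiff ℝ (⊤ : ℕ∞) S :=
    (hvs.sphLap.add hvs.radD.radD).add (((hP.pow 2).sub contDiff_const).mul hvs)
  have hAs : ContDiff ℝ (⊤ : ℕ∞) A := ((contDiff_const.mul hP).mul hvs.radD).add (hQ.mul hvs)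
  have hA0 : ∀ x ∉ tsupport u, A x = 0 := fun x hx => by
    have hx' : x ∉ tsupport v := fun h => hx (hvsupp h)
    rw [hA, antiPart, radD_eq_zero_of_notMem hx', image_eq_zero_of_notMem_tsupport hx']; ring
  have hS0 : ∀ x ∉ tsupport u, S x = 0 := fun x hx => by
    have hx' : x ∉ tsupport v := fun h => hx (hvsupp h)
    have hx'' : x ∉ tsupport (radD v) := fun h => hx' (tsupport_radD_subset h)
    rw [hS, symPart, sphLap, radD_eq_zero_of_notMem hx', radD_eq_zero_of_notMem hx'',
      lap_eq_zero_of_notMem hx', image_eq_zero_of_notMem_tsupport hx']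
    ring
  set F := fun x => Real.exp (-(n : ℝ) * s x) *
    (-2 * k₂ (s x) * (radD v x ^ 2 + (k₁ (s x) + c) ^ 2 * v x ^ 2) + (1 / 2) * k₄ (s x) * v x ^ 2)
    with hF
  have hIF : ∫ x, Real.exp (-(n : ℝ) * s x) * (S x * A x) = ∫ x, F x :=
    integral_symPart_mul_antiPart (hs.mono hvsupp) hvs hvc c
      (k₁ := fun t => k₁ t + c) (fun t => (d₁ t).add_const c) d₂ d₃ (hk₁.add contDiff_const) hk₂ hk₃ hk₄
  have hFint : Integrable F := by
    refine Continuous.integrable_of_hasCompactSupport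
      (hρ.mul (((contDiff_const.mul hQ).mul ((hvs.radD.pow 2).add
        ((hP.pow 2).mul (hvs.pow 2)))).add ((contDiff_const.mul hT).mul (hvs.pow 2)))).continuous
      (hc.of_tsupport (tsupport_subset_of_eq_zero fun x hx => ?_))
    have hx' : x ∉ tsupport v := fun h => hx (hvsupp h)
    rw [hF]
    simp only [radD_eq_zero_of_notMem hx', image_eq_zero_of_notMem_tsupport hx']
    ring
  have hSA : Integrable fun x => Real.exp (-(n : ℝ) * s x) * (S x * A x) :=
    (hρ.mul (hSs.mul hAs)).continuous.integrable_of_hasCompactSupport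
      (hc.of_tsupport (tsupport_subset_of_eq_zero fun x hx => by rw [hA0 x hx]; ring))
  have hL2 : Integrable fun x => Real.exp (-(n : ℝ) * s x) * (S x + A x) ^ 2 :=
    (hρ.mul ((hSs.add hAs).pow 2)).continuous.integrable_of_hasCompactSupport
      (hc.of_tsupport (tsupport_subset_of_eq_zero fun x hx => by rw [hA0 x hx, hS0 x hx]; ring))
  have hmem : ∀ x ∈ tsupport u, s x = Real.log ‖x‖ ∧ Real.log ‖x‖ < -10 ∧
      Real.exp (-(n : ℝ) * s x) = ‖x‖ ^ (-(n : ℝ)) ∧ carWt τ x = Real.exp (-k (s x)) := fun x hx => by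
    have hx0 : 0 < ‖x‖ := norm_pos_iff.2 (hs.ne_zero x hx)
    have hlog : Real.log ‖x‖ < -10 := by
      rw [Real.log_lt_iff_lt_exp hx0]; simpa using (hsupp hx).1
    refine ⟨hs.eq hx, hlog, ?_, ?_⟩
    · rw [hs.eq hx, Real.rpow_def_of_pos hx0, mul_comm]
    · rw [hs.eq hx, carWt, phiC]
      simp only [k]
      rw [(hval _ (by linarith)).1, neg_mul]
  have hτ0 : 0 < τ := by linarith
  have hlow : ∀ x, τ ^ 3 * (‖x‖ ^ (-(n : ℝ)) * ((Real.log ‖x‖)⁻¹ * (carWt τ x * u x)) ^ 2) ≤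
      2 * F x := fun x => by
    by_cases hx : x ∈ tsupport u
    · obtain ⟨hsx, hlog, hρx, hwx⟩ := hmem x hx
      obtain ⟨-, v1, v2, -, v4⟩ := hval (Real.log ‖x‖) (by linarith)
      have hvx : carWt τ x * u x = v x := by rw [hwx]
      have hρ0 : 0 < ‖x‖ ^ (-(n : ℝ)) := by rw [← hρx]; exact Real.exp_pos _
      set t := Real.log ‖x‖ with ht
      have ht0 : t ≠ 0 := by linarith
      have hFx : F x = ‖x‖ ^ (-(n : ℝ)) * (4 * τ * (t⁻¹ ^ 2 * radD v x ^ 2 +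
          (τ * (1 + 2 * t⁻¹) + c) ^ 2 * (t⁻¹ * v x) ^ 2) - 6 * τ * t⁻¹ ^ 2 * (t⁻¹ * v x) ^ 2) := by
        have hρt := hρx
        rw [hsx] at hρt
        simp only [hF, k₂, k₁, k₄, hsx, v1, v2, v4, hρt]
        simp only [div_eq_mul_inv, ← inv_pow]
        ring
      have hi : t⁻¹ < 0 := by rw [inv_lt_zero]; linarith
      have hi2 : -(1 / 10) < t⁻¹ := by
        rw [show (-(1 / 10) : ℝ) = (-10)⁻¹ by norm_num]
        exact (inv_lt_inv_of_neg (by norm_num) (by linarith)).2 hlog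
      have hP' : τ / 2 ≤ τ * (1 + 2 * t⁻¹) + c := by nlinarith
      have hP2 : τ ^ 2 / 4 ≤ (τ * (1 + 2 * t⁻¹) + c) ^ 2 := by
        calc τ ^ 2 / 4 = (τ / 2) ^ 2 := by ring
          _ ≤ _ := by gcongr
      have hi4 : t⁻¹ ^ 2 ≤ 1 / 100 := by nlinarith
      have hτ2 : 1 ≤ τ ^ 2 := by nlinarith
      rw [hFx, hvx, mul_left_comm, mul_left_comm 2]
      refine mul_le_mul_of_nonneg_left ?_ hρ0.le
      have h1 : τ ^ 2 / 4 * (t⁻¹ * v x) ^ 2 ≤ (τ * (1 + 2 * t⁻¹) + c) ^ 2 * (t⁻¹ * v x) ^ 2 := by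
        gcongr
      have h2 : t⁻¹ ^ 2 * (t⁻¹ * v x) ^ 2 ≤ τ ^ 2 / 100 * (t⁻¹ * v x) ^ 2 := by
        gcongr; linarith
      have h3 : 0 ≤ t⁻¹ ^ 2 * radD v x ^ 2 := by positivity
      have h4 : 0 ≤ τ ^ 3 * (t⁻¹ * v x) ^ 2 := by positivity
      have h1' := mul_le_mul_of_nonneg_left h1 hτ0.le
      have h2' := mul_le_mul_of_nonneg_left h2 hτ0.le
      have h3' := mul_nonneg hτ0.le h3
      generalize (τ * (1 + 2 * t⁻¹) + c) ^ 2 * (t⁻¹ * v x) ^ 2 = X at h1' ⊢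
      rw [mul_assoc (6 * τ)]
      generalize t⁻¹ ^ 2 * (t⁻¹ * v x) ^ 2 = Y at h2' ⊢
      generalize t⁻¹ ^ 2 * radD v x ^ 2 = Z at h3' ⊢
      generalize (t⁻¹ * v x) ^ 2 = W at h1' h2' h4 ⊢
      linarith
    · have hx' : x ∉ tsupport v := fun h => hx (hvsupp h)
      simp only [hF, radD_eq_zero_of_notMem hx', image_eq_zero_of_notMem_tsupport hx',
        image_eq_zero_of_notMem_tsupport hx]
      simp
  have hup : ∀ x, Real.exp (-(n : ℝ) * s x) * (S x + A x) ^ 2 =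
      ‖x‖ ^ (-(n : ℝ)) * (carWt τ x * (‖x‖ ^ 2 * lap u x)) ^ 2 := fun x => by
    by_cases hx : x ∈ tsupport u
    · obtain ⟨-, -, hρx, hwx⟩ := hmem x hx
      rw [hρx, hwx, conj_lap_eq hs hu d₀ d₁ hk hk₁ hx]
    · rw [hA0 x hx, hS0 x hx, lap_eq_zero_of_notMem hx]; ring
  have h2F : 0 ≤ᵐ[volume] fun x => 2 * F x := Eventually.of_forall fun x =>
    le_trans (by positivity) (hlow x)
  calc ENNReal.ofReal (τ ^ 3) *
      ∫⁻ x, ENNReal.ofReal (‖x‖ ^ (-(n : ℝ)) * ((Real.log ‖x‖)⁻¹ * (carWt τ x * u x)) ^ 2)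
      = ∫⁻ x, ENNReal.ofReal (τ ^ 3 *
          (‖x‖ ^ (-(n : ℝ)) * ((Real.log ‖x‖)⁻¹ * (carWt τ x * u x)) ^ 2)) := by
        rw [← lintegral_const_mul' _ _ ENNReal.ofReal_ne_top]
        exact lintegral_congr fun x => (ENNReal.ofReal_mul (by positivity)).symm
    _ ≤ ∫⁻ x, ENNReal.ofReal (2 * F x) :=
        lintegral_mono fun x => ENNReal.ofReal_le_ofReal (hlow x)
    _ = ENNReal.ofReal (∫ x, 2 * F x) :=
        (ofReal_integral_eq_lintegral_ofReal (hFint.const_mul 2) h2F).symm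
    _ ≤ ENNReal.ofReal (∫ x, Real.exp (-(n : ℝ) * s x) * (S x + A x) ^ 2) := by
        refine ENNReal.ofReal_le_ofReal ?_
        rw [integral_const_mul, ← hIF, ← integral_const_mul]
        refine integral_mono (hSA.const_mul 2) hL2 fun x => ?_
        have := mul_nonneg (Real.exp_pos (-(n : ℝ) * s x)).le
          (add_nonneg (sq_nonneg (S x)) (sq_nonneg (A x)))
        simp only
        nlinarith
    _ = ∫⁻ x, ENNReal.ofReal (Real.exp (-(n : ℝ) * s x) * (S x + A x) ^ 2) :=
        ofReal_integral_eq_lintegral_ofReal hL2 (Eventually.of_forall fun x => by positivity)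
    _ = _ := lintegral_congr fun x => by rw [hup x]

/-- The `L²` Carleman inequality for the Laplacian. -/
theorem carleman_eLpNorm (hn : 3 ≤ n) (hu : ContDiff ℝ (⊤ : ℕ∞) u) (hc : HasCompactSupport u)
    (hsupp : tsupport u ⊆ ball 0 (Real.exp (-10)) \ {0}) {τ : ℝ} (hτ : 1 < τ) :
    ENNReal.ofReal (τ ^ (3 / 2 : ℝ)) *
      eLpNorm (fun x => (Real.log ‖x‖)⁻¹ * (carWt τ x * u x)) 2 (radMeas n) ≤
      eLpNorm (fun x => carWt τ x * (‖x‖ ^ 2 * lap u x)) 2 (radMeas n) := by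
  have hτ0 : 0 < τ := by linarith
  rw [eLpNorm_two_radMeas, eLpNorm_two_radMeas, show τ ^ (3 / 2 : ℝ) = (τ ^ 3) ^ (1 / 2 : ℝ) by
    rw [← Real.rpow_natCast, ← Real.rpow_mul hτ0.le]; norm_num,
    ← ENNReal.ofReal_rpow_of_nonneg (by positivity) (by norm_num),
    ← ENNReal.mul_rpow_of_nonneg _ _ (by norm_num)]
  exact ENNReal.rpow_le_rpow (carleman_lintegral hn hu hc hsupp hτ) (by norm_num)

end CarlemanL2

section WeightComparison

open Filter Topology RealInnerProductSpace

variable {n : ℕ} {x y : EuclideanSpace ℝ (Fin n)}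

theorem abs_log_one_add_sub_le {z : ℝ} (hz : |z| ≤ 1 / 2) : |Real.log (1 + z) - z| ≤ 2 * z ^ 2 := by
  obtain ⟨h1, h2⟩ := abs_le.1 hz
  have hpos : 0 < 1 + z := by linarith
  have hu := Real.log_le_sub_one_of_pos hpos
  have hl := Real.one_sub_inv_le_log_of_pos hpos
  have : 1 - (1 + z)⁻¹ - z = -(z ^ 2 * (1 + z)⁻¹) := by field_simp; ring
  have hi : (1 + z)⁻¹ ≤ 2 := by
    rw [inv_le_comm₀ hpos two_pos]; linarith
  rw [abs_le]
  constructor <;> nlinarith [mul_le_mul_of_nonneg_left hi (sq_nonneg z), sq_nonneg z]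

set_option maxHeartbeats 800000 in
theorem abs_phiC_sub_le (hx : x ≠ 0) (hlog : Real.log ‖x‖ ≤ -11) {d : ℝ} (hd : d ≤ 1 / 5)
    (hy : ‖y - x‖ ≤ d * ‖x‖) :
    |phiC ‖y‖ - phiC ‖x‖ - (1 + 2 / Real.log ‖x‖) * (⟪x, y - x⟫ / ‖x‖ ^ 2)| ≤ 20 * d ^ 2 := by
  have hx0 : 0 < ‖x‖ := norm_pos_iff.2 hx
  have hd0 : 0 ≤ d := nonneg_of_mul_nonneg_left ((norm_nonneg _).trans hy) hx0
  set t := Real.log ‖x‖ with ht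
  have ht0 : t ≠ 0 := by linarith
  set z := ⟪x, y - x⟫ / ‖x‖ ^ 2 with hz
  set e := ‖y - x‖ / ‖x‖ with he
  have he0 : 0 ≤ e := by positivity
  have hed : e ≤ d := (div_le_iff₀ hx0).2 hy
  have hzd : |z| ≤ d := by
    rw [hz, abs_div, abs_of_pos (by positivity : 0 < ‖x‖ ^ 2), div_le_iff₀ (by positivity)]
    calc |⟪x, y - x⟫| ≤ ‖x‖ * ‖y - x‖ := abs_real_inner_le_norm _ _
      _ ≤ ‖x‖ * (d * ‖x‖) := by gcongr
      _ = d * ‖x‖ ^ 2 := by ring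
  obtain ⟨hz1, hz2⟩ := abs_le.1 hzd
  set a := 2 * z + e ^ 2 with ha
  have hnorm : ‖y‖ ^ 2 = ‖x‖ ^ 2 * (1 + a) := by
    have := norm_add_sq_real x (y - x)
    rw [add_sub_cancel] at this
    rw [this, ha, hz, he]
    field_simp
    ring
  have he2 : e ^ 2 ≤ d ^ 2 := by gcongr
  have ha1 : |a| ≤ 2.2 * d := by
    rw [abs_le]; constructor <;> nlinarith
  have ha2 : a ^ 2 ≤ 4.84 * d ^ 2 := by
    rw [← sq_abs]; nlinarith [abs_nonneg a]
  have ha3 : |a| ≤ 1 / 2 := by linarith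
  have hapos : 0 < 1 + a := by linarith [(abs_le.1 ha3).1]
  obtain ⟨hl1, hl2⟩ := abs_le.1 (abs_log_one_add_sub_le ha3)
  set h := Real.log (1 + a) / 2 with hh
  have hty : Real.log ‖y‖ = t + h := by
    have h1 := congrArg Real.log hnorm
    rw [Real.log_mul (by positivity) hapos.ne', Real.log_pow, Real.log_pow] at h1
    push_cast at h1
    rw [hh, ht]; linarith
  have hhz : |h - z| ≤ 5.5 * d ^ 2 := by
    rw [abs_le, hh]; constructor <;> linarith [sq_nonneg e]
  obtain ⟨hhz1, hhz2⟩ := abs_le.1 hhz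
  have hdd : d ^ 2 ≤ d / 5 := by nlinarith
  have hhd : |h| ≤ 2.1 * d := by
    rw [abs_le]; constructor <;> linarith
  set i := t⁻¹ with hi
  have hi0 : i < 0 := by rw [hi, inv_lt_zero]; linarith
  have hi1 : -(1 / 11) ≤ i := by
    rw [hi, show (-(1 / 11) : ℝ) = (-11)⁻¹ by norm_num]
    exact (inv_le_inv_of_neg (by norm_num) (by linarith)).2 hlog
  have hki : |h * i| ≤ 0.2 * d := by
    rw [abs_mul, abs_of_neg hi0]
    nlinarith [abs_nonneg h]
  have hk2 : (h * i) ^ 2 ≤ 0.04 * d ^ 2 := by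
    rw [← sq_abs]; nlinarith [abs_nonneg (h * i)]
  have hk3 : |h * i| ≤ 1 / 2 := by linarith
  have hkpos : 0 < 1 + h * i := by linarith [(abs_le.1 hk3).1]
  obtain ⟨hm1, hm2⟩ := abs_le.1 (abs_log_one_add_sub_le hk3)
  have hphi : phiC ‖y‖ - phiC ‖x‖ = h + 2 * Real.log (1 + h * i) := by
    rw [phiC, phiC, hty, ← ht, show t + h = t * (1 + h * i) by rw [hi]; field_simp, mul_pow,
      Real.log_mul (by positivity) (by positivity), Real.log_pow (1 + h * i)]
    have : t * (1 + h * i) = t + h := by rw [hi]; field_simp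
    push_cast
    linarith
  have hfin : phiC ‖y‖ - phiC ‖x‖ - (1 + 2 / t) * z =
      (h - z) * (1 + 2 * i) + 2 * (Real.log (1 + h * i) - h * i) := by
    rw [hphi, div_eq_mul_inv]; ring
  have h12 : |(h - z) * (1 + 2 * i)| ≤ 5.5 * d ^ 2 := by
    rw [abs_mul]
    have : |1 + 2 * i| ≤ 1 := by rw [abs_le]; constructor <;> linarith
    exact (mul_le_of_le_one_right (abs_nonneg _) this).trans hhz
  rw [hfin]
  obtain ⟨h3, h4⟩ := abs_le.1 h12
  rw [abs_le]
  constructor <;> linarith [sq_nonneg d]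

/-- The gradient of `τ φ(‖·‖)` at `x`. -/
def phaseGrad (τ : ℝ) (x : EuclideanSpace ℝ (Fin n)) : EuclideanSpace ℝ (Fin n) :=
  (τ * (1 + 2 / Real.log ‖x‖) / ‖x‖ ^ 2) • x

theorem norm_phaseGrad (hx : x ≠ 0) (hlog : Real.log ‖x‖ ≤ -11) {τ : ℝ} (hτ : 1 < τ) :
    τ / 2 * ‖x‖⁻¹ ≤ ‖phaseGrad τ x‖ ∧ ‖phaseGrad τ x‖ ≤ τ * ‖x‖⁻¹ := by
  have hx0 : 0 < ‖x‖ := norm_pos_iff.2 hx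
  set t := Real.log ‖x‖ with ht
  have hi0 : t⁻¹ < 0 := by rw [inv_lt_zero]; linarith
  have hi1 : -(1 / 11) ≤ t⁻¹ := by
    rw [show (-(1 / 11) : ℝ) = (-11)⁻¹ by norm_num]
    exact (inv_le_inv_of_neg (by norm_num) (by linarith)).2 hlog
  have : ‖phaseGrad τ x‖ = τ * (1 + 2 * t⁻¹) * ‖x‖⁻¹ := by
    rw [phaseGrad, norm_smul, Real.norm_eq_abs, abs_of_nonneg, div_eq_mul_inv 2, ← ht]
    · field_simp
    · rw [div_eq_mul_inv 2]
      have : 0 ≤ 1 + 2 * t⁻¹ := by linarith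
      positivity
  rw [this]
  constructor <;> gcongr
  · nlinarith
  · nlinarith

theorem carWt_compare (hx : x ≠ 0) (hlog : Real.log ‖x‖ ≤ -11) {τ : ℝ} (hτ : 1 < τ)
    (hy : ‖y - x‖ ≤ τ ^ (-(1 / 2) : ℝ) / 5 * ‖x‖) :
    carWt τ y ≤ Real.exp 1 * (carWt τ x * Real.exp ⟪phaseGrad τ x, x⟫) *
        Real.exp (-⟪phaseGrad τ x, y⟫) ∧
      (carWt τ x * Real.exp ⟪phaseGrad τ x, x⟫) * Real.exp (-⟪phaseGrad τ x, y⟫) ≤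
        Real.exp 1 * carWt τ y := by
  have hτ0 : 0 < τ := by linarith
  have hs : (τ ^ (-(1 / 2) : ℝ)) ^ 2 = τ⁻¹ := by
    rw [← Real.rpow_natCast, ← Real.rpow_mul hτ0.le, ← Real.rpow_neg_one]; norm_num
  have hs1 : τ ^ (-(1 / 2) : ℝ) ≤ 1 := Real.rpow_le_one_of_one_le_of_nonpos hτ.le (by norm_num)
  have h := abs_phiC_sub_le hx hlog (by linarith) hy
  rw [div_pow, hs] at h
  have hb : ⟪phaseGrad τ x, y⟫ = ⟪phaseGrad τ x, x⟫ +
      τ * ((1 + 2 / Real.log ‖x‖) * (⟪x, y - x⟫ / ‖x‖ ^ 2)) := by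
    rw [phaseGrad, real_inner_smul_left, real_inner_smul_left, inner_sub_right]
    ring
  set D := (1 + 2 / Real.log ‖x‖) * (⟪x, y - x⟫ / ‖x‖ ^ 2)
  obtain ⟨h1, h2⟩ := abs_le.1 h
  have hτi : τ * τ⁻¹ = 1 := mul_inv_cancel₀ hτ0.ne'
  have h1' := mul_le_mul_of_nonneg_left h1 hτ0.le
  have h2' := mul_le_mul_of_nonneg_left h2 hτ0.le
  simp only [carWt, ← Real.exp_add, hb]
  constructor <;> refine Real.exp_le_exp.2 ?_ <;> nlinarith

end WeightComparison

section LocalTools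

open Filter Topology RealInnerProductSpace

variable {n : ℕ} {p : ℝ}

theorem eLpNorm_ofReal_eq (hp : 0 < p) {α : Type*} [MeasurableSpace α] (ν : Measure α) (g : α → ℝ) :
    eLpNorm g (ENNReal.ofReal p) ν = (∫⁻ x, ENNReal.ofReal (|g x| ^ p) ∂ν) ^ (1 / p) := by
  rw [eLpNorm_eq_lintegral_rpow_enorm_toReal (by simpa using hp) ENNReal.ofReal_ne_top,
    ENNReal.toReal_ofReal hp.le]
  congr 1
  refine lintegral_congr fun x => ?_
  rw [← ENNReal.ofReal_rpow_of_nonneg (abs_nonneg _) hp.le, Real.enorm_eq_ofReal_abs]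

theorem eLpNorm_radMeas_le (hp : 0 < p) {g : EuclideanSpace ℝ (Fin n) → ℝ} {a : ℝ} (ha : 0 < a)
    (hg : ∀ y, g y ≠ 0 → a ≤ ‖y‖) :
    eLpNorm g (ENNReal.ofReal p) (radMeas n) ≤
      ENNReal.ofReal (a ^ (-(n : ℝ) / p)) * eLpNorm g (ENNReal.ofReal p) volume := by
  rw [eLpNorm_radMeas hp, eLpNorm_ofReal_eq hp, div_eq_mul_one_div (-(n : ℝ)) p, Real.rpow_mul ha.le,
    ← ENNReal.ofReal_rpow_of_nonneg (by positivity) (by positivity),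
    ← ENNReal.mul_rpow_of_nonneg _ _ (by positivity), ← lintegral_const_mul' _ _ ofReal_ne_top]
  refine ENNReal.rpow_le_rpow (lintegral_mono fun y => ?_) (by positivity)
  rw [← ENNReal.ofReal_mul (by positivity), mul_comm]
  refine ENNReal.ofReal_le_ofReal ?_
  rcases eq_or_ne (g y) 0 with h | h
  · rw [h, abs_zero, Real.zero_rpow hp.ne']; simp
  · gcongr ?_ * _
    exact Real.rpow_le_rpow_of_nonpos ha (hg y h) (by simp)

theorem eLpNorm_volume_le (hp : 0 < p) {g : EuclideanSpace ℝ (Fin n) → ℝ} {a : ℝ} (ha : 0 < a)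
    (hg : ∀ y, g y ≠ 0 → y ≠ 0 ∧ ‖y‖ ≤ a) :
    eLpNorm g (ENNReal.ofReal p) volume ≤
      ENNReal.ofReal (a ^ ((n : ℝ) / p)) * eLpNorm g (ENNReal.ofReal p) (radMeas n) := by
  rw [eLpNorm_radMeas hp, eLpNorm_ofReal_eq hp, div_eq_mul_one_div (n : ℝ) p, Real.rpow_mul ha.le,
    ← ENNReal.ofReal_rpow_of_nonneg (by positivity) (by positivity),
    ← ENNReal.mul_rpow_of_nonneg _ _ (by positivity), ← lintegral_const_mul' _ _ ofReal_ne_top]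
  refine ENNReal.rpow_le_rpow (lintegral_mono fun y => ?_) (by positivity)
  rw [← ENNReal.ofReal_mul (by positivity)]
  refine ENNReal.ofReal_le_ofReal ?_
  rcases eq_or_ne (g y) 0 with h | h
  · rw [h, abs_zero, Real.zero_rpow hp.ne']; simp
  · have hy : 0 < ‖y‖ := norm_pos_iff.2 (hg y h).1
    calc |g y| ^ p = ‖y‖ ^ (n : ℝ) * (|g y| ^ p * ‖y‖ ^ (-(n : ℝ))) := by
          rw [mul_left_comm, ← Real.rpow_add hy, add_neg_cancel, Real.rpow_zero, mul_one]
      _ ≤ _ := by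
          gcongr
          exact (hg y h).2

theorem eLpNorm_two_le_of_sq_le {α : Type*} [MeasurableSpace α] {ν : Measure α} {h G : α → ℝ}
    (hG : Integrable G ν) (hle : ∀ x, h x ^ 2 ≤ G x) {c B : ℝ} (hc : 0 ≤ c)
    (hGB : ∫ x, G x ∂ν ≤ c ^ 2 * B) :
    eLpNorm h 2 ν ≤ ENNReal.ofReal c * ENNReal.ofReal B ^ (1 / 2 : ℝ) := by
  have h2 := eLpNorm_ofReal_eq two_pos ν h
  rw [show ENNReal.ofReal (2 : ℝ) = 2 by simp] at h2
  have hc2 : ENNReal.ofReal c = ENNReal.ofReal (c ^ 2) ^ (1 / 2 : ℝ) := by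
    rw [ENNReal.ofReal_rpow_of_nonneg (by positivity) (by norm_num), ← Real.sqrt_eq_rpow,
      Real.sqrt_sq hc]
  rw [h2, hc2, ← ENNReal.mul_rpow_of_nonneg _ _ (by norm_num), ← ENNReal.ofReal_mul (by positivity)]
  refine ENNReal.rpow_le_rpow ?_ (by norm_num)
  calc ∫⁻ x, ENNReal.ofReal (|h x| ^ (2 : ℝ)) ∂ν ≤ ∫⁻ x, ENNReal.ofReal (G x) ∂ν :=
        lintegral_mono fun x => ENNReal.ofReal_le_ofReal (by
          rw [Real.rpow_two, sq_abs]; exact hle x)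
    _ = ENNReal.ofReal (∫ x, G x ∂ν) := (ofReal_integral_eq_lintegral_ofReal hG
        (Eventually.of_forall fun x => (sq_nonneg _).trans (hle x))).symm
    _ ≤ _ := ENNReal.ofReal_le_ofReal hGB

theorem pd_sq_le_gradSq (u : EuclideanSpace ℝ (Fin n) → ℝ) (x : EuclideanSpace ℝ (Fin n))
    (i : Fin n) : pd i u x ^ 2 ≤ gradSq u x :=
  Finset.single_le_sum (f := fun i => pd i u x ^ 2) (fun _ _ => sq_nonneg _) (Finset.mem_univ i)

theorem exists_parametrix_eLpNorm (hn : 3 ≤ n) (hp : 2 * (n : ℝ) / (n + 2) < p) (hp2 : p ≤ 2) :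
    ∃ C, 0 < C ∧ ∀ b : EuclideanSpace ℝ (Fin n), b ≠ 0 → ∀ ε : ℝ, 0 < ε → ε ≤ 1 →
      ∀ f : EuclideanSpace ℝ (Fin n) → ℝ, ContDiff ℝ (⊤ : ℕ∞) f → HasCompactSupport f →
      ∃ (W : EuclideanSpace ℝ (Fin n) → ℝ) (M : ℝ≥0∞), ContDiff ℝ (⊤ : ℕ∞) W ∧
        M = ENNReal.ofReal (C * ε ^ (-1 + ((n : ℝ) + 2) / 2 * (1 / p - 1 / 2)) *
            ‖b‖ ^ ((n : ℝ) * (1 / p - 1 / 2))) *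
          eLpNorm (fun x => Real.exp (-⟪b, x⟫) * f x) (ENNReal.ofReal p) volume ∧
        eLpNorm (fun x => Real.exp (-⟪b, x⟫) * W x) 2 volume ≤ ENNReal.ofReal (‖b‖⁻¹ ^ 2) * M ∧
        (∀ i, eLpNorm (fun x => Real.exp (-⟪b, x⟫) * pd i W x) 2 volume ≤
          ENNReal.ofReal ‖b‖⁻¹ * M) ∧
        eLpNorm (fun x => Real.exp (-⟪b, x⟫) * (lap W x - f x)) 2 volume ≤
          ENNReal.ofReal ε * M := by
  obtain ⟨C, hC, h⟩ := exists_parametrix_const hn hp hp2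
  have hp0 : 0 < p := lt_of_le_of_lt (by positivity) hp
  refine ⟨√C, Real.sqrt_pos.2 hC, fun b hb ε hε hε1 f hf hfc => ?_⟩
  obtain ⟨W, N, hW, hN, i1, e1, i2, e2, i3, e3⟩ := h b hb ε hε hε1 f hf hfc
  have hb0 : 0 < ‖b‖ := norm_pos_iff.2 hb
  have hJ : ENNReal.ofReal N ^ (1 / 2 : ℝ) =
      ENNReal.ofReal (√C * ε ^ (-1 + ((n : ℝ) + 2) / 2 * (1 / p - 1 / 2)) *
            ‖b‖ ^ ((n : ℝ) * (1 / p - 1 / 2))) *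
          eLpNorm (fun x => Real.exp (-⟪b, x⟫) * f x) (ENNReal.ofReal p) volume := by
    have hcont : Continuous fun x => |Real.exp (-⟪b, x⟫) * f x| ^ p := by
      have := hf.continuous
      exact Continuous.rpow_const (by fun_prop) fun _ => Or.inr hp0.le
    have hint : Integrable fun x => |Real.exp (-⟪b, x⟫) * f x| ^ p :=
      hcont.integrable_of_hasCompactSupport (hfc.mono fun x hx => by
        contrapose! hx
        rw [Function.notMem_support] at hx ⊢
        rw [hx, mul_zero, abs_zero, Real.zero_rpow hp0.ne'])
    have hJ0 : 0 ≤ ∫ x, |Real.exp (-⟪b, x⟫) * f x| ^ p := integral_nonneg fun x => by positivity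
    rw [eLpNorm_ofReal_eq hp0, ← ofReal_integral_eq_lintegral_ofReal hint
      (Eventually.of_forall fun x => by positivity), hN,
      ENNReal.ofReal_rpow_of_nonneg (by positivity) (by norm_num),
      ENNReal.ofReal_rpow_of_nonneg hJ0 (by positivity), ← ENNReal.ofReal_mul (by positivity)]
    congr 1
    rw [Real.mul_rpow (by positivity) (by positivity), Real.mul_rpow (by positivity) (by positivity),
      Real.mul_rpow (by positivity) (by positivity), ← Real.sqrt_eq_rpow C, ← Real.rpow_mul hε.le,
      ← Real.rpow_mul hb0.le, ← Real.rpow_mul hJ0]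
    ring_nf
  refine ⟨W, _, hW, rfl, ?_, fun i => ?_, ?_⟩
  · rw [← hJ]
    exact eLpNorm_two_le_of_sq_le i1 (fun x => by rw [mul_pow]) (by positivity)
      (e1.trans_eq (by ring))
  · rw [← hJ]
    refine eLpNorm_two_le_of_sq_le i2 (fun x => ?_) (by positivity) e2
    rw [mul_pow]
    gcongr
    exact pd_sq_le_gradSq W x i
  · rw [← hJ]
    exact eLpNorm_two_le_of_sq_le i3 (fun x => by rw [mul_pow]) hε.le e3

theorem pd_comp_scale {η : EuclideanSpace ℝ (Fin n) → ℝ} (hη : ContDiff ℝ (⊤ : ℕ∞) η) (c : ℝ)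
    (x y : EuclideanSpace ℝ (Fin n)) (i : Fin n) :
    pd i (fun z => η (c • (z - x))) y = c * pd i η (c • (y - x)) := by
  have h1 : HasFDerivAt (fun z : EuclideanSpace ℝ (Fin n) => c • (z - x))
      (c • ContinuousLinearMap.id ℝ (EuclideanSpace ℝ (Fin n))) y :=
    ((hasFDerivAt_id y).sub_const x).const_smul c
  have h2 := (hη.diffAt (x := c • (y - x))).hasFDerivAt.comp y h1
  unfold pd
  rw [show (fun z => η (c • (z - x))) = η ∘ fun z => c • (z - x) from rfl, h2.fderiv]
  simp

theorem exists_cutoff (n : ℕ) : ∃ C, 0 < C ∧ ∀ (x : EuclideanSpace ℝ (Fin n)) (ρ : ℝ), 0 < ρ →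
    ∃ χ : EuclideanSpace ℝ (Fin n) → ℝ, ContDiff ℝ (⊤ : ℕ∞) χ ∧ (∀ y, |χ y| ≤ 1) ∧
      (∀ y ∈ closedBall x (6 * ρ), χ y = 1) ∧ tsupport χ ⊆ closedBall x (8 * ρ) ∧
      ∀ y, (∀ i, |pd i χ y| ≤ C / ρ) ∧ |lap χ y| ≤ C / ρ ^ 2 := by
  let η : ContDiffBump (0 : EuclideanSpace ℝ (Fin n)) := ⟨6, 8, by norm_num, by norm_num⟩
  have hη : ContDiff ℝ (⊤ : ℕ∞) η := η.contDiff
  have hηc : HasCompactSupport η := η.hasCompactSupport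
  have hb1 : ∀ i, ∃ C, ∀ y, ‖pd i η y‖ ≤ C := fun i =>
    HasCompactSupport.exists_bound_of_continuous
      (hηc.of_tsupport tsupport_pd_subset) hη.pd.continuous
  choose B hB using hb1
  obtain ⟨B', hB'⟩ := HasCompactSupport.exists_bound_of_continuous
      (hηc.of_tsupport (tsupport_subset_of_eq_zero fun x hx => lap_eq_zero_of_notMem hx))
      hη.lap.continuous
  refine ⟨∑ i, |B i| + |B'| + 1, by positivity, fun x ρ hρ => ?_⟩
  have e1 : ∀ i, pd i (fun z => η (ρ⁻¹ • (z - x))) = fun y => ρ⁻¹ * pd i η (ρ⁻¹ • (y - x)) :=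
    fun i => funext fun y => pd_comp_scale hη _ _ _ _
  have hcs : ContDiff ℝ (⊤ : ℕ∞) fun z : EuclideanSpace ℝ (Fin n) => ρ⁻¹ • (z - x) :=
    (contDiff_id.sub contDiff_const).const_smul ρ⁻¹
  have e2 : ∀ y, lap (fun z => η (ρ⁻¹ • (z - x))) y = ρ⁻¹ ^ 2 * lap η (ρ⁻¹ • (y - x)) := fun y => by
    unfold lap
    rw [Finset.mul_sum]
    refine Finset.sum_congr rfl fun i _ => ?_
    have hc' : ContDiff ℝ (⊤ : ℕ∞) fun y => pd i η (ρ⁻¹ • (y - x)) := hη.pd.comp hcs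
    rw [e1 i, pd_const_mul _ hc'.diffAt, pd_comp_scale hη.pd]
    ring
  have hnorm : ∀ y, ‖ρ⁻¹ • (y - x)‖ = dist y x / ρ := fun y => by
    rw [norm_smul, Real.norm_eq_abs, abs_of_pos (by positivity), dist_eq_norm]; field_simp
  refine ⟨fun z => η (ρ⁻¹ • (z - x)), hη.comp hcs, fun y => ?_, fun y hy => ?_, ?_, fun y =>
    ⟨fun i => ?_, ?_⟩⟩
  · rw [abs_of_nonneg η.nonneg]; exact η.le_one
  · refine η.one_of_mem_closedBall ?_
    rw [mem_closedBall_zero_iff, hnorm, div_le_iff₀ hρ]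
    exact hy
  · refine closure_minimal (fun y hy => ?_) isClosed_closedBall
    by_contra h
    refine hy (η.zero_of_le_dist ?_)
    rw [dist_zero_right, hnorm, le_div_iff₀ hρ]
    exact (not_le.1 h).le
  · rw [e1, abs_mul, abs_of_pos (by positivity), div_eq_inv_mul]
    gcongr
    have h1 := (hB i (ρ⁻¹ • (y - x))).trans (le_abs_self _)
    have h2 := Finset.single_le_sum (f := fun i => |B i|) (fun _ _ => abs_nonneg _)
      (Finset.mem_univ i)
    rw [Real.norm_eq_abs] at h1
    linarith [abs_nonneg B']
  · rw [e2, abs_mul, abs_of_pos (by positivity), div_eq_inv_mul, ← inv_pow]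
    gcongr
    have h1 := (hB' (ρ⁻¹ • (y - x))).trans (le_abs_self _)
    have h2 : 0 ≤ ∑ i, |B i| := Finset.sum_nonneg fun _ _ => abs_nonneg _
    rw [Real.norm_eq_abs] at h1
    linarith

end LocalTools

section LocalParametrix

open Filter Topology RealInnerProductSpace

variable {n : ℕ} {p : ℝ} {x : EuclideanSpace ℝ (Fin n)} {τ : ℝ}

/-- The radius of the balls on which the Carleman weight is comparable to an exponential. -/
def ballRad (τ : ℝ) (x : EuclideanSpace ℝ (Fin n)) : ℝ := ‖x‖ * τ ^ (-(1 / 2) : ℝ) / 40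

theorem ballRad_pos (hx : x ≠ 0) (hτ : 1 < τ) : 0 < ballRad τ x := by
  have : 0 < ‖x‖ := norm_pos_iff.2 hx
  unfold ballRad; positivity

theorem rpow_neg_half_le_one (hτ : 1 < τ) : τ ^ (-(1 / 2) : ℝ) ≤ 1 :=
  Real.rpow_le_one_of_one_le_of_nonpos hτ.le (by norm_num)

theorem norm_bounds_of_mem (hτ : 1 < τ) {y : EuclideanSpace ℝ (Fin n)}
    (hy : y ∈ closedBall x (8 * ballRad τ x)) :
    4 / 5 * ‖x‖ ≤ ‖y‖ ∧ ‖y‖ ≤ 6 / 5 * ‖x‖ ∧ ‖y - x‖ ≤ τ ^ (-(1 / 2) : ℝ) / 5 * ‖x‖ := by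
  have h1 := rpow_neg_half_le_one hτ
  rw [mem_closedBall, dist_eq_norm] at hy
  have h2 : ‖y - x‖ ≤ τ ^ (-(1 / 2) : ℝ) / 5 * ‖x‖ := hy.trans_eq (by unfold ballRad; ring)
  have h3 : τ ^ (-(1 / 2) : ℝ) / 5 * ‖x‖ ≤ 1 / 5 * ‖x‖ := by gcongr
  have h4 := norm_sub_norm_le y x
  have h5 := norm_sub_norm_le x y
  rw [norm_sub_rev] at h5
  exact ⟨by linarith, by linarith, h2⟩

/-- The constant comparing the Carleman weight at `x` to its exponential approximation. -/
def cmpConst (τ : ℝ) (x : EuclideanSpace ℝ (Fin n)) : ℝ :=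
  carWt τ x * Real.exp ⟪phaseGrad τ x, x⟫

theorem cmpConst_pos : 0 < cmpConst τ x := mul_pos (carWt_pos _ _) (Real.exp_pos _)

theorem eLpNorm_carWt_le (hp : 0 < p) (hx : x ≠ 0) (hlog : Real.log ‖x‖ ≤ -11) (hτ : 1 < τ)
    {G g : EuclideanSpace ℝ (Fin n) → ℝ} {c : ℝ} (hG : ∀ y, |G y| ≤ c * |g y|) (hc : 0 ≤ c)
    (hsupp : ∀ y, G y ≠ 0 → y ∈ closedBall x (8 * ballRad τ x)) :
    eLpNorm (fun y => carWt τ y * G y) (ENNReal.ofReal p) (radMeas n) ≤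
      ENNReal.ofReal ((‖x‖ / 2) ^ (-(n : ℝ) / p) * (Real.exp 1 * cmpConst τ x * c)) *
        eLpNorm (fun y => Real.exp (-⟪phaseGrad τ x, y⟫) * g y) (ENNReal.ofReal p) volume := by
  have hx0 : 0 < ‖x‖ := norm_pos_iff.2 hx
  rw [ENNReal.ofReal_mul (by positivity), mul_assoc]
  refine (eLpNorm_radMeas_le hp (a := ‖x‖ / 2) (by positivity) fun y hy => ?_).trans ?_
  · have := (norm_bounds_of_mem hτ (hsupp y (right_ne_zero_of_mul hy))).1
    linarith
  · gcongr
    refine eLpNorm_le_mul_eLpNorm_of_ae_le_mul (Eventually.of_forall fun y => ?_) _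
    rcases eq_or_ne (G y) 0 with h | h
    · rw [h, mul_zero, norm_zero]
      have := cmpConst_pos (τ := τ) (x := x)
      positivity
    · have h1 := (carWt_compare hx hlog hτ (norm_bounds_of_mem hτ (hsupp y h)).2.2).1
      rw [norm_mul, norm_mul, Real.norm_of_nonneg (carWt_pos _ _).le,
        Real.norm_of_nonneg (Real.exp_pos _).le, Real.norm_eq_abs, Real.norm_eq_abs]
      calc carWt τ y * |G y| ≤ (Real.exp 1 * (carWt τ x * Real.exp ⟪phaseGrad τ x, x⟫) *
            Real.exp (-⟪phaseGrad τ x, y⟫)) * (c * |g y|) :=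
            mul_le_mul h1 (hG y) (abs_nonneg _) ((carWt_pos _ _).le.trans h1)
        _ = _ := by unfold cmpConst; ring

theorem eLpNorm_exp_le (hp : 0 < p) (hx : x ≠ 0) (hlog : Real.log ‖x‖ ≤ -11) (hτ : 1 < τ)
    {G g : EuclideanSpace ℝ (Fin n) → ℝ} {c : ℝ} (hG : ∀ y, |g y| ≤ c * |G y|) (hc : 0 ≤ c)
    (hsupp : ∀ y, G y ≠ 0 → y ∈ closedBall x (8 * ballRad τ x)) :
    eLpNorm (fun y => Real.exp (-⟪phaseGrad τ x, y⟫) * g y) (ENNReal.ofReal p) volume ≤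
      ENNReal.ofReal ((Real.exp 1 * (cmpConst τ x)⁻¹ * c) * (2 * ‖x‖) ^ ((n : ℝ) / p)) *
    eLpNorm (fun y => carWt τ y * G y) (ENNReal.ofReal p) (radMeas n) := by
  have hx0 : 0 < ‖x‖ := norm_pos_iff.2 hx
  have hk := cmpConst_pos (τ := τ) (x := x)
  have h2 : eLpNorm (fun y => carWt τ y * G y) (ENNReal.ofReal p) volume ≤
      ENNReal.ofReal ((2 * ‖x‖) ^ ((n : ℝ) / p)) *
        eLpNorm (fun y => carWt τ y * G y) (ENNReal.ofReal p) (radMeas n) := by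
    refine eLpNorm_volume_le hp (a := 2 * ‖x‖) (by positivity) fun y hy => ?_
    have := norm_bounds_of_mem hτ (hsupp y (right_ne_zero_of_mul hy))
    exact ⟨norm_pos_iff.1 (by linarith), by linarith⟩
  rw [ENNReal.ofReal_mul (by positivity), mul_assoc]
  refine le_trans ?_ (mul_le_mul_right h2 _)
  refine eLpNorm_le_mul_eLpNorm_of_ae_le_mul (Eventually.of_forall fun y => ?_) _
  rcases eq_or_ne (G y) 0 with h | h
  · have : g y = 0 := by
      have := hG y
      rw [h, abs_zero, mul_zero] at this
      exact abs_nonpos_iff.1 this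
    simp [this, h]
  · have h1 := (carWt_compare hx hlog hτ (norm_bounds_of_mem hτ (hsupp y h)).2.2).2
    rw [norm_mul, norm_mul, Real.norm_of_nonneg (carWt_pos _ _).le,
      Real.norm_of_nonneg (Real.exp_pos _).le, Real.norm_eq_abs, Real.norm_eq_abs]
    have h3 : Real.exp (-⟪phaseGrad τ x, y⟫) ≤ (cmpConst τ x)⁻¹ * (Real.exp 1 * carWt τ y) := by
      rw [le_inv_mul_iff₀ hk]; exact h1
    calc _ ≤ ((cmpConst τ x)⁻¹ * (Real.exp 1 * carWt τ y)) * (c * |G y|) := by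
          refine mul_le_mul h3 (hG y) (abs_nonneg _) ((Real.exp_pos _).le.trans h3)
      _ = _ := by ring

theorem exists_local_parametrix (hn : 3 ≤ n) (hp : 2 * (n : ℝ) / (n + 2) < p) (hp2 : p ≤ 2) :
    ∃ C, 0 < C ∧ ∀ x : EuclideanSpace ℝ (Fin n), x ≠ 0 → Real.log ‖x‖ ≤ -11 → ∀ τ : ℝ, 1 < τ →
      ∀ f : EuclideanSpace ℝ (Fin n) → ℝ, ContDiff ℝ (⊤ : ℕ∞) f →
      (∀ y, f y ≠ 0 → y ∈ closedBall x (6 * ballRad τ x)) →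
      ∃ U : EuclideanSpace ℝ (Fin n) → ℝ, ContDiff ℝ (⊤ : ℕ∞) U ∧
        tsupport U ⊆ closedBall x (8 * ballRad τ x) ∧
        eLpNorm (fun y => carWt τ y * U y) 2 (radMeas n) ≤
          ENNReal.ofReal (C * τ ^ (-(3 / 2) + (3 * (n : ℝ) - 2) / 4 * (1 / p - 1 / 2))) *
            eLpNorm (fun y => carWt τ y * (‖y‖ ^ 2 * f y)) (ENNReal.ofReal p) (radMeas n) ∧
        eLpNorm (fun y => carWt τ y * (‖y‖ ^ 2 * (f y - lap U y))) 2 (radMeas n) ≤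
          ENNReal.ofReal (C * τ ^ ((3 * (n : ℝ) - 2) / 4 * (1 / p - 1 / 2))) *
            eLpNorm (fun y => carWt τ y * (‖y‖ ^ 2 * f y)) (ENNReal.ofReal p) (radMeas n) := by
  obtain ⟨C₁, hC₁, hpar⟩ := exists_parametrix_eLpNorm hn hp hp2
  obtain ⟨C₂, hC₂, hcut⟩ := exists_cutoff n
  have hp0 : 0 < p := lt_of_le_of_lt (by positivity) hp
  have hδ : 0 ≤ 1 / p - 1 / 2 := by
    rw [sub_nonneg]; exact one_div_le_one_div_of_le hp0 hp2
  set δ := 1 / p - 1 / 2 with hδd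
  -- the constant in the bound for the local source
  set K := C₁ * (Real.exp 1 * 4 * 2 ^ ((n : ℝ) / p)) with hK
  have hK0 : 0 < K := by positivity
  set C := Real.exp 1 * (2 : ℝ) ^ ((n : ℝ) / 2) * 4 * (1 + 160 * C₂ * n + 6400 * C₂) * K with hC
  have hC0 : 0 < C := by positivity
  refine ⟨C, hC0, fun x hx hlog τ hτ f hf hfs => ?_⟩
  have hτ0 : 0 < τ := by linarith
  have hs : 0 < ‖x‖ := norm_pos_iff.2 hx
  have hρ := ballRad_pos hx hτ
  obtain ⟨hb1, hb2⟩ := norm_phaseGrad hx hlog hτ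
  have hb0 : 0 < ‖phaseGrad τ x‖ := lt_of_lt_of_le (by positivity) hb1
  have hbi : ‖phaseGrad τ x‖⁻¹ ≤ 2 * ‖x‖ * τ⁻¹ := by
    refine (inv_anti₀ (by positivity) hb1).trans_eq ?_
    field_simp
  have hfc : HasCompactSupport f :=
    HasCompactSupport.intro (isCompact_closedBall x (6 * ballRad τ x)) fun y hy => by
      by_contra h; exact hy (hfs y h)
  obtain ⟨W, M, hW, hM, hW0, hW1, hW2⟩ := hpar (phaseGrad τ x) (norm_pos_iff.1 hb0)
    (τ ^ (-(1 / 2) : ℝ)) (by positivity) (rpow_neg_half_le_one hτ) f hf hfc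
  obtain ⟨χ, hχ, hχ1, hχe, hχs, hχd⟩ := hcut x (ballRad τ x) hρ
  set F := eLpNorm (fun y => carWt τ y * (‖y‖ ^ 2 * f y)) (ENNReal.ofReal p) (radMeas n) with hF
  set κ := cmpConst τ x with hκ
  have hκ0 : 0 < κ := cmpConst_pos
  set A := ‖x‖ ^ ((n : ℝ) / 2) with hA
  have hA0 : 0 < A := by positivity
  set γ := (3 * (n : ℝ) - 2) / 4 * δ with hγ
  have hfb : ∀ y, f y ≠ 0 → y ∈ closedBall x (8 * ballRad τ x) := fun y hy =>
    closedBall_subset_closedBall (by linarith) (hfs y hy)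
  have hMF : M ≤ ENNReal.ofReal (K * κ⁻¹ * (A * (‖x‖ ^ 2)⁻¹) * τ ^ (1 / 2 + γ)) * F := by
    have h1 := eLpNorm_exp_le hp0 hx hlog hτ (g := f) (G := fun y => ‖y‖ ^ 2 * f y)
      (c := 4 * (‖x‖ ^ 2)⁻¹) (fun y => by
        rcases eq_or_ne (f y) 0 with h | h
        · simp [h]
        · have h2 := (norm_bounds_of_mem hτ (hfb y h)).1
          have h3 : ‖x‖ / 2 ≤ ‖y‖ := by linarith
          rw [abs_mul, abs_of_nonneg (by positivity : 0 ≤ ‖y‖ ^ 2)]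
          calc |f y| = 4 * (‖x‖ ^ 2)⁻¹ * ((‖x‖ / 2) ^ 2 * |f y|) := by field_simp; norm_num
            _ ≤ _ := by gcongr) (by positivity) (fun y hy => hfb y (right_ne_zero_of_mul hy))
    rw [hM]
    refine (mul_le_mul_right h1 _).trans ?_
    rw [← mul_assoc, ← ENNReal.ofReal_mul (by positivity)]
    refine mul_le_mul_left (ENNReal.ofReal_le_ofReal ?_) _
    have h2 : ‖phaseGrad τ x‖ ^ ((n : ℝ) * δ) ≤ (τ * ‖x‖⁻¹) ^ ((n : ℝ) * δ) := by gcongr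
    have h3 : (τ ^ (-(1 / 2) : ℝ)) ^ (-1 + ((n : ℝ) + 2) / 2 * δ) * τ ^ ((n : ℝ) * δ) =
        τ ^ (1 / 2 + γ) := by
      rw [← Real.rpow_mul hτ0.le, ← Real.rpow_add hτ0]; congr 1; rw [hγ]; ring
    have h4 : (2 * ‖x‖) ^ ((n : ℝ) / p) = 2 ^ ((n : ℝ) / p) * (A * ‖x‖ ^ ((n : ℝ) * δ)) := by
      rw [Real.mul_rpow (by norm_num) hs.le, hA, ← Real.rpow_add hs]
      congr 2; rw [hδd]; ring
    rw [h4]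
    calc _ ≤ C₁ * (τ ^ (-(1 / 2) : ℝ)) ^ (-1 + ((n : ℝ) + 2) / 2 * δ) *
          (τ * ‖x‖⁻¹) ^ ((n : ℝ) * δ) * (Real.exp 1 * κ⁻¹ * (4 * (‖x‖ ^ 2)⁻¹) *
            (2 ^ ((n : ℝ) / p) * (A * ‖x‖ ^ ((n : ℝ) * δ)))) := by gcongr
      _ = _ := by
        rw [← h3, Real.mul_rpow hτ0.le (by positivity), Real.inv_rpow hs.le, hK]
        have : 0 < ‖x‖ ^ ((n : ℝ) * δ) := by positivity
        field_simp
  have hfin : ∀ {H g : EuclideanSpace ℝ (Fin n) → ℝ} {c d a : ℝ}, 0 ≤ c → 0 ≤ d →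
      (∀ y, |H y| ≤ c * |g y|) → (∀ y, H y ≠ 0 → y ∈ closedBall x (8 * ballRad τ x)) →
      eLpNorm (fun y => Real.exp (-⟪phaseGrad τ x, y⟫) * g y) 2 volume ≤ ENNReal.ofReal d * M →
      Real.exp 1 * (2 : ℝ) ^ ((n : ℝ) / 2) * (c * d) * K * (‖x‖ ^ 2)⁻¹ * τ ^ (1 / 2 + γ) ≤ a →
      eLpNorm (fun y => carWt τ y * H y) 2 (radMeas n) ≤ ENNReal.ofReal a * F := by
    intro H g c d a hc hd hHg hsupp hg ha
    have h1 := eLpNorm_carWt_le two_pos hx hlog hτ hHg hc hsupp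
    rw [show ENNReal.ofReal (2 : ℝ) = 2 by simp] at h1
    refine h1.trans ((mul_le_mul_right (hg.trans (mul_le_mul_right hMF _)) _).trans ?_)
    rw [← mul_assoc, ← mul_assoc, ← ENNReal.ofReal_mul (by positivity),
      ← ENNReal.ofReal_mul (by positivity)]
    refine mul_le_mul_left (ENNReal.ofReal_le_ofReal (le_trans (le_of_eq ?_) ha)) _
    rw [neg_div, Real.div_rpow hs.le (by norm_num), Real.rpow_neg hs.le, ← hA,
      Real.rpow_neg (by norm_num), ← hκ]
    field_simp
  have hU0 : ∀ y, χ y * W y ≠ 0 → y ∈ closedBall x (8 * ballRad τ x) := fun y hy =>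
    hχs (subset_tsupport _ (left_ne_zero_of_mul hy))
  have hts : tsupport (fun y => χ y * W y) ⊆ closedBall x (8 * ballRad τ x) :=
    closure_minimal (fun y hy => hU0 y hy) isClosed_closedBall
  refine ⟨fun y => χ y * W y, hχ.mul hW, hts, ?_, ?_⟩
  · refine hfin (c := 1) zero_le_one (sq_nonneg _) (fun y => ?_) hU0 hW0 ?_
    · rw [abs_mul]
      exact mul_le_mul_of_nonneg_right (hχ1 y) (abs_nonneg _)
    · have h5 : τ ^ (-(3 / 2) + γ) = τ⁻¹ ^ 2 * τ ^ (1 / 2 + γ) := by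
        rw [inv_pow, ← Real.rpow_natCast τ 2, ← Real.rpow_neg hτ0.le, ← Real.rpow_add hτ0]
        congr 1; push_cast; ring
      rw [h5]
      calc _ ≤ Real.exp 1 * (2 : ℝ) ^ ((n : ℝ) / 2) * (1 * (2 * ‖x‖ * τ⁻¹) ^ 2) * K *
            (‖x‖ ^ 2)⁻¹ * τ ^ (1 / 2 + γ) := by gcongr
        _ = Real.exp 1 * (2 : ℝ) ^ ((n : ℝ) / 2) * 4 * 1 * K * (τ⁻¹ ^ 2 * τ ^ (1 / 2 + γ)) := by
            field_simp; ring
        _ ≤ _ := by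
            rw [hC]
            gcongr
            have : 0 ≤ 160 * C₂ * n + 6400 * C₂ := by positivity
            linarith
  · set E : EuclideanSpace ℝ (Fin n) → ℝ := fun y => Real.exp (-⟪phaseGrad τ x, y⟫) with hE
    have hEc : Continuous E := by fun_prop
    have hWc := hW.continuous
    have hWl := hW.lap.continuous
    have hWp : ∀ i, Continuous (pd i W) := fun i => hW.pd.continuous
    have hfcont := hf.continuous
    set B := C₂ / ballRad τ x with hB
    have hB0 : 0 < B := by positivity
    set B' := C₂ / ballRad τ x ^ 2 with hB'
    have hB'0 : 0 < B' := by positivity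
    set g : EuclideanSpace ℝ (Fin n) → ℝ := fun y =>
      |lap W y - f y| + (∑ i, 2 * B * |pd i W y|) + B' * |W y| with hg
    have hgn : ∀ y, 0 ≤ g y := fun y =>
      add_nonneg (add_nonneg (abs_nonneg _) (Finset.sum_nonneg fun i _ => by positivity))
        (by positivity)
    have hd0 : 0 ≤ τ ^ (-(1 / 2) : ℝ) + n * (2 * B * ‖phaseGrad τ x‖⁻¹) +
        B' * ‖phaseGrad τ x‖⁻¹ ^ 2 := by positivity
    refine hfin (g := g) (c := 4 * ‖x‖ ^ 2) (by positivity) hd0 (fun y => ?_) (fun y hy => ?_) ?_ ?_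
    · rcases em (y ∈ closedBall x (8 * ballRad τ x)) with h | h
      · have h1 := (norm_bounds_of_mem hτ h).2.1
        have h2 : ‖y‖ ^ 2 ≤ 4 * ‖x‖ ^ 2 := by
          calc ‖y‖ ^ 2 ≤ (2 * ‖x‖) ^ 2 := by gcongr; linarith
            _ = _ := by ring
        rw [abs_mul, abs_of_nonneg (sq_nonneg ‖y‖), abs_of_nonneg (hgn y)]
        refine mul_le_mul h2 ?_ (abs_nonneg _) (by positivity)
        have h3 : f y = χ y * f y := by
          rcases eq_or_ne (f y) 0 with h | h
          · rw [h, mul_zero]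
          · rw [hχe y (hfs y h), one_mul]
        have h4 : f y - lap (fun y => χ y * W y) y = -(χ y * (lap W y - f y)) +
            -(∑ i, 2 * (pd i χ y * pd i W y)) + -(W y * lap χ y) := by
          rw [lap_mul hχ hW, ← Finset.mul_sum]; linear_combination h3
        rw [h4]
        refine (abs_add_three _ _ _).trans ?_
        rw [abs_neg, abs_neg, abs_neg, hg]
        refine add_le_add (add_le_add ?_ ((Finset.abs_sum_le_sum_abs _ _).trans
          (Finset.sum_le_sum fun i _ => ?_))) ?_
        · rw [abs_mul]
          exact mul_le_of_le_one_left (abs_nonneg _) (hχ1 y)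
        · rw [abs_mul, abs_mul, abs_two, mul_assoc]
          have := (hχd y).1 i
          gcongr
        · rw [abs_mul, mul_comm]
          have := (hχd y).2
          gcongr
      · have h1 : f y = 0 := by
          by_contra h'; exact h (hfb y h')
        have h2 : lap (fun y => χ y * W y) y = 0 := lap_eq_zero_of_notMem fun h' => h (hts h')
        rw [h1, h2]
        simp only [sub_zero, mul_zero, abs_zero]
        positivity
    · by_contra h
      have h1 : f y = 0 := by
        by_contra h'; exact h (hfb y h')
      have h2 : lap (fun y => χ y * W y) y = 0 := lap_eq_zero_of_notMem fun h' => h (hts h')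
      rw [h1, h2] at hy
      simp at hy
    · have e1 : (fun y => E y * g y) = (fun y => E y * |lap W y - f y|) +
          (∑ i, fun y => E y * (2 * B * |pd i W y|)) + fun y => E y * (B' * |W y|) := by
        funext y
        simp only [hg, Pi.add_apply, Finset.sum_apply, ← Finset.mul_sum]
        ring
      have hpd : ∀ i ∈ Finset.univ, AEStronglyMeasurable
          (fun y => E y * (2 * B * |pd i W y|)) volume := fun i _ => by
        have := hWp i
        exact Continuous.aestronglyMeasurable (by fun_prop)
      have hsc : ∀ {h : EuclideanSpace ℝ (Fin n) → ℝ} {c : ℝ}, 0 ≤ c →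
          eLpNorm (fun y => E y * (c * |h y|)) 2 volume ≤
            ENNReal.ofReal c * eLpNorm (fun y => E y * h y) 2 volume := fun {h c} hc =>
        eLpNorm_le_mul_eLpNorm_of_ae_le_mul (Eventually.of_forall fun y => le_of_eq (by
          rw [norm_mul, norm_mul, norm_mul, Real.norm_of_nonneg hc, Real.norm_eq_abs |h y|,
            abs_abs, Real.norm_eq_abs (h y)]; ring)) _
      rw [e1]
      refine (eLpNorm_add_le ((Continuous.aestronglyMeasurable (by fun_prop)).add
        (Finset.aestronglyMeasurable_sum _ hpd)) (Continuous.aestronglyMeasurable (by fun_prop))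
        (by norm_num)).trans ?_
      rw [ENNReal.ofReal_add (by positivity) (by positivity),
        ENNReal.ofReal_add (by positivity) (by positivity), add_mul, add_mul]
      refine add_le_add ((eLpNorm_add_le (Continuous.aestronglyMeasurable (by fun_prop))
        (Finset.aestronglyMeasurable_sum _ hpd) (by norm_num)).trans (add_le_add ?_ ?_)) ?_
      · refine le_trans (le_of_eq ?_) hW2
        rw [← eLpNorm_norm, ← eLpNorm_norm (fun y => Real.exp _ * _)]
        simp [hE]
      · refine (eLpNorm_sum_le hpd (by norm_num)).trans ?_
        refine (Finset.sum_le_card_nsmul _ _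
          (ENNReal.ofReal (2 * B * ‖phaseGrad τ x‖⁻¹) * M) fun i _ => ?_).trans_eq ?_
        · rw [ENNReal.ofReal_mul (by positivity), mul_assoc]
          exact (hsc (by positivity)).trans (mul_le_mul_right (hW1 i) _)
        · rw [Finset.card_univ, Fintype.card_fin, nsmul_eq_mul,
            ENNReal.ofReal_mul (p := (n : ℝ)) (by positivity), ENNReal.ofReal_natCast, mul_assoc (n : ℝ≥0∞)]
      · rw [ENNReal.ofReal_mul (by positivity), mul_assoc]
        exact (hsc (by positivity)).trans (mul_le_mul_right hW0 _)
    · have e2 : τ ^ (1 / 2 + γ) = τ ^ (1 / 2 : ℝ) * τ ^ γ := Real.rpow_add hτ0 _ _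
      have e3 : τ ^ (-(1 / 2) : ℝ) = (τ ^ (1 / 2 : ℝ))⁻¹ := Real.rpow_neg hτ0.le _
      set R := τ ^ (1 / 2 : ℝ) with hR
      have hR0 : 0 < R := by positivity
      have hR1 : 1 ≤ R := Real.one_le_rpow hτ.le (by norm_num)
      have e4 : τ = R ^ 2 := by
        rw [hR, ← Real.rpow_natCast, ← Real.rpow_mul hτ0.le]; norm_num
      have e5 : ballRad τ x = ‖x‖ * R⁻¹ / 40 := by rw [ballRad, e3]
      have hd : R⁻¹ + n * (2 * B * ‖phaseGrad τ x‖⁻¹) + B' * ‖phaseGrad τ x‖⁻¹ ^ 2 ≤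
          R⁻¹ * (1 + 160 * C₂ * n + 6400 * C₂) := by
        calc _ ≤ R⁻¹ + n * (2 * B * (2 * ‖x‖ * τ⁻¹)) + B' * (2 * ‖x‖ * τ⁻¹) ^ 2 := by gcongr
          _ = R⁻¹ * (1 + 160 * C₂ * n + 6400 * C₂ * R⁻¹) := by
            rw [hB, hB', e5, e4]; field_simp; ring
          _ ≤ R⁻¹ * (1 + 160 * C₂ * n + 6400 * C₂ * 1) := by
            have : R⁻¹ ≤ 1 := inv_le_one_of_one_le₀ hR1
            gcongr
          _ = _ := by ring
      rw [e3, e2]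
      calc _ ≤ Real.exp 1 * (2 : ℝ) ^ ((n : ℝ) / 2) * (4 * ‖x‖ ^ 2 *
            (R⁻¹ * (1 + 160 * C₂ * n + 6400 * C₂))) * K * (‖x‖ ^ 2)⁻¹ * (R * τ ^ γ) := by
            gcongr
        _ = _ := by rw [hC]; field_simp

end LocalParametrix

section Gluing

open Filter Topology RealInnerProductSpace

variable {n : ℕ} {p : ℝ} {τ : ℝ}

theorem card_filter_mem_closedBall_le (hτ : 1 < τ) {t : Finset (EuclideanSpace ℝ (Fin n))}
    (ht0 : ∀ b ∈ t, b ≠ 0)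
    (hd : (t : Set (EuclideanSpace ℝ (Fin n))).PairwiseDisjoint fun b => closedBall b (ballRad τ b))
    (y : EuclideanSpace ℝ (Fin n)) [DecidablePred fun b => y ∈ closedBall b (8 * ballRad τ b)] :
    (t.filter fun b => y ∈ closedBall b (8 * ballRad τ b)).card ≤ 13 ^ n := by
  set s := t.filter fun b => y ∈ closedBall b (8 * ballRad τ b) with hs
  rcases s.eq_empty_or_nonempty with h | ⟨b₀, hb₀⟩
  · simp [h]
  have hst : ∀ b ∈ s, b ∈ t ∧ y ∈ closedBall b (8 * ballRad τ b) := fun b hb => by simpa [hs] using hb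
  have hτ0 : 0 < τ := by linarith
  set ε := τ ^ (-(1 / 2) : ℝ) with hε
  have hε0 : 0 < ε := by positivity
  have hy : 0 < ‖y‖ := by
    have h1 := (norm_bounds_of_mem hτ (hst b₀ hb₀).2).1
    have h2 : 0 < ‖b₀‖ := norm_pos_iff.2 (ht0 _ (hst b₀ hb₀).1)
    linarith
  set ρ := ‖y‖ * ε / 48 with hρ
  have hρ0 : 0 < ρ := by positivity
  have hsub : ∀ b ∈ s, closedBall b ρ ⊆ closedBall b (ballRad τ b) := fun b hb => by
    refine closedBall_subset_closedBall ?_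
    have h1 := (norm_bounds_of_mem hτ (hst b hb).2).2.1
    rw [hρ, ballRad, ← hε]
    nlinarith
  have hbig : ⋃ b ∈ s, closedBall b ρ ⊆ closedBall y (13 * ρ) := by
    refine Set.iUnion₂_subset fun b hb => closedBall_subset_closedBall' ?_
    obtain ⟨h1, -, h3⟩ := norm_bounds_of_mem hτ (hst b hb).2
    rw [dist_comm, dist_eq_norm]
    rw [hρ]
    nlinarith
  have hdis : (s : Set (EuclideanSpace ℝ (Fin n))).PairwiseDisjoint fun b => closedBall b ρ := by
    intro a ha b hb hab
    exact (hd (hst a ha).1 (hst b hb).1 hab).mono (hsub a ha) (hsub b hb)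
  have hm := measure_mono (μ := volume) hbig
  rw [measure_biUnion_finset hdis fun _ _ => measurableSet_closedBall] at hm
  simp_rw [Measure.addHaar_closedBall _ _ hρ0.le] at hm
  rw [Measure.addHaar_closedBall _ _ (by positivity), Finset.sum_const, nsmul_eq_mul, mul_pow,
    ENNReal.ofReal_mul (by positivity), finrank_euclideanSpace_fin, mul_assoc] at hm
  have hv0 : volume (ball (0 : EuclideanSpace ℝ (Fin n)) 1) ≠ 0 :=
    (measure_ball_pos _ _ one_pos).ne'
  have hρn : ENNReal.ofReal (ρ ^ n) ≠ 0 := by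
    rw [Ne, ENNReal.ofReal_eq_zero, not_le]; positivity
  rw [ENNReal.mul_le_mul_iff_left (mul_ne_zero hρn hv0)
    (ENNReal.mul_ne_top ofReal_ne_top measure_ball_lt_top.ne)] at hm
  rw [show ENNReal.ofReal ((13 : ℝ) ^ n) = ((13 ^ n : ℕ) : ℝ≥0∞) by
    rw [← ENNReal.ofReal_natCast]; push_cast; rfl] at hm
  exact_mod_cast hm

theorem ENNReal.sum_rpow_le_rpow_sum {ι : Type*} (s : Finset ι) (a : ι → ℝ≥0∞) {q : ℝ}
    (hq : 1 ≤ q) : ∑ i ∈ s, a i ^ q ≤ (∑ i ∈ s, a i) ^ q := by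
  classical
  induction s using Finset.induction_on with
  | empty => simp
  | insert i s hi ih =>
    rw [Finset.sum_insert hi, Finset.sum_insert hi]
    exact (add_le_add_right ih _).trans (ENNReal.add_rpow_le_rpow_add _ _ hq)

theorem eLpNorm_two_sq {α : Type*} [MeasurableSpace α] (ν : Measure α) (g : α → ℝ) :
    eLpNorm g 2 ν ^ 2 = ∫⁻ x, ENNReal.ofReal (g x ^ 2) ∂ν := by
  have h2 := eLpNorm_ofReal_eq two_pos ν g
  rw [show ENNReal.ofReal (2 : ℝ) = 2 by simp] at h2
  rw [h2, ← ENNReal.rpow_natCast, ← ENNReal.rpow_mul]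
  norm_num

theorem eLpNorm_sum_le_of_card_le {α ι : Type*} [MeasurableSpace α] {ν : Measure α}
    {t : Finset ι} {g : ι → α → ℝ} {N : ℕ} (hm : ∀ j ∈ t, Measurable (g j))
    (hN : ∀ y, ∃ s ⊆ t, s.card ≤ N ∧ ∀ j ∈ t, j ∉ s → g j y = 0) {a F : ℝ≥0∞} {G : ι → ℝ≥0∞}
    (hg : ∀ j ∈ t, eLpNorm (g j) 2 ν ≤ a * G j) (hF : ∑ j ∈ t, G j ^ 2 ≤ F ^ 2) :
    eLpNorm (fun y => ∑ j ∈ t, g j y) 2 ν ≤ (N : ℝ≥0∞) * (a * F) := by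
  rw [← ENNReal.pow_le_pow_left_iff two_ne_zero, eLpNorm_two_sq]
  calc ∫⁻ x, ENNReal.ofReal ((∑ j ∈ t, g j x) ^ 2) ∂ν
      ≤ ∫⁻ x, (N : ℝ≥0∞) * ∑ j ∈ t, ENNReal.ofReal (g j x ^ 2) ∂ν := by
        refine lintegral_mono fun y => ?_
        obtain ⟨s, hst, hsN, hs0⟩ := hN y
        rw [← Finset.sum_subset hst hs0, ← ENNReal.ofReal_sum_of_nonneg fun _ _ => sq_nonneg _,
          ← ENNReal.ofReal_natCast, ← ENNReal.ofReal_mul (by positivity)]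
        refine ENNReal.ofReal_le_ofReal ((sq_sum_le_card_mul_sum_sq).trans ?_)
        refine mul_le_mul (by exact_mod_cast hsN) ?_ (Finset.sum_nonneg fun _ _ => sq_nonneg _)
          (by positivity)
        exact Finset.sum_le_sum_of_subset_of_nonneg hst fun _ _ _ => sq_nonneg _
    _ = (N : ℝ≥0∞) * ∑ j ∈ t, eLpNorm (g j) 2 ν ^ 2 := by
        rw [lintegral_const_mul' _ _ (ENNReal.natCast_ne_top N), lintegral_finsetSum' _ fun j hj =>
          ((hm j hj).pow_const 2).ennreal_ofReal.aemeasurable]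
        simp_rw [eLpNorm_two_sq]
    _ ≤ (N : ℝ≥0∞) * ∑ j ∈ t, (a * G j) ^ 2 := by
        gcongr with j hj
        exact hg j hj
    _ = (N : ℝ≥0∞) * (a ^ 2 * ∑ j ∈ t, G j ^ 2) := by simp_rw [mul_pow, Finset.mul_sum]
    _ ≤ (N : ℝ≥0∞) ^ 2 * (a ^ 2 * F ^ 2) := by
        gcongr
        exact_mod_cast Nat.le_self_pow two_ne_zero N
    _ = _ := by ring

theorem sum_eLpNorm_sq_le {α ι : Type*} [MeasurableSpace α] {ν : Measure α} (hp : 1 ≤ p)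
    (hp2 : p ≤ 2) {t : Finset ι} {χ : ι → α → ℝ} {h : α → ℝ} (hχm : ∀ j ∈ t, Measurable (χ j))
    (hm : Measurable h) (h0 : ∀ j ∈ t, ∀ y, 0 ≤ χ j y) (h1 : ∀ y, ∑ j ∈ t, χ j y ≤ 1) :
    ∑ j ∈ t, eLpNorm (fun y => χ j y * h y) (ENNReal.ofReal p) ν ^ 2 ≤
      eLpNorm h (ENNReal.ofReal p) ν ^ 2 := by
  have hp0 : 0 < p := by linarith
  have e : ∀ a : ℝ≥0∞, (a ^ (1 / p)) ^ 2 = a ^ (2 / p) := fun a => by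
    rw [← ENNReal.rpow_natCast, ← ENNReal.rpow_mul]; congr 1; push_cast; ring
  simp_rw [eLpNorm_ofReal_eq hp0, e]
  refine (ENNReal.sum_rpow_le_rpow_sum _ _ ((one_le_div hp0).2 hp2)).trans
    (ENNReal.rpow_le_rpow ?_ (by positivity))
  rw [← lintegral_finsetSum' _ fun j hj => by
    have := hχm j hj
    exact Measurable.aemeasurable (by fun_prop)]
  refine lintegral_mono fun y => ?_
  dsimp only
  rw [← ENNReal.ofReal_sum_of_nonneg fun _ _ => by positivity]
  refine ENNReal.ofReal_le_ofReal ?_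
  calc ∑ j ∈ t, |χ j y * h y| ^ p ≤ ∑ j ∈ t, χ j y * |h y| ^ p := by
        refine Finset.sum_le_sum fun j hj => ?_
        have hj0 := h0 j hj y
        have hj1 : χ j y ≤ 1 :=
          (Finset.single_le_sum (f := fun j => χ j y) (fun i hi => h0 i hi y) hj).trans (h1 y)
        rw [abs_mul, abs_of_nonneg hj0, Real.mul_rpow hj0 (abs_nonneg _)]
        gcongr
        exact Real.rpow_le_self_of_le_one hj0 hj1 hp
    _ = (∑ j ∈ t, χ j y) * |h y| ^ p := by rw [Finset.sum_mul]
    _ ≤ _ := mul_le_of_le_one_left (by positivity) (h1 y)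

theorem exists_disjoint_cover (hτ : 1 < τ) {K : Set (EuclideanSpace ℝ (Fin n))} (hK : IsCompact K)
    (h0 : ∀ x ∈ K, x ≠ 0) : ∃ t : Finset (EuclideanSpace ℝ (Fin n)), (∀ b ∈ t, b ∈ K) ∧
      ((t : Set (EuclideanSpace ℝ (Fin n))).PairwiseDisjoint fun b =>
        closedBall b (ballRad τ b)) ∧
      ∀ y ∈ K, ∃ b ∈ t, y ∈ ball b (6 * ballRad τ b) := by
  obtain ⟨s, hsK, hcov⟩ := hK.elim_nhds_subcover (fun b => closedBall b (ballRad τ b)) fun b hb =>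
    closedBall_mem_nhds _ (ballRad_pos (h0 b hb) hτ)
  obtain ⟨u, hus, hud, huc⟩ := Vitali.exists_disjoint_subfamily_covering_enlargement_closedBall
    (s : Set (EuclideanSpace ℝ (Fin n))) id (fun b => ballRad τ b) (∑ b ∈ s, |ballRad τ b|)
    (fun a ha => (le_abs_self _).trans
      (Finset.single_le_sum (f := fun b => |ballRad τ b|) (fun _ _ => abs_nonneg _) ha))
    5 (by norm_num)
  have huf : u.Finite := s.finite_toSet.subset hus
  refine ⟨huf.toFinset, fun b hb => hsK b (hus (huf.mem_toFinset.1 hb)), ?_, fun y hy => ?_⟩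
  · rw [huf.coe_toFinset]; exact hud
  · obtain ⟨a, ha, hya⟩ := Set.mem_iUnion₂.1 (hcov hy)
    obtain ⟨b, hb, hab⟩ := huc a ha
    refine ⟨b, huf.mem_toFinset.2 hb, ?_⟩
    have h2 := mem_closedBall.1 (hab hya)
    have h3 := ballRad_pos (h0 b (hsK b (hus hb))) hτ
    rw [mem_ball]
    simp only [id] at h2
    linarith

theorem exists_partition {K : Set (EuclideanSpace ℝ (Fin n))} (hK : IsClosed K)
    {t : Finset (EuclideanSpace ℝ (Fin n))} {r : EuclideanSpace ℝ (Fin n) → ℝ}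
    (hcov : ∀ y ∈ K, ∃ b ∈ t, y ∈ ball b (r b)) :
    ∃ χ : EuclideanSpace ℝ (Fin n) → EuclideanSpace ℝ (Fin n) → ℝ,
      (∀ b, ContDiff ℝ (⊤ : ℕ∞) (χ b)) ∧ (∀ b y, 0 ≤ χ b y) ∧
      (∀ y, ∑ b ∈ t, χ b y ≤ 1) ∧ (∀ y ∈ K, ∑ b ∈ t, χ b y = 1) ∧
      ∀ b ∈ t, ∀ y, χ b y ≠ 0 → y ∈ ball b (r b) := by
  classical
  obtain ⟨f, hf⟩ := SmoothPartitionOfUnity.exists_isSubordinate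
    (modelWithCornersSelf ℝ (EuclideanSpace ℝ (Fin n))) hK
    (fun b : t => ball (b : EuclideanSpace ℝ (Fin n)) (r b)) (fun _ => isOpen_ball)
    (fun y hy => by
      obtain ⟨b, hb, h⟩ := hcov y hy
      exact Set.mem_iUnion.2 ⟨⟨b, hb⟩, h⟩)
  have hsum : ∀ y, ∑ b ∈ t, (if h : b ∈ t then f ⟨b, h⟩ y else 0) = ∑ᶠ i, f i y := fun y => by
    rw [finsum_eq_sum_of_fintype, ← Finset.sum_coe_sort]
    refine Finset.sum_congr rfl fun b _ => ?_
    simp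
  refine ⟨fun b y => if h : b ∈ t then f ⟨b, h⟩ y else 0, fun b => ?_, fun b y => ?_, fun y => ?_,
    fun y hy => ?_, fun b hb y hy => ?_⟩
  · by_cases h : b ∈ t
    · simp only [h, dite_true]
      exact contMDiff_iff_contDiff.1 (f ⟨b, h⟩).contMDiff
    · simp only [h, dite_false]
      exact contDiff_const
  · by_cases h : b ∈ t
    · simp only [h, dite_true]
      exact f.nonneg _ _
    · simp only [h, dite_false]
      exact le_rfl
  · exact (hsum y).trans_le (f.sum_le_one y)
  · exact (hsum y).trans (f.sum_eq_one hy)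
  · simp only [hb, dite_true] at hy
    exact hf ⟨b, hb⟩ (subset_tsupport _ hy)

end Gluing

section Core

open Filter Topology RealInnerProductSpace

variable {n : ℕ} {p : ℝ} {τ : ℝ}

theorem measurable_carWt (τ : ℝ) : Measurable (carWt (n := n) τ) := by
  unfold carWt phiC
  fun_prop

set_option maxHeartbeats 1600000 in
theorem carleman_core (hn : 3 ≤ n) (hp : 2 * (n : ℝ) / (n + 2) < p) (hp2 : p ≤ 2) :
    ∃ C, 0 < C ∧ ∀ u : EuclideanSpace ℝ (Fin n) → ℝ, ContDiff ℝ (⊤ : ℕ∞) u → HasCompactSupport u →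
      tsupport u ⊆ ball 0 (Real.exp (-11)) \ {0} → ∀ τ : ℝ, 1 < τ →
      ENNReal.ofReal (τ ^ (3 / 2 - (3 * (n : ℝ) - 2) / 4 * (1 / p - 1 / 2))) *
          eLpNorm (fun x => (Real.log ‖x‖)⁻¹ * (carWt τ x * u x)) 2 (radMeas n) ≤
        ENNReal.ofReal C *
          eLpNorm (fun x => carWt τ x * (‖x‖ ^ 2 * lap u x)) (ENNReal.ofReal p) (radMeas n) := by
  classical
  obtain ⟨C, hC, hloc⟩ := exists_local_parametrix hn hp hp2
  have hp1 : 1 ≤ p := by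
    refine le_trans ?_ hp.le
    rw [one_le_div (by positivity)]
    have : (3 : ℝ) ≤ n := by exact_mod_cast hn
    linarith
  set γ := (3 * (n : ℝ) - 2) / 4 * (1 / p - 1 / 2) with hγ
  refine ⟨2 * (13 ^ n * C), by positivity, fun u hu huc hus τ hτ => ?_⟩
  have hτ0 : 0 < τ := by linarith
  have h0 : ∀ x ∈ tsupport u, x ≠ 0 := fun x hx => (hus hx).2
  have hlog : ∀ x ∈ tsupport u, Real.log ‖x‖ ≤ -11 := fun x hx => by
    have h1 := mem_ball_zero_iff.1 (hus hx).1
    rw [← Real.log_exp (-11)]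
    exact Real.log_le_log (norm_pos_iff.2 (h0 x hx)) h1.le
  obtain ⟨t, htK, hdis, hcov⟩ := exists_disjoint_cover hτ huc h0
  obtain ⟨χ, hχ, hχ0, hχ1, hχK, hχs⟩ := exists_partition (isClosed_tsupport u) hcov
  have hlu := hu.lap
  have hex : ∀ b ∈ t, ∃ U : EuclideanSpace ℝ (Fin n) → ℝ, ContDiff ℝ (⊤ : ℕ∞) U ∧
        tsupport U ⊆ closedBall b (8 * ballRad τ b) ∧
        eLpNorm (fun y => carWt τ y * U y) 2 (radMeas n) ≤
          ENNReal.ofReal (C * τ ^ (-(3 / 2) + γ)) *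
            eLpNorm (fun y => carWt τ y * (‖y‖ ^ 2 * (χ b y * lap u y)))
              (ENNReal.ofReal p) (radMeas n) ∧
        eLpNorm (fun y => carWt τ y * (‖y‖ ^ 2 * (χ b y * lap u y - lap U y))) 2 (radMeas n) ≤
          ENNReal.ofReal (C * τ ^ γ) *
            eLpNorm (fun y => carWt τ y * (‖y‖ ^ 2 * (χ b y * lap u y)))
              (ENNReal.ofReal p) (radMeas n) := fun b hb =>
    hloc b (h0 b (htK b hb)) (hlog b (htK b hb)) τ hτ (fun y => χ b y * lap u y)
      ((hχ b).mul hlu) fun y hy => ball_subset_closedBall (hχs b hb y (left_ne_zero_of_mul hy))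
  choose! U hU hUs hU1 hU2 using hex
  set h : EuclideanSpace ℝ (Fin n) → ℝ := fun y => carWt τ y * (‖y‖ ^ 2 * lap u y) with hh
  set F := eLpNorm h (ENNReal.ofReal p) (radMeas n) with hF
  set G : EuclideanSpace ℝ (Fin n) → ℝ≥0∞ := fun b =>
    eLpNorm (fun y => carWt τ y * (‖y‖ ^ 2 * (χ b y * lap u y))) (ENNReal.ofReal p) (radMeas n)
    with hG
  have hcm := measurable_carWt (n := n) τ
  have hlm : Measurable (lap u) := hlu.continuous.measurable
  have hGF : ∑ b ∈ t, G b ^ 2 ≤ F ^ 2 := by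
    have := sum_eLpNorm_sq_le (ν := radMeas n) hp1 hp2 (t := t) (χ := χ) (h := h)
      (fun b _ => (hχ b).continuous.measurable) (by fun_prop) (fun b _ => hχ0 b) hχ1
    refine le_trans (le_of_eq (Finset.sum_congr rfl fun b _ => ?_)) this
    have e : (fun y => carWt τ y * (‖y‖ ^ 2 * (χ b y * lap u y))) = fun y => χ b y * h y := by
      funext y
      simp only [hh]
      ring
    simp only [hG, e]
  have hover : ∀ y, ∃ s ⊆ t, s.card ≤ 13 ^ n ∧ ∀ b ∈ t, b ∉ s →
      y ∉ closedBall b (8 * ballRad τ b) := fun y =>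
    ⟨t.filter fun b => y ∈ closedBall b (8 * ballRad τ b), Finset.filter_subset _ _,
      card_filter_mem_closedBall_le hτ (fun b hb => h0 b (htK b hb)) hdis y, fun b hb hbs hy =>
      hbs (Finset.mem_filter.2 ⟨hb, hy⟩)⟩
  have hUz : ∀ b ∈ t, ∀ y, y ∉ closedBall b (8 * ballRad τ b) → U b y = 0 := fun b hb y hy =>
    image_eq_zero_of_notMem_tsupport fun h' => hy (hUs b hb h')
  have hUl : ∀ b ∈ t, ∀ y, y ∉ closedBall b (8 * ballRad τ b) → lap (U b) y = 0 :=
    fun b hb y hy => lap_eq_zero_of_notMem fun h' => hy (hUs b hb h')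
  have hχz : ∀ b ∈ t, ∀ y, y ∉ closedBall b (8 * ballRad τ b) → χ b y = 0 := fun b hb y hy => by
    by_contra h'
    refine hy (ball_subset_closedBall (ball_subset_ball ?_ (hχs b hb y h')))
    have := ballRad_pos (h0 b (htK b hb)) hτ
    linarith
  have hS1 : eLpNorm (fun y => ∑ b ∈ t, carWt τ y * U b y) 2 (radMeas n) ≤
      ((13 ^ n : ℕ) : ℝ≥0∞) * (ENNReal.ofReal (C * τ ^ (-(3 / 2) + γ)) * F) :=
    eLpNorm_sum_le_of_card_le (g := fun b y => carWt τ y * U b y) (fun b hb => hcm.mul (hU b hb).continuous.measurable)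
      (fun y => by
        obtain ⟨s, hs, hc, hs'⟩ := hover y
        exact ⟨s, hs, hc, fun b hb hbs => by rw [hUz b hb y (hs' b hb hbs), mul_zero]⟩) hU1 hGF
  have hS2 : eLpNorm (fun y => ∑ b ∈ t, carWt τ y * (‖y‖ ^ 2 * (χ b y * lap u y - lap (U b) y)))
      2 (radMeas n) ≤ ((13 ^ n : ℕ) : ℝ≥0∞) * (ENNReal.ofReal (C * τ ^ γ) * F) :=
    eLpNorm_sum_le_of_card_le (fun b hb => by
        have h1 := (hU b hb).lap.continuous.measurable
        have h2 := (hχ b).continuous.measurable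
        fun_prop)
      (fun y => by
        obtain ⟨s, hs, hc, hs'⟩ := hover y
        exact ⟨s, hs, hc, fun b hb hbs => by
          rw [hUl b hb y (hs' b hb hbs), hχz b hb y (hs' b hb hbs)]; simp⟩) hU2 hGF
  -- the corrected function
  set V : EuclideanSpace ℝ (Fin n) → ℝ := fun y => u y - ∑ b ∈ t, U b y with hV
  have hUsum : ContDiff ℝ (⊤ : ℕ∞) fun y => ∑ b ∈ t, U b y := ContDiff.sum fun b hb => hU b hb
  have hVs : ContDiff ℝ (⊤ : ℕ∞) V := hu.sub hUsum
  have hcl : IsCompact (tsupport u ∪ ⋃ b ∈ t, closedBall b (8 * ballRad τ b)) :=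
    huc.isCompact.union (t.isCompact_biUnion fun _ _ => isCompact_closedBall _ _)
  have hVsub : tsupport V ⊆ tsupport u ∪ ⋃ b ∈ t, closedBall b (8 * ballRad τ b) := by
    refine closure_minimal (fun y hy => ?_) hcl.isClosed
    by_contra h'
    rw [Set.mem_union, Set.mem_iUnion₂, not_or] at h'
    push Not at h'
    refine hy ?_
    simp only [hV]
    rw [image_eq_zero_of_notMem_tsupport h'.1, Finset.sum_eq_zero fun b hb => hUz b hb y (h'.2 b hb),
      sub_zero]
  have hbig : ∀ b ∈ t, ∀ y ∈ closedBall b (8 * ballRad τ b), y ∈ ball 0 (Real.exp (-10)) \ {0} :=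
    fun b hb y hy => by
      obtain ⟨h1, h2, -⟩ := norm_bounds_of_mem hτ hy
      have h3 : 0 < ‖b‖ := norm_pos_iff.2 (h0 b (htK b hb))
      have h4 := mem_ball_zero_iff.1 (hus (htK b hb)).1
      refine ⟨?_, norm_pos_iff.1 (by linarith)⟩
      rw [mem_ball_zero_iff]
      have h5 : Real.exp (-10) = Real.exp (-11) * Real.exp 1 := by
        rw [← Real.exp_add]; norm_num
      have h6 := Real.add_one_le_exp (1 : ℝ)
      have h7 := Real.exp_pos (-11)
      rw [h5]
      nlinarith
  have hVsupp : tsupport V ⊆ ball 0 (Real.exp (-10)) \ {0} := by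
    refine hVsub.trans (Set.union_subset (hus.trans (Set.sdiff_subset_sdiff_left
      (ball_subset_ball (Real.exp_le_exp.2 (by norm_num))))) ?_)
    exact Set.iUnion₂_subset fun b hb y hy => hbig b hb y hy
  have hVc : HasCompactSupport V := hcl.of_isClosed_subset (isClosed_tsupport V) hVsub
  have hVl : ∀ y, lap V y = ∑ b ∈ t, (χ b y * lap u y - lap (U b) y) := fun y => by
    rw [hV, lap_sub hu hUsum, lap_sum fun b hb => hU b hb, Finset.sum_sub_distrib, ← Finset.sum_mul]
    by_cases hy : y ∈ tsupport u
    · rw [hχK y hy, one_mul]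
    · rw [lap_eq_zero_of_notMem hy, mul_zero]
  have hcar := carleman_eLpNorm hn hVs hVc hVsupp hτ
  have hlapV : (fun x => carWt τ x * (‖x‖ ^ 2 * lap V x)) =
      fun y => ∑ b ∈ t, carWt τ y * (‖y‖ ^ 2 * (χ b y * lap u y - lap (U b) y)) := by
    funext y
    rw [hVl, Finset.mul_sum, Finset.mul_sum]
  rw [hlapV] at hcar
  have hUlog : eLpNorm (fun x => (Real.log ‖x‖)⁻¹ * (carWt τ x * ∑ b ∈ t, U b x)) 2 (radMeas n) ≤
      eLpNorm (fun y => ∑ b ∈ t, carWt τ y * U b y) 2 (radMeas n) := by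
    refine eLpNorm_mono fun y => ?_
    rw [← Finset.mul_sum, norm_mul (Real.log ‖y‖)⁻¹]
    by_cases hy : ∃ b ∈ t, y ∈ closedBall b (8 * ballRad τ b)
    · obtain ⟨b, hb, hyb⟩ := hy
      obtain ⟨h1, h2⟩ := hbig b hb y hyb
      rw [mem_ball_zero_iff] at h1
      have h3 : Real.log ‖y‖ ≤ -10 := by
        rw [← Real.log_exp (-10)]
        exact Real.log_le_log (norm_pos_iff.2 h2) h1.le
      refine mul_le_of_le_one_left (norm_nonneg _) ?_
      rw [norm_inv, Real.norm_eq_abs, abs_of_neg (by linarith)]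
      exact inv_le_one_of_one_le₀ (by linarith)
    · push Not at hy
      rw [Finset.sum_eq_zero fun b hb => hUz b hb y (hy b hb)]
      simp
  have hsplit : eLpNorm (fun x => (Real.log ‖x‖)⁻¹ * (carWt τ x * u x)) 2 (radMeas n) ≤
      eLpNorm (fun x => (Real.log ‖x‖)⁻¹ * (carWt τ x * V x)) 2 (radMeas n) +
        eLpNorm (fun x => (Real.log ‖x‖)⁻¹ * (carWt τ x * ∑ b ∈ t, U b x)) 2 (radMeas n) := by
    have e : (fun x => (Real.log ‖x‖)⁻¹ * (carWt τ x * u x)) =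
        (fun x => (Real.log ‖x‖)⁻¹ * (carWt τ x * V x)) +
          fun x => (Real.log ‖x‖)⁻¹ * (carWt τ x * ∑ b ∈ t, U b x) := by
      funext x
      simp only [hV, Pi.add_apply]
      ring
    have m1 := hVs.continuous.measurable
    have m2 := hUsum.continuous.measurable
    rw [e]
    exact eLpNorm_add_le (Measurable.aestronglyMeasurable (by fun_prop))
      (Measurable.aestronglyMeasurable (by fun_prop)) (by norm_num)
  have hN : ((13 ^ n : ℕ) : ℝ≥0∞) = ENNReal.ofReal ((13 : ℝ) ^ n) := by
    rw [← ENNReal.ofReal_natCast]; push_cast; rfl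
  rw [hN] at hS1 hS2
  refine (mul_le_mul_right hsplit _).trans ?_
  rw [mul_add, two_mul, ENNReal.ofReal_add (by positivity) (by positivity), add_mul]
  refine add_le_add ?_ ?_
  · rw [sub_eq_neg_add, Real.rpow_add hτ0, ENNReal.ofReal_mul (by positivity), mul_assoc]
    refine (mul_le_mul_right (hcar.trans hS2) _).trans (le_of_eq ?_)
    rw [← mul_assoc, ← mul_assoc, ← ENNReal.ofReal_mul (by positivity),
      ← ENNReal.ofReal_mul (by positivity), Real.rpow_neg hτ0.le]
    congr 2
    field_simp
  · refine (mul_le_mul_right (hUlog.trans hS1) _).trans (le_of_eq ?_)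
    rw [← mul_assoc, ← mul_assoc, ← ENNReal.ofReal_mul (by positivity),
      ← ENNReal.ofReal_mul (by positivity)]
    congr 2
    have : τ ^ (3 / 2 - γ) * τ ^ (-(3 / 2) + γ) = 1 := by
      rw [← Real.rpow_add hτ0]; ring_nf; exact Real.rpow_zero τ
    linear_combination (13 ^ n * C) * this

end Core

section EnergyWeight

open Filter Topology

variable {n : ℕ} {τ : ℝ}

/-- A globally smooth function agreeing near `K` with the weight of the energy estimate. -/
theorem exists_energy_weight (hn : 3 ≤ n) {K : Set (EuclideanSpace ℝ (Fin n))} (hK : IsClosed K)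
    (hsub : K ⊆ ball 0 (Real.exp (-11)) \ {0}) (hτ : 1 < τ) :
    ∃ w : EuclideanSpace ℝ (Fin n) → ℝ, ContDiff ℝ (⊤ : ℕ∞) w ∧ ∀ x ∈ K,
      w x = ‖x‖ ^ (-(((n : ℝ) - 2) / 2)) * (|Real.log ‖x‖|⁻¹ * carWt τ x) ∧
        gradSq w x ≤ (n * τ) ^ 2 * (w x ^ 2 / ‖x‖ ^ 2) := by
  obtain ⟨s, hs⟩ := exists_isLogOn hK fun h => (hsub h).2 rfl
  obtain ⟨Φ, Φ₁, Φ₂, Φ₃, Φ₄, hΦ, hΦ₁, -, -, -, h₀, -, -, -, hval⟩ := exists_smooth_weight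
  set c : ℝ := (n - 2) / 2 with hc
  set L : ℝ → ℝ := fun t => -τ * Φ t - (Φ t - t) / 2 - c * t with hL
  set L₁ : ℝ → ℝ := fun t => -τ * Φ₁ t - (Φ₁ t - 1) / 2 - c with hL₁
  have hLs : ContDiff ℝ (⊤ : ℕ∞) L :=
    ((contDiff_const.mul hΦ).sub ((hΦ.sub contDiff_id).div_const 2)).sub
      (contDiff_const.mul contDiff_id)
  have hLd : ∀ t, HasDerivAt L (L₁ t) t := fun t => by
    refine ((((h₀ t).const_mul (-τ)).sub (((h₀ t).sub (hasDerivAt_id t)).div_const 2)).sub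
      ((hasDerivAt_id t).const_mul c)).congr_deriv ?_
    simp [hL₁]
  refine ⟨fun x => Real.exp (L (s x)), (hLs.comp hs.contDiff).exp, fun x hx => ?_⟩
  have hx0 : 0 < ‖x‖ := norm_pos_iff.2 (hsub hx).2
  have hsx := hs.eq hx
  have hlt : Real.log ‖x‖ < -11 := by
    rw [Real.log_lt_iff_lt_exp hx0]
    simpa using (hsub hx).1
  set t := Real.log ‖x‖ with ht
  obtain ⟨e0, e1, -⟩ := hval t (by linarith)
  have ht0 : 0 < -t := by linarith
  refine ⟨?_, ?_⟩
  · have h1 : |t|⁻¹ = Real.exp (-(Real.log (t ^ 2) / 2)) := by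
      rw [Real.log_pow, ← Real.log_abs, Real.exp_neg]
      push_cast
      rw [mul_div_cancel_left₀ _ (two_ne_zero), Real.exp_log (by rw [abs_pos]; linarith)]
    rw [h1, Real.rpow_def_of_pos hx0, carWt, phiC, ← ht, ← Real.exp_add, ← Real.exp_add]
    simp only [hL]
    rw [hsx, e0]
    congr 1
    ring
  · have hd : ∀ i, pd i (fun y => Real.exp (L (s y))) x =
        (Real.exp (L (s x)) * L₁ (s x)) * (x i / ‖x‖ ^ 2) := fun i =>
      hs.pd_comp hx (g := fun t => Real.exp (L t)) (g' := fun t => Real.exp (L t) * L₁ t)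
        fun t => (hLd t).exp
    have hg : gradSq (fun y => Real.exp (L (s y))) x =
        L₁ (s x) ^ 2 * (Real.exp (L (s x)) ^ 2 / ‖x‖ ^ 2) := by
      unfold gradSq
      simp only [hd]
      calc ∑ i, (Real.exp (L (s x)) * L₁ (s x) * (x i / ‖x‖ ^ 2)) ^ 2
          = Real.exp (L (s x)) ^ 2 * L₁ (s x) ^ 2 / ‖x‖ ^ 4 * ∑ i, x i * x i := by
            rw [Finset.mul_sum]; exact Finset.sum_congr rfl fun i _ => by field_simp
        _ = _ := by rw [sum_coord_sq]; field_simp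
    rw [hg]
    refine mul_le_mul_of_nonneg_right ?_ (by positivity)
    rw [hsx, hL₁]
    simp only
    rw [e1]
    have hn' : (3 : ℝ) ≤ n := by exact_mod_cast hn
    have h2 : 1 / t < 0 := one_div_neg.2 (by linarith)
    have h3 : -1 / 2 ≤ 1 / t := by
      rw [le_div_iff_of_neg (by linarith)]; linarith
    have e : -τ * (1 + 2 / t) - (1 + 2 / t - 1) / 2 - c = -(τ * (1 + 2 * (1 / t)) + 1 / t + c) := by
      ring
    rw [e, neg_sq]
    refine sq_le_sq' ?_ ?_
    · nlinarith
    · nlinarith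

end EnergyWeight

section EnergyIdentity

open Filter Topology

variable {n : ℕ} {w u : EuclideanSpace ℝ (Fin n) → ℝ}

theorem gradSq_mul (hw : ContDiff ℝ (⊤ : ℕ∞) w) (hu : ContDiff ℝ (⊤ : ℕ∞) u)
    (x : EuclideanSpace ℝ (Fin n)) :
    gradSq (fun y => w y * u y) x = gradSq w x * u x ^ 2 - w x ^ 2 * u x * lap u x +
      ∑ i, pd i (fun y => w y ^ 2 * u y * pd i u y) x := by
  unfold gradSq lap
  have h1 : ∀ i, pd i (fun y => w y * u y) x = w x * pd i u x + u x * pd i w x := fun i =>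
    pd_mul hw.diffAt hu.diffAt
  have h2 : ∀ i, pd i (fun y => w y ^ 2 * u y * pd i u y) x =
      w x ^ 2 * u x * pd i (pd i u) x +
        pd i u x * (w x ^ 2 * pd i u x + u x * (2 * w x * pd i w x)) := fun i => by
    have h3 : pd i (fun y => w y ^ 2) x = 2 * w x * pd i w x := by
      refine pd_comp (g := fun t => t ^ 2) ?_ hw.diffAt
      simpa using hasDerivAt_pow 2 (w x)
    rw [pd_mul ((hw.pow 2).mul hu).diffAt hu.pd.diffAt, pd_mul (hw.pow 2).diffAt hu.diffAt, h3]
  simp only [h1, h2]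
  rw [Finset.sum_mul, Finset.mul_sum, ← Finset.sum_sub_distrib, ← Finset.sum_add_distrib]
  exact Finset.sum_congr rfl fun i _ => by ring

theorem integral_gradSq_mul (hw : ContDiff ℝ (⊤ : ℕ∞) w) (hu : ContDiff ℝ (⊤ : ℕ∞) u)
    (hc : HasCompactSupport u) :
    ∫ x, gradSq (fun y => w y * u y) x =
      (∫ x, gradSq w x * u x ^ 2) - ∫ x, w x ^ 2 * u x * lap u x := by
  have hz : ∀ x ∉ tsupport u, u x = 0 := fun x hx => image_eq_zero_of_notMem_tsupport hx
  have i1 : Integrable fun x => gradSq w x * u x ^ 2 :=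
    (hw.gradSq.mul (hu.pow 2)).continuous.integrable_of_hasCompactSupport
      (hc.of_tsupport (tsupport_subset_of_eq_zero fun x hx => by rw [hz x hx]; ring))
  have i2 : Integrable fun x => w x ^ 2 * u x * lap u x :=
    (((hw.pow 2).mul hu).mul hu.lap).continuous.integrable_of_hasCompactSupport
      (hc.of_tsupport (tsupport_subset_of_eq_zero fun x hx => by rw [hz x hx]; ring))
  have hv : ∀ i, ContDiff ℝ (⊤ : ℕ∞) fun y => w y ^ 2 * u y * pd i u y := fun i =>
    ((hw.pow 2).mul hu).mul hu.pd
  have hvc : ∀ i, HasCompactSupport fun y => w y ^ 2 * u y * pd i u y := fun i =>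
    hc.of_tsupport (tsupport_subset_of_eq_zero fun x hx => by rw [hz x hx]; ring)
  have i3 : ∀ i, Integrable fun x => pd i (fun y => w y ^ 2 * u y * pd i u y) x := fun i =>
    (hv i).pd.continuous.integrable_of_hasCompactSupport
      ((hvc i).mono' ((subset_tsupport _).trans tsupport_pd_subset))
  have e : (fun x => gradSq (fun y => w y * u y) x) = fun x =>
      (gradSq w x * u x ^ 2 - w x ^ 2 * u x * lap u x) +
        ∑ i, pd i (fun y => w y ^ 2 * u y * pd i u y) x := funext fun x => gradSq_mul hw hu x
  have i12 : Integrable fun x => gradSq w x * u x ^ 2 - w x ^ 2 * u x * lap u x := i1.sub i2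
  have i4 : Integrable fun x => ∑ i, pd i (fun y => w y ^ 2 * u y * pd i u y) x :=
    integrable_finsetSum _ fun i _ => i3 i
  rw [e, integral_add i12 i4, integral_sub i1 i2, integral_finsetSum _ fun i _ => i3 i,
    Finset.sum_eq_zero fun i _ => integral_pd_eq_zero ((hv i).of_le (by simp)) (hvc i), add_zero]

theorem norm_fderiv_le_sqrt_gradSq (u : EuclideanSpace ℝ (Fin n) → ℝ)
    (x : EuclideanSpace ℝ (Fin n)) : ‖fderiv ℝ u x‖ ≤ Real.sqrt (gradSq u x) := by
  refine ContinuousLinearMap.opNorm_le_bound _ (Real.sqrt_nonneg _) fun y => ?_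
  have h : fderiv ℝ u x y = ∑ i, pd i u x * y i := by
    conv_lhs => rw [← (EuclideanSpace.basisFun (Fin n) ℝ).sum_repr y]
    simp [pd, mul_comm]
  rw [h, Real.norm_eq_abs, EuclideanSpace.norm_eq, ← Real.sqrt_mul (gradSq_nonneg u x)]
  refine Real.abs_le_sqrt ?_
  refine (Finset.sum_mul_sq_le_sq_mul_sq _ _ _).trans (le_of_eq ?_)
  simp [gradSq, sq_abs]

/-- The pointwise product rule, in the form of an upper bound for the weighted gradient. -/
theorem sq_mul_gradSq_le (hw : ContDiff ℝ (⊤ : ℕ∞) w) (hu : ContDiff ℝ (⊤ : ℕ∞) u)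
    (x : EuclideanSpace ℝ (Fin n)) :
    w x ^ 2 * gradSq u x ≤ 2 * gradSq (fun y => w y * u y) x + 2 * (gradSq w x * u x ^ 2) := by
  unfold gradSq
  have h1 : ∀ i, pd i (fun y => w y * u y) x = w x * pd i u x + u x * pd i w x := fun i =>
    pd_mul hw.diffAt hu.diffAt
  simp only [h1]
  rw [Finset.sum_mul, Finset.mul_sum, Finset.mul_sum, Finset.mul_sum, ← Finset.sum_add_distrib]
  refine Finset.sum_le_sum fun i _ => ?_
  nlinarith [sq_nonneg (w x * pd i u x + 2 * (u x * pd i w x))]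

end EnergyIdentity

section LebesgueNorms

theorem eLpNorm_le_interpolate {α : Type*} [MeasurableSpace α] {ν : Measure α} {g : α → ℝ}
    (hg : Measurable g) {P q θ : ℝ} (hP : 0 < P) (hq : 0 < q) (h0 : 0 ≤ θ) (h1 : θ ≤ 1)
    (h : 1 / q = (1 - θ) / 2 + θ / P) :
    eLpNorm g (ENNReal.ofReal q) ν ≤
      eLpNorm g 2 ν ^ (1 - θ) * eLpNorm g (ENNReal.ofReal P) ν ^ θ := by
  rw [← show ENNReal.ofReal (2 : ℝ) = 2 by simp, eLpNorm_ofReal_eq hq, eLpNorm_ofReal_eq hP,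
    eLpNorm_ofReal_eq (by norm_num : (0 : ℝ) < 2), ← ENNReal.rpow_mul, ← ENNReal.rpow_mul]
  have hm : ∀ r : ℝ, Measurable fun x => ENNReal.ofReal (|g x| ^ r) := fun r =>
    (hg.abs.pow_const r).ennreal_ofReal
  have ha : 0 ≤ q * (1 - θ) / 2 := by
    have : 0 ≤ 1 - θ := by linarith
    positivity
  have hb : 0 ≤ q * θ / P := by positivity
  have hab : q * (1 - θ) / 2 + q * θ / P = 1 := by
    calc q * (1 - θ) / 2 + q * θ / P = q * ((1 - θ) / 2 + θ / P) := by ring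
      _ = 1 := by rw [← h]; field_simp
  have key := ENNReal.lintegral_mul_norm_pow_le (μ := ν) (hm 2).aemeasurable (hm P).aemeasurable
    ha hb hab
  have e : (fun x => ENNReal.ofReal (|g x| ^ q)) = fun x =>
      ENNReal.ofReal (|g x| ^ (2 : ℝ)) ^ (q * (1 - θ) / 2) *
        ENNReal.ofReal (|g x| ^ P) ^ (q * θ / P) := by
    funext x
    rw [ENNReal.ofReal_rpow_of_nonneg (by positivity) ha,
      ENNReal.ofReal_rpow_of_nonneg (by positivity) hb, ← ENNReal.ofReal_mul (by positivity),
      ← Real.rpow_mul (abs_nonneg _), ← Real.rpow_mul (abs_nonneg _),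
      ← Real.rpow_add_of_nonneg (abs_nonneg _) (by positivity) (by positivity)]
    congr 2
    field_simp
    ring
  rw [e]
  refine (ENNReal.rpow_le_rpow key (by positivity)).trans (le_of_eq ?_)
  rw [ENNReal.mul_rpow_of_nonneg _ _ (by positivity), ← ENNReal.rpow_mul, ← ENNReal.rpow_mul]
  congr 2
  · field_simp
  · field_simp

/-- Hölder's inequality for products of real-valued functions. -/
theorem lintegral_abs_mul_le {α : Type*} [MeasurableSpace α] {ν : Measure α} {g k : α → ℝ}
    (hg : Measurable g) (hk : Measurable k) {p p' : ℝ} (h : p'.HolderConjugate p) :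
    ∫⁻ x, ENNReal.ofReal (|g x| * |k x|) ∂ν ≤
      eLpNorm g (ENNReal.ofReal p') ν * eLpNorm k (ENNReal.ofReal p) ν := by
  rw [eLpNorm_ofReal_eq h.pos, eLpNorm_ofReal_eq h.symm.pos]
  have key := ENNReal.lintegral_mul_le_Lp_mul_Lq ν h (f := fun x => ENNReal.ofReal |g x|)
    (g := fun x => ENNReal.ofReal |k x|) hg.abs.ennreal_ofReal.aemeasurable
    hk.abs.ennreal_ofReal.aemeasurable
  simp only [Pi.mul_apply, ENNReal.ofReal_rpow_of_nonneg (abs_nonneg _) h.nonneg,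
    ENNReal.ofReal_rpow_of_nonneg (abs_nonneg _) h.symm.nonneg,
    ← ENNReal.ofReal_mul (abs_nonneg _)] at key
  exact key

/-- The Sobolev inequality for compactly supported functions on `ℝⁿ`. -/
theorem exists_sobolev {n : ℕ} (hn : 3 ≤ n) : ∃ S : ℝ, 0 < S ∧
    ∀ h : EuclideanSpace ℝ (Fin n) → ℝ, ContDiff ℝ 1 h → HasCompactSupport h →
      eLpNorm h (ENNReal.ofReal (2 * n / (n - 2))) volume ≤
        ENNReal.ofReal S * eLpNorm (fun x => ‖fderiv ℝ h x‖) 2 volume := by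
  have hn' : (3 : ℝ) ≤ n := by exact_mod_cast hn
  have hn2 : (0 : ℝ) < n - 2 := by linarith
  refine ⟨(eLpNormLESNormFDerivOfEqInnerConst
    (volume : Measure (EuclideanSpace ℝ (Fin n))) (2 : NNReal) : ℝ) + 1, by positivity,
    fun h hs hc => ?_⟩
  have key := eLpNorm_le_eLpNorm_fderiv_of_eq_inner
    (volume : Measure (EuclideanSpace ℝ (Fin n))) hs hc (p := 2)
    (p' := Real.toNNReal (2 * n / (n - 2))) (by norm_num) (by simp; omega) (by
      rw [Real.coe_toNNReal _ (by positivity)]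
      simp
      field_simp)
  rw [eLpNorm_norm]
  refine key.trans ?_
  refine mul_le_mul_left ?_ _
  rw [← ENNReal.ofReal_coe_nnreal]
  exact ENNReal.ofReal_le_ofReal (by linarith)

end LebesgueNorms

section Energy

open Filter Topology

variable {n : ℕ} {τ : ℝ}

set_option maxHeartbeats 1600000 in
/-- The energy `E` of the weighted function controls its `L^{2*}` norm and its gradient, and is
itself controlled by the `L²` norm and a dual pairing with the Laplacian. -/
theorem exists_energy_bound (hn : 3 ≤ n) : ∃ S : ℝ, 0 < S ∧
    ∀ u : EuclideanSpace ℝ (Fin n) → ℝ, ContDiff ℝ (⊤ : ℕ∞) u → HasCompactSupport u →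
      tsupport u ⊆ ball 0 (Real.exp (-11)) \ {0} → ∀ τ : ℝ, 1 < τ →
      ∃ E : ℝ≥0∞, E ≠ ⊤ ∧
        E ≤ ENNReal.ofReal ((n * τ) ^ 2) *
              eLpNorm (fun x => (Real.log ‖x‖)⁻¹ * (carWt τ x * u x)) 2 (radMeas n) ^ 2 +
            ∫⁻ x, ENNReal.ofReal (|(Real.log ‖x‖)⁻¹ * (carWt τ x * u x)| *
              |carWt τ x * (‖x‖ ^ 2 * lap u x)|) ∂(radMeas n) ∧
        eLpNorm (fun x => (Real.log ‖x‖)⁻¹ * (carWt τ x * u x))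
            (ENNReal.ofReal (2 * n / (n - 2))) (radMeas n) ≤ ENNReal.ofReal S * E ^ (1 / 2 : ℝ) ∧
        eLpNorm (fun x => (Real.log ‖x‖)⁻¹ * (carWt τ x * (‖x‖ * Real.sqrt (gradSq u x)))) 2
            (radMeas n) ^ 2 ≤
          2 * E + 2 * (ENNReal.ofReal ((n * τ) ^ 2) *
            eLpNorm (fun x => (Real.log ‖x‖)⁻¹ * (carWt τ x * u x)) 2 (radMeas n) ^ 2) := by
  obtain ⟨S, hS, hsob⟩ := exists_sobolev hn
  refine ⟨S, hS, fun u hu hc hsub τ hτ => ?_⟩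
  obtain ⟨w, hw, hwK⟩ := exists_energy_weight hn (isClosed_tsupport u) hsub hτ
  have hn' : (3 : ℝ) ≤ n := by exact_mod_cast hn
  have hn2 : (0 : ℝ) < n - 2 := by linarith
  set h : EuclideanSpace ℝ (Fin n) → ℝ := fun y => w y * u y with hh
  set g : EuclideanSpace ℝ (Fin n) → ℝ :=
    fun x => (Real.log ‖x‖)⁻¹ * (carWt τ x * u x) with hg
  have hz : ∀ x ∉ tsupport u, u x = 0 := fun x hx => image_eq_zero_of_notMem_tsupport hx
  have hhs : ContDiff ℝ (⊤ : ℕ∞) h := hw.mul hu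
  have hsubh : tsupport h ⊆ tsupport u := tsupport_subset_of_eq_zero fun x hx => by
    rw [hh]; simp only [hz x hx, mul_zero]
  have hhc : HasCompactSupport h := hc.of_tsupport hsubh
  have hgz : ∀ x ∉ tsupport u, g x = 0 := fun x hx => by
    rw [hg]; simp only [hz x hx, mul_zero]
  have hpos : ∀ x ∈ tsupport u, 0 < ‖x‖ := fun x hx => norm_pos_iff.2 (hsub hx).2
  have hlog : ∀ x ∈ tsupport u, |Real.log ‖x‖|⁻¹ ≤ 1 := fun x hx => by
    have : Real.log ‖x‖ < -11 := by
      rw [Real.log_lt_iff_lt_exp (hpos x hx)]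
      simpa using (hsub hx).1
    refine inv_le_one_of_one_le₀ ?_
    rw [abs_of_neg (by linarith)]; linarith
  have hw2 : ∀ x ∈ tsupport u, w x ^ 2 =
      ‖x‖ ^ (-(n : ℝ)) * ‖x‖ ^ 2 * ((Real.log ‖x‖)⁻¹ * carWt τ x) ^ 2 := fun x hx => by
    have e : (‖x‖ ^ (-(((n : ℝ) - 2) / 2))) ^ 2 = ‖x‖ ^ (-(n : ℝ)) * ‖x‖ ^ 2 := by
      rw [← Real.rpow_natCast, ← Real.rpow_natCast, ← Real.rpow_mul (hpos x hx).le,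
        ← Real.rpow_add (hpos x hx)]
      congr 1; push_cast; ring
    rw [(hwK x hx).1, mul_pow, e, mul_pow, mul_pow, ← abs_inv, sq_abs]
  have hgw : ∀ x, gradSq w x * u x ^ 2 ≤ (n * τ) ^ 2 * (‖x‖ ^ (-(n : ℝ)) * g x ^ 2) := fun x => by
    by_cases hx : x ∈ tsupport u
    · have h0 := hpos x hx
      calc gradSq w x * u x ^ 2 ≤ (n * τ) ^ 2 * (w x ^ 2 / ‖x‖ ^ 2) * u x ^ 2 :=
            mul_le_mul_of_nonneg_right (hwK x hx).2 (sq_nonneg _)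
        _ = _ := by rw [hw2 x hx, hg]; field_simp
    · rw [hz x hx, hgz x hx]; simp
  have hA : ∫⁻ x, ENNReal.ofReal ((n * τ) ^ 2 * (‖x‖ ^ (-(n : ℝ)) * g x ^ 2)) =
      ENNReal.ofReal ((n * τ) ^ 2) * eLpNorm g 2 (radMeas n) ^ 2 := by
    rw [eLpNorm_two_sq, lintegral_radMeas, ← lintegral_const_mul' _ _ ofReal_ne_top]
    refine lintegral_congr fun x => ?_
    rw [ENNReal.ofReal_mul (by positivity), ENNReal.ofReal_mul (by positivity)]
  have i0 : Integrable fun x => gradSq h x :=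
    hhs.gradSq.continuous.integrable_of_hasCompactSupport
      (hhc.of_tsupport (tsupport_subset_of_eq_zero fun x hx => by
        simp [gradSq, pd_eq_zero_of_notMem hx]))
  have hE : ENNReal.ofReal (∫ x, gradSq h x) = ∫⁻ x, ENNReal.ofReal (gradSq h x) :=
    ofReal_integral_eq_lintegral_ofReal i0 (ae_of_all _ fun x => gradSq_nonneg _ _)
  refine ⟨∫⁻ x, ENNReal.ofReal (gradSq h x), ?_, ?_, ?_, ?_⟩
  · rw [← hE]; exact ofReal_ne_top
  · have i1 : Integrable fun x => gradSq w x * u x ^ 2 :=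
      (hw.gradSq.mul (hu.pow 2)).continuous.integrable_of_hasCompactSupport
        (hc.of_tsupport (tsupport_subset_of_eq_zero fun x hx => by rw [hz x hx]; ring))
    have i2 : Integrable fun x => |w x ^ 2 * u x * lap u x| :=
      ((((hw.pow 2).mul hu).mul hu.lap).continuous.integrable_of_hasCompactSupport
        (hc.of_tsupport (tsupport_subset_of_eq_zero fun x hx => by rw [hz x hx]; ring))).abs
    have h1 : ∫ x, gradSq h x ≤
        (∫ x, gradSq w x * u x ^ 2) + ∫ x, |w x ^ 2 * u x * lap u x| := by
      rw [hh, integral_gradSq_mul hw hu hc]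
      have := abs_integral_le_integral_abs (f := fun x => w x ^ 2 * u x * lap u x)
        (μ := (volume : Measure (EuclideanSpace ℝ (Fin n))))
      linarith [neg_abs_le (∫ x, w x ^ 2 * u x * lap u x)]
    rw [← hE]
    refine (ENNReal.ofReal_le_ofReal h1).trans (ENNReal.ofReal_add_le.trans (add_le_add ?_ ?_))
    · rw [ofReal_integral_eq_lintegral_ofReal i1
        (ae_of_all _ fun x => mul_nonneg (gradSq_nonneg _ _) (sq_nonneg _)), ← hA]
      exact lintegral_mono fun x => ENNReal.ofReal_le_ofReal (hgw x)
    · rw [ofReal_integral_eq_lintegral_ofReal i2 (ae_of_all _ fun x => abs_nonneg _),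
        lintegral_radMeas]
      refine lintegral_mono fun x => ?_
      rw [← ENNReal.ofReal_mul (by positivity)]
      refine ENNReal.ofReal_le_ofReal ?_
      by_cases hx : x ∈ tsupport u
      · rw [abs_mul, abs_mul, abs_of_nonneg (sq_nonneg (w x)), hw2 x hx, mul_pow, abs_mul, abs_mul,
          abs_mul (carWt τ x), abs_mul (‖x‖ ^ 2), abs_of_pos (carWt_pos τ x),
          abs_of_nonneg (sq_nonneg ‖x‖), ← sq_abs (Real.log ‖x‖)⁻¹, abs_inv]
        have h0 := carWt_pos τ x
        calc ‖x‖ ^ (-(n : ℝ)) * ‖x‖ ^ 2 * (|Real.log ‖x‖|⁻¹ ^ 2 * carWt τ x ^ 2) * |u x| * |lap u x|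
            = |Real.log ‖x‖|⁻¹ * (‖x‖ ^ (-(n : ℝ)) * ((|Real.log ‖x‖|⁻¹ * (carWt τ x * |u x|)) *
                (carWt τ x * (‖x‖ ^ 2 * |lap u x|)))) := by ring
          _ ≤ 1 * (‖x‖ ^ (-(n : ℝ)) * ((|Real.log ‖x‖|⁻¹ * (carWt τ x * |u x|)) *
                (carWt τ x * (‖x‖ ^ 2 * |lap u x|)))) :=
              mul_le_mul_of_nonneg_right (hlog x hx) (by positivity)
          _ = _ := one_mul _
      · rw [hz x hx]; simp
  · set P : ℝ := 2 * n / (n - 2) with hP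
    have hP0 : 0 < P := by positivity
    have e : eLpNorm g (ENNReal.ofReal P) (radMeas n) = eLpNorm h (ENNReal.ofReal P) volume := by
      rw [eLpNorm_ofReal_eq hP0, eLpNorm_ofReal_eq hP0, lintegral_radMeas]
      congr 1
      refine lintegral_congr fun x => ?_
      rw [← ENNReal.ofReal_mul (by positivity)]
      congr 1
      by_cases hx : x ∈ tsupport u
      · have e1 : ‖x‖ ^ (-(n : ℝ)) = (‖x‖ ^ (-(((n : ℝ) - 2) / 2))) ^ P := by
          rw [← Real.rpow_mul (hpos x hx).le]
          congr 1
          rw [hP]; field_simp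
        rw [e1, ← Real.mul_rpow (by positivity) (abs_nonneg _), hh, hg]
        simp only
        rw [(hwK x hx).1, abs_mul, abs_mul, abs_mul, abs_mul, abs_mul, abs_of_pos (carWt_pos τ x),
          abs_of_nonneg (Real.rpow_nonneg (norm_nonneg x) _), abs_inv, abs_inv, abs_abs]
        congr 1
        ring
      · rw [hgz x hx, hh]; simp [hz x hx, hP0.ne']
    rw [e]
    refine (hsob h (hhs.of_le (by simp)) hhc).trans (mul_le_mul_right ?_ _)
    have e2 := eLpNorm_ofReal_eq (p := 2) (by norm_num) volume fun x => ‖fderiv ℝ h x‖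
    rw [ENNReal.ofReal_ofNat] at e2
    rw [e2]
    refine ENNReal.rpow_le_rpow (lintegral_mono fun x => ENNReal.ofReal_le_ofReal ?_) (by norm_num)
    rw [abs_norm, Real.rpow_two]
    calc ‖fderiv ℝ h x‖ ^ 2 ≤ Real.sqrt (gradSq h x) ^ 2 :=
          pow_le_pow_left₀ (norm_nonneg _) (norm_fderiv_le_sqrt_gradSq h x) 2
      _ = _ := Real.sq_sqrt (gradSq_nonneg _ _)
  · rw [← hA, eLpNorm_two_sq, lintegral_radMeas, ← lintegral_const_mul' _ _ (by simp),
      ← lintegral_const_mul' _ _ (by simp), ← lintegral_add_left']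
    swap
    · exact ((hhs.gradSq.continuous.measurable).ennreal_ofReal.const_mul _).aemeasurable
    refine lintegral_mono fun x => ?_
    have two : ∀ a : ℝ, 2 * ENNReal.ofReal a = ENNReal.ofReal (2 * a) := fun a => by
      rw [ENNReal.ofReal_mul (by norm_num), ENNReal.ofReal_ofNat]
    rw [two, two, ← ENNReal.ofReal_mul (by positivity),
      ← ENNReal.ofReal_add (mul_nonneg (by norm_num) (gradSq_nonneg _ _)) (by positivity)]
    refine ENNReal.ofReal_le_ofReal ?_
    by_cases hx : x ∈ tsupport u
    · have h1 := sq_mul_gradSq_le hw hu x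
      have h2 := hgw x
      have e : ‖x‖ ^ (-(n : ℝ)) *
          ((Real.log ‖x‖)⁻¹ * (carWt τ x * (‖x‖ * Real.sqrt (gradSq u x)))) ^ 2 =
            w x ^ 2 * gradSq u x := by
        rw [hw2 x hx, mul_pow, mul_pow, mul_pow, Real.sq_sqrt (gradSq_nonneg _ _)]
        ring
      rw [e]
      linarith
    · have : gradSq u x = 0 := by simp [gradSq, pd_eq_zero_of_notMem hx]
      rw [this]
      have := gradSq_nonneg h x
      refine le_trans (le_of_eq ?_) (show 0 ≤ _ by positivity)
      simp

end Energy

section Bootstrap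

theorem rpow_mul_rpow_le {a g y B C S τ θ : ℝ} (ha : 0 ≤ a) (hg : 0 ≤ g) (hy : 0 ≤ y) (hB : 0 ≤ B)
    (hC : 0 ≤ C) (hS : 0 ≤ S) (hτ : 0 < τ) (h0 : 0 ≤ θ) (h1 : θ ≤ 1) (haB : a ≤ C * B / τ)
    (hgy : g ≤ S * y) :
    a ^ (1 - θ) * g ^ θ ≤ C ^ (1 - θ) * S ^ θ * τ ^ (θ - 1) * (B ^ (1 - θ) * y ^ θ) := by
  have h1' : 0 ≤ 1 - θ := by linarith
  calc a ^ (1 - θ) * g ^ θ ≤ (C * B / τ) ^ (1 - θ) * (S * y) ^ θ :=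
        mul_le_mul (Real.rpow_le_rpow ha haB h1') (Real.rpow_le_rpow hg hgy h0) (by positivity)
          (by positivity)
    _ = _ := by
        rw [Real.div_rpow (by positivity) hτ.le, Real.mul_rpow hC hB, Real.mul_rpow hS hy,
          show θ - 1 = -(1 - θ) by ring, Real.rpow_neg hτ.le]
        ring

/-- The self-improving inequality closing the energy estimate. -/
theorem energy_bootstrap {a f y g d C S N τ β θ : ℝ} (ha : 0 ≤ a) (hf : 0 ≤ f) (hy : 0 ≤ y)
    (hg : 0 ≤ g) (hC : 0 < C) (hS : 0 < S) (hN : 0 ≤ N) (hτ : 1 < τ) (h0 : 0 ≤ θ) (h1 : θ ≤ 1)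
    (hβ : θ - 1 + β ≤ 0) (haf : τ ^ (β + 1) * a ≤ C * f)
    (hyg : y ^ 2 ≤ (N * τ) ^ 2 * a ^ 2 + a ^ (1 - θ) * g ^ θ * f) (hgy : g ≤ S * y)
    (hd : d ^ 2 ≤ 2 * y ^ 2 + 2 * ((N * τ) ^ 2 * a ^ 2)) :
    a ≤ C * (f / τ ^ β) / τ ∧ y ≤ (N * C + C ^ (1 - θ) * S ^ θ + 1) * (f / τ ^ β) ∧
      d ≤ 2 * (N * C + C ^ (1 - θ) * S ^ θ + 1) * (f / τ ^ β) := by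
  have hτ0 : 0 < τ := by linarith
  have hτβ : 0 < τ ^ β := Real.rpow_pos_of_pos hτ0 _
  set B := f / τ ^ β with hB
  have hfB : f = τ ^ β * B := by rw [hB]; field_simp
  have hB0 : 0 ≤ B := by positivity
  have haB : a ≤ C * B / τ := by
    rw [le_div_iff₀ hτ0]
    rw [Real.rpow_add hτ0, Real.rpow_one, hfB] at haf
    have : τ ^ β * (a * τ) ≤ τ ^ β * (C * B) := by linarith
    exact le_of_mul_le_mul_left this hτβ
  set M := C ^ (1 - θ) * S ^ θ with hM
  have hM0 : 0 < M := by positivity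
  have hq : (N * τ) ^ 2 * a ^ 2 ≤ (N * C) ^ 2 * B ^ 2 := by
    have : a * τ ≤ C * B := (le_div_iff₀ hτ0).1 haB
    have h2 : (a * τ) ^ 2 ≤ (C * B) ^ 2 := pow_le_pow_left₀ (by positivity) this 2
    calc (N * τ) ^ 2 * a ^ 2 = N ^ 2 * (a * τ) ^ 2 := by ring
      _ ≤ N ^ 2 * (C * B) ^ 2 := mul_le_mul_of_nonneg_left h2 (sq_nonneg _)
      _ = _ := by ring
  have hyB : y ≤ (N * C + M + 1) * B := by
    have hNC : 0 ≤ N * C := by positivity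
    rcases le_or_gt y B with hyB | hyB
    · nlinarith [mul_nonneg (add_nonneg hNC hM0.le) hB0]
    · have h2 : a ^ (1 - θ) * g ^ θ * f ≤ M * (B * y) := by
        have h3 := rpow_mul_rpow_le ha hg hy hB0 hC.le hS.le hτ0 h0 h1 haB hgy
        have h4 : B ^ (1 - θ) * y ^ θ ≤ y := by
          calc B ^ (1 - θ) * y ^ θ ≤ y ^ (1 - θ) * y ^ θ :=
                mul_le_mul_of_nonneg_right (Real.rpow_le_rpow hB0 hyB.le (by linarith))
                  (Real.rpow_nonneg hy _)
            _ = y := by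
                rw [← Real.rpow_add (lt_of_le_of_lt hB0 hyB)]; simp
        have h5 : τ ^ (θ - 1) * τ ^ β ≤ 1 := by
          rw [← Real.rpow_add hτ0]
          exact Real.rpow_le_one_of_one_le_of_nonpos hτ.le hβ
        calc a ^ (1 - θ) * g ^ θ * f
            ≤ M * τ ^ (θ - 1) * (B ^ (1 - θ) * y ^ θ) * f := mul_le_mul_of_nonneg_right h3 hf
          _ = (τ ^ (θ - 1) * τ ^ β) * (M * ((B ^ (1 - θ) * y ^ θ) * B)) := by
              rw [hfB]; ring
          _ ≤ 1 * (M * (y * B)) := by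
              refine mul_le_mul h5 ?_ (by positivity) zero_le_one
              exact mul_le_mul_of_nonneg_left (mul_le_mul_of_nonneg_right h4 hB0) hM0.le
          _ = _ := by ring
      by_contra! hlt
      have h6 : y ^ 2 ≤ (N * C) ^ 2 * B ^ 2 + M * (B * y) := by linarith
      have hy0 : 0 < y := lt_of_le_of_lt hB0 hyB
      have h7 : (N * C + M + 1) * B * y < y * y := mul_lt_mul_of_pos_right hlt hy0
      have h8 : N * C * B ≤ y := by nlinarith [mul_nonneg hM0.le hB0]
      have h9 : (N * C * B) * (N * C * B) ≤ (N * C * B) * y :=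
        mul_le_mul_of_nonneg_left h8 (by positivity)
      nlinarith [mul_nonneg hB0 hy]
  refine ⟨haB, hyB, ?_⟩
  have h2 : y ^ 2 ≤ ((N * C + M + 1) * B) ^ 2 := pow_le_pow_left₀ hy hyB 2
  have h3 : (N * C) ^ 2 * B ^ 2 ≤ ((N * C + M + 1) * B) ^ 2 := by
    rw [← mul_pow]
    refine pow_le_pow_left₀ (by positivity) ?_ 2
    exact mul_le_mul_of_nonneg_right (by linarith) hB0
  refine le_of_abs_le (abs_le_of_sq_le_sq ?_ (by positivity))
  nlinarith

end Bootstrap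

section RealCarleman

variable {n : ℕ} {p q : ℝ}

set_option maxHeartbeats 1600000 in
/-- The Carleman estimate for real-valued functions. -/
theorem carleman_real (hn : 3 ≤ n) (hp : 2 * (n : ℝ) / (n + 2) < p) (hp2 : p ≤ 2) (hq : 2 ≤ q)
    (hq2 : q ≤ 2 * (n : ℝ) / (n - 2)) :
    ∃ C, 0 < C ∧ ∀ u : EuclideanSpace ℝ (Fin n) → ℝ, ContDiff ℝ (⊤ : ℕ∞) u → HasCompactSupport u →
      tsupport u ⊆ ball 0 (Real.exp (-11)) \ {0} → ∀ τ : ℝ, 1 < τ →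
      ENNReal.ofReal (τ ^ (3 / 2 - (3 * (n : ℝ) - 2) / 4 * (1 / p - 1 / 2) -
            n * (1 / 2 - 1 / q))) *
          eLpNorm (fun x => (Real.log ‖x‖)⁻¹ * (carWt τ x * u x)) (ENNReal.ofReal q) (radMeas n) ≤
        ENNReal.ofReal C *
          eLpNorm (fun x => carWt τ x * (‖x‖ ^ 2 * lap u x)) (ENNReal.ofReal p) (radMeas n) ∧
      ENNReal.ofReal (τ ^ (1 / 2 - (3 * (n : ℝ) - 2) / 4 * (1 / p - 1 / 2))) *
          eLpNorm (fun x => (Real.log ‖x‖)⁻¹ * (carWt τ x * (‖x‖ * Real.sqrt (gradSq u x)))) 2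
            (radMeas n) ≤
        ENNReal.ofReal C *
          eLpNorm (fun x => carWt τ x * (‖x‖ ^ 2 * lap u x)) (ENNReal.ofReal p) (radMeas n) := by
  obtain ⟨C, hC, hcore⟩ := carleman_core hn hp hp2
  obtain ⟨S, hS, henergy⟩ := exists_energy_bound hn
  have hn' : (3 : ℝ) ≤ n := by exact_mod_cast hn
  have hn2 : (0 : ℝ) < n - 2 := by linarith
  have hn0 : (0 : ℝ) < n := by linarith
  have hp1 : 1 < p := by
    refine lt_of_le_of_lt ?_ hp
    rw [one_le_div (by positivity)]
    linarith
  have hp0 : 0 < p := by linarith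
  have hq0 : 0 < q := by linarith
  set δ : ℝ := 1 / p - 1 / 2 with hδ
  have hδ0 : 0 ≤ δ := by
    have : 1 / 2 ≤ 1 / p := one_div_le_one_div_of_le hp0 hp2
    linarith
  have hδ1 : n * δ ≤ 1 := by
    have h1 : 1 / p ≤ (n + 2) / (2 * n) := by
      rw [div_le_div_iff₀ hp0 (by positivity)]
      rw [div_lt_iff₀ (by positivity)] at hp
      linarith
    have h2 : (n : ℝ) * ((n + 2) / (2 * n)) = (n + 2) / 2 := by field_simp
    have h3 := mul_le_mul_of_nonneg_left h1 hn0.le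
    rw [hδ, mul_sub]
    linarith
  set θ : ℝ := n * δ with hθ
  have hθ0 : 0 ≤ θ := by positivity
  set t : ℝ := n * (1 / 2 - 1 / q) with ht
  have ht0 : 0 ≤ t := by
    have : 1 / q ≤ 1 / 2 := one_div_le_one_div_of_le two_pos hq
    have : 0 ≤ 1 / 2 - 1 / q := by linarith
    positivity
  set P : ℝ := 2 * n / (n - 2) with hP
  have hP0 : 0 < P := by positivity
  have hPinv : 1 / P = 1 / 2 - 1 / n := by rw [hP]; field_simp
  have ht1 : t ≤ 1 := by
    have h1 : 1 / P ≤ 1 / q := one_div_le_one_div_of_le hq0 hq2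
    rw [hPinv] at h1
    have h2 : 1 / 2 - 1 / q ≤ 1 / n := by linarith
    calc t ≤ n * (1 / n) := mul_le_mul_of_nonneg_left h2 hn0.le
      _ = 1 := by field_simp
  set β : ℝ := 1 / 2 - (3 * (n : ℝ) - 2) / 4 * δ with hβ
  have hβ1 : θ - 1 + β ≤ 0 := by
    have : θ - 1 + β = (θ + 2 * δ) / 4 - 1 / 2 := by rw [hβ, hθ]; ring
    have h2 : 3 * δ ≤ θ := mul_le_mul_of_nonneg_right hn' hδ0
    rw [this]
    linarith
  set M : ℝ := n * C + C ^ (1 - θ) * S ^ θ + 1 with hM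
  have hM0 : 0 < M := by positivity
  refine ⟨2 * M + C ^ (1 - t) * (S * M) ^ t, by positivity, fun u hu hc hsub τ hτ => ?_⟩
  have hτ0 : 0 < τ := by linarith
  have hcore' := hcore u hu hc hsub τ hτ
  obtain ⟨E, hE, hE1, hE2, hE3⟩ := henergy u hu hc hsub τ hτ
  have hgm : Measurable fun x : EuclideanSpace ℝ (Fin n) =>
      (Real.log ‖x‖)⁻¹ * (carWt τ x * u x) :=
    (Real.measurable_log.comp measurable_norm).inv.mul
      ((measurable_carWt τ).mul hu.continuous.measurable)
  have hkm : Measurable fun x : EuclideanSpace ℝ (Fin n) => carWt τ x * (‖x‖ ^ 2 * lap u x) :=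
    (measurable_carWt τ).mul ((measurable_norm.pow_const 2).mul hu.lap.continuous.measurable)
  have hconj : (p / (p - 1)).HolderConjugate p := (Real.HolderConjugate.conjExponent hp1).symm
  have hhold := lintegral_abs_mul_le (ν := radMeas n) hgm hkm hconj
  have hint := eLpNorm_le_interpolate (ν := radMeas n) hgm (P := P) (q := p / (p - 1)) (θ := θ) hP0
    hconj.pos hθ0 hδ1 (by
      have : θ / P = θ * (1 / P) := by ring
      rw [this, hPinv, hθ, hδ]
      field_simp
      ring)
  have hintq := eLpNorm_le_interpolate (ν := radMeas n) hgm (P := P) (q := q) (θ := t) hP0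
    hq0 ht0 ht1 (by
      have : t / P = t * (1 / P) := by ring
      rw [this, hPinv, ht]
      field_simp
      ring)
  have hE1' := hE1.trans (add_le_add le_rfl (hhold.trans (mul_le_mul_left hint _)))
  clear hE1 hhold hint
  set g : EuclideanSpace ℝ (Fin n) → ℝ := fun x => (Real.log ‖x‖)⁻¹ * (carWt τ x * u x)
  set F := eLpNorm (fun x => carWt τ x * (‖x‖ ^ 2 * lap u x)) (ENNReal.ofReal p) (radMeas n)
  set D := eLpNorm (fun x => (Real.log ‖x‖)⁻¹ * (carWt τ x * (‖x‖ * Real.sqrt (gradSq u x)))) 2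
    (radMeas n)
  set A := eLpNorm g 2 (radMeas n)
  set G := eLpNorm g (ENNReal.ofReal P) (radMeas n)
  set Q := eLpNorm g (ENNReal.ofReal q) (radMeas n)
  clear_value F D A G Q
  set K := 2 * M + C ^ (1 - t) * (S * M) ^ t with hK
  have hK0 : 0 < K := by positivity
  rcases eq_or_ne F ⊤ with hF | hF
  · rw [hF, ENNReal.mul_top (by simpa using hK0)]
    exact ⟨le_top, le_top⟩
  have e1 : 3 / 2 - (3 * (n : ℝ) - 2) / 4 * δ = β + 1 := by rw [hβ]; ring
  rw [e1] at hcore' ⊢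
  have hA : A ≠ ⊤ := fun h => by
    rw [h, ENNReal.mul_top (by simpa using Real.rpow_pos_of_pos hτ0 _), top_le_iff] at hcore'
    exact ENNReal.mul_ne_top ofReal_ne_top hF hcore'
  have hE2' : ENNReal.ofReal S * E ^ (1 / 2 : ℝ) ≠ ⊤ :=
    ENNReal.mul_ne_top ofReal_ne_top (ENNReal.rpow_ne_top_of_nonneg (by norm_num) hE)
  have hG : G ≠ ⊤ := ne_top_of_le_ne_top hE2' hE2
  have hAG : ∀ r : ℝ, 0 ≤ r → r ≤ 1 → A ^ (1 - r) * G ^ r ≠ ⊤ := fun r h0 h1 =>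
    ENNReal.mul_ne_top (ENNReal.rpow_ne_top_of_nonneg (by linarith) hA)
      (ENNReal.rpow_ne_top_of_nonneg h0 hG)
  have hQ : Q ≠ ⊤ := ne_top_of_le_ne_top (hAG t ht0 ht1) hintq
  have hAA : ENNReal.ofReal ((n * τ) ^ 2) * A ^ 2 ≠ ⊤ :=
    ENNReal.mul_ne_top ofReal_ne_top (ENNReal.pow_ne_top hA)
  have hD3 : 2 * E + 2 * (ENNReal.ofReal ((n * τ) ^ 2) * A ^ 2) ≠ ⊤ :=
    ENNReal.add_ne_top.2 ⟨ENNReal.mul_ne_top (by simp) hE, ENNReal.mul_ne_top (by simp) hAA⟩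
  have hD : D ≠ ⊤ := fun h => by
    rw [h, top_pow two_ne_zero, top_le_iff] at hE3
    exact hD3 hE3
  have r1 := ENNReal.toReal_mono (ENNReal.mul_ne_top ofReal_ne_top hF) hcore'
  have r2 := ENNReal.toReal_mono (ENNReal.add_ne_top.2 ⟨hAA,
    ENNReal.mul_ne_top (hAG θ hθ0 hδ1) hF⟩) hE1'
  have r3 := ENNReal.toReal_mono hE2' hE2
  have r4 := ENNReal.toReal_mono hD3 hE3
  have r5 := ENNReal.toReal_mono (hAG t ht0 ht1) hintq
  rw [ENNReal.toReal_mul, ENNReal.toReal_mul, ENNReal.toReal_ofReal (by positivity),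
    ENNReal.toReal_ofReal hC.le] at r1
  rw [ENNReal.toReal_add hAA (ENNReal.mul_ne_top (hAG θ hθ0 hδ1) hF), ENNReal.toReal_mul,
    ENNReal.toReal_ofReal (by positivity), ENNReal.toReal_pow, ENNReal.toReal_mul,
    ENNReal.toReal_mul, ← ENNReal.toReal_rpow, ← ENNReal.toReal_rpow] at r2
  rw [ENNReal.toReal_mul, ENNReal.toReal_ofReal hS.le, ← ENNReal.toReal_rpow,
    ← Real.sqrt_eq_rpow] at r3
  rw [ENNReal.toReal_add (ENNReal.mul_ne_top (by simp) hE) (ENNReal.mul_ne_top (by simp) hAA),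
    ENNReal.toReal_mul, ENNReal.toReal_mul, ENNReal.toReal_mul,
    ENNReal.toReal_ofReal (by positivity), ENNReal.toReal_pow, ENNReal.toReal_pow,
    ENNReal.toReal_ofNat] at r4
  rw [ENNReal.toReal_mul, ← ENNReal.toReal_rpow, ← ENNReal.toReal_rpow] at r5
  have hsq : Real.sqrt E.toReal ^ 2 = E.toReal := Real.sq_sqrt ENNReal.toReal_nonneg
  obtain ⟨b1, b2, b3⟩ := energy_bootstrap (N := n) (d := D.toReal) ENNReal.toReal_nonneg ENNReal.toReal_nonneg
    (Real.sqrt_nonneg E.toReal) ENNReal.toReal_nonneg hC hS hn0.le hτ hθ0 hδ1 hβ1 r1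
    (by rw [hsq]; exact r2) r3 (by rw [hsq]; exact r4)
  have hτβ : 0 < τ ^ β := Real.rpow_pos_of_pos hτ0 _
  have hf0 : 0 ≤ F.toReal := ENNReal.toReal_nonneg
  have hB0 : 0 ≤ F.toReal / τ ^ β := by positivity
  rw [← hM] at b2 b3
  constructor
  · have h3 := rpow_mul_rpow_le ENNReal.toReal_nonneg ENNReal.toReal_nonneg hB0 hB0 hC.le
      (mul_nonneg hS.le hM0.le) hτ0 ht0 ht1 b1
      (r3.trans ((mul_le_mul_of_nonneg_left b2 hS.le).trans (le_of_eq (mul_assoc _ _ _).symm)))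
    have h4 : (F.toReal / τ ^ β) ^ (1 - t) * (F.toReal / τ ^ β) ^ t = F.toReal / τ ^ β := by
      rw [← Real.rpow_add_of_nonneg hB0 (by linarith) ht0]; simp
    rw [h4] at h3
    have h5 : τ ^ (β + 1 - t) * Q.toReal ≤ K * F.toReal := by
      calc τ ^ (β + 1 - t) * Q.toReal
          ≤ τ ^ (β + 1 - t) * (C ^ (1 - t) * (S * M) ^ t * τ ^ (t - 1) * (F.toReal / τ ^ β)) :=
            mul_le_mul_of_nonneg_left (r5.trans h3) (by positivity)
        _ = (τ ^ (β + 1 - t) * τ ^ (t - 1) / τ ^ β) * (C ^ (1 - t) * (S * M) ^ t * F.toReal) := by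
            ring
        _ = C ^ (1 - t) * (S * M) ^ t * F.toReal := by
            rw [← Real.rpow_add hτ0, show β + 1 - t + (t - 1) = β by ring, div_self hτβ.ne', one_mul]
        _ ≤ K * F.toReal := mul_le_mul_of_nonneg_right (by rw [hK]; linarith) hf0
    rw [← ENNReal.ofReal_toReal hQ, ← ENNReal.ofReal_toReal hF, ← ENNReal.ofReal_mul (by positivity),
      ← ENNReal.ofReal_mul hK0.le]
    exact ENNReal.ofReal_le_ofReal h5
  · have h5 : τ ^ β * D.toReal ≤ K * F.toReal := by
      calc τ ^ β * D.toReal ≤ τ ^ β * (2 * M * (F.toReal / τ ^ β)) :=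
            mul_le_mul_of_nonneg_left b3 hτβ.le
        _ = 2 * M * F.toReal := by field_simp
        _ ≤ K * F.toReal := by
            refine mul_le_mul_of_nonneg_right ?_ hf0
            have : 0 < C ^ (1 - t) * (S * M) ^ t := by positivity
            rw [hK]; linarith
    rw [← ENNReal.ofReal_toReal hD, ← ENNReal.ofReal_toReal hF, ← ENNReal.ofReal_mul (by positivity),
      ← ENNReal.ofReal_mul hK0.le]
    exact ENNReal.ofReal_le_ofReal h5

end RealCarleman

section ComplexValued

variable {n : ℕ} {u : EuclideanSpace ℝ (Fin n) → ℂ}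

theorem pd_clm_comp (L : ℂ →L[ℝ] ℝ) (hu : ContDiff ℝ (⊤ : ℕ∞) u) (i : Fin n)
    (x : EuclideanSpace ℝ (Fin n)) : pd i (fun y => L (u y)) x = L (pderivC u i x) := by
  have h := L.hasFDerivAt.comp x ((hu.differentiable (by simp)) x).hasFDerivAt
  unfold pd pderivC
  rw [show (fun y => L (u y)) = L ∘ u from rfl, h.fderiv]
  rfl

theorem contDiff_pderivC (hu : ContDiff ℝ (⊤ : ℕ∞) u) (i : Fin n) :
    ContDiff ℝ (⊤ : ℕ∞) (pderivC u i) := by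
  unfold pderivC
  exact (hu.fderiv_right (m := (⊤ : ℕ∞)) (by simp)).clm_apply contDiff_const

theorem lapl_eq_sum_pderivC (hu : ContDiff ℝ (⊤ : ℕ∞) u) (x : EuclideanSpace ℝ (Fin n)) :
    lapl u x = ∑ i, pderivC (pderivC u i) i x := by
  have hd : DifferentiableAt ℝ (fderiv ℝ u) x :=
    ((hu.fderiv_right (m := (⊤ : ℕ∞)) (by simp)).differentiable (by simp)) x
  refine Finset.sum_congr rfl fun i _ => ?_
  unfold pderivC
  rw [fderiv_clm_apply hd (differentiableAt_const _)]
  simp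

theorem lap_clm_comp (L : ℂ →L[ℝ] ℝ) (hu : ContDiff ℝ (⊤ : ℕ∞) u) (x : EuclideanSpace ℝ (Fin n)) :
    lap (fun y => L (u y)) x = L (lapl u x) := by
  rw [lapl_eq_sum_pderivC hu, map_sum]
  refine Finset.sum_congr rfl fun i _ => ?_
  rw [show pd i (fun y => L (u y)) = fun y => L (pderivC u i y) from
    funext fun y => pd_clm_comp L hu i y, pd_clm_comp L (contDiff_pderivC hu i)]

theorem gradN_le (hu : ContDiff ℝ (⊤ : ℕ∞) u) (x : EuclideanSpace ℝ (Fin n)) :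
    gradN u x ≤ Real.sqrt (gradSq (fun y => (u y).re) x) +
      Real.sqrt (gradSq (fun y => (u y).im) x) := by
  have h1 : ∀ i, pd i (fun y => (u y).re) x = (pderivC u i x).re := fun i =>
    pd_clm_comp Complex.reCLM hu i x
  have h2 : ∀ i, pd i (fun y => (u y).im) x = (pderivC u i x).im := fun i =>
    pd_clm_comp Complex.imCLM hu i x
  have e : ∑ i, ‖pderivC u i x‖ ^ 2 =
      gradSq (fun y => (u y).re) x + gradSq (fun y => (u y).im) x := by
    unfold gradSq
    rw [← Finset.sum_add_distrib]
    refine Finset.sum_congr rfl fun i _ => ?_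
    rw [h1, h2, ← Complex.normSq_eq_norm_sq, Complex.normSq_apply]
    ring
  unfold gradN
  rw [e]
  refine Real.sqrt_le_iff.2 ⟨by positivity, ?_⟩
  rw [add_sq, Real.sq_sqrt (gradSq_nonneg _ _), Real.sq_sqrt (gradSq_nonneg _ _)]
  have : 0 ≤ 2 * Real.sqrt (gradSq (fun y => (u y).re) x) *
    Real.sqrt (gradSq (fun y => (u y).im) x) := by positivity
  linarith

theorem eLpNorm_le_add_of_abs_le {α : Type*} [MeasurableSpace α] {ν : Measure α} {f g h : α → ℝ}
    (hg : Measurable g) (hh : Measurable h) {p : ℝ≥0∞} (hp : 1 ≤ p)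
    (hle : ∀ x, |f x| ≤ |g x| + |h x|) : eLpNorm f p ν ≤ eLpNorm g p ν + eLpNorm h p ν := by
  have h1 := eLpNorm_add_le (μ := ν) hg.norm.aestronglyMeasurable hh.norm.aestronglyMeasurable hp
  have h2 := eLpNorm_norm (μ := ν) (p := p) g
  have h3 := eLpNorm_norm (μ := ν) (p := p) h
  rw [h2, h3] at h1
  refine le_trans (eLpNorm_mono fun x => ?_) h1
  exact (hle x).trans (le_abs_self _)

theorem wLp_zero_eq_eLpNorm {p : ℝ} (hp : 0 < p) (g : EuclideanSpace ℝ (Fin n) → ℝ) :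
    wLp 0 p g Set.univ = eLpNorm g (ENNReal.ofReal p) (radMeas n) := by
  rw [eLpNorm_radMeas hp, wLp, Measure.restrict_univ]
  simp only [sub_zero]

theorem wLp_eq_wLp_zero (x₀ : EuclideanSpace ℝ (Fin n)) (p : ℝ)
    (g : EuclideanSpace ℝ (Fin n) → ℝ) :
    wLp x₀ p g Set.univ = wLp 0 p (fun x => g (x + x₀)) Set.univ := by
  unfold wLp
  rw [Measure.restrict_univ, ← lintegral_add_right_eq_self _ x₀]
  simp only [add_sub_cancel_right, sub_zero]

theorem pderivC_comp_add_right (u : EuclideanSpace ℝ (Fin n) → ℂ) (x₀ : EuclideanSpace ℝ (Fin n))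
    (i : Fin n) (x : EuclideanSpace ℝ (Fin n)) :
    pderivC (fun y => u (y + x₀)) i x = pderivC u i (x + x₀) := by
  unfold pderivC
  rw [fderiv_comp_add_right]

theorem lapl_comp_add_right (u : EuclideanSpace ℝ (Fin n) → ℂ) (x₀ x : EuclideanSpace ℝ (Fin n)) :
    lapl (fun y => u (y + x₀)) x = lapl u (x + x₀) := by
  unfold lapl
  have e : fderiv ℝ (fun y => u (y + x₀)) = fun y => fderiv ℝ u (y + x₀) :=
    funext fun y => fderiv_comp_add_right x₀
  rw [e, fderiv_comp_add_right]

theorem gradN_comp_add_right (u : EuclideanSpace ℝ (Fin n) → ℂ) (x₀ x : EuclideanSpace ℝ (Fin n)) :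
    gradN (fun y => u (y + x₀)) x = gradN u (x + x₀) := by
  unfold gradN
  simp only [pderivC_comp_add_right]

theorem eLpNorm_clm_le {p τ : ℝ} (L : ℂ →L[ℝ] ℝ) (hL : ∀ z, |L z| ≤ ‖z‖)
    (hu : ContDiff ℝ (⊤ : ℕ∞) u) (hsub : tsupport u ⊆ ball 0 (Real.exp (-11)) \ {0}) :
    eLpNorm (fun x => carWt τ x * (‖x‖ ^ 2 * lap (fun y => L (u y)) x)) (ENNReal.ofReal p)
        (radMeas n) ≤
      eLpNorm (fun x => Real.log ‖x‖ * Real.exp (-τ * phiC ‖x‖) * (‖x‖ ^ 2 * ‖lapl u x‖))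
        (ENNReal.ofReal p) (radMeas n) := by
  refine eLpNorm_mono fun x => ?_
  rw [Real.norm_eq_abs, Real.norm_eq_abs]
  by_cases hx : x ∈ tsupport u
  · have hx0 : 0 < ‖x‖ := norm_pos_iff.2 (hsub hx).2
    have hlt : Real.log ‖x‖ < -11 := by
      rw [Real.log_lt_iff_lt_exp hx0]
      simpa using (hsub hx).1
    have h1 : 1 ≤ |Real.log ‖x‖| := by
      rw [abs_of_neg (by linarith)]; linarith
    rw [lap_clm_comp L hu, abs_mul, abs_mul, abs_mul, abs_mul, abs_mul, abs_norm,
      abs_of_pos (carWt_pos τ x), abs_of_pos (Real.exp_pos _), mul_assoc]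
    have h2 := hL (lapl u x)
    calc carWt τ x * (|‖x‖ ^ 2| * |L (lapl u x)|)
        ≤ carWt τ x * (|‖x‖ ^ 2| * ‖lapl u x‖) :=
          mul_le_mul_of_nonneg_left (mul_le_mul_of_nonneg_left h2 (abs_nonneg _))
            (carWt_pos τ x).le
      _ ≤ |Real.log ‖x‖| * (carWt τ x * (|‖x‖ ^ 2| * ‖lapl u x‖)) :=
          le_mul_of_one_le_left
            (mul_nonneg (carWt_pos τ x).le (mul_nonneg (abs_nonneg _) (norm_nonneg _))) h1
  · have h : lap (fun y => L (u y)) x = 0 := lap_eq_zero_of_notMem fun h =>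
      hx (closure_mono (fun y hy => by
        contrapose! hy
        rw [Function.notMem_support] at hy ⊢
        rw [hy, map_zero]) h)
    rw [h, mul_zero, mul_zero, abs_zero]
    exact abs_nonneg _

end ComplexValued

section CenteredCarleman

variable {n : ℕ} {p q : ℝ}

/-- The Carleman estimate for complex-valued functions, centred at the origin. -/
theorem carleman_centered (hn : 3 ≤ n) (hp : 2 * (n : ℝ) / (n + 2) < p) (hp2 : p ≤ 2)
    (hq : 2 ≤ q) (hq2 : q ≤ 2 * (n : ℝ) / (n - 2)) :
    ∃ C, 0 < C ∧ ∀ u : EuclideanSpace ℝ (Fin n) → ℂ, ContDiff ℝ (⊤ : ℕ∞) u → HasCompactSupport u →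
      tsupport u ⊆ ball 0 (Real.exp (-11)) \ {0} → ∀ τ : ℝ, 1 < τ →
      ENNReal.ofReal (τ ^ (3 / 2 - (3 * (n : ℝ) - 2) / 4 * (1 / p - 1 / 2) -
            n * (1 / 2 - 1 / q))) *
          wLp 0 q (fun x => (Real.log ‖x‖)⁻¹ * Real.exp (-τ * phiC ‖x‖) * ‖u x‖) Set.univ +
        ENNReal.ofReal (τ ^ (1 / 2 - (3 * (n : ℝ) - 2) / 4 * (1 / p - 1 / 2))) *
          wLp 0 2 (fun x => (Real.log ‖x‖)⁻¹ * Real.exp (-τ * phiC ‖x‖) * (‖x‖ * gradN u x))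
            Set.univ ≤
        ENNReal.ofReal C *
          wLp 0 p (fun x => Real.log ‖x‖ * Real.exp (-τ * phiC ‖x‖) * (‖x‖ ^ 2 * ‖lapl u x‖))
            Set.univ := by
  obtain ⟨C, hC, hreal⟩ := carleman_real hn hp hp2 hq hq2
  have hp0 : 0 < p := lt_of_le_of_lt (by positivity) hp
  have hq0 : 0 < q := by linarith
  refine ⟨4 * C, by positivity, fun u hu hc hsub τ hτ => ?_⟩
  rw [wLp_zero_eq_eLpNorm hp0, wLp_zero_eq_eLpNorm hq0, wLp_zero_eq_eLpNorm two_pos,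
    ENNReal.ofReal_ofNat]
  have hcomp : ∀ L : ℂ →L[ℝ] ℝ, ContDiff ℝ (⊤ : ℕ∞) (fun y => L (u y)) ∧
      HasCompactSupport (fun y => L (u y)) ∧
      tsupport (fun y => L (u y)) ⊆ ball 0 (Real.exp (-11)) \ {0} := fun L => by
    have h : tsupport (fun y => L (u y)) ⊆ tsupport u := closure_mono fun y hy => by
      contrapose! hy
      rw [Function.notMem_support] at hy ⊢
      rw [hy, map_zero]
    exact ⟨L.contDiff.comp hu, hc.comp_left (map_zero L), h.trans hsub⟩
  have hest : ∀ L : ℂ →L[ℝ] ℝ, (∀ z, |L z| ≤ ‖z‖) → _ := fun L hL =>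
    have h := hreal (fun y => L (u y)) (hcomp L).1 (hcomp L).2.1 (hcomp L).2.2 τ hτ
    have hF := mul_le_mul_right (eLpNorm_clm_le (p := p) (τ := τ) L hL hu hsub) (ENNReal.ofReal C)
    And.intro (h.1.trans hF) (h.2.trans hF)
  obtain ⟨hr1, hr2⟩ := hest Complex.reCLM fun z => Complex.abs_re_le_norm z
  obtain ⟨hi1, hi2⟩ := hest Complex.imCLM fun z => Complex.abs_im_le_norm z
  have hlog : Measurable fun x : EuclideanSpace ℝ (Fin n) => (Real.log ‖x‖)⁻¹ :=
    (Real.measurable_log.comp measurable_norm).inv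
  have hm0 : ∀ L : ℂ →L[ℝ] ℝ, Measurable fun x : EuclideanSpace ℝ (Fin n) =>
      (Real.log ‖x‖)⁻¹ * (carWt τ x * L (u x)) := fun L =>
    hlog.mul ((measurable_carWt τ).mul (hcomp L).1.continuous.measurable)
  have hm1 : ∀ L : ℂ →L[ℝ] ℝ, Measurable fun x : EuclideanSpace ℝ (Fin n) =>
      (Real.log ‖x‖)⁻¹ * (carWt τ x * (‖x‖ * Real.sqrt (gradSq (fun y => L (u y)) x))) := fun L =>
    hlog.mul ((measurable_carWt τ).mul
      (measurable_norm.mul (hcomp L).1.gradSq.continuous.measurable.sqrt))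
  have k1 := eLpNorm_le_add_of_abs_le (ν := radMeas n) (p := ENNReal.ofReal q)
    (f := fun x => (Real.log ‖x‖)⁻¹ * Real.exp (-τ * phiC ‖x‖) * ‖u x‖)
    (hm0 Complex.reCLM) (hm0 Complex.imCLM) (by
      rw [← ENNReal.ofReal_one]
      exact ENNReal.ofReal_le_ofReal (by linarith)) fun x => by
    rw [abs_mul, abs_mul, abs_mul, abs_mul, abs_mul, abs_mul, abs_norm, abs_of_pos (carWt_pos τ x),
      abs_of_pos (Real.exp_pos _), ← mul_add, ← mul_add, mul_assoc]
    exact mul_le_mul_of_nonneg_left (mul_le_mul_of_nonneg_left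
      (Complex.norm_le_abs_re_add_abs_im (u x)) (carWt_pos τ x).le) (abs_nonneg _)
  have k2 := eLpNorm_le_add_of_abs_le (ν := radMeas n) (p := 2)
    (f := fun x => (Real.log ‖x‖)⁻¹ * Real.exp (-τ * phiC ‖x‖) * (‖x‖ * gradN u x))
    (hm1 Complex.reCLM) (hm1 Complex.imCLM) (by norm_num) fun x => by
    have hg : 0 ≤ gradN u x := Real.sqrt_nonneg _
    rw [abs_mul, abs_mul, abs_mul, abs_mul, abs_mul, abs_mul, abs_mul, abs_mul, abs_mul, abs_norm,
      abs_of_pos (carWt_pos τ x), abs_of_pos (Real.exp_pos _), ← mul_add, ← mul_add, ← mul_add,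
      mul_assoc, abs_of_nonneg hg, abs_of_nonneg (Real.sqrt_nonneg _),
      abs_of_nonneg (Real.sqrt_nonneg _)]
    exact mul_le_mul_of_nonneg_left (mul_le_mul_of_nonneg_left
      (mul_le_mul_of_nonneg_left (gradN_le hu x) (norm_nonneg x)) (carWt_pos τ x).le) (abs_nonneg _)
  have k1' := mul_le_mul_right k1 (ENNReal.ofReal (τ ^ (3 / 2 - (3 * (n : ℝ) - 2) / 4 *
    (1 / p - 1 / 2) - n * (1 / 2 - 1 / q))))
  have k2' := mul_le_mul_right k2 (ENNReal.ofReal (τ ^ (1 / 2 - (3 * (n : ℝ) - 2) / 4 *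
    (1 / p - 1 / 2))))
  rw [mul_add] at k1' k2'
  refine (add_le_add (k1'.trans (add_le_add hr1 hi1)) (k2'.trans (add_le_add hr2 hi2))).trans
    (le_of_eq ?_)
  rw [ENNReal.ofReal_mul (by norm_num), ENNReal.ofReal_ofNat]
  ring

end CenteredCarleman

/-- Theorem 3.1: the quantitative `L^p → L^q` Carleman estimate for the
Laplacian. -/
theorem statement6 (n : ℕ) (hn : 3 ≤ n) (p q : ℝ)
    (hp : 2 * (n : ℝ) / (n + 2) < p) (hp2 : p ≤ 2)
    (hq : 2 ≤ q) (hq2 : q ≤ 2 * (n : ℝ) / (n - 2)) :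
    ∃ C R₀ : ℝ, 0 < C ∧ 0 < R₀ ∧ R₀ < 1 ∧
      ∀ (x₀ : EuclideanSpace ℝ (Fin n)) (u : EuclideanSpace ℝ (Fin n) → ℂ),
        ContDiff ℝ (⊤ : ℕ∞) u → HasCompactSupport u →
        tsupport u ⊆ ball x₀ R₀ \ {x₀} →
        ∀ τ : ℝ, 1 < τ →
          let β₀ : ℝ := 3 / 2 - (3 * (n : ℝ) - 2) * (2 - p) / (8 * p) - (n : ℝ) * (q - 2) / (2 * q)
          let β₁ : ℝ := 1 / 2 - (3 * (n : ℝ) - 2) * (2 - p) / (8 * p)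
          ENNReal.ofReal (τ ^ β₀) *
              wLp x₀ q (fun x => (Real.log ‖x - x₀‖)⁻¹ * Real.exp (-τ * phiC ‖x - x₀‖) * ‖u x‖)
                Set.univ +
            ENNReal.ofReal (τ ^ β₁) *
              wLp x₀ 2 (fun x => (Real.log ‖x - x₀‖)⁻¹ * Real.exp (-τ * phiC ‖x - x₀‖) *
                (‖x - x₀‖ * gradN u x)) Set.univ ≤
          ENNReal.ofReal C *
            wLp x₀ p (fun x => Real.log ‖x - x₀‖ * Real.exp (-τ * phiC ‖x - x₀‖) *
              (‖x - x₀‖ ^ 2 * ‖lapl u x‖)) Set.univ := by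
  obtain ⟨C, hC, hmain⟩ := carleman_centered hn hp hp2 hq hq2
  have hp0 : 0 < p := lt_of_le_of_lt (by positivity) hp
  have hq0 : 0 < q := by linarith
  refine ⟨C, Real.exp (-11), hC, Real.exp_pos _, Real.exp_lt_one_iff.2 (by norm_num),
    fun x₀ u hu hc hsub τ hτ => ?_⟩
  intro β₀ β₁
  have e0 : β₀ = 3 / 2 - (3 * (n : ℝ) - 2) / 4 * (1 / p - 1 / 2) - n * (1 / 2 - 1 / q) := by
    simp only [β₀]; field_simp; ring
  have e1 : β₁ = 1 / 2 - (3 * (n : ℝ) - 2) / 4 * (1 / p - 1 / 2) := by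
    simp only [β₁]; field_simp; ring
  rw [e0, e1, wLp_eq_wLp_zero x₀, wLp_eq_wLp_zero x₀, wLp_eq_wLp_zero x₀]
  simp only [add_sub_cancel_right]
  have hs : tsupport (fun y => u (y + x₀)) = (fun y => y + x₀) ⁻¹' tsupport u :=
    tsupport_comp_eq_preimage u (Homeomorph.addRight x₀)
  have hsub' : tsupport (fun y => u (y + x₀)) ⊆ ball 0 (Real.exp (-11)) \ {0} := fun y hy => by
    rw [hs] at hy
    have h := hsub hy
    simpa using h
  have h := hmain (fun y => u (y + x₀)) (hu.comp (contDiff_id.add contDiff_const))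
    (hc.comp_homeomorph (Homeomorph.addRight x₀)) hsub' τ hτ
  simp only [gradN_comp_add_right, lapl_comp_add_right] at h
  exact h
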